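/- In a finite Coxeter group W, every element is conjugate to its inverse: for each w ∈ W there exists x ∈ W with x w x⁻¹ = w⁻¹. -/

import Mathlib

namespace RootSet

open scoped RealInnerProductSpace

section

variable {V : Type*} [NormedAddCommGroup V] [InnerProductSpace ℝ V]

/-- The orthogonal reflection in the hyperplane perpendicular to `a`. -/
noncomputable def refl (a : V) : V ≃ₗᵢ[ℝ] V := (ℝ ∙ a)ᗮ.reflection

theorem mul_apply (f g : V ≃ₗᵢ[ℝ] V) (x : V) : (f * g) x = f (g x) := rfl

theorem inv_apply_self (f : V ≃ₗᵢ[ℝ] V) (x : V) : f⁻¹ (f x) = x := f.symm_apply_apply x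

theorem apply_inv_self (f : V ≃ₗᵢ[ℝ] V) (x : V) : f (f⁻¹ x) = x := f.apply_symm_apply x

theorem inner_inv_left (f : V ≃ₗᵢ[ℝ] V) (x y : V) : ⟪f⁻¹ x, y⟫ = ⟪x, f y⟫ := by
  rw [← f.inner_map_map, apply_inv_self]

theorem inner_inv_right (f : V ≃ₗᵢ[ℝ] V) (x y : V) : ⟪x, f⁻¹ y⟫ = ⟪f x, y⟫ := by
  rw [← f.inner_map_map, apply_inv_self]

theorem refl_apply {a : V} (ha : ⟪a, a⟫ = 2) (x : V) : refl a x = x - ⟪a, x⟫ • a := by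
  have h : ‖a‖ ^ 2 = 2 := by rw [← real_inner_self_eq_norm_sq, ha]
  unfold refl
  rw [Submodule.reflection_orthogonal_apply, Submodule.reflection_singleton_apply]
  simp only [RCLike.ofReal_real_eq_id, id, h]
  module

theorem refl_self {a : V} (ha : ⟪a, a⟫ = 2) : refl a a = -a := by
  rw [refl_apply ha, ha, two_smul]; abel

theorem refl_refl (a x : V) : refl a (refl a x) = x := by
  unfold refl; simp

theorem refl_mul_refl (a : V) : refl a * refl a = 1 := by
  ext x; exact refl_refl a x

theorem refl_inv (a : V) : (refl a)⁻¹ = refl a := inv_eq_of_mul_eq_one_left (refl_mul_refl a)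

theorem refl_neg (a : V) : refl (-a) = refl a := by
  have : (ℝ ∙ (-a)) = ℝ ∙ a := by
    rw [← Set.neg_singleton, Submodule.span_neg]
  unfold refl
  simp only [this]

theorem refl_map {a : V} (ha : ⟪a, a⟫ = 2) (g : V ≃ₗᵢ[ℝ] V) : refl (g a) = g * refl a * g⁻¹ := by
  ext x
  obtain ⟨y, rfl⟩ := g.surjective x
  have h : ⟪g a, g a⟫ = 2 := by rw [g.inner_map_map, ha]
  have h2 : g⁻¹ (g y) = y := g.symm_apply_apply y
  rw [refl_apply h, g.inner_map_map, mul_apply,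
    mul_apply, h2, refl_apply ha]
  simp

/-- A finite set of vectors of squared length `2` stable under its own reflections. -/
structure IsRoot (Φ : Set V) : Prop where
  finite : Φ.Finite
  norm : ∀ a ∈ Φ, ⟪a, a⟫ = 2
  refl_mem : ∀ a ∈ Φ, ∀ b ∈ Φ, refl a b ∈ Φ

/-- The reflection group of `Φ`. -/
def weyl (Φ : Set V) : Subgroup (V ≃ₗᵢ[ℝ] V) := Subgroup.closure (refl '' Φ)

theorem refl_mem_weyl {Φ : Set V} {a : V} (ha : a ∈ Φ) : refl a ∈ weyl Φ :=
  Subgroup.subset_closure ⟨a, ha, rfl⟩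

theorem weyl_mono {Φ Ψ : Set V} (h : Φ ⊆ Ψ) : weyl Φ ≤ weyl Ψ :=
  Subgroup.closure_mono (Set.image_mono h)

theorem weyl_le {Φ : Set V} {G : Subgroup (V ≃ₗᵢ[ℝ] V)} (h : ∀ a ∈ Φ, refl a ∈ G) :
    weyl Φ ≤ G := by
  rw [weyl, Subgroup.closure_le]
  rintro _ ⟨a, ha, rfl⟩
  exact h a ha

theorem weyl_induction {Φ : Set V} {p : (V ≃ₗᵢ[ℝ] V) → Prop} (one : p 1)
    (mul : ∀ a ∈ Φ, ∀ g, g ∈ weyl Φ → p g → p (refl a * g)) {g : V ≃ₗᵢ[ℝ] V} (hg : g ∈ weyl Φ) :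
    p g := by
  refine Subgroup.closure_induction_left (p := fun g _ => p g) one ?_ ?_ hg
  · rintro _ ⟨a, ha, rfl⟩ y hy h
    exact mul a ha y hy h
  · rintro _ ⟨a, ha, rfl⟩ y hy h
    rw [refl_inv]
    exact mul a ha y hy h

namespace IsRoot

variable {Φ : Set V}

theorem neg_mem (h : IsRoot Φ) {a : V} (ha : a ∈ Φ) : -a ∈ Φ := by
  rw [← refl_self (h.norm a ha)]
  exact h.refl_mem a ha a ha

theorem ne_zero (h : IsRoot Φ) {a : V} (ha : a ∈ Φ) : a ≠ 0 := by
  rintro rfl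
  simpa using h.norm 0 ha

theorem map_mem (h : IsRoot Φ) {g : V ≃ₗᵢ[ℝ] V} (hg : g ∈ weyl Φ) :
    ∀ b ∈ Φ, g b ∈ Φ := by
  refine weyl_induction (p := fun g => ∀ b ∈ Φ, g b ∈ Φ) (fun b hb => hb) ?_ hg
  intro a ha g _ ih b hb
  exact h.refl_mem a ha _ (ih b hb)

theorem sub_mem_span (h : IsRoot Φ) {g : V ≃ₗᵢ[ℝ] V} (hg : g ∈ weyl Φ) :
    ∀ x, g x - x ∈ Submodule.span ℝ Φ := by
  refine weyl_induction (p := fun g => ∀ x, g x - x ∈ Submodule.span ℝ Φ) (fun x => by simp) ?_ hg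
  intro a ha g _ ih x
  rw [mul_apply, refl_apply (h.norm a ha)]
  have e : g x - ⟪a, g x⟫ • a - x = (g x - x) - ⟪a, g x⟫ • a := by abel
  rw [e]
  exact sub_mem (ih x) (Submodule.smul_mem _ _ (Submodule.subset_span ha))

theorem inter (h : IsRoot Φ) (U : Submodule ℝ V) : IsRoot (Φ ∩ U) where
  finite := h.finite.inter_of_left _
  norm a ha := h.norm a ha.1
  refl_mem a ha b hb := by
    refine ⟨h.refl_mem a ha.1 b hb.1, ?_⟩
    rw [refl_apply (h.norm a ha.1)]
    exact sub_mem hb.2 (U.smul_mem _ ha.2)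

/-- Two roots that are parallel are equal or opposite. -/
theorem eq_or_eq_neg (h : IsRoot Φ) {a b : V} (ha : a ∈ Φ) (hb : b ∈ Φ) {c : ℝ}
    (hc : b = c • a) : b = a ∨ b = -a := by
  have h1 := h.norm a ha
  have h2 := h.norm b hb
  rw [hc, real_inner_smul_left, real_inner_smul_right, h1] at h2
  have : (c - 1) * (c + 1) = 0 := by linarith
  rcases mul_eq_zero.1 this with h | h
  · left; rw [hc, show c = 1 by linarith, one_smul]
  · right; rw [hc, show c = -1 by linarith]; simp

theorem inner_lt_two (h : IsRoot Φ) {a b : V} (ha : a ∈ Φ) (hb : b ∈ Φ) (hab : a ≠ b) :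
    ⟪a, b⟫ < 2 := by
  have h0 : 0 < ⟪a - b, a - b⟫ := by
    rw [real_inner_self_eq_norm_sq]
    have := norm_pos_iff.2 (sub_ne_zero.2 hab)
    positivity
  rw [inner_sub_left, inner_sub_right, inner_sub_right, h.norm a ha, h.norm b hb,
    real_inner_comm] at h0
  rw [real_inner_comm]
  linarith

end IsRoot

/-- `Δ` is a simple system for the roots that are positive with respect to `ρ`. -/
structure IsBase (Φ : Set V) (ρ : V) (Δ : Finset V) : Prop where
  regular : ∀ a ∈ Φ, ⟪ρ, a⟫ ≠ 0
  mem : ∀ d ∈ Δ, d ∈ Φ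
  pos : ∀ d ∈ Δ, 0 < ⟪ρ, d⟫
  obtuse : ∀ d ∈ Δ, ∀ e ∈ Δ, d ≠ e → ⟪d, e⟫ ≤ 0
  comb : ∀ a ∈ Φ, 0 < ⟪ρ, a⟫ → ∃ c : V → ℝ, (∀ d, 0 ≤ c d) ∧ a = ∑ d ∈ Δ, c d • d

theorem obtuse_aux {ρ : V} {Δ : Finset V} (hpos : ∀ d ∈ Δ, 0 < ⟪ρ, d⟫)
    (hmin : ∀ b ∈ Δ, ∀ c : V → ℝ, (∀ d, 0 ≤ c d) → c b = 0 → b ≠ ∑ d ∈ Δ, c d • d)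
    {a b : V} (ha : a ∈ Δ) (hb : b ∈ Δ) (hab : a ≠ b) {t : ℝ} (ht : 0 < t) {c : V → ℝ}
    (hc : ∀ d, 0 ≤ c d) (he : b - t • a = ∑ d ∈ Δ, c d • d) : False := by
  classical
  have hsum : b = ∑ d ∈ Δ, (c d + if d = a then t else 0) • d := by
    simp only [add_smul, Finset.sum_add_distrib, ite_smul, zero_smul, Finset.sum_ite_eq', ha,
      if_true, ← he]
    abel
  set c' : V → ℝ := fun d => c d + if d = a then t else 0 with hc'
  have hc'0 : ∀ d, 0 ≤ c' d := fun d => by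
    simp only [hc']; have := hc d; split_ifs <;> linarith
  replace hsum : b = ∑ d ∈ Δ, c' d • d := hsum
  have hcb : c' b = c b := by simp [hc', hab.symm]
  rw [← Finset.add_sum_erase _ _ hb, hcb] at hsum
  rcases lt_or_ge (c b) 1 with hlt | hge
  · apply hmin b hb (fun d => if d = b then 0 else (1 - c b)⁻¹ * c' d)
    · intro d
      have := hc'0 d
      have h1 : 0 < 1 - c b := by linarith
      split_ifs
      · exact le_rfl
      · positivity
    · simp
    · rw [← Finset.add_sum_erase _ _ hb]
      simp only [if_true, zero_smul, zero_add]
      have e : ∑ x ∈ Δ.erase b, (if x = b then 0 else (1 - c b)⁻¹ * c' x) • x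
          = (1 - c b)⁻¹ • ∑ x ∈ Δ.erase b, c' x • x := by
        rw [Finset.smul_sum]
        refine Finset.sum_congr rfl fun x hx => ?_
        rw [if_neg (Finset.ne_of_mem_erase hx), mul_smul]
      rw [e, eq_inv_smul_iff₀ (by linarith : (1 - c b) ≠ 0), sub_smul, one_smul, sub_eq_iff_eq_add,
        add_comm]
      exact hsum
  · have h1 : ⟪ρ, b⟫ = c b * ⟪ρ, b⟫ + ∑ d ∈ Δ.erase b, c' d * ⟪ρ, d⟫ := by
      conv_lhs => rw [hsum]
      rw [inner_add_right, inner_sum, real_inner_smul_right]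
      simp only [real_inner_smul_right]
    have h2 : 0 ≤ ∑ d ∈ Δ.erase b, c' d * ⟪ρ, d⟫ := Finset.sum_nonneg fun d hd =>
      mul_nonneg (hc'0 d) (hpos d (Finset.mem_of_mem_erase hd)).le
    have h3 := hpos b hb
    have h5 : ∑ d ∈ Δ.erase b, c' d * ⟪ρ, d⟫ = 0 := by nlinarith
    have h6 := (Finset.sum_eq_zero_iff_of_nonneg fun d hd =>
      mul_nonneg (hc'0 d) (hpos d (Finset.mem_of_mem_erase hd)).le).1 h5 a
        (Finset.mem_erase.2 ⟨hab, ha⟩)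
    have h7 : c' a = 0 := by
      rcases mul_eq_zero.1 h6 with h | h
      · exact h
      · exact absurd h (hpos a ha).ne'
    simp only [hc', if_true] at h7
    linarith [hc a]

theorem exists_isBase {Φ : Set V} (h : IsRoot Φ) {ρ : V} (hρ : ∀ a ∈ Φ, ⟪ρ, a⟫ ≠ 0) :
    ∃ Δ, IsBase Φ ρ Δ := by
  classical
  let P : Finset V → Prop := fun Δ => (∀ d ∈ Δ, d ∈ Φ ∧ 0 < ⟪ρ, d⟫) ∧
    ∀ a ∈ Φ, 0 < ⟪ρ, a⟫ → ∃ c : V → ℝ, (∀ d, 0 ≤ c d) ∧ a = ∑ d ∈ Δ, c d • d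
  have hex : ∃ n, ∃ Δ, P Δ ∧ Δ.card = n := by
    refine ⟨_, h.finite.toFinset.filter (fun a => 0 < ⟪ρ, a⟫), ⟨fun d hd => by simpa using hd, ?_⟩,
      rfl⟩
    intro a ha hpa
    refine ⟨fun d => if d = a then 1 else 0, fun d => by
      by_cases hd : d = a <;> simp [hd], ?_⟩
    simp [ite_smul, ha, hpa]
  obtain ⟨Δ, hP, hcard⟩ := Nat.find_spec hex
  have hmin : ∀ b ∈ Δ, ∀ c : V → ℝ, (∀ d, 0 ≤ c d) → c b = 0 → b ≠ ∑ d ∈ Δ, c d • d := by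
    intro b hb c hc hcb hbs
    refine Nat.find_min hex (m := (Δ.erase b).card) ?_ ⟨Δ.erase b, ⟨fun d hd =>
      hP.1 d (Finset.mem_of_mem_erase hd), ?_⟩, rfl⟩
    · rw [← hcard]
      exact Finset.card_erase_lt_of_mem hb
    · intro a ha hpa
      obtain ⟨c', hc', hac⟩ := hP.2 a ha hpa
      refine ⟨fun d => c' d + c' b * c d, fun d => add_nonneg (hc' d) (mul_nonneg (hc' b) (hc d)),
        ?_⟩
      rw [← Finset.add_sum_erase _ _ hb, hcb, zero_smul, zero_add] at hbs
      rw [← Finset.add_sum_erase _ _ hb] at hac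
      simp only [add_smul, mul_smul, Finset.sum_add_distrib, ← Finset.smul_sum, ← hbs]
      rw [hac, add_comm]
  refine ⟨Δ, hρ, fun d hd => (hP.1 d hd).1, fun d hd => (hP.1 d hd).2, ?_, hP.2⟩
  intro a ha b hb hab
  by_contra! hlt
  have hbΦ := (hP.1 b hb).1
  have haΦ := (hP.1 a ha).1
  have hr := h.refl_mem a haΦ b hbΦ
  have hpos : ∀ d ∈ Δ, 0 < ⟪ρ, d⟫ := fun d hd => (hP.1 d hd).2
  rcases lt_or_gt_of_ne (hρ _ hr) with hneg | hp
  · obtain ⟨c, hc, he⟩ := hP.2 _ (h.neg_mem hr) (by rw [inner_neg_right]; linarith)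
    rw [refl_apply (h.norm _ haΦ)] at he
    refine obtuse_aux hpos hmin hb ha hab.symm (inv_pos.2 hlt) (c := fun d => ⟪a, b⟫⁻¹ * c d)
      (fun d => mul_nonneg (inv_pos.2 hlt).le (hc d)) ?_
    simp only [mul_smul, ← Finset.smul_sum, ← he]
    rw [neg_sub, smul_sub, inv_smul_smul₀ hlt.ne']
  · obtain ⟨c, hc, he⟩ := hP.2 _ hr hp
    rw [refl_apply (h.norm _ haΦ)] at he
    exact obtuse_aux hpos hmin ha hb hab hlt hc he

theorem eq_zero_of_obtuse {ρ : V} {Δ : Finset V} (hpos : ∀ d ∈ Δ, 0 < ⟪ρ, d⟫)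
    (hob : ∀ d ∈ Δ, ∀ e ∈ Δ, d ≠ e → ⟪d, e⟫ ≤ 0) {c : V → ℝ}
    (hc : ∑ d ∈ Δ, c d • d = 0) : ∀ d ∈ Δ, c d = 0 := by
  classical
  set v := ∑ d ∈ Δ, (max (c d) 0) • d with hv
  have hv' : v = ∑ d ∈ Δ, (max (-c d) 0) • d := by
    rw [← sub_eq_zero, hv, ← Finset.sum_sub_distrib, ← hc]
    refine Finset.sum_congr rfl fun d _ => ?_
    rw [← sub_smul]
    congr 1
    rcases le_total (c d) 0 with h | h
    · rw [max_eq_right h, max_eq_left (by linarith)]; ring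
    · rw [max_eq_left h, max_eq_right (by linarith)]; ring
  have hvv : ⟪v, v⟫ ≤ 0 := by
    conv_lhs => rw [hv']; arg 3; rw [← hv', hv]
    simp only [sum_inner, inner_sum, real_inner_smul_left, real_inner_smul_right]
    refine Finset.sum_nonpos fun d hd => Finset.sum_nonpos fun e he => ?_
    by_cases hde : d = e
    · subst hde
      rcases le_total (c d) 0 with h | h
      · rw [max_eq_right h]; simp
      · rw [max_eq_right (by linarith : -c d ≤ 0)]; simp
    · exact mul_nonpos_of_nonneg_of_nonpos (le_max_right _ _)
        (mul_nonpos_of_nonneg_of_nonpos (le_max_right _ _) (hob e he d hd (Ne.symm hde)))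
  have hv0 : v = 0 := by
    rw [← inner_self_eq_zero (𝕜 := ℝ)]
    exact le_antisymm hvv real_inner_self_nonneg
  have key : ∀ f : V → ℝ, (∀ d, 0 ≤ f d) → ∑ d ∈ Δ, f d • d = 0 → ∀ d ∈ Δ, f d = 0 := by
    intro f hf h0 d hd
    have h1 : ∑ d ∈ Δ, f d * ⟪ρ, d⟫ = 0 := by
      have := congrArg (fun x => ⟪ρ, x⟫) h0
      simpa only [inner_sum, real_inner_smul_right, inner_zero_right] using this
    have h2 := (Finset.sum_eq_zero_iff_of_nonneg fun d hd =>
      mul_nonneg (hf d) (hpos d hd).le).1 h1 d hd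
    exact (mul_eq_zero.1 h2).resolve_right (hpos d hd).ne'
  intro d hd
  have h1 := key _ (fun _ => le_max_right _ _) (hv.symm.trans hv0) d hd
  have h2 := key _ (fun _ => le_max_right _ _) (hv'.symm.trans hv0) d hd
  have h3 : c d ≤ max (c d) 0 := le_max_left _ _
  have h4 : -c d ≤ max (-c d) 0 := le_max_left _ _
  linarith

namespace IsBase

variable {Φ : Set V} {ρ : V} {Δ : Finset V}

theorem eq_zero (b : IsBase Φ ρ Δ) {c : V → ℝ} (hc : ∑ d ∈ Δ, c d • d = 0) :
    ∀ d ∈ Δ, c d = 0 := eq_zero_of_obtuse b.pos b.obtuse hc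

theorem coeff_ext (b : IsBase Φ ρ Δ) {c c' : V → ℝ}
    (h : ∑ d ∈ Δ, c d • d = ∑ d ∈ Δ, c' d • d) : ∀ d ∈ Δ, c d = c' d := by
  intro d hd
  have := b.eq_zero (c := fun d => c d - c' d) (by
    simp only [sub_smul, Finset.sum_sub_distrib, h, sub_self]) d hd
  linarith

theorem linearIndepOn (b : IsBase Φ ρ Δ) : LinearIndepOn ℝ id (Δ : Set V) := by
  rw [linearIndepOn_finset_iff]
  exact fun c hc => b.eq_zero hc

theorem span_eq (b : IsBase Φ ρ Δ) (h : IsRoot Φ) :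
    Submodule.span ℝ (Δ : Set V) = Submodule.span ℝ Φ := by
  refine le_antisymm (Submodule.span_mono fun d hd => b.mem d hd) (Submodule.span_le.2 ?_)
  have key : ∀ a ∈ Φ, 0 < ⟪ρ, a⟫ → a ∈ Submodule.span ℝ (Δ : Set V) := fun a ha hp => by
    obtain ⟨c, -, hc⟩ := b.comb a ha hp
    rw [hc]
    exact Submodule.sum_mem _ fun d hd => Submodule.smul_mem _ _ (Submodule.subset_span hd)
  intro a ha
  rcases lt_or_gt_of_ne (b.regular a ha) with hn | hp
  · rw [← neg_neg a]
    exact neg_mem (key _ (h.neg_mem ha) (by rw [inner_neg_right]; linarith))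
  · exact key a ha hp

theorem refl_pos (b : IsBase Φ ρ Δ) (h : IsRoot Φ) {d a : V} (hd : d ∈ Δ) (ha : a ∈ Φ)
    (hp : 0 < ⟪ρ, a⟫) (hne : a ≠ d) : 0 < ⟪ρ, refl d a⟫ := by
  classical
  have hdΦ := b.mem d hd
  obtain ⟨c, hc, he⟩ := b.comb a ha hp
  rcases lt_or_gt_of_ne (b.regular _ (h.refl_mem d hdΦ a ha)) with hn | hp'
  · exfalso
    obtain ⟨c', hc', he'⟩ := b.comb _ (h.neg_mem (h.refl_mem d hdΦ a ha))
      (by rw [inner_neg_right]; linarith)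
    rw [refl_apply (h.norm d hdΦ)] at he'
    have h1 : ∑ e ∈ Δ, (c e + c' e) • e = ∑ e ∈ Δ, (if e = d then ⟪d, a⟫ else 0) • e := by
      simp only [add_smul, Finset.sum_add_distrib, ← he, ← he', ite_smul, zero_smul,
        Finset.sum_ite_eq', hd, if_true]
      abel
    have h2 := b.coeff_ext h1
    have h3 : ∀ e ∈ Δ, e ≠ d → c e = 0 := fun e he hed => by
      have := h2 e he
      rw [if_neg hed] at this
      linarith [hc e, hc' e]
    have h4 : a = c d • d := by
      rw [he, Finset.sum_eq_single_of_mem d hd fun e he hed => by rw [h3 e he hed, zero_smul]]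
    rcases h.eq_or_eq_neg hdΦ ha h4 with h5 | h5
    · exact hne h5
    · rw [h5, inner_neg_right] at hp
      linarith [b.pos d hd]
  · exact hp'

theorem exists_inner_pos (b : IsBase Φ ρ Δ) (h : IsRoot Φ) {a : V} (ha : a ∈ Φ)
    (hp : 0 < ⟪ρ, a⟫) : ∃ d ∈ Δ, 0 < ⟪d, a⟫ := by
  obtain ⟨c, hc, he⟩ := b.comb a ha hp
  by_contra! hcon
  have h1 := h.norm a ha
  nth_rw 1 [he] at h1
  rw [sum_inner] at h1
  have : ∑ d ∈ Δ, ⟪c d • d, a⟫ ≤ 0 := Finset.sum_nonpos fun d hd => by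
    rw [real_inner_smul_left]
    exact mul_nonpos_of_nonneg_of_nonpos (hc d) (hcon d hd)
  linarith

theorem exists_conj (b : IsBase Φ ρ Δ) (h : IsRoot Φ) {a : V} (ha : a ∈ Φ) :
    ∃ g ∈ weyl (Δ : Set V), ∃ d ∈ Δ, a = g d := by
  have key : ∀ a ∈ Φ, 0 < ⟪ρ, a⟫ → ∃ g ∈ weyl (Δ : Set V), ∃ d ∈ Δ, a = g d := by
    by_contra! hcon
    obtain ⟨a, ⟨haΦ, hap, hbad⟩, hmin⟩ := Set.exists_min_image
      {a | a ∈ Φ ∧ 0 < ⟪ρ, a⟫ ∧ ∀ g ∈ weyl (Δ : Set V), ∀ d ∈ Δ, a ≠ g d} (fun a => ⟪ρ, a⟫)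
      (h.finite.subset fun a ha => ha.1) hcon
    obtain ⟨d, hd, hda⟩ := b.exists_inner_pos h haΦ hap
    have hne : a ≠ d := fun hh => hbad 1 (one_mem _) d hd hh
    have h1 := b.refl_pos h hd haΦ hap hne
    have h2 := hmin (refl d a) ⟨h.refl_mem d (b.mem d hd) a haΦ, h1, fun g hg e he hh =>
      hbad (refl d * g) (mul_mem (refl_mem_weyl hd) hg) e he (by rw [mul_apply, ← hh, refl_refl])⟩
    rw [refl_apply (h.norm d (b.mem d hd)), inner_sub_right, real_inner_smul_right] at h2
    nlinarith [b.pos d hd]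
  rcases lt_or_gt_of_ne (b.regular a ha) with hn | hp
  · obtain ⟨g, hg, d, hd, he⟩ := key (-a) (h.neg_mem ha) (by rw [inner_neg_right]; linarith)
    refine ⟨g * refl d, mul_mem hg (refl_mem_weyl hd), d, hd, ?_⟩
    rw [mul_apply, refl_self (h.norm d (b.mem d hd)), map_neg, ← he, neg_neg]
  · exact key a ha hp

theorem weyl_eq (b : IsBase Φ ρ Δ) (h : IsRoot Φ) : weyl (Δ : Set V) = weyl Φ := by
  refine le_antisymm (weyl_mono fun d hd => b.mem d hd) (weyl_le fun a ha => ?_)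
  obtain ⟨g, hg, d, hd, rfl⟩ := b.exists_conj h ha
  rw [refl_map (h.norm d (b.mem d hd))]
  exact mul_mem (mul_mem hg (refl_mem_weyl hd)) (inv_mem hg)

theorem exists_list (b : IsBase Φ ρ Δ) (h : IsRoot Φ) {g : V ≃ₗᵢ[ℝ] V} (hg : g ∈ weyl Φ) :
    ∃ l : List V, (∀ d ∈ l, d ∈ Δ) ∧ (l.map refl).prod = g := by
  rw [← b.weyl_eq h] at hg
  refine weyl_induction (p := fun g => ∃ l : List V, (∀ d ∈ l, d ∈ Δ) ∧ (l.map refl).prod = g)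
    ⟨[], by simp⟩ ?_ hg
  rintro a ha g - ⟨l, hl, rfl⟩
  exact ⟨a :: l, by simpa using ⟨ha, hl⟩, by simp⟩

theorem list_mem (b : IsBase Φ ρ Δ) {l : List V} (hl : ∀ d ∈ l, d ∈ Δ) :
    (l.map refl).prod ∈ weyl Φ := by
  refine Subgroup.list_prod_mem _ fun x hx => ?_
  obtain ⟨d, hd, rfl⟩ := List.mem_map.1 hx
  exact refl_mem_weyl (b.mem d (hl d hd))

/-- The exchange property. -/
theorem exchange (b : IsBase Φ ρ Δ) (h : IsRoot Φ) {d : V} (hd : d ∈ Δ) :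
    ∀ l : List V, (∀ e ∈ l, e ∈ Δ) → ⟪ρ, (l.map refl).prod d⟫ < 0 →
      ∃ l' : List V, (∀ e ∈ l', e ∈ Δ) ∧ l'.length + 1 = l.length ∧
        (l'.map refl).prod = (l.map refl).prod * refl d := by
  intro l
  induction l with
  | nil =>
    intro _ hn
    have := b.pos d hd
    simp only [List.map_nil, List.prod_nil, LinearIsometryEquiv.coe_one, id] at hn
    linarith
  | cons e l ih =>
    intro hl hn
    have hl' : ∀ x ∈ l, x ∈ Δ := fun x hx => hl x (List.mem_cons_of_mem _ hx)
    have he : e ∈ Δ := hl e List.mem_cons_self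
    set g := (l.map refl).prod with hg
    have hgW : g ∈ weyl Φ := b.list_mem hl'
    have hgd : g d ∈ Φ := h.map_mem hgW d (b.mem d hd)
    rcases lt_or_gt_of_ne (b.regular _ hgd) with hlt | hgt
    · obtain ⟨l', h1, h2, h3⟩ := ih hl' hlt
      refine ⟨e :: l', by simpa using ⟨he, h1⟩, by simp [h2], ?_⟩
      simp [h3, mul_assoc, hg]
    · have heq : g d = e := by
        by_contra hne
        have := b.refl_pos h he hgd hgt hne
        rw [List.map_cons, List.prod_cons, mul_apply] at hn
        linarith
      refine ⟨l, hl', by simp, ?_⟩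
      have h1 := refl_map (h.norm d (b.mem d hd)) g
      rw [heq] at h1
      rw [List.map_cons, List.prod_cons, ← hg, h1]
      simp only [mul_assoc, inv_mul_cancel_left, refl_mul_refl, mul_one]

/-- An element of the reflection group that preserves positivity of simple roots is trivial. -/
theorem eq_one (b : IsBase Φ ρ Δ) (h : IsRoot Φ) {g : V ≃ₗᵢ[ℝ] V} (hg : g ∈ weyl Φ)
    (hpos : ∀ d ∈ Δ, 0 < ⟪ρ, g d⟫) : g = 1 := by
  classical
  have hex : ∃ n, ∃ l : List V, (∀ d ∈ l, d ∈ Δ) ∧ (l.map refl).prod = g ∧ l.length = n := by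
    obtain ⟨l, h1, h2⟩ := b.exists_list h hg
    exact ⟨_, l, h1, h2, rfl⟩
  obtain ⟨l, h1, h2, h3⟩ := Nat.find_spec hex
  rcases List.eq_nil_or_concat l with rfl | ⟨l', d, rfl⟩
  · simpa using h2.symm
  · exfalso
    have hd : d ∈ Δ := h1 d (by simp)
    have hl' : ∀ x ∈ l', x ∈ Δ := fun x hx => h1 x (by simp [hx])
    have hg' : (l'.map refl).prod = g * refl d := by
      rw [← h2]; simp [mul_assoc, refl_mul_refl]
    obtain ⟨l'', h4, h5, h6⟩ := b.exchange h hd l' hl' (by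
      rw [hg', mul_apply, refl_self (h.norm d (b.mem d hd)), map_neg, inner_neg_right]
      linarith [hpos d hd])
    refine Nat.find_min hex (m := l''.length) ?_ ⟨l'', h4, ?_, rfl⟩
    · rw [← h3, List.concat_eq_append, List.length_append]
      simp; omega
    · rw [h6, hg', mul_assoc, refl_mul_refl, mul_one]

end IsBase

theorem IsRoot.finite_weyl [FiniteDimensional ℝ V] {Φ : Set V} (h : IsRoot Φ) :
    Finite (weyl Φ) := by
  have := h.finite.to_subtype
  let f : weyl Φ → (Φ → Φ) := fun g a => ⟨g.1 a.1, h.map_mem g.2 _ a.2⟩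
  refine Finite.of_injective f fun g g' hgg => ?_
  have hΦ : ∀ a ∈ Φ, g.1 a = g'.1 a := fun a ha => congrArg Subtype.val (congrFun hgg ⟨a, ha⟩)
  ext x
  have h1 : g.1 x - g'.1 x ∈ Submodule.span ℝ Φ := by
    have := sub_mem (h.sub_mem_span g.2 x) (h.sub_mem_span g'.2 x)
    rwa [sub_sub_sub_cancel_right] at this
  have h2 : ∀ y ∈ Submodule.span ℝ Φ, ⟪y, g.1 x - g'.1 x⟫ = 0 := by
    intro y hy
    induction hy using Submodule.span_induction with
    | mem y hy =>
      have hz : g.1⁻¹ y ∈ Φ := h.map_mem (inv_mem g.2) y hy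
      have e1 : y = g.1 (g.1⁻¹ y) := (apply_inv_self _ _).symm
      have e2 : y = g'.1 (g.1⁻¹ y) := by rw [← hΦ _ hz, apply_inv_self]
      rw [inner_sub_right]
      nth_rw 1 [e1]
      nth_rw 2 [e2]
      rw [LinearIsometryEquiv.inner_map_map, LinearIsometryEquiv.inner_map_map, sub_self]
    | zero => simp
    | add y z _ _ hy hz => rw [inner_add_left, hy, hz, add_zero]
    | smul c y _ hy => rw [real_inner_smul_left, hy, mul_zero]
  exact sub_eq_zero.1 (inner_self_eq_zero.1 (h2 _ h1))

theorem IsRoot.exists_regular [FiniteDimensional ℝ V] {Φ : Set V} (h : IsRoot Φ) :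
    ∃ ρ : V, ∀ a ∈ Φ, ⟪ρ, a⟫ ≠ 0 := by
  have := h.finite.to_subtype
  obtain ⟨f, hf⟩ := Module.exists_dual_forall_apply_ne_zero (K := ℝ) (fun a : Φ => (a : V))
    (fun a => h.ne_zero a.2)
  refine ⟨(InnerProductSpace.toDual ℝ V).symm (LinearMap.toContinuousLinearMap f), fun a ha => ?_⟩
  rw [InnerProductSpace.toDual_symm_apply]
  exact hf ⟨a, ha⟩

theorem IsRoot.exists_base [FiniteDimensional ℝ V] {Φ : Set V} (h : IsRoot Φ) :
    ∃ ρ Δ, IsBase Φ ρ Δ := by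
  obtain ⟨ρ, hρ⟩ := h.exists_regular
  exact ⟨ρ, exists_isBase h hρ⟩

/-- Every vector is conjugate into the closed fundamental chamber. -/
theorem IsBase.exists_dominant [FiniteDimensional ℝ V] {Φ : Set V} {ρ : V} {Δ : Finset V}
    (b : IsBase Φ ρ Δ) (h : IsRoot Φ) (v : V) :
    ∃ g ∈ weyl Φ, ∀ d ∈ Δ, 0 ≤ ⟪g v, d⟫ := by
  have := h.finite_weyl
  obtain ⟨g, hg⟩ := Finite.exists_max fun g : weyl Φ => ⟪g.1 v, ρ⟫
  refine ⟨g.1, g.2, fun d hd => ?_⟩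
  have h1 := hg ⟨refl d * g.1, mul_mem (refl_mem_weyl (b.mem d hd)) g.2⟩
  simp only [mul_apply] at h1
  rw [refl_apply (h.norm d (b.mem d hd)), inner_sub_left, real_inner_smul_left,
    real_inner_comm ρ d] at h1
  have := b.pos d hd
  rw [real_inner_comm]
  nlinarith

theorem mem_weyl_map {Φ : Set V} (h : IsRoot Φ) {g w : V ≃ₗᵢ[ℝ] V} (hw : w ∈ weyl Φ) :
    g * w * g⁻¹ ∈ weyl (g '' Φ) := by
  refine weyl_induction (p := fun w => g * w * g⁻¹ ∈ weyl (g '' Φ)) (by simp) ?_ hw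
  intro a ha w _ ih
  have : g * (refl a * w) * g⁻¹ = refl (g a) * (g * w * g⁻¹) := by
    rw [refl_map (h.norm a ha)]; group
  rw [this]
  exact mul_mem (refl_mem_weyl ⟨a, ha, rfl⟩) ih

/-- Steinberg's theorem for a single vector: the stabiliser of `v` is generated by the reflections
that fix `v`. -/
theorem IsRoot.mem_weyl_of_fixed [FiniteDimensional ℝ V] {Φ : Set V} (h : IsRoot Φ)
    {w : V ≃ₗᵢ[ℝ] V} (hw : w ∈ weyl Φ) {v : V} (hv : w v = v) :
    w ∈ weyl (Φ ∩ (ℝ ∙ v)ᗮ) := by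
  obtain ⟨ρ, Δ, b⟩ := h.exists_base
  have key : ∀ n : ℕ, ∀ l : List V, l.length = n → (∀ d ∈ l, d ∈ Δ) → ∀ v : V,
      (∀ d ∈ Δ, 0 ≤ ⟪v, d⟫) → (l.map refl).prod v = v →
        (l.map refl).prod ∈ weyl (Φ ∩ (ℝ ∙ v)ᗮ) := by
    intro n
    induction n with
    | zero =>
      intro l hl _ v _ _
      rw [List.length_eq_zero_iff.1 hl]
      simp
    | succ n ih =>
      intro l hl hlΔ v hv hfix
      set w := (l.map refl).prod with hw
      have hwW : w ∈ weyl Φ := b.list_mem hlΔ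
      by_cases hone : w = 1
      · rw [hone]; exact one_mem _
      obtain ⟨d, hd, hneg⟩ : ∃ d ∈ Δ, ⟪ρ, w d⟫ ≤ 0 := by
        by_contra! hcon
        exact hone (b.eq_one h hwW hcon)
      have hwd : w d ∈ Φ := h.map_mem hwW d (b.mem d hd)
      have hlt := lt_of_le_of_ne hneg (b.regular _ hwd)
      have hvd : ⟪v, d⟫ = 0 := by
        refine le_antisymm ?_ (hv d hd)
        obtain ⟨c, hc, he⟩ := b.comb _ (h.neg_mem hwd) (by rw [inner_neg_right]; linarith)
        have h1 : 0 ≤ ⟪v, -w d⟫ := by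
          rw [he, inner_sum]
          exact Finset.sum_nonneg fun e he => by
            rw [real_inner_smul_right]; exact mul_nonneg (hc e) (hv e he)
        rw [inner_neg_right] at h1
        nth_rw 1 [← hfix] at h1
        rw [LinearIsometryEquiv.inner_map_map] at h1
        linarith
      obtain ⟨l', h1, h2, h3⟩ := b.exchange h hd l hlΔ hlt
      have hdv : refl d v = v := by
        rw [refl_apply (h.norm d (b.mem d hd)), real_inner_comm, hvd]; simp
      have h4 := ih l' (by omega) h1 v hv (by rw [h3, mul_apply, hdv]; exact hfix)
      have h5 : w = (l'.map refl).prod * refl d := by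
        rw [h3, mul_assoc, refl_mul_refl, mul_one]
      rw [h5]
      exact mul_mem h4 (refl_mem_weyl ⟨b.mem d hd, Submodule.mem_orthogonal_singleton_iff_inner_right.2 hvd⟩)
  obtain ⟨g, hg, hdom⟩ := b.exists_dominant h v
  obtain ⟨l, hl, hlw⟩ := b.exists_list h (mul_mem (mul_mem hg hw) (inv_mem hg))
  have h1 := key _ l rfl hl (g v) hdom (by
    rw [hlw, mul_apply, mul_apply, inv_apply_self, hv])
  rw [hlw] at h1
  have h2 := mem_weyl_map (h.inter _) (g := g⁻¹) h1
  have h3 : g⁻¹ * (g * w * g⁻¹) * g⁻¹⁻¹ = w := by group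
  rw [h3] at h2
  refine weyl_mono ?_ h2
  rintro _ ⟨a, ⟨ha, hav⟩, rfl⟩
  refine ⟨h.map_mem (inv_mem hg) a ha, Submodule.mem_orthogonal_singleton_iff_inner_right.2 ?_⟩
  rw [inner_inv_right]
  exact Submodule.mem_orthogonal_singleton_iff_inner_right.1 hav

end

section

variable {V : Type*} [NormedAddCommGroup V] [InnerProductSpace ℝ V]

namespace IsBase

variable {Φ : Set V} {ρ : V} {Δ : Finset V}

theorem coeff_mul_nonneg (b : IsBase Φ ρ Δ) (h : IsRoot Φ) {d e : V} (hd : d ∈ Δ) (he : e ∈ Δ)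
    (hde : d ≠ e) {s t : ℝ} (hr : s • d + t • e ∈ Φ) : 0 ≤ s * t := by
  classical
  have key : ∀ s t : ℝ, s • d + t • e ∈ Φ → 0 < ⟪ρ, s • d + t • e⟫ → 0 ≤ s ∧ 0 ≤ t := by
    intro s t hr hp
    obtain ⟨c, hc, hs⟩ := b.comb _ hr hp
    have h1 : ∑ x ∈ Δ, ((if x = d then s else 0) + (if x = e then t else 0)) • x
        = ∑ x ∈ Δ, c x • x := by
      rw [← hs]
      simp [add_smul, Finset.sum_add_distrib, ite_smul, hd, he]
    have h2 := b.coeff_ext h1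
    have h3 := h2 d hd
    have h4 := h2 e he
    simp only [if_true, if_neg hde, if_neg hde.symm, add_zero, zero_add] at h3 h4
    exact ⟨h3 ▸ hc d, h4 ▸ hc e⟩
  rcases lt_or_gt_of_ne (b.regular _ hr) with hn | hp
  · have h1 : (-s) • d + (-t) • e ∈ Φ := by
      have := h.neg_mem hr
      rwa [neg_add, ← neg_smul, ← neg_smul] at this
    have h2 := key (-s) (-t) h1 (by
      rw [show (-s) • d + (-t) • e = -(s • d + t • e) by module, inner_neg_right]; linarith)
    nlinarith
  · have := key s t hr hp
    exact mul_nonneg this.1 this.2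

/-- The possible values of the off-diagonal Gram entries of a simple system. -/
theorem gram_values (b : IsBase Φ ρ Δ) (h : IsRoot Φ) {d e : V} (hd : d ∈ Δ) (he : e ∈ Δ)
    (hde : d ≠ e) : ⟪d, e⟫ = 0 ∨ ⟪d, e⟫ = -1 ∨ ⟪d, e⟫ = -√2 ∨ ⟪d, e⟫ = -Real.goldenRatio ∨
      ⟪d, e⟫ ≤ -√3 := by
  obtain ⟨x, hx⟩ : ∃ x, x = -⟪d, e⟫ := ⟨_, rfl⟩
  have hx0 : 0 ≤ x := by linarith [b.obtuse d hd e he hde]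
  have hdd := h.norm d (b.mem d hd)
  have hee := h.norm e (b.mem e he)
  have hde' : ⟪d, e⟫ = -x := by linarith
  have hed' : ⟪e, d⟫ = -x := by rw [real_inner_comm]; linarith
  have step1 : ∀ s t : ℝ, s • d + t • e ∈ Φ → (x * t - s) • d + t • e ∈ Φ := fun s t hr => by
    have := h.refl_mem d (b.mem d hd) _ hr
    rw [refl_apply hdd, inner_add_right, real_inner_smul_right, real_inner_smul_right, hdd,
      hde'] at this
    convert this using 1
    module
  have step2 : ∀ s t : ℝ, s • d + t • e ∈ Φ → s • d + (x * s - t) • e ∈ Φ := fun s t hr => by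
    have := h.refl_mem e (b.mem e he) _ hr
    rw [refl_apply hee, inner_add_right, real_inner_smul_right, real_inner_smul_right, hee,
      hed'] at this
    convert this using 1
    module
  have r0 : (1 : ℝ) • d + (0 : ℝ) • e ∈ Φ := by simpa using b.mem d hd
  have r0' : (0 : ℝ) • d + (1 : ℝ) • e ∈ Φ := by simpa using b.mem e he
  have r2 := step1 _ _ (step2 _ _ r0)
  have r3 := step1 _ _ (step2 _ _ (step1 _ _ r0'))
  have r4 := step1 _ _ (step2 _ _ r2)
  have r5 := step1 _ _ (step2 _ _ r3)
  have q2 := b.coeff_mul_nonneg h hd he hde r2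
  have q3 := b.coeff_mul_nonneg h hd he hde r3
  have q4 := b.coeff_mul_nonneg h hd he hde r4
  have q5 := b.coeff_mul_nonneg h hd he hde r5
  have e2 : 0 ≤ x * (x ^ 2 - 1) := by nlinarith
  have e3 : 0 ≤ x * ((x ^ 2 - 1) * (x ^ 2 - 2)) := by nlinarith
  have e4 : 0 ≤ x * ((x ^ 2 - 2) * (x ^ 4 - 3 * x ^ 2 + 1)) := by nlinarith
  have e5 : 0 ≤ x * ((x ^ 4 - 3 * x ^ 2 + 1) * ((x ^ 2 - 1) * (x ^ 2 - 3))) := by nlinarith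
  rcases hx0.eq_or_lt with h0 | h0
  · left; linarith
  have f2 := nonneg_of_mul_nonneg_right e2 h0
  have f3 := nonneg_of_mul_nonneg_right e3 h0
  have f4 := nonneg_of_mul_nonneg_right e4 h0
  have f5 := nonneg_of_mul_nonneg_right e5 h0
  have hsq : ∀ c : ℝ, 0 ≤ c → c * c = x ^ 2 → ⟪d, e⟫ = -c := fun c hc hcc => by
    rw [hde', neg_inj]; nlinarith
  rcases f2.eq_or_lt with h1 | h1
  · right; left; exact hsq 1 zero_le_one (by linarith)
  have f3' := nonneg_of_mul_nonneg_right f3 h1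
  rcases f3'.eq_or_lt with h2 | h2
  · right; right; left
    exact hsq _ (Real.sqrt_nonneg 2) (by rw [Real.mul_self_sqrt (by norm_num)]; linarith)
  have f4' := nonneg_of_mul_nonneg_right f4 h2
  have f5' : (x ^ 4 - 3 * x ^ 2 + 1) * (x ^ 2 - 3) ≥ 0 := by
    by_contra! hcon
    nlinarith
  rcases f4'.eq_or_lt with h4 | h4
  · right; right; right; left
    have hg := Real.goldenRatio_sq
    have hgp := Real.one_lt_goldenRatio
    have hh : (x ^ 2 - x - 1) * (x ^ 2 + x - 1) = 0 := by nlinarith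
    have h7 : x ^ 2 - x - 1 = 0 := (mul_eq_zero.1 hh).resolve_right (by nlinarith)
    have h8 : (x - Real.goldenRatio) * (x + Real.goldenRatio - 1) = 0 := by nlinarith
    have h9 : x - Real.goldenRatio = 0 := (mul_eq_zero.1 h8).resolve_right (by nlinarith)
    rw [hde']; linarith
  · right; right; right; right
    have := nonneg_of_mul_nonneg_right f5' h4
    rw [hde', neg_le_neg_iff]
    exact Real.sqrt_le_iff.2 ⟨hx0, by linarith⟩

end IsBase

theorem IsRoot.eq_of_eqOn {Φ : Set V} (h : IsRoot Φ) {g g' : V ≃ₗᵢ[ℝ] V}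
    (hg : g ∈ weyl Φ) (hg' : g' ∈ weyl Φ) (hΦ : ∀ a ∈ Φ, g a = g' a) : g = g' := by
  ext x
  have h1 : g x - g' x ∈ Submodule.span ℝ Φ := by
    have := sub_mem (h.sub_mem_span hg x) (h.sub_mem_span hg' x)
    rwa [sub_sub_sub_cancel_right] at this
  have h2 : ∀ y ∈ Submodule.span ℝ Φ, ⟪y, g x - g' x⟫ = 0 := by
    intro y hy
    induction hy using Submodule.span_induction with
    | mem y hy =>
      have hz : g⁻¹ y ∈ Φ := h.map_mem (inv_mem hg) y hy
      have e1 : y = g (g⁻¹ y) := (apply_inv_self _ _).symm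
      have e2 : y = g' (g⁻¹ y) := by rw [← hΦ _ hz, apply_inv_self]
      rw [inner_sub_right]
      nth_rw 1 [e1]
      nth_rw 2 [e2]
      rw [LinearIsometryEquiv.inner_map_map, LinearIsometryEquiv.inner_map_map, sub_self]
    | zero => simp
    | add y z _ _ hy hz => rw [inner_add_left, hy, hz, add_zero]
    | smul c y _ hy => rw [real_inner_smul_left, hy, mul_zero]
  exact sub_eq_zero.1 (inner_self_eq_zero.1 (h2 _ h1))

/-- Every element of the reflection group of `Φ` is conjugate to its inverse there. -/
def Reversible (Φ : Set V) : Prop := ∀ w ∈ weyl Φ, ∃ g ∈ weyl Φ, g * w * g⁻¹ = w⁻¹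

theorem refl_eq_of_inner_eq_zero {a : V} (ha : ⟪a, a⟫ = 2) {x : V} (h : ⟪a, x⟫ = 0) :
    refl a x = x := by rw [refl_apply ha, h]; simp

theorem commute_refl {a b : V} (ha : ⟪a, a⟫ = 2) (h : ⟪a, b⟫ = 0) :
    Commute (refl a) (refl b) := by
  have h2 := refl_map ha (refl b)
  by_cases hb : b = 0
  · subst hb
    have : refl (0 : V) = 1 := by
      ext x; unfold refl; rw [Submodule.reflection_orthogonal_apply]; simp
    rw [this]; exact Commute.one_right _
  have h3 : refl b a = a := by
    unfold refl
    rw [Submodule.reflection_mem_subspace_eq_self]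
    rw [Submodule.mem_orthogonal_singleton_iff_inner_left]
    exact h
  rw [h3] at h2
  have h4 : refl a * refl b = refl b * refl a := by
    nth_rw 1 [h2]
    rw [inv_mul_cancel_right]
  exact h4

theorem commute_weyl {Φ Ψ : Set V} (hΦ : IsRoot Φ) (h : ∀ a ∈ Φ, ∀ b ∈ Ψ, ⟪a, b⟫ = 0)
    {g k : V ≃ₗᵢ[ℝ] V} (hg : g ∈ weyl Φ) (hk : k ∈ weyl Ψ) : Commute g k := by
  have h1 : ∀ a ∈ Φ, Commute (refl a) k := fun a ha =>
    weyl_induction (p := fun k => Commute (refl a) k) (Commute.one_right _)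
      (fun b hb _ _ ih => (commute_refl (hΦ.norm a ha) (h a ha b hb)).mul_right ih) hk
  exact weyl_induction (p := fun g => Commute g k) (Commute.one_left _)
    (fun a ha _ _ ih => (h1 a ha).mul_left ih) hg

theorem exists_mul_of_orthogonal {Φ Ψ : Set V} (hΦ : IsRoot Φ)
    (h : ∀ a ∈ Φ, ∀ b ∈ Ψ, ⟪a, b⟫ = 0) {w : V ≃ₗᵢ[ℝ] V} (hw : w ∈ weyl (Φ ∪ Ψ)) :
    ∃ g ∈ weyl Φ, ∃ k ∈ weyl Ψ, w = g * k := by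
  refine weyl_induction (p := fun w => ∃ g ∈ weyl Φ, ∃ k ∈ weyl Ψ, w = g * k)
    ⟨1, one_mem _, 1, one_mem _, by simp⟩ ?_ hw
  rintro a (ha | ha) w _ ⟨g, hg, k, hk, rfl⟩
  · exact ⟨refl a * g, mul_mem (refl_mem_weyl ha) hg, k, hk, by rw [mul_assoc]⟩
  · refine ⟨g, hg, refl a * k, mul_mem (refl_mem_weyl ha) hk, ?_⟩
    rw [← mul_assoc, ← mul_assoc, (commute_weyl hΦ h hg (refl_mem_weyl ha)).eq]

theorem Reversible.union {Φ Ψ : Set V} (hΦ : IsRoot Φ) (h : ∀ a ∈ Φ, ∀ b ∈ Ψ, ⟪a, b⟫ = 0)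
    (h1 : Reversible Φ) (h2 : Reversible Ψ) : Reversible (Φ ∪ Ψ) := by
  intro w hw
  obtain ⟨g, hg, k, hk, rfl⟩ := exists_mul_of_orthogonal hΦ h hw
  obtain ⟨x, hx, hxg⟩ := h1 g hg
  obtain ⟨y, hy, hyk⟩ := h2 k hk
  refine ⟨x * y, mul_mem (weyl_mono Set.subset_union_left hx)
    (weyl_mono Set.subset_union_right hy), ?_⟩
  have c1 := commute_weyl hΦ h hg hy
  have c2 := commute_weyl hΦ h hx hk
  have c3 := commute_weyl hΦ h hx hy
  have c4 := commute_weyl hΦ h hg hk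
  calc x * y * (g * k) * (x * y)⁻¹ = x * (y * g) * k * (y⁻¹ * x⁻¹) := by group
    _ = x * g * (y * k * y⁻¹) * x⁻¹ := by rw [c1.symm.eq]; group
    _ = x * g * (k⁻¹ * x⁻¹) := by rw [hyk]; group
    _ = (x * g * x⁻¹) * k⁻¹ := by rw [(c2.inv_inv).symm.eq]; group
    _ = (g * k)⁻¹ := by rw [hxg, c4.eq, mul_inv_rev]

theorem isRoot_pair {a : V} (ha : ⟪a, a⟫ = 2) : IsRoot {a, -a} where
  finite := by simp
  norm := by rintro _ (rfl | rfl) <;> simp only [inner_neg_neg, ha]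
  refl_mem := by
    have h1 : refl a a = -a := refl_self ha
    rintro _ (rfl | rfl) _ (rfl | rfl) <;> simp [refl_neg, h1]

theorem reversible_pair {a : V} (ha : ⟪a, a⟫ = 2) : Reversible {a, -a} := by
  intro w hw
  refine ⟨1, one_mem _, ?_⟩
  have : w = 1 ∨ w = refl a := by
    refine weyl_induction (p := fun w => w = 1 ∨ w = refl a) (Or.inl rfl) ?_ hw
    have : ∀ g, g = 1 ∨ g = refl a → refl a * g = 1 ∨ refl a * g = refl a := by
      rintro g (rfl | rfl)
      · right; rw [mul_one]
      · left; exact refl_mul_refl a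
    rintro _ (rfl | rfl) g _ hg
    · exact this g hg
    · rw [refl_neg]; exact this g hg
  rcases this with rfl | rfl
  · simp
  · rw [refl_inv]; simp

/-- `w` is an irreversible element of the reflection group of a minimal `Φ`. -/
structure Critical (Φ : Set V) (w : V ≃ₗᵢ[ℝ] V) : Prop where
  isRoot : IsRoot Φ
  span : Submodule.span ℝ Φ = ⊤
  mem : w ∈ weyl Φ
  irrev : ∀ g ∈ weyl Φ, g * w * g⁻¹ ≠ w⁻¹
  ih : ∀ Ψ, Ψ ⊂ Φ → IsRoot Ψ → Reversible Ψ

namespace Critical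

variable {Φ : Set V} {w : V ≃ₗᵢ[ℝ] V}

theorem notMem (h : Critical Φ w) {Ψ : Set V} (hΨ : Ψ ⊆ Φ) (hr : Reversible Ψ) : w ∉ weyl Ψ := by
  intro hw
  obtain ⟨g, hg, he⟩ := hr w hw
  exact h.irrev g (weyl_mono hΨ hg) he

theorem eq_of_mem (h : Critical Φ w) {Ψ : Set V} (hΨ : Ψ ⊆ Φ) (hr : IsRoot Ψ)
    (hw : w ∈ weyl Ψ) : Ψ = Φ := by
  by_contra hne
  exact h.notMem hΨ (h.ih Ψ (hΨ.ssubset_of_ne hne) hr) hw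

theorem eq_zero_of_orthogonal (h : Critical Φ w) {v : V} (hv : ∀ a ∈ Φ, ⟪v, a⟫ = 0) : v = 0 := by
  have : v ∈ (Submodule.span ℝ Φ)ᗮ := by
    rw [Submodule.mem_orthogonal]
    intro u hu
    induction hu using Submodule.span_induction with
    | mem y hy => rw [real_inner_comm]; exact hv y hy
    | zero => simp
    | add y z _ _ hy hz => rw [inner_add_left, hy, hz, add_zero]
    | smul c y _ hy => rw [real_inner_smul_left, hy, mul_zero]
  rw [h.span] at this
  simpa using this

theorem eq_zero_of_fixed [FiniteDimensional ℝ V] (h : Critical Φ w) {v : V} (hv : w v = v) :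
    v = 0 := by
  have h1 := h.eq_of_mem Set.inter_subset_left (h.isRoot.inter _) (h.isRoot.mem_weyl_of_fixed h.mem hv)
  refine h.eq_zero_of_orthogonal fun a ha => ?_
  rw [← h1] at ha
  exact Submodule.mem_orthogonal_singleton_iff_inner_right.1 ha.2

theorem apply_ne_neg [FiniteDimensional ℝ V] (h : Critical Φ w) {a : V} (ha : a ∈ Φ) :
    w a ≠ -a := by
  intro hwa
  have haa := h.isRoot.norm a ha
  have h1 : refl a * w ∈ weyl (Φ ∩ (ℝ ∙ a)ᗮ) :=
    h.isRoot.mem_weyl_of_fixed (mul_mem (refl_mem_weyl ha) h.mem)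
      (by rw [mul_apply, hwa, map_neg, refl_self haa, neg_neg])
  have hsub : ({a, -a} : Set V) ∪ (Φ ∩ (ℝ ∙ a)ᗮ) ⊆ Φ := by
    rintro x ((rfl | rfl) | hx)
    · exact ha
    · exact h.isRoot.neg_mem ha
    · exact hx.1
  refine h.notMem hsub (Reversible.union (isRoot_pair haa) ?_ (reversible_pair haa) (h.ih _ ?_
    (h.isRoot.inter _))) ?_
  · rintro x (rfl | rfl) y hy
    · exact Submodule.mem_orthogonal_singleton_iff_inner_right.1 hy.2
    · rw [inner_neg_left, neg_eq_zero]
      exact Submodule.mem_orthogonal_singleton_iff_inner_right.1 hy.2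
  · refine ⟨Set.inter_subset_left, fun hc => ?_⟩
    have := Submodule.mem_orthogonal_singleton_iff_inner_right.1 (hc ha).2
    rw [haa] at this
    norm_num at this
  · have : w = refl a * (refl a * w) := by rw [← mul_assoc, refl_mul_refl, one_mul]
    rw [this]
    exact mul_mem (refl_mem_weyl (by simp)) (weyl_mono Set.subset_union_right h1)

theorem mul_self_ne_one (h : Critical Φ w) : w * w ≠ 1 := by
  intro h1
  refine h.irrev 1 (one_mem _) ?_
  rw [inv_eq_of_mul_eq_one_left h1]
  simp

theorem neg (h : Critical Φ w) (hn : LinearIsometryEquiv.neg ℝ ∈ weyl Φ) :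
    Critical Φ (LinearIsometryEquiv.neg ℝ * w) where
  isRoot := h.isRoot
  span := h.span
  mem := mul_mem hn h.mem
  irrev g hg he := by
    refine h.irrev g hg ?_
    have hcomm : ∀ f : V ≃ₗᵢ[ℝ] V, Commute (LinearIsometryEquiv.neg ℝ) f := fun f => by
      show LinearIsometryEquiv.neg ℝ * f = f * LinearIsometryEquiv.neg ℝ
      ext x; simp [mul_apply]
    rw [← mul_assoc, ← (hcomm g).eq, mul_assoc, mul_assoc, mul_inv_rev, ← (hcomm w⁻¹).inv_left.eq]
      at he
    have hinv : (LinearIsometryEquiv.neg ℝ : V ≃ₗᵢ[ℝ] V)⁻¹ = LinearIsometryEquiv.neg ℝ := by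
      refine inv_eq_of_mul_eq_one_left ?_
      ext x; simp [mul_apply]
    rw [hinv, ← mul_assoc g] at he
    exact mul_left_cancel he
  ih := h.ih

theorem eq_zero_of_neg [FiniteDimensional ℝ V] (h : Critical Φ w)
    (hn : LinearIsometryEquiv.neg ℝ ∈ weyl Φ) {v : V} (hv : w v = -v) : v = 0 :=
  (h.neg hn).eq_zero_of_fixed (by rw [mul_apply, hv]; simp)

theorem conj (h : Critical Φ w) {k : V ≃ₗᵢ[ℝ] V} (hk : k ∈ weyl Φ) :
    Critical Φ (k * w * k⁻¹) where
  isRoot := h.isRoot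
  span := h.span
  mem := mul_mem (mul_mem hk h.mem) (inv_mem hk)
  irrev g hg he := by
    refine h.irrev (k⁻¹ * g * k) (mul_mem (mul_mem (inv_mem hk) hg) hk) ?_
    have : k⁻¹ * g * k * w * (k⁻¹ * g * k)⁻¹ = k⁻¹ * (g * (k * w * k⁻¹) * g⁻¹) * k := by group
    rw [this, he]
    group
  ih := h.ih

end Critical

end

section

variable {V : Type*} [NormedAddCommGroup V] [InnerProductSpace ℝ V]

/-- An isometry of an odd dimensional space has eigenvalue `1` or `-1`. -/
theorem exists_fixed_or_neg [FiniteDimensional ℝ V] (hodd : Odd (Module.finrank ℝ V))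
    (w : V ≃ₗᵢ[ℝ] V) : ∃ v ≠ 0, w v = v ∨ w v = -v := by
  classical
  by_contra! hcon
  obtain ⟨b⟩ : Nonempty (OrthonormalBasis (Fin (Module.finrank ℝ V)) ℝ V) :=
    ⟨stdOrthonormalBasis ℝ V⟩
  set A := LinearMap.toMatrix b.toBasis b.toBasis w.toLinearEquiv.toLinearMap with hA
  have hAt : A.transpose * A = 1 := by
    ext i j
    have : ∀ i j, A i j = ⟪b i, w (b j)⟫ := fun i j => by
      rw [hA, LinearMap.toMatrix_apply]
      simp [OrthonormalBasis.repr_apply_apply]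
    rw [Matrix.mul_apply]
    simp only [Matrix.transpose_apply, this]
    have h1 := b.sum_inner_mul_inner (w (b i)) (w (b j))
    rw [w.inner_map_map] at h1
    simp only [real_inner_comm] at h1 ⊢
    rw [h1, Matrix.one_apply, orthonormal_iff_ite.1 b.orthonormal, eq_comm]
  have hAt' : A * A.transpose = 1 := mul_eq_one_comm.1 hAt
  have hdet : ∀ c : ℝ, (∀ v, w v = c • v → v = 0) → (A - c • 1).det ≠ 0 := by
    intro c hc
    have : A - c • 1 = LinearMap.toMatrix b.toBasis b.toBasis
        (w.toLinearEquiv.toLinearMap - c • LinearMap.id) := by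
      rw [map_sub, map_smul, LinearMap.toMatrix_id]
    rw [this, LinearMap.det_toMatrix]
    intro h0
    obtain ⟨v, hv, hv0⟩ := (Submodule.ne_bot_iff _).1
      (LinearMap.bot_lt_ker_of_det_eq_zero h0).ne'
    refine hv0 (hc v ?_)
    rw [LinearMap.mem_ker] at hv
    simpa [sub_eq_zero] using hv
  have h1 := hdet 1 (fun v hv => by
    by_contra h0; exact (hcon v h0).1 (by simpa using hv))
  have h2 := hdet (-1) (fun v hv => by
    by_contra h0; exact (hcon v h0).2 (by simpa using hv))
  have e1 : A - (1 : ℝ) • 1 = A * (-(A - (1 : ℝ) • 1).transpose) := by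
    simp [Matrix.mul_sub, hAt']
  have e2 : A - (-1 : ℝ) • 1 = A * (A - (-1 : ℝ) • 1).transpose := by
    simp [Matrix.mul_add, hAt', add_comm]
  have e1' := congrArg Matrix.det e1
  have e2' := congrArg Matrix.det e2
  rw [Matrix.det_mul, Matrix.det_neg, Matrix.det_transpose, Fintype.card_fin, hodd.neg_one_pow] at e1'
  rw [Matrix.det_mul, Matrix.det_transpose] at e2'
  have d2 : A.det = 1 := mul_right_cancel₀ h2 (by linarith)
  rw [d2] at e1'
  exact h1 (by linarith)

theorem mem_span_of_finset_perp [FiniteDimensional ℝ V] {Φ : Set V} (S : Finset V)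
    (hΦ : ∀ a ∈ S, ⟪a, a⟫ = 2) (hS : ∀ a ∈ S, a ∈ Φ)
    (ho : ∀ a ∈ S, ∀ b ∈ S, a ≠ b → ⟪a, b⟫ = 0) :
    ∃ u ∈ weyl Φ, (∀ b ∈ S, u b = -b) ∧ ∀ x, (∀ b ∈ S, ⟪b, x⟫ = 0) → u x = x := by
  classical
  induction S using Finset.induction_on with
  | empty => exact ⟨1, one_mem _, by simp, by simp⟩
  | insert a S ha ih =>
    obtain ⟨u, hu, h1, h2⟩ := ih (fun b hb => hΦ b (by simp [hb])) (fun b hb => hS b (by simp [hb]))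
      (fun b hb c hc => ho b (by simp [hb]) c (by simp [hc]))
    have haa := hΦ a (by simp)
    have hab : ∀ b ∈ S, ⟪a, b⟫ = 0 := fun b hb =>
      ho a (by simp) b (by simp [hb]) (by rintro rfl; exact ha hb)
    refine ⟨refl a * u, mul_mem (refl_mem_weyl (hS a (by simp))) hu, ?_, ?_⟩
    · intro b hb
      rw [mul_apply]
      rcases Finset.mem_insert.1 hb with rfl | hb
      · rw [h2 _ (fun c hc => by rw [real_inner_comm, hab c hc]), refl_self haa]
      · rw [h1 b hb, map_neg, refl_eq_of_inner_eq_zero haa (hab b hb)]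
    · intro x hx
      rw [mul_apply, h2 x (fun b hb => hx b (by simp [hb])),
        refl_eq_of_inner_eq_zero haa (hx a (by simp))]

theorem neg_mem_weyl_of_family {ι : Type*} [Fintype ι] [FiniteDimensional ℝ V] {Φ : Set V}
    (f : ι → V) (hΦ : ∀ i, ⟪f i, f i⟫ = 2) (hS : ∀ i, f i ∈ Φ)
    (ho : ∀ i j, i ≠ j → ⟪f i, f j⟫ = 0) (hspan : ⊤ ≤ Submodule.span ℝ (Set.range f)) :
    LinearIsometryEquiv.neg ℝ ∈ weyl Φ := by
  classical
  obtain ⟨u, hu, h1, -⟩ := mem_span_of_finset_perp (Φ := Φ) (Finset.univ.image f) (by simpa using hΦ)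
    (by simpa using hS) (by
      intro a ha b hb hab
      obtain ⟨i, -, rfl⟩ := Finset.mem_image.1 ha
      obtain ⟨j, -, rfl⟩ := Finset.mem_image.1 hb
      exact ho i j (by rintro rfl; exact hab rfl))
  convert hu
  ext x
  have hx : x ∈ Submodule.span ℝ (Set.range f) := hspan trivial
  induction hx using Submodule.span_induction with
  | mem y hy =>
    obtain ⟨i, rfl⟩ := hy
    rw [h1 _ (by simp)]; simp
  | zero => simp
  | add y z _ _ hy hz => rw [map_add, map_add, hy, hz]
  | smul c y _ hy => rw [map_smul, map_smul, hy]

namespace Critical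
variable {Φ : Set V} {w : V ≃ₗᵢ[ℝ] V}

theorem even_finrank [FiniteDimensional ℝ V] (h : Critical Φ w)
    (hn : LinearIsometryEquiv.neg ℝ ∈ weyl Φ) : Even (Module.finrank ℝ V) := by
  by_contra hodd
  rw [Nat.not_even_iff_odd] at hodd
  obtain ⟨v, hv, h1 | h1⟩ := exists_fixed_or_neg hodd w
  · exact hv (h.eq_zero_of_fixed h1)
  · exact hv (h.eq_zero_of_neg hn h1)

theorem nonempty (h : Critical Φ w) : Φ.Nonempty := by
  by_contra h0
  rw [Set.not_nonempty_iff_eq_empty] at h0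
  have hw := h.mem
  refine h.mul_self_ne_one ?_
  rw [h0, weyl, Set.image_empty, Subgroup.closure_empty, Subgroup.mem_bot] at hw
  simp [hw]

/-- A criterion for conjugating by an isometry reversing `w` on a spanning set. -/
theorem false_of_reverses (h : Critical Φ w) {g : V ≃ₗᵢ[ℝ] V} (hg : g ∈ weyl Φ) {S : Set V}
    (hS : ⊤ ≤ Submodule.span ℝ S) (he : ∀ x ∈ S, w (g (w x)) = g x) : False := by
  refine h.irrev g hg ?_
  have : w * (g * w) = g := by
    ext x
    have hx : x ∈ Submodule.span ℝ S := hS trivial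
    simp only [mul_apply]
    induction hx using Submodule.span_induction with
    | mem y hy => exact he y hy
    | zero => simp
    | add y z _ _ hy hz => simp only [map_add, hy, hz]
    | smul c y _ hy => simp only [map_smul, hy]
  rw [mul_inv_eq_iff_eq_mul, eq_inv_mul_iff_mul_eq, this]

/-- Lack of a common splitting: `w` cannot preserve an orthogonal pair of proper subsystems. -/
theorem false_of_split (h : Critical Φ w) {Ψ₁ Ψ₂ : Set V} (h1 : Ψ₁ ⊂ Φ) (h2 : Ψ₂ ⊂ Φ)
    (hr1 : IsRoot Ψ₁) (hr2 : IsRoot Ψ₂) (ho : ∀ a ∈ Ψ₁, ∀ b ∈ Ψ₂, ⟪a, b⟫ = 0)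
    (hw : w ∈ weyl (Ψ₁ ∪ Ψ₂)) : False :=
  h.notMem (Set.union_subset h1.1 h2.1) ((h.ih _ h1 hr1).union hr1 ho (h.ih _ h2 hr2)) hw

end Critical

end

section

variable {V : Type*} [NormedAddCommGroup V] [InnerProductSpace ℝ V]

namespace Critical
variable {Φ : Set V} {w : V ≃ₗᵢ[ℝ] V}

theorem apply_ne_self [FiniteDimensional ℝ V] (h : Critical Φ w) {a : V} (ha : a ∈ Φ) :
    w a ≠ a := fun hw => h.isRoot.ne_zero ha (h.eq_zero_of_fixed hw)

theorem two_lt_finrank [FiniteDimensional ℝ V] (h : Critical Φ w) : 2 < Module.finrank ℝ V := by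
  by_contra! hr
  obtain ⟨a, ha⟩ := h.nonempty
  obtain ⟨b, hb⟩ : ∃ b, b = w a := ⟨_, rfl⟩
  obtain ⟨c, hc⟩ : ∃ c, c = ⟪a, b⟫ := ⟨_, rfl⟩
  have hbΦ : b ∈ Φ := hb ▸ h.isRoot.map_mem h.mem a ha
  have hab : a ≠ b := by rw [hb]; exact (h.apply_ne_self ha).symm
  have hab' : a ≠ -b := by
    rw [hb]; intro he; exact h.apply_ne_neg ha (by rw [eq_neg_iff_add_eq_zero, add_comm, ← eq_neg_iff_add_eq_zero]; exact he)
  have haa := h.isRoot.norm a ha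
  have hbb := h.isRoot.norm b hbΦ
  have h1 := h.isRoot.inner_lt_two ha hbΦ hab
  have h2 := h.isRoot.inner_lt_two ha (h.isRoot.neg_mem hbΦ) hab'
  rw [inner_neg_right] at h2
  have hli : LinearIndependent ℝ ![a, b] := by
    rw [LinearIndependent.pair_iff' (h.isRoot.ne_zero ha)]
    intro t ht
    rcases h.isRoot.eq_or_eq_neg ha hbΦ ht.symm with h3 | h3
    · exact hab h3.symm
    · exact hab' (by rw [h3, neg_neg])
  have hspan : (⊤ : Submodule ℝ V) ≤ Submodule.span ℝ {a, b} := by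
    have h3 := hli.fintype_card_le_finrank
    have h4 := hli.span_eq_top_of_card_eq_finrank (by simp at h3 ⊢; omega)
    rw [← h4]; simp [Matrix.range_cons, Set.pair_comm]
  obtain ⟨x, y, hxy⟩ := Submodule.mem_span_pair.1 (hspan (Submodule.mem_top (x := w b)))
  have e1 : x * c + 2 * y = c := by
    have : ⟪w b, b⟫ = c := by rw [hc]; nth_rw 2 [hb]; rw [w.inner_map_map, real_inner_comm]
    rw [← hxy, inner_add_left, inner_smul_left, inner_smul_left, hbb, ← hc] at this
    simp at this; linarith
  have e2 : 2 * x ^ 2 + 2 * x * y * c + 2 * y ^ 2 = 2 := by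
    have : ⟪w b, w b⟫ = 2 := by rw [w.inner_map_map, hbb]
    rw [← hxy] at this
    simp only [inner_add_left, inner_add_right, real_inner_smul_left, real_inner_smul_right, haa,
      hbb, real_inner_comm a b, ← hc] at this
    nlinarith
  have e3 : (x - 1) * (x + 1) = 0 := by
    have h6 : (4 - c ^ 2) * ((x - 1) * (x + 1)) = 0 := by
      have : y = c * (1 - x) / 2 := by linarith
      rw [this] at e2; nlinarith
    rcases mul_eq_zero.1 h6 with h7 | h7
    · nlinarith
    · exact h7
  rcases mul_eq_zero.1 e3 with h3 | h3
  · have hx : x = 1 := by linarith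
    have hy : y = 0 := by rw [hx] at e1; linarith
    refine hab' (eq_neg_of_add_eq_zero_left (h.eq_zero_of_fixed (v := a + b) ?_))
    rw [map_add, ← hxy, ← hb, hx, hy]; simp [add_comm]
  · have hx : x = -1 := by linarith
    have hy : y = c := by rw [hx] at e1; linarith
    have hwb : w b = -a + c • b := by rw [← hxy, hx, hy]; simp
    refine h.false_of_reverses (refl_mem_weyl ha) hspan ?_
    rintro z (rfl | rfl)
    · rw [← hb, refl_self haa, refl_apply haa, ← hc, map_sub, map_smul, hwb, ← hb]; abel
    · rw [hwb, map_add, map_neg, map_smul, refl_self haa, refl_apply haa, ← hc, neg_neg, map_add,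
        map_smul, map_sub, map_smul, hwb, ← hb]; module

theorem sq_add_ne_zero [FiniteDimensional ℝ V] (h : Critical Φ w) {a : V} (ha : a ∈ Φ) :
    w (w a) + w a + a ≠ 0 := by
  intro h0
  obtain ⟨b, hb⟩ : ∃ b, b = w a := ⟨_, rfl⟩
  have hbΦ : b ∈ Φ := hb ▸ h.isRoot.map_mem h.mem a ha
  have haa := h.isRoot.norm a ha
  have hbb := h.isRoot.norm b hbΦ
  rw [← hb] at h0
  have hwb : w b = -b - a := by rw [← sub_eq_zero, ← h0]; abel
  have hab : ⟪a, b⟫ = -1 := by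
    have : ⟪w b, w a⟫ = ⟪b, a⟫ := w.inner_map_map _ _
    rw [hwb, ← hb, inner_sub_left, inner_neg_left, hbb, real_inner_comm] at this
    linarith [real_inner_comm a b]
  have hba : ⟪b, a⟫ = -1 := by rw [real_inner_comm, hab]
  obtain ⟨g, hg⟩ : ∃ g, g = refl b * refl a * w := ⟨_, rfl⟩
  have hwg : w = refl a * refl b * g := by
    rw [hg, mul_assoc, mul_assoc, ← mul_assoc (refl b) (refl b), refl_mul_refl, one_mul,
      ← mul_assoc, refl_mul_refl, one_mul]
  have hgm : g ∈ weyl Φ := by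
    rw [hg]; exact mul_mem (mul_mem (refl_mem_weyl hbΦ) (refl_mem_weyl ha)) h.mem
  have hga : g a = a := by
    rw [hg, mul_apply, mul_apply, ← hb, refl_apply haa, hab, refl_apply hbb, inner_sub_right,
      real_inner_smul_right, hbb, hba]; module
  have hgb : g b = b := by
    rw [hg, mul_apply, mul_apply, hwb, map_sub, map_neg, refl_self haa, refl_apply haa, hab,
      refl_apply hbb]
    simp only [inner_sub_right, inner_neg_right, real_inner_smul_right, hbb, hba]; module
  have hr1 := h.isRoot.inter (ℝ ∙ a)ᗮ
  have hg1 := hr1.mem_weyl_of_fixed (h.isRoot.mem_weyl_of_fixed hgm hga) hgb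
  have hr2 := hr1.inter (ℝ ∙ b)ᗮ
  set Ψ := Φ ∩ (ℝ ∙ a)ᗮ ∩ (ℝ ∙ b)ᗮ with hΨ
  have hΨ1 : ∀ x ∈ Ψ, ⟪a, x⟫ = 0 ∧ ⟪b, x⟫ = 0 := fun x hx =>
    ⟨Submodule.mem_orthogonal_singleton_iff_inner_right.1 hx.1.2,
      Submodule.mem_orthogonal_singleton_iff_inner_right.1 hx.2⟩
  refine h.false_of_split (Ψ₁ := Φ ∩ Submodule.span ℝ {a, b}) (Ψ₂ := Ψ)
    ⟨Set.inter_subset_left, fun hs => ?_⟩ ⟨fun x hx => hx.1.1, fun hs => ?_⟩ (h.isRoot.inter _) hr2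
    ?_ ?_
  · have h1 : (⊤ : Submodule ℝ V) ≤ Submodule.span ℝ {a, b} := by
      rw [← h.span]; exact Submodule.span_le.2 fun x hx => (hs hx).2
    have h2 := finrank_span_finset_le_card (R := ℝ) (M := V) (by classical exact {a, b})
    have h3 : (Set.finrank ℝ ({a, b} : Set V)) ≤ 2 := by
      classical
      have := finrank_span_finset_le_card (R := ℝ) (M := V) {a, b}
      rw [Finset.coe_pair] at this
      exact this.trans Finset.card_le_two
    have h4 := h.two_lt_finrank
    unfold Set.finrank at h3
    rw [top_le_iff.1 h1, finrank_top] at h3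
    omega
  · have := (hΨ1 a (hs ha)).1; rw [haa] at this; norm_num at this
  · rintro x ⟨-, hx⟩ y hy
    obtain ⟨s, t, rfl⟩ := Submodule.mem_span_pair.1 hx
    rw [inner_add_left, real_inner_smul_left, real_inner_smul_left, (hΨ1 y hy).1, (hΨ1 y hy).2]
    simp
  · rw [hwg]
    exact mul_mem (mul_mem (refl_mem_weyl (Or.inl ⟨ha, Submodule.subset_span (by simp)⟩))
      (refl_mem_weyl (Or.inl ⟨hbΦ, Submodule.subset_span (by simp)⟩)))
      (weyl_mono Set.subset_union_right hg1)

/-- The diagram of a base is connected. -/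
theorem exists_adjacent [FiniteDimensional ℝ V] [DecidableEq V] (h : Critical Φ w) {ρ : V}
    {Δ : Finset V} (b : IsBase Φ ρ Δ) {T : Finset V} (hT : T ⊆ Δ) (hne : T.Nonempty) (hT' : T ≠ Δ) :
    ∃ s ∈ Δ, s ∉ T ∧ ∃ t ∈ T, ⟪s, t⟫ ≠ 0 := by
  by_contra! hcon
  obtain ⟨t, ht⟩ := hne
  obtain ⟨s, hs, hsT⟩ : ∃ s ∈ Δ, s ∉ T := by
    by_contra! hc; exact hT' (hT.antisymm hc)
  set U := Submodule.span ℝ (T : Set V)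
  have hsU : ∀ x ∈ U, ⟪s, x⟫ = 0 := by
    intro x hx
    induction hx using Submodule.span_induction with
    | mem y hy => exact hcon s hs hsT y hy
    | zero => simp
    | add y z _ _ hy hz => rw [inner_add_right, hy, hz, add_zero]
    | smul c y _ hy => rw [real_inner_smul_right, hy, mul_zero]
  refine h.false_of_split (Ψ₁ := Φ ∩ U) (Ψ₂ := Φ ∩ Uᗮ) ⟨Set.inter_subset_left, fun hc => ?_⟩
    ⟨Set.inter_subset_left, fun hc => ?_⟩ (h.isRoot.inter _) (h.isRoot.inter _) ?_ ?_
  · have := hsU s (hc (b.mem s hs)).2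
    rw [h.isRoot.norm s (b.mem s hs)] at this; norm_num at this
  · have := (Submodule.mem_orthogonal _ _).1 (hc (b.mem t (hT ht))).2 t (Submodule.subset_span ht)
    rw [h.isRoot.norm t (b.mem t (hT ht))] at this; norm_num at this
  · intro x hx y hy
    exact (Submodule.mem_orthogonal _ _).1 hy.2 x hx.2
  · have hw := h.mem
    rw [← b.weyl_eq h.isRoot] at hw
    refine weyl_mono (fun d hd => ?_) hw
    by_cases hdT : d ∈ T
    · exact Or.inl ⟨b.mem d hd, Submodule.subset_span hdT⟩
    · refine Or.inr ⟨b.mem d hd, ?_⟩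
      rw [SetLike.mem_coe, Submodule.mem_orthogonal]
      intro x hx
      induction hx using Submodule.span_induction with
      | mem y hy => rw [real_inner_comm]; exact hcon d hd hdT y hy
      | zero => simp
      | add y z _ _ hy hz => rw [inner_add_left, hy, hz, add_zero]
      | smul c y _ hy => rw [real_inner_smul_left, hy, mul_zero]

/-- Multiplying a critical element by a reflection produces a fixed vector. -/
theorem exists_fixed_refl_mul [FiniteDimensional ℝ V] (h : Critical Φ w) {a : V} (ha : a ∈ Φ) :
    ∃ u, ⟪u, a⟫ = 1 ∧ (refl a * w) u = u := by
  have hinj : Function.Injective (LinearMap.id - w.toLinearEquiv.toLinearMap : V →ₗ[ℝ] V) := by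
    rw [← LinearMap.ker_eq_bot, LinearMap.ker_eq_bot']
    intro v hv
    have : v = w v := by simpa [sub_eq_zero] using hv
    exact h.eq_zero_of_fixed this.symm
  obtain ⟨u, hu⟩ := LinearMap.injective_iff_surjective.1 hinj a
  have hwu : w u = u - a := by rw [← hu]; simp
  have haa := h.isRoot.norm a ha
  have h3 : ⟪u - a, u - a⟫ = ⟪u, u⟫ := by rw [← hwu, w.inner_map_map]
  have h4 : ⟪u, a⟫ = 1 := by
    simp only [inner_sub_left, inner_sub_right, haa] at h3
    linarith [real_inner_comm u a]
  refine ⟨u, h4, ?_⟩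
  rw [mul_apply, hwu, map_sub, refl_self haa, refl_apply haa, real_inner_comm, h4]
  module

end Critical

end

section

section restrict
variable {V : Type*} [NormedAddCommGroup V] [InnerProductSpace ℝ V]
variable {Φ : Set V} {U : Submodule ℝ V}

theorem coe_refl {a : U} (ha : ⟪(a : V), (a : V)⟫ = 2) (x : U) :
    ((refl a x : U) : V) = refl (a : V) (x : V) := by
  have ha' : ⟪a, a⟫ = 2 := ha
  rw [refl_apply ha, refl_apply ha']; simp

theorem IsRoot.preimage (h : IsRoot Φ) : IsRoot ((↑) ⁻¹' Φ : Set U) where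
  finite := h.finite.preimage (Set.injOn_of_injective Subtype.val_injective)
  norm a ha := h.norm a ha
  refl_mem a ha b hb := by
    show ((refl a b : U) : V) ∈ Φ
    rw [coe_refl (h.norm _ ha)]; exact h.refl_mem _ ha _ hb

theorem IsRoot.exists_restrict (h : IsRoot Φ) (hU : Φ ⊆ U) {w : V ≃ₗᵢ[ℝ] V} (hw : w ∈ weyl Φ) :
    ∃ w' ∈ weyl ((↑) ⁻¹' Φ : Set U), ∀ x : U, ((w' x : U) : V) = w x := by
  let p : (V ≃ₗᵢ[ℝ] V) → Prop := fun w => ∃ w' ∈ weyl ((↑) ⁻¹' Φ : Set U), ∀ x : U,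
    ((w' x : U) : V) = w x
  have h0 : p 1 := ⟨1, one_mem _, fun x => rfl⟩
  refine weyl_induction (p := p) h0 ?_ hw
  rintro a ha g - ⟨g', hg', h1⟩
  refine ⟨refl ⟨a, hU ha⟩ * g', mul_mem (refl_mem_weyl (show a ∈ Φ from ha)) hg', fun x => ?_⟩
  rw [mul_apply, mul_apply, coe_refl (h.norm a ha), h1]

theorem IsRoot.exists_extend (h : IsRoot Φ) {w' : U ≃ₗᵢ[ℝ] U} (hw : w' ∈ weyl ((↑) ⁻¹' Φ : Set U)) :
    ∃ w ∈ weyl Φ, ∀ x : U, ((w' x : U) : V) = w x := by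
  refine weyl_induction (p := fun w' : U ≃ₗᵢ[ℝ] U => ∃ w ∈ weyl Φ, ∀ x : U,
    ((w' x : U) : V) = w x) ⟨1, one_mem _, fun x => by simp only [LinearIsometryEquiv.coe_one, id]⟩ ?_ hw
  rintro a ha g - ⟨g', hg', h1⟩
  refine ⟨refl (a : V) * g', mul_mem (refl_mem_weyl ha) hg', fun x => ?_⟩
  rw [mul_apply, mul_apply, coe_refl (h.norm a ha), h1]

theorem IsRoot.reversible_of_preimage (h : IsRoot Φ) (hU : Φ ⊆ U)
    (hr : Reversible ((↑) ⁻¹' Φ : Set U)) : Reversible Φ := by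
  intro w hw
  obtain ⟨w', hw', h1⟩ := h.exists_restrict hU hw
  obtain ⟨g', hg', hrev⟩ := hr w' hw'
  obtain ⟨g, hg, h2⟩ := h.exists_extend hg'
  refine ⟨g, hg, ?_⟩
  rw [mul_inv_eq_iff_eq_mul, eq_inv_mul_iff_mul_eq] at hrev ⊢
  refine h.eq_of_eqOn (mul_mem hw (mul_mem hg hw)) hg fun a ha => ?_
  have := congrArg (fun f : U ≃ₗᵢ[ℝ] U => ((f ⟨a, hU ha⟩ : U) : V)) hrev
  simpa only [mul_apply, h1, h2] using this

end restrict

universe u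

theorem reversible_of_not_critical (hcrit : ∀ (V : Type u) [NormedAddCommGroup V]
      [InnerProductSpace ℝ V] [FiniteDimensional ℝ V] (Φ : Set V) (w : V ≃ₗᵢ[ℝ] V), ¬ Critical Φ w)
    {V : Type u} [NormedAddCommGroup V] [InnerProductSpace ℝ V] [FiniteDimensional ℝ V]
    {Φ : Set V} (h : IsRoot Φ) : Reversible Φ := by
  obtain ⟨n, hn⟩ : ∃ n, Φ.ncard = n := ⟨_, rfl⟩
  induction n using Nat.strong_induction_on generalizing V with
  | _ n ih =>
    have ih' : ∀ {V' : Type u} [NormedAddCommGroup V'] [InnerProductSpace ℝ V']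
        [FiniteDimensional ℝ V'] {Ψ : Set V'}, IsRoot Ψ → Ψ.ncard = n →
        Submodule.span ℝ Ψ = ⊤ → Reversible Ψ := by
      intro V' _ _ _ Ψ hΨ hc hs w hw
      by_contra! hcon
      refine hcrit V' Ψ w ⟨hΨ, hs, hw, hcon, fun Θ hΘ hr => ?_⟩
      exact ih Θ.ncard (hc ▸ Set.ncard_lt_ncard hΘ hΨ.finite) hr rfl
    refine h.reversible_of_preimage (U := Submodule.span ℝ Φ) Submodule.subset_span
      (ih' h.preimage ?_ ?_)
    · rw [← hn, Set.ncard_preimage_of_injective_subset_range Subtype.val_injective]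
      rw [Subtype.range_coe]; exact Submodule.subset_span
    · exact Submodule.span_span_coe_preimage

end

section

section perm
variable {ι : Type*} (σ : Equiv.Perm ι)

/-- A labelling of each cycle of `σ` that is symmetric under some reflection is preserved by a
permutation inverting `σ`. -/
theorem exists_reversing_perm {τ : Type*} (t : ι → τ)
    (h : ∀ i, ∃ j : ℤ, ∀ k : ℤ, t ((σ ^ k) i) = t ((σ ^ (j - k)) i)) :
    ∃ π : Equiv.Perm ι, ∀ i, π (σ i) = σ⁻¹ (π i) ∧ t (σ⁻¹ (π i)) = t i := by
  classical
  let S := Equiv.Perm.SameCycle.setoid σ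
  let r : ι → ι := fun i => (Quotient.mk S i).out
  have hr : ∀ i, ∃ k : ℤ, (σ ^ k) (r i) = i := fun i => Quotient.exact (Quotient.out_eq (Quotient.mk S i))
  have hr' : ∀ i (k : ℤ), r ((σ ^ k) i) = r i := fun i k => by
    have : Quotient.mk S ((σ ^ k) i) = Quotient.mk S i :=
      Quotient.sound (show σ.SameCycle _ _ from ⟨-k, by simp⟩)
    simp only [r, this]
  choose k hk using hr
  choose j hj using h
  let f : ι → ι := fun i => (σ ^ (j (r i) + 1 - k i)) (r i)
  have hf : ∀ i (a : ℤ), (σ ^ a) (r i) = i → f i = (σ ^ (j (r i) + 1 - a)) (r i) := by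
    intro i a ha
    have h1 : (σ ^ (k i)) (r i) = (σ ^ a) (r i) := by rw [hk, ha]
    have h2 := congrArg (σ ^ (j (r i) + 1 - a - k i)) h1
    rw [← Equiv.Perm.mul_apply, ← Equiv.Perm.mul_apply, ← zpow_add, ← zpow_add] at h2
    simp only [f]
    convert h2.symm using 3 <;> ring_nf
  have hinv : Function.Involutive f := by
    intro i
    have h1 : r (f i) = r i := by simp only [f]; rw [hr']; exact (by
      have := hr' (r i) (k i); rw [hk] at this; exact this.symm)
    rw [hf (f i) (j (r i) + 1 - k i) (by rw [h1]), h1]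
    convert hk i using 3
    ring
  refine ⟨hinv.toPerm f, fun i => ?_⟩
  have h1 : r (σ i) = r i := by simpa using hr' i 1
  have h2 : f (σ i) = σ⁻¹ (f i) := by
    rw [hf (σ i) (1 + k i) (by rw [h1, zpow_one_add, Equiv.Perm.mul_apply, hk]), h1]
    show _ = σ⁻¹ ((σ ^ (j (r i) + 1 - k i)) (r i))
    rw [← Equiv.Perm.mul_apply, ← zpow_neg_one, ← zpow_add]
    congr 2; ring
  refine ⟨h2, ?_⟩
  show t (σ⁻¹ (f i)) = t i
  rw [← h2, hf (σ i) (1 + k i) (by rw [h1, zpow_one_add, Equiv.Perm.mul_apply, hk]), h1]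
  have h3 := hj (r i) (k i)
  rw [hk] at h3
  rw [h3]
  congr 3; ring

/-- Signs can be gauged away except for at most one point on each cycle. -/
theorem exists_gauge [Finite ι] {s : ι → ℝ} (hs : ∀ i, s i = 1 ∨ s i = -1) :
    ∃ e : ι → ℝ, (∀ i, e i = 1 ∨ e i = -1) ∧ ∀ i, ∃ j : ℤ, ∀ k : ℤ,
      e ((σ ^ k) i) * s ((σ ^ k) i) * e (σ ((σ ^ k) i)) =
        e ((σ ^ (j - k)) i) * s ((σ ^ (j - k)) i) * e (σ ((σ ^ (j - k)) i)) := by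
  classical
  let S := Equiv.Perm.SameCycle.setoid σ
  let r : ι → ι := fun i => (Quotient.mk S i).out
  have hr : ∀ i, ∃ k : ℕ, (σ ^ k) (r i) = i := fun i => by
    have : σ.SameCycle (r i) i := Quotient.exact (Quotient.out_eq (Quotient.mk S i))
    obtain ⟨k, -, hk⟩ := this.exists_pow_eq'
    exact ⟨k, hk⟩
  have hr' : ∀ i (k : ℤ), r ((σ ^ k) i) = r i := fun i k => by
    have : Quotient.mk S ((σ ^ k) i) = Quotient.mk S i :=
      Quotient.sound (show σ.SameCycle _ _ from ⟨-k, by simp⟩)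
    simp only [r, this]
  have hr1 : ∀ i, r (σ i) = r i := fun i => by simpa using hr' i 1
  let e : ι → ℝ := fun i => ∏ l ∈ Finset.range (Nat.find (hr i)), s ((σ ^ l) (r i))
  have he : ∀ i, e i = 1 ∨ e i = -1 := fun i => by
    refine Finset.prod_induction _ (fun x : ℝ => x = 1 ∨ x = -1) ?_ (Or.inl rfl) (fun l _ => hs _)
    rintro a b (rfl | rfl) (rfl | rfl) <;> norm_num
  have hsq : ∀ x : ℝ, x = 1 ∨ x = -1 → x * x = 1 := by rintro x (rfl | rfl) <;> norm_num
  have ht : ∀ i, σ i ≠ r i → e i * s i * e (σ i) = 1 := by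
    intro i hi
    have h1 : Nat.find (hr (σ i)) = Nat.find (hr i) + 1 := by
      rw [Nat.find_eq_iff]
      refine ⟨?_, ?_⟩
      · rw [hr1, pow_succ', Equiv.Perm.mul_apply, Nat.find_spec (hr i)]
      · intro m hm hc
        rw [hr1] at hc
        cases m with
        | zero => exact hi (by simpa using hc.symm)
        | succ m =>
          rw [pow_succ', Equiv.Perm.mul_apply] at hc
          exact Nat.find_min (hr i) (by omega) (σ.injective hc)
    have h2 : e (σ i) = e i * s i := by
      show ∏ l ∈ Finset.range (Nat.find (hr (σ i))), s ((σ ^ l) (r (σ i))) =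
        (∏ l ∈ Finset.range (Nat.find (hr i)), s ((σ ^ l) (r i))) * s i
      rw [h1, Finset.prod_range_succ, hr1]
      congr 2
      exact Nat.find_spec (hr i)
    rw [h2]
    exact hsq _ (by rcases he i with h | h <;> rcases hs i with h' | h' <;> rw [h, h'] <;> norm_num)
  refine ⟨e, he, fun i => ?_⟩
  obtain ⟨a, ha⟩ := hr i
  obtain ⟨x, hx⟩ : ∃ x, x = r i := ⟨_, rfl⟩
  rw [← hx] at ha
  have hrx : r x = x := by
    have := hr' x a
    rw [zpow_natCast, ha, ← hx] at this
    exact this.symm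
  have key : ∀ k : ℤ, (σ ^ k) x ≠ x → (σ ^ (-k)) x ≠ x := by
    intro k hk hc
    refine hk ?_
    nth_rw 1 [← hc]
    rw [← Equiv.Perm.mul_apply, ← zpow_add]; simp
  have ht' : ∀ k : ℤ, (σ ^ (k + 1)) x ≠ x →
      e ((σ ^ k) x) * s ((σ ^ k) x) * e (σ ((σ ^ k) x)) = 1 := by
    intro k hk
    refine ht _ ?_
    rw [hr', hrx, ← Equiv.Perm.mul_apply, ← zpow_one_add, add_comm]; exact hk
  refine ⟨-2 - 2 * a, fun k => ?_⟩
  have hi : ∀ m : ℤ, (σ ^ m) i = (σ ^ (m + a)) x := fun m => by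
    rw [zpow_add, Equiv.Perm.mul_apply, zpow_natCast, ha]
  rw [hi, hi]
  by_cases hk : (σ ^ (k + a + 1)) x = x
  · have h1 : (σ ^ (k + a)) x = (σ ^ (-2 - 2 * a - k + a : ℤ)) x := by
      have h2 : (σ ^ (-(k + a + 1) : ℤ)) x = x := by
        by_contra hc; exact key _ hc (by rw [neg_neg]; exact hk)
      have h3 := congrArg (σ ^ (-1 : ℤ)) (hk.trans h2.symm)
      rw [← Equiv.Perm.mul_apply, ← Equiv.Perm.mul_apply, ← zpow_add, ← zpow_add] at h3
      convert h3 using 3 <;> ring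
    rw [h1]
  · rw [ht' _ hk, ht' _ (by convert key _ hk using 4; ring)]

end perm

variable {V : Type*} [NormedAddCommGroup V] [InnerProductSpace ℝ V]

theorem refl_sub_apply {g g' : V} (h : ⟪g, g⟫ = 1) (h' : ⟪g', g'⟫ = 1) (ho : ⟪g, g'⟫ = 0) :
    refl (g - g') g = g' := by
  have h2 : ⟪g', g⟫ = 0 := by rw [real_inner_comm, ho]
  rw [refl_apply (by simp only [inner_sub_left, inner_sub_right, h, h', ho, h2]; norm_num),
    inner_sub_left, h, h2]
  simp

/-- Permutations of an orthonormal family whose differences are roots. -/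
theorem exists_weyl_perm {ι : Type*} [Finite ι] {Φ : Set V} {g : ι → V} (hg : Orthonormal ℝ g)
    (hΦ : ∀ i j, i ≠ j → g i - g j ∈ Φ) (π : Equiv.Perm ι) :
    ∃ u ∈ weyl Φ, (∀ i, u (g i) = g (π i)) ∧
      ∀ x, (∀ i j, ⟪g i - g j, x⟫ = 0) → u x = x := by
  classical
  have h1 : ∀ i, ⟪g i, g i⟫ = 1 := fun i => by
    rw [real_inner_self_eq_norm_sq, hg.1 i]; norm_num
  have h2 : ∀ i j, i ≠ j → ⟪g i, g j⟫ = 0 := fun i j hij => hg.2 hij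
  have h3 : ∀ i j, i ≠ j → ⟪g i - g j, g i - g j⟫ = 2 := fun i j hij => by
    simp only [inner_sub_left, inner_sub_right, h1, h2 i j hij, h2 j i hij.symm]; norm_num
  induction π using Equiv.Perm.swap_induction_on with
  | one => exact ⟨1, one_mem _, by simp, by simp⟩
  | swap_mul π x y hxy ih =>
    obtain ⟨u, hu, hu1, hu2⟩ := ih
    refine ⟨refl (g x - g y) * u, mul_mem (refl_mem_weyl (hΦ x y hxy)) hu, fun i => ?_, fun z hz => ?_⟩
    · rw [mul_apply, hu1, Equiv.Perm.mul_apply]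
      obtain ⟨m, hm⟩ : ∃ m, m = π i := ⟨_, rfl⟩
      rw [← hm]
      by_cases hx : m = x
      · rw [hx, Equiv.swap_apply_left, refl_sub_apply (h1 x) (h1 y) (h2 x y hxy)]
      by_cases hy : m = y
      · rw [hy, Equiv.swap_apply_right, ← refl_neg, neg_sub,
          refl_sub_apply (h1 y) (h1 x) (h2 y x hxy.symm)]
      · rw [Equiv.swap_apply_of_ne_of_ne hx hy, refl_eq_of_inner_eq_zero (h3 x y hxy)]
        rw [inner_sub_left, h2 _ _ (Ne.symm hx), h2 _ _ (Ne.symm hy), sub_zero]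
    · rw [mul_apply, hu2 z hz, refl_eq_of_inner_eq_zero (h3 x y hxy) (hz x y)]

/-- Orthonormal families whose signed differences are all roots. -/
structure Frame {ι : Type*} (Φ : Set V) (f : ι → V) : Prop where
  orthonormal : Orthonormal ℝ f
  add_mem : ∀ i j, i ≠ j → f i + f j ∈ Φ
  sub_mem : ∀ i j, i ≠ j → f i - f j ∈ Φ

namespace Frame
variable {ι : Type*} {Φ : Set V} {f : ι → V}

theorem inner_self (h : Frame Φ f) (i : ι) : ⟪f i, f i⟫ = 1 := by
  rw [real_inner_self_eq_norm_sq, h.orthonormal.1 i]; norm_num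

theorem inner_ne (h : Frame Φ f) {i j : ι} (hij : i ≠ j) : ⟪f i, f j⟫ = 0 := h.orthonormal.2 hij

theorem inner_eq [DecidableEq ι] (h : Frame Φ f) (i j : ι) : ⟪f i, f j⟫ = if i = j then 1 else 0 :=
  orthonormal_iff_ite.1 h.orthonormal i j

theorem signs (h : Frame Φ f) (hΦ : IsRoot Φ) {e : ι → ℝ} (he : ∀ i, e i = 1 ∨ e i = -1) :
    Frame Φ (fun i => e i • f i) where
  orthonormal := by
    refine ⟨fun i => ?_, fun i j hij => ?_⟩
    · rcases he i with h1 | h1 <;> simp [h1, h.orthonormal.1 i]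
    · simp [real_inner_smul_left, real_inner_smul_right, h.inner_ne hij]
  add_mem i j hij := by
    have h1 := h.add_mem i j hij
    have h2 := h.sub_mem i j hij
    have h3 := h.sub_mem j i hij.symm
    rcases he i with hi | hi <;> rcases he j with hj | hj <;> simp only [hi, hj, one_smul, neg_smul]
    · exact h1
    · rwa [← sub_eq_add_neg]
    · rwa [neg_add_eq_sub]
    · rw [← neg_add]; exact hΦ.neg_mem h1
  sub_mem i j hij := by
    have h1 := h.add_mem i j hij
    have h2 := h.sub_mem i j hij
    have h3 := h.sub_mem j i hij.symm
    rcases he i with hi | hi <;> rcases he j with hj | hj <;> simp only [hi, hj, one_smul, neg_smul]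
    · exact h2
    · rwa [sub_neg_eq_add]
    · rw [← neg_add']; exact hΦ.neg_mem h1
    · rwa [neg_sub_neg]

theorem map (h : Frame Φ f) (hΦ : IsRoot Φ) {g : V ≃ₗᵢ[ℝ] V} (hg : g ∈ weyl Φ) :
    Frame Φ (fun i => g (f i)) where
  orthonormal := h.orthonormal.comp_linearIsometryEquiv g
  add_mem i j hij := by rw [← map_add]; exact hΦ.map_mem hg _ (h.add_mem i j hij)
  sub_mem i j hij := by rw [← map_sub]; exact hΦ.map_mem hg _ (h.sub_mem i j hij)

end Frame

/-- A signed permutation whose sign pattern is symmetric on each cycle is inverted by a pure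
permutation. -/
theorem exists_weyl_reversing {ι : Type*} [Finite ι] {Φ : Set V} {g : ι → V}
    (hg : Orthonormal ℝ g) (hΦ : ∀ i j, i ≠ j → g i - g j ∈ Φ) {w : V ≃ₗᵢ[ℝ] V}
    {σ : Equiv.Perm ι} {t : ι → ℝ} (ht : ∀ i, t i = 1 ∨ t i = -1)
    (hw : ∀ i, w (g i) = t i • g (σ i))
    (h : ∀ i, ∃ j : ℤ, ∀ k : ℤ, t ((σ ^ k) i) = t ((σ ^ (j - k)) i)) :
    ∃ u ∈ weyl Φ, (∀ x, (∀ i j, ⟪g i - g j, x⟫ = 0) → u x = x) ∧ ∀ i, w (u (w (g i))) = u (g i) := by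
  obtain ⟨π, hπ⟩ := exists_reversing_perm σ t h
  obtain ⟨u, hu, h1, h2⟩ := exists_weyl_perm hg hΦ π
  refine ⟨u, hu, h2, fun i => ?_⟩
  rw [hw, map_smul, map_smul, h1, h1, (hπ i).1, hw, (hπ i).2, smul_smul]
  have : t i * t i = 1 := by rcases ht i with h | h <;> rw [h] <;> norm_num
  rw [this, one_smul]; simp

/-- The permutation underlying a signed permutation. -/
theorem exists_perm_of_signed {ι : Type*} [Finite ι] {f : ι → V} (hf : Orthonormal ℝ f)
    {w : V ≃ₗᵢ[ℝ] V} (hw : ∀ i, ∃ j, w (f i) = f j ∨ w (f i) = -f j) :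
    ∃ (σ : Equiv.Perm ι) (s : ι → ℝ), (∀ i, s i = 1 ∨ s i = -1) ∧ ∀ i, w (f i) = s i • f (σ i) := by
  classical
  choose σ hσ using hw
  have hinj : Function.Injective σ := by
    intro i j hij
    by_contra hne
    have h0 : ⟪w (f i), w (f j)⟫ = 0 := by rw [w.inner_map_map]; exact hf.2 hne
    have h1 : ⟪f (σ j), f (σ j)⟫ = 1 := by rw [real_inner_self_eq_norm_sq, hf.1]; norm_num
    rcases hσ i with h | h <;> rcases hσ j with h' | h' <;> rw [h, h', hij] at h0 <;>
      simp only [inner_neg_left, inner_neg_right, h1] at h0 <;> norm_num at h0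
  refine ⟨Equiv.ofBijective σ (Finite.injective_iff_bijective.1 hinj),
    fun i => if w (f i) = f (σ i) then 1 else -1, fun i => by dsimp only; split_ifs <;> simp, fun i => ?_⟩
  simp only [Equiv.ofBijective_apply]
  split_ifs with h
  · rw [h, one_smul]
  · rw [(hσ i).resolve_left h, neg_one_smul]

theorem Critical.false_of_signed {ι : Type*} [Finite ι] {Φ : Set V} {w : V ≃ₗᵢ[ℝ] V}
    (h : Critical Φ w) {f : ι → V} (hf : Frame Φ f) (hspan : ⊤ ≤ Submodule.span ℝ (Set.range f))
    (hw : ∀ i, ∃ j, w (f i) = f j ∨ w (f i) = -f j) : False := by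
  obtain ⟨σ, s, hs, hσ⟩ := exists_perm_of_signed hf.orthonormal hw
  obtain ⟨e, he, hsym⟩ := exists_gauge σ hs
  have hfe := hf.signs h.isRoot he
  have hsq : ∀ i, e i * e i = 1 := fun i => by rcases he i with h | h <;> rw [h] <;> norm_num
  obtain ⟨u, hu, -, hrev⟩ := exists_weyl_reversing hfe.orthonormal hfe.sub_mem
    (t := fun i => e i * s i * e (σ i)) (σ := σ) (w := w) (fun i => by
      rcases he i with h1 | h1 <;> rcases hs i with h2 | h2 <;> rcases he (σ i) with h3 | h3 <;>
        simp only [h1, h2, h3] <;> norm_num) (fun i => by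
      rw [map_smul, hσ, smul_smul, smul_smul, mul_assoc _ (e (σ i)), hsq, mul_one]) hsym
  refine h.false_of_reverses hu hspan ?_
  rintro _ ⟨i, rfl⟩
  have h1 := congrArg (fun x => e i • x) (hrev i)
  simpa only [map_smul, smul_smul, hsq, one_smul] using h1

/-- If `w = refl a * w'` and `w'` is inverted by an element fixing `a`, then so is `w`. -/
theorem Critical.false_of_refl_mul {Φ : Set V} {w : V ≃ₗᵢ[ℝ] V} (h : Critical Φ w) {a : V}
    (ha : a ∈ Φ) {u : V ≃ₗᵢ[ℝ] V} (hu : u ∈ weyl Φ) (hua : u a = a) {S : Set V}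
    (hS : ⊤ ≤ Submodule.span ℝ S)
    (hrev : ∀ x ∈ S, (refl a * w) (u ((refl a * w) x)) = u x) : False := by
  refine h.false_of_reverses (mul_mem (refl_mem_weyl ha) hu) hS fun x hx => ?_
  have h1 := congrArg (refl a) (hrev x hx)
  have h2 : u * refl a = refl a * u := by
    have := refl_map (h.isRoot.norm a ha) u
    rw [hua] at this
    nth_rw 2 [this]; rw [inv_mul_cancel_right]
  have h3 : ∀ y, u (refl a y) = refl a (u y) := fun y => congrArg (fun f : V ≃ₗᵢ[ℝ] V => f y) h2
  simp only [mul_apply, refl_refl, h3] at h1 ⊢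
  exact h1

end

section

variable {V : Type*} [NormedAddCommGroup V] [InnerProductSpace ℝ V]

/-- The vectors with integral inner product with all elements of `Φ`. -/
def dualLattice (Φ : Set V) : AddSubgroup V where
  carrier := {v | ∀ b ∈ Φ, ∃ n : ℤ, ⟪v, b⟫ = n}
  zero_mem' b _ := ⟨0, by simp⟩
  add_mem' {x y} hx hy b hb := by
    obtain ⟨m, hm⟩ := hx b hb
    obtain ⟨n, hn⟩ := hy b hb
    exact ⟨m + n, by rw [inner_add_left, hm, hn]; push_cast; ring⟩
  neg_mem' {x} hx b hb := by
    obtain ⟨m, hm⟩ := hx b hb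
    exact ⟨-m, by rw [inner_neg_left, hm]; push_cast; ring⟩

theorem map_mem_dualLattice {Φ : Set V} (hΦ : IsRoot Φ) {g : V ≃ₗᵢ[ℝ] V} (hg : g ∈ weyl Φ) {v : V}
    (hv : v ∈ dualLattice Φ) : g v ∈ dualLattice Φ := by
  intro b hb
  obtain ⟨n, hn⟩ := hv _ (hΦ.map_mem (inv_mem hg) b hb)
  exact ⟨n, by rw [← hn, inner_inv_right]⟩

/-- An orthonormal frame exhibiting `Φ` as a root system of type `E₈`. -/
structure E8Frame (Φ : Set V) (f : Fin 8 → V) : Prop extends Frame Φ f where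
  span : ⊤ ≤ Submodule.span ℝ (Set.range f)
  spin : ∀ e : Fin 8 → ℝ, (∀ i, e i = 1 ∨ e i = -1) → ∏ i, e i = 1 →
    (1 / 2 : ℝ) • ∑ i, e i • f i ∈ Φ
  gram : ∀ a ∈ Φ, ∀ b ∈ Φ, ∃ n : ℤ, ⟪a, b⟫ = n

theorem span_smul_eq_top {ι : Type*} {f : ι → V} (h : ⊤ ≤ Submodule.span ℝ (Set.range f)) {e : ι → ℝ}
    (he : ∀ i, e i ≠ 0) : ⊤ ≤ Submodule.span ℝ (Set.range fun i => e i • f i) := by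
  refine h.trans (Submodule.span_le.2 ?_)
  rintro _ ⟨i, rfl⟩
  have := Submodule.smul_mem _ (e i)⁻¹
    (Submodule.subset_span (R := ℝ) (Set.mem_range_self (f := fun i => e i • f i) i))
  rwa [smul_smul, inv_mul_cancel₀ (he i), one_smul] at this

theorem span_map_eq_top {ι : Type*} {f : ι → V} (h : ⊤ ≤ Submodule.span ℝ (Set.range f))
    (g : V ≃ₗᵢ[ℝ] V) : ⊤ ≤ Submodule.span ℝ (Set.range fun i => g (f i)) := by
  intro x _
  have := Submodule.mem_map_of_mem (f := (g.toLinearEquiv : V →ₗ[ℝ] V))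
    (h (x := g⁻¹ x) Submodule.mem_top)
  rw [Submodule.map_span, ← Set.range_comp] at this
  rw [← apply_inv_self g x]
  exact this

theorem Orthonormal.sum_inner_sq {ι : Type*} [Fintype ι] {f : ι → V} (h : Orthonormal ℝ f)
    (hs : ⊤ ≤ Submodule.span ℝ (Set.range f)) (v : V) : ∑ i, ⟪f i, v⟫ ^ 2 = ⟪v, v⟫ := by
  have := (OrthonormalBasis.mk h hs).sum_inner_mul_inner v v
  simp only [OrthonormalBasis.coe_mk] at this
  rw [← this]
  exact Finset.sum_congr rfl fun i _ => by rw [sq, real_inner_comm v (f i)]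

theorem Orthonormal.sum_inner_smul {ι : Type*} [Fintype ι] {f : ι → V} (h : Orthonormal ℝ f)
    (hs : ⊤ ≤ Submodule.span ℝ (Set.range f)) (v : V) : ∑ i, ⟪f i, v⟫ • f i = v := by
  have := (OrthonormalBasis.mk h hs).sum_repr' v
  simpa only [OrthonormalBasis.coe_mk] using this

namespace E8Frame
variable {Φ : Set V} {f : Fin 8 → V}

theorem map (h : E8Frame Φ f) (hΦ : IsRoot Φ) {g : V ≃ₗᵢ[ℝ] V} (hg : g ∈ weyl Φ) :
    E8Frame Φ (fun i => g (f i)) where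
  toFrame := h.toFrame.map hΦ hg
  span := span_map_eq_top h.span g
  spin e he hp := by
    have := hΦ.map_mem hg _ (h.spin e he hp)
    simpa only [map_smul, map_sum] using this
  gram := h.gram

theorem signs (h : E8Frame Φ f) (hΦ : IsRoot Φ) {e : Fin 8 → ℝ} (he : ∀ i, e i = 1 ∨ e i = -1)
    (hp : ∏ i, e i = 1) : E8Frame Φ (fun i => e i • f i) where
  toFrame := h.toFrame.signs hΦ he
  span := span_smul_eq_top h.span fun i => by rcases he i with h | h <;> rw [h] <;> norm_num
  spin e' he' hp' := by
    simp only [smul_smul]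
    refine h.spin (fun i => e' i * e i) (fun i => ?_) ?_
    · rcases he i with h | h <;> rcases he' i with h' | h' <;> simp [h, h']
    · rw [Finset.prod_mul_distrib, hp, hp', one_mul]
  gram := h.gram

theorem perm (h : E8Frame Φ f) (π : Equiv.Perm (Fin 8)) : E8Frame Φ (fun i => f (π i)) where
  orthonormal := h.orthonormal.comp _ π.injective
  add_mem i j hij := h.add_mem _ _ (π.injective.ne hij)
  sub_mem i j hij := h.sub_mem _ _ (π.injective.ne hij)
  span := by rw [show (fun i => f (π i)) = f ∘ π from rfl, π.surjective.range_comp]; exact h.span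
  spin e he hp := by
    have := h.spin (fun i => e (π.symm i)) (fun i => he _)
      (by rw [Equiv.prod_comp π.symm]; exact hp)
    rw [← Equiv.sum_comp π] at this
    simpa using this
  gram := h.gram

theorem root_mem_dualLattice (h : E8Frame Φ f) {a : V} (ha : a ∈ Φ) : a ∈ dualLattice Φ := h.gram a ha

theorem two_smul_mem_dualLattice (h : E8Frame Φ f) (i : Fin 8) : (2 : ℝ) • f i ∈ dualLattice Φ := by
  obtain ⟨j, hj⟩ := exists_ne i
  have := add_mem (h.root_mem_dualLattice (h.add_mem i j hj.symm))
    (h.root_mem_dualLattice (h.sub_mem i j hj.symm))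
  convert this using 1
  module

/-- Twice the coordinates of a lattice vector are integers of the same parity. -/
theorem exists_coord (h : E8Frame Φ f) {v : V} (hv : v ∈ dualLattice Φ) :
    ∃ m : Fin 8 → ℤ, (∀ i, ⟪f i, v⟫ = m i / 2) ∧ (∀ i j, m i % 2 = m j % 2) ∧
      ((∑ i, m i ^ 2 : ℤ) : ℝ) = 4 * ⟪v, v⟫ ∧
      ∀ e : Fin 8 → ℤ, (∀ i, e i = 1 ∨ e i = -1) → ∏ i, e i = 1 → 4 ∣ ∑ i, e i * m i := by
  have h1 : ∀ i, ∃ n : ℤ, ⟪f i, v⟫ = n / 2 := fun i => by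
    obtain ⟨j, hj⟩ := exists_ne i
    obtain ⟨p, hp⟩ := hv _ (h.add_mem i j hj.symm)
    obtain ⟨q, hq⟩ := hv _ (h.sub_mem i j hj.symm)
    refine ⟨p + q, ?_⟩
    rw [inner_add_right] at hp
    rw [inner_sub_right] at hq
    rw [real_inner_comm]
    push_cast
    linarith
  choose m hm using h1
  refine ⟨m, hm, fun i j => ?_, ?_, fun e he hp => ?_⟩
  · rcases eq_or_ne i j with rfl | hij
    · rfl
    obtain ⟨q, hq⟩ := hv _ (h.sub_mem i j hij)
    rw [real_inner_comm, inner_sub_left, hm, hm] at hq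
    have : m i - m j = 2 * q := by
      have : (m i - m j : ℝ) = 2 * q := by linarith
      exact_mod_cast this
    omega
  · rw [← Orthonormal.sum_inner_sq h.orthonormal h.span v, Finset.mul_sum]
    push_cast
    exact Finset.sum_congr rfl fun i _ => by rw [hm]; ring
  · obtain ⟨q, hq⟩ := hv _ (h.spin (fun i => e i)
      (fun i => by rcases he i with h | h <;> simp [h]) (by exact_mod_cast hp))
    refine ⟨q, ?_⟩
    rw [inner_smul_right, inner_sum] at hq
    simp only [inner_smul_right] at hq
    have : ((∑ i, e i * m i : ℤ) : ℝ) = 4 * q := by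
      rw [← hq]
      push_cast
      rw [← mul_assoc, Finset.mul_sum]
      exact Finset.sum_congr rfl fun i _ => by rw [real_inner_comm, hm]; ring
    exact_mod_cast this

theorem eq_sum (h : E8Frame Φ f) {v : V} {m : Fin 8 → ℤ} (hm : ∀ i, ⟪f i, v⟫ = m i / 2) :
    v = (1 / 2 : ℝ) • ∑ i, (m i : ℝ) • f i := by
  rw [← Orthonormal.sum_inner_smul h.orthonormal h.span v, Finset.smul_sum]
  exact Finset.sum_congr rfl fun i _ => by rw [hm, smul_smul]; ring_nf

theorem _root_.RootSet.prod_eq_one_of_sum {e : Fin 8 → ℤ} (he : ∀ i, e i = 1 ∨ e i = -1)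
    (hs : 4 ∣ ∑ i, e i) : ∏ i, e i = 1 := by
  have key : ∀ b : Fin 8 → Bool, 4 ∣ ∑ i, (if b i then (1 : ℤ) else -1) →
      ∏ i, (if b i then (1 : ℤ) else -1) = 1 := by decide +kernel
  have he' : e = fun i => if decide (e i = 1) then (1 : ℤ) else -1 := by
    funext i
    rcases he i with h | h <;> simp [h]
  rw [he'] at hs ⊢
  exact key _ hs

/-- A lattice vector whose doubled coordinates are signs is a root. -/
theorem mem_of_coord (h : E8Frame Φ f) {v : V} (hv : v ∈ dualLattice Φ)
    (hs : ∀ i, ⟪f i, v⟫ = 1 / 2 ∨ ⟪f i, v⟫ = -1 / 2) : v ∈ Φ := by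
  obtain ⟨m, hm, -, -, h4⟩ := h.exists_coord hv
  have he : ∀ i, m i = 1 ∨ m i = -1 := fun i => by
    have := hs i
    rw [hm] at this
    rcases this with h | h
    · exact Or.inl (by exact_mod_cast (by linarith : (m i : ℝ) = 1))
    · exact Or.inr (by exact_mod_cast (by linarith : (m i : ℝ) = -1))
  have := h4 1 (by simp) (by simp)
  simp only [Pi.one_apply, one_mul] at this
  rw [h.eq_sum hm]
  refine h.spin (fun i => (m i : ℝ)) (fun i => ?_) (by exact_mod_cast prod_eq_one_of_sum he this)
  rcases he i with h | h <;> simp [h]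

theorem eq_zero_of_inner_lt (h : E8Frame Φ f) {v : V} (hv : v ∈ dualLattice Φ) (hlt : ⟪v, v⟫ < 2) :
    v = 0 := by
  obtain ⟨m, hm, hpar, hsum, h4⟩ := h.exists_coord hv
  have hlt' : ∑ i, m i ^ 2 < 8 := by
    have : ((∑ i, m i ^ 2 : ℤ) : ℝ) < 8 := by rw [hsum]; linarith
    exact_mod_cast this
  have hle : ∀ i, m i ^ 2 < 8 := fun i =>
    (Finset.single_le_sum (f := fun i => m i ^ 2) (fun _ _ => sq_nonneg _)
      (Finset.mem_univ i)).trans_lt hlt'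
  have hb : ∀ i, -2 ≤ m i ∧ m i ≤ 2 := fun i => by
    have := hle i
    constructor <;> nlinarith
  have heven : ∀ i, m i % 2 = 0 := by
    by_contra! hc
    obtain ⟨i, hi⟩ := hc
    have : ∀ j, 1 ≤ m j ^ 2 := fun j => by
      have := hpar i j
      have hj : m j ≠ 0 := by rintro h0; rw [h0] at this; omega
      exact sq_pos_of_ne_zero hj
    have := Finset.sum_le_sum fun j (_ : j ∈ Finset.univ) => this j
    simp at this
    omega
  have hz : ∀ i, m i = 0 := by
    by_contra! hc
    obtain ⟨i, hi⟩ := hc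
    have hi4 : m i ^ 2 = 4 := by
      have := hb i
      have := heven i
      obtain h | h : m i = 2 ∨ m i = -2 := by omega
      all_goals rw [h]; norm_num
    have hz' : ∀ j, j ≠ i → m j = 0 := fun j hj => by
      by_contra hjn
      have : m j ^ 2 = 4 := by
        have := hb j
        have := heven j
        obtain h | h : m j = 2 ∨ m j = -2 := by omega
        all_goals rw [h]; norm_num
      have h2 := Finset.sum_le_sum_of_subset_of_nonneg (f := fun i => m i ^ 2)
        (Finset.subset_univ {i, j}) (fun _ _ _ => sq_nonneg _)
      rw [Finset.sum_pair hj.symm] at h2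
      omega
    have h5 := h4 1 (by simp) (by simp)
    simp only [Pi.one_apply, one_mul] at h5
    rw [Finset.sum_eq_single i (fun j _ hj => hz' j hj) (by simp)] at h5
    have := hb i
    have := heven i
    omega
  rw [h.eq_sum hm]
  simp [hz]

/-- The doubled coordinates of a lattice vector of norm `4`. -/
theorem coord_cases {m : Fin 8 → ℤ} (hpar : ∀ i j, m i % 2 = m j % 2) (hsum : ∑ i, m i ^ 2 = 16) :
    (∃ k, (m k = 4 ∨ m k = -4) ∧ ∀ i, i ≠ k → m i = 0) ∨
      (∀ i, m i = 0 ∨ m i = 2 ∨ m i = -2) ∨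
      ∃ k, (m k = 3 ∨ m k = -3) ∧ ∀ i, i ≠ k → m i = 1 ∨ m i = -1 := by
  have hle : ∀ i, m i ^ 2 ≤ 16 := fun i => hsum ▸
    Finset.single_le_sum (f := fun i => m i ^ 2) (fun _ _ => sq_nonneg _) (Finset.mem_univ i)
  have hb : ∀ i, -4 ≤ m i ∧ m i ≤ 4 := fun i => by
    have := hle i
    constructor <;> nlinarith
  by_cases hk : ∃ k, m k = 4 ∨ m k = -4
  · obtain ⟨k, hk⟩ := hk
    refine Or.inl ⟨k, hk, fun i hi => ?_⟩
    have h2 := Finset.sum_le_sum_of_subset_of_nonneg (f := fun i => m i ^ 2)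
      (Finset.subset_univ {i, k}) (fun _ _ _ => sq_nonneg _)
    rw [Finset.sum_pair hi, hsum] at h2
    have : m k ^ 2 = 16 := by rcases hk with h | h <;> rw [h] <;> norm_num
    have : m i ^ 2 ≤ 0 := by omega
    exact pow_eq_zero_iff two_ne_zero |>.1 (le_antisymm this (sq_nonneg _))
  push Not at hk
  refine Or.inr ?_
  by_cases heven : ∀ i, m i % 2 = 0
  · refine Or.inl fun i => ?_
    have := heven i
    have := hk i
    have := hb i
    omega
  push Not at heven
  obtain ⟨i₀, hi₀⟩ := heven
  have hodd : ∀ i, m i = 1 ∨ m i = -1 ∨ m i = 3 ∨ m i = -3 := fun i => by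
    have := hb i
    have := hpar i i₀
    omega
  refine Or.inr ?_
  have hge : ∀ i, 1 ≤ m i ^ 2 := fun i => by rcases hodd i with h | h | h | h <;> rw [h] <;> norm_num
  obtain ⟨k, hk3⟩ : ∃ k, m k = 3 ∨ m k = -3 := by
    by_contra! hc
    have : ∀ i, m i ^ 2 = 1 := fun i => by
      have := hc i
      rcases hodd i with h | h | h | h
      · rw [h]; norm_num
      · rw [h]; norm_num
      · exact absurd h this.1
      · exact absurd h this.2
    simp [this] at hsum
  refine ⟨k, hk3, fun i hi => ?_⟩
  have h2 : ∑ j, m j ^ 2 = m i ^ 2 + m k ^ 2 + ∑ j ∈ Finset.univ \ {i, k}, m j ^ 2 := by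
    rw [← Finset.sum_sdiff (Finset.subset_univ {i, k}), Finset.sum_pair hi]; ring
  have h3 := Finset.sum_le_sum fun j (_ : j ∈ Finset.univ \ {i, k}) => hge j
  rw [Finset.sum_const, Finset.card_sdiff_of_subset (Finset.subset_univ _), Finset.card_pair hi] at h3
  simp only [Finset.card_univ, Fintype.card_fin, nsmul_eq_mul, Nat.reduceSub, Nat.cast_ofNat,
    mul_one] at h3
  have : m k ^ 2 = 9 := by rcases hk3 with h | h <;> rw [h] <;> norm_num
  rcases hodd i with h | h | h | h
  · exact Or.inl h
  · exact Or.inr h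
  all_goals
    have : m i ^ 2 = 9 := by rw [h]; norm_num
    omega

/-- A vector of norm `4` congruent to `±2 f k` modulo twice the lattice is some `±2 f i`. -/
theorem eq_of_congr (h : E8Frame Φ f) {y : V} (hy : ⟪y, y⟫ = 4) {k : Fin 8} {s : ℝ}
    (hs : s = 1 ∨ s = -1) {r : V} (hr : r ∈ dualLattice Φ) (he : y = (2 * s) • f k + (2 : ℝ) • r) :
    ∃ i, y = (2 : ℝ) • f i ∨ y = (-2 : ℝ) • f i := by
  obtain ⟨n, hn, hpar, -, -⟩ := h.exists_coord hr
  obtain ⟨z, hz⟩ : ∃ z : ℤ, s = z := by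
    rcases hs with h | h
    · exact ⟨1, by simp [h]⟩
    · exact ⟨-1, by simp [h]⟩
  obtain ⟨m, hm⟩ : ∃ m : Fin 8 → ℤ, m = fun i => 2 * (n i + if i = k then 2 * z else 0) := ⟨_, rfl⟩
  have hmy : ∀ i, ⟪f i, y⟫ = m i / 2 := fun i => by
    rw [he, inner_add_right, inner_smul_right, inner_smul_right, hn, h.inner_eq, hm, hz]
    rcases eq_or_ne i k with hik | hik <;> simp [hik] <;> ring
  have hsum : ∑ i, m i ^ 2 = 16 := by
    have := Orthonormal.sum_inner_sq h.orthonormal h.span y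
    rw [hy] at this
    have h2 : ((∑ i, m i ^ 2 : ℤ) : ℝ) = 16 := by
      rw [show (16 : ℝ) = 4 * 4 by norm_num]
      nth_rewrite 2 [← this]
      rw [Finset.mul_sum]
      push_cast
      exact Finset.sum_congr rfl fun i _ => by rw [hmy]; ring
    exact_mod_cast h2
  have hm2 : ∀ i, m i % 2 = 0 := fun i => by rw [hm]; simp
  rcases coord_cases (fun i j => by rw [hm2, hm2]) hsum with ⟨i, hi, h0⟩ | h2 | ⟨i, hi, -⟩
  · refine ⟨i, ?_⟩
    have hy' : y = (m i / 2 : ℝ) • f i := by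
      rw [h.eq_sum hmy, Finset.sum_eq_single i (fun j _ hj => by simp [h0 j hj]) (by simp), smul_smul]
      ring_nf
    rcases hi with hi | hi <;> rw [hi] at hy' <;> norm_num at hy'
    · exact Or.inl hy'
    · exact Or.inr (by rw [hy', neg_smul])
  · exfalso
    have hp : ∀ i j, m i % 4 = m j % 4 := fun i j => by
      have := hpar i j
      rw [hm]
      dsimp only
      split_ifs <;> omega
    have h4 : ∀ i, m i = 0 := by
      by_contra! hc
      obtain ⟨i, hi⟩ := hc
      have : ∀ j, m j ^ 2 = 4 := fun j => by
        have := hp i j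
        have := h2 i
        obtain h | h : m j = 2 ∨ m j = -2 := by have := h2 j; omega
        all_goals rw [h]; norm_num
      simp [this] at hsum
    simp [h4] at hsum
  · have := hm2 i
    omega

/-- An element of the reflection group sending one frame line to a frame line permutes them. -/
theorem signed_of_one (h : E8Frame Φ f) (hΦ : IsRoot Φ) {w : V ≃ₗᵢ[ℝ] V} (hw : w ∈ weyl Φ)
    {j k : Fin 8} (hj : w (f j) = f k ∨ w (f j) = -f k) (i : Fin 8) :
    ∃ l, w (f i) = f l ∨ w (f i) = -f l := by
  obtain ⟨s, hs, hjs⟩ : ∃ s : ℝ, (s = 1 ∨ s = -1) ∧ w (f j) = s • f k := by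
    rcases hj with hj | hj
    · exact ⟨1, Or.inl rfl, by rw [hj, one_smul]⟩
    · exact ⟨-1, Or.inr rfl, by rw [hj, neg_smul, one_smul]⟩
  have hr : w (f i - f j) ∈ dualLattice Φ := by
    rcases eq_or_ne i j with rfl | hij
    · rw [sub_self, map_zero]; exact zero_mem _
    · exact h.root_mem_dualLattice (hΦ.map_mem hw _ (h.sub_mem i j hij))
  obtain ⟨l, hl⟩ := h.eq_of_congr (y := w ((2 : ℝ) • f i))
    (by rw [LinearIsometryEquiv.inner_map_map, inner_smul_left, inner_smul_right, h.inner_self]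
        norm_num) hs hr (by rw [map_sub, map_smul, hjs]; module) (k := k)
  refine ⟨l, ?_⟩
  rw [map_smul] at hl
  rcases hl with hl | hl
  · exact Or.inl (smul_right_injective V (two_ne_zero (α := ℝ)) hl)
  · right
    apply smul_right_injective V (two_ne_zero (α := ℝ))
    simp only [hl]
    module

end E8Frame

end

section

variable {V : Type*} [NormedAddCommGroup V] [InnerProductSpace ℝ V]

theorem exists_weyl_orthogonal {ι : Type*} {Φ : Set V} (hΦ : IsRoot Φ) (r : ι → V)
    (hr : ∀ i, r i ∈ Φ) (ho : ∀ i j, i ≠ j → ⟪r i, r j⟫ = 0) (s : Finset ι) :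
    ∃ u ∈ weyl Φ, ∀ x, u x = x - ∑ i ∈ s, ⟪r i, x⟫ • r i := by
  classical
  induction s using Finset.induction_on with
  | empty => exact ⟨1, one_mem _, fun x => by simp⟩
  | insert i s hi ih =>
    obtain ⟨u, hu, hux⟩ := ih
    refine ⟨refl (r i) * u, mul_mem (refl_mem_weyl (hr i)) hu, fun x => ?_⟩
    have h0 : ∑ j ∈ s, ⟪r i, ⟪r j, x⟫ • r j⟫ = 0 := Finset.sum_eq_zero fun j hj => by
      rw [inner_smul_right, ho i j (ne_of_mem_of_not_mem hj hi).symm, mul_zero]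
    rw [mul_apply, hux, refl_apply (hΦ.norm _ (hr i)), Finset.sum_insert hi, inner_sub_right,
      inner_sum, h0, sub_zero]
    abel

/-- `A / c` is the matrix of `g` in the family `f`. -/
def IsMatrix {n : ℕ} (f : Fin n → V) (c : ℤ) (g : V ≃ₗᵢ[ℝ] V) (A : Matrix (Fin n) (Fin n) ℤ) : Prop :=
  ∀ j, (c : ℝ) • g (f j) = ∑ i, (A i j : ℝ) • f i

theorem IsMatrix.mul {n : ℕ} {f : Fin n → V} {c d : ℤ} {g k : V ≃ₗᵢ[ℝ] V}
    {A B : Matrix (Fin n) (Fin n) ℤ} (hA : IsMatrix f c g A) (hB : IsMatrix f d k B) :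
    IsMatrix f (c * d) (g * k) (A * B) := by
  intro j
  rw [mul_apply, Int.cast_mul, mul_smul, ← map_smul, hB j, map_sum, Finset.smul_sum]
  simp_rw [map_smul, smul_comm (c : ℝ), hA _, Finset.smul_sum, smul_smul]
  rw [Finset.sum_comm]
  refine Finset.sum_congr rfl fun i _ => ?_
  rw [← Finset.sum_smul, Matrix.mul_apply]
  push_cast
  exact congrArg (· • f i) (Finset.sum_congr rfl fun k _ => mul_comm _ _)

/-- Doubled coordinates of a root of `E₈` in a frame. -/
def IsRootVec (v : Fin 8 → ℤ) : Prop :=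
  ((∀ i, v i = 1 ∨ v i = -1) ∧ ∏ i, v i = 1) ∨
    ∃ i j, i ≠ j ∧ ((∀ k, v k = if k = i ∨ k = j then 2 else 0) ∨
      ∀ k, v k = if k = i then 2 else if k = j then -2 else 0)

instance (v : Fin 8 → ℤ) : Decidable (IsRootVec v) := by unfold IsRootVec; infer_instance

namespace E8Frame
variable {Φ : Set V} {f : Fin 8 → V}

theorem mem_of_isRootVec (h : E8Frame Φ f) {v : Fin 8 → ℤ} (hv : IsRootVec v) :
    (1 / 2 : ℝ) • ∑ i, (v i : ℝ) • f i ∈ Φ := by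
  rcases hv with ⟨hv, hp⟩ | ⟨i, j, hij, hv | hv⟩
  · exact h.spin (fun i => (v i : ℝ)) (fun i => by rcases hv i with h | h <;> simp [h])
      (by exact_mod_cast hp)
  · convert h.add_mem i j hij using 1
    rw [← Finset.sum_subset (Finset.subset_univ {i, j}) (fun k _ hk => by
      simp only [Finset.mem_insert, Finset.mem_singleton] at hk
      rw [hv, if_neg hk]; simp), Finset.sum_pair hij, hv, hv]
    simp only [true_or, or_true, if_true, Int.cast_ofNat]
    module
  · convert h.sub_mem i j hij using 1
    rw [← Finset.sum_subset (Finset.subset_univ {i, j}) (fun k _ hk => by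
      simp only [Finset.mem_insert, Finset.mem_singleton, not_or] at hk
      rw [hv, if_neg hk.1, if_neg hk.2]; simp), Finset.sum_pair hij, hv, hv]
    simp only [if_true, if_neg hij.symm, Int.cast_ofNat, Int.cast_neg]
    module

theorem inner_half_sum (h : E8Frame Φ f) (v : Fin 8 → ℤ) (j : Fin 8) :
    ⟪(1 / 2 : ℝ) • ∑ i, (v i : ℝ) • f i, f j⟫ = v j / 2 := by
  rw [real_inner_smul_left, sum_inner]
  simp only [inner_smul_left, h.inner_eq]
  simp
  ring

theorem inner_half_sum_half_sum (h : E8Frame Φ f) (v v' : Fin 8 → ℤ) :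
    ⟪(1 / 2 : ℝ) • ∑ i, (v i : ℝ) • f i, (1 / 2 : ℝ) • ∑ i, (v' i : ℝ) • f i⟫ =
      ((∑ i, v i * v' i : ℤ) : ℝ) / 4 := by
  rw [inner_smul_right, inner_sum]
  simp only [inner_smul_right, h.inner_half_sum]
  push_cast
  rw [Finset.mul_sum, Finset.sum_div]
  exact Finset.sum_congr rfl fun i _ => by ring

/-- A criterion for an explicit product of four orthogonal reflections to reverse
`s_α w'`, where `w'` is the signed permutation `(c, t)` and `α` is half the sum of the frame. -/
theorem false_of_matrix (h : E8Frame Φ f) {w : V ≃ₗᵢ[ℝ] V} (hw : Critical Φ w) {c : Fin 8 → Fin 8}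
    {t : Fin 8 → ℤ}
    (ht : ∀ k, (refl ((1 / 2 : ℝ) • ∑ i, f i) * w) (f k) = (t k : ℝ) • f (c k))
    (B : Fin 4 → Fin 8 → ℤ) (hB : ∀ r, IsRootVec (B r))
    (ho : ∀ r s, r ≠ s → ∑ i, B r i * B s i = 0)
    (hm : (Matrix.of fun i k => (4 * (if i = c k then 1 else 0) - 1) * t k) *
      (Matrix.of fun i j => 4 * (if i = j then 1 else 0) - ∑ r, B r i * B r j) *
      (Matrix.of fun i k => (4 * (if i = c k then 1 else 0) - 1) * t k) =
      (16 : ℤ) • (Matrix.of fun i j => 4 * (if i = j then 1 else 0) - ∑ r, B r i * B r j :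
        Matrix (Fin 8) (Fin 8) ℤ)) : False := by
  set A : Matrix (Fin 8) (Fin 8) ℤ := Matrix.of fun i k => (4 * (if i = c k then 1 else 0) - 1) * t k
  set X : Matrix (Fin 8) (Fin 8) ℤ :=
    Matrix.of fun i j => 4 * (if i = j then 1 else 0) - ∑ r, B r i * B r j
  obtain ⟨u, hu, hux⟩ := exists_weyl_orthogonal hw.isRoot
    (fun r => (1 / 2 : ℝ) • ∑ i, (B r i : ℝ) • f i) (fun r => h.mem_of_isRootVec (hB r))
    (fun r s hrs => by rw [h.inner_half_sum_half_sum, ho r s hrs]; simp) Finset.univ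
  have hα : (1 / 2 : ℝ) • ∑ i, f i ∈ Φ := by
    have := h.spin 1 (by simp) (by simp)
    simpa using this
  have hX : IsMatrix f 4 u X := by
    intro j
    rw [hux]
    simp only [h.inner_half_sum, X, Matrix.of_apply]
    push_cast
    simp only [sub_smul, Finset.sum_sub_distrib, mul_ite, mul_one, mul_zero, ite_smul, zero_smul,
      Finset.sum_ite_eq', Finset.mem_univ, if_true, smul_sub, Finset.smul_sum, Finset.sum_smul,
      smul_smul]
    rw [Finset.sum_comm]
    congr 1
    refine Finset.sum_congr rfl fun i _ => Finset.sum_congr rfl fun r _ => ?_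
    congr 1
    ring
  have hA : IsMatrix f 4 w A := by
    intro j
    have : w (f j) = (t j : ℝ) • refl ((1 / 2 : ℝ) • ∑ i, f i) (f (c j)) := by
      rw [← map_smul, ← ht j, mul_apply, refl_refl]
    rw [this, refl_apply (hw.isRoot.norm _ hα)]
    have h1 := h.inner_half_sum 1 (c j)
    simp only [Pi.one_apply, Int.cast_one, one_smul] at h1
    rw [h1]
    simp only [A, Matrix.of_apply]
    push_cast
    simp only [mul_smul, ← mul_comm (t j : ℝ)]
    rw [← Finset.smul_sum]
    simp only [sub_smul, Finset.sum_sub_distrib, mul_ite, mul_one, mul_zero, ite_smul, zero_smul,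
      Finset.sum_ite_eq', Finset.mem_univ, if_true, one_smul]
    module
  refine hw.false_of_reverses hu h.span ?_
  rintro _ ⟨j, rfl⟩
  have h1 := (hA.mul hX).mul hA j
  rw [hm] at h1
  have h2 : ((64 : ℝ)) • w (u (w (f j))) = (16 : ℝ) • (4 : ℝ) • u (f j) := by
    have h3 := hX j
    push_cast at h3
    rw [h3, Finset.smul_sum]
    convert h1 using 1
    · rw [mul_apply, mul_apply]; norm_num
    · exact Finset.sum_congr rfl fun i _ => by simp [smul_smul]
  have : (64 : ℝ) ≠ 0 := by norm_num
  apply smul_right_injective V this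
  simp only
  rw [h2, smul_smul]
  norm_num

end E8Frame

end

section

variable {V : Type*} [NormedAddCommGroup V] [InnerProductSpace ℝ V]

/-- The sign attached to a truth value. -/
def sgn (b : Bool) : ℤ := if b then 1 else -1

def SymmWord {L : ℕ} (v : ZMod L → Bool) : Prop := ∃ j, ∀ k, v k = v (j - k)

theorem symmWord_of_le {L : ℕ} (h0 : L ≠ 0) (hL : L ≤ 5) (v : ZMod L → Bool) : SymmWord v := by
  unfold SymmWord
  interval_cases L
  · exact absurd rfl h0
  · revert v; decide +kernel
  · revert v; decide +kernel
  · revert v; decide +kernel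
  · revert v; decide +kernel
  · revert v; decide +kernel

theorem word_six (v : Fin 6 → Bool) : (∃ j, ∀ k, v k = v (j - k)) ∨ ∃ r,
    (∀ k, v (r + k) = (![false, true, false, true, true, false] : Fin 6 → Bool) k) ∨
    (∀ k, v (r + k) = (![true, true, false, true, false, false] : Fin 6 → Bool) k) := by
  revert v
  decide +kernel

theorem word_eight (v : Fin 8 → Bool) (h : 4 ∣ ∑ k, sgn (v k)) : (∃ j, ∀ k, v k = v (j - k)) ∨
    ∃ r,
    (∀ k, v (r + k) = (![false, false, true, false, true, true, true, false] : Fin 8 → Bool) k) ∨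
    (∀ k, v (r + k) = (![true, true, true, false, true, false, false, false] : Fin 8 → Bool) k) ∨
    (∀ k, v (r + k) = (![false, true, false, true, false, true, true, false] : Fin 8 → Bool) k) ∨
    (∀ k, v (r + k) = (![true, true, false, true, false, true, false, false] : Fin 8 → Bool) k) := by
  revert v
  decide +kernel

theorem zpow_val_apply {α : Type*} {σ : Equiv.Perm α} {i : α} {L : ℕ} [NeZero L] (hL : (σ ^ L) i = i)
    (k : ℤ) : (σ ^ (k : ZMod L).val) i = (σ ^ k) i := by
  have h1 : ((k : ZMod L).val : ℤ) = k % L := ZMod.val_intCast k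
  rw [← zpow_natCast, h1]
  conv_rhs => rw [← Int.emod_add_mul_ediv k L, zpow_add, zpow_mul, zpow_natCast, Equiv.Perm.mul_apply,
    Equiv.Perm.zpow_apply_eq_self_of_apply_eq_self hL]

theorem pow_val_add_apply {α : Type*} {σ : Equiv.Perm α} {i : α} {L : ℕ} [NeZero L]
    (hL : (σ ^ L) i = i) (r k : ZMod L) :
    (σ ^ (r + k).val) i = (σ ^ k.val) ((σ ^ r.val) i) := by
  have := zpow_val_apply hL (k.val + r.val)
  rw [zpow_add, Equiv.Perm.mul_apply, zpow_natCast, zpow_natCast] at this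
  rw [← this]
  simp [add_comm]

theorem exists_symm_of_symmWord {α : Type*} {σ : Equiv.Perm α} {i : α} {L : ℕ} [NeZero L]
    (hL : (σ ^ L) i = i) (b : α → Bool) (h : SymmWord (L := L) fun z => b ((σ ^ z.val) i)) :
    ∃ j : ℤ, ∀ k : ℤ, b ((σ ^ k) i) = b ((σ ^ (j - k)) i) := by
  obtain ⟨j, hj⟩ := h
  refine ⟨j.val, fun k => ?_⟩
  have := hj k
  simp only at this
  rw [zpow_val_apply hL] at this
  rw [this, ← zpow_val_apply hL]
  simp

theorem exists_perm_extend {n : ℕ} (σ : Equiv.Perm (Fin n)) (i : Fin n) :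
    ∃ π : Equiv.Perm (Fin n), ∀ k : Fin n, (k : ℕ) < Function.minimalPeriod σ i →
      π k = (σ ^ (k : ℕ)) i := by
  have hinj : Set.InjOn (fun k : Fin n => (σ ^ (k : ℕ)) i)
      (Finset.univ.filter fun k : Fin n => (k : ℕ) < Function.minimalPeriod σ i : Finset (Fin n)) := by
    intro k hk l hl hkl
    simp only [Finset.coe_filter, Finset.mem_univ, true_and, Set.mem_ofPred_eq] at hk hl
    simp only [Equiv.Perm.coe_pow] at hkl
    exact Fin.ext (Function.iterate_injOn_Iio_minimalPeriod hk hl hkl)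
  obtain ⟨g, hg⟩ := Finset.exists_equiv_extend_of_card_eq (α := Fin n) (t := Finset.univ) (by simp)
    (Finset.subset_univ _) hinj
  refine ⟨g.trans (Equiv.subtypeUnivEquiv (by simp)), fun k hk => ?_⟩
  exact hg k (by simpa using hk)

theorem exists_normal_form (σ : Equiv.Perm (Fin 8)) (b : Fin 8 → Bool) (hb : 4 ∣ ∑ i, sgn (b i)) :
    (∀ i, ∃ j : ℤ, ∀ k : ℤ, b ((σ ^ k) i) = b ((σ ^ (j - k)) i)) ∨
    ∃ π : Equiv.Perm (Fin 8),
      ((∀ k, σ (π k) = π ((![1, 2, 3, 4, 5, 6, 7, 0] : Fin 8 → Fin 8) k)) ∧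
        ((∀ k, b (π k) = (![false, false, true, false, true, true, true, false] : Fin 8 → Bool) k) ∨
        (∀ k, b (π k) = (![true, true, true, false, true, false, false, false] : Fin 8 → Bool) k) ∨
        (∀ k, b (π k) = (![false, true, false, true, false, true, true, false] : Fin 8 → Bool) k) ∨
        (∀ k, b (π k) = (![true, true, false, true, false, true, false, false] : Fin 8 → Bool) k))) ∨
      ((∀ k, σ (π k) = π ((![1, 2, 3, 4, 5, 6, 0, 7] : Fin 8 → Fin 8) k)) ∧
        ∏ k : Fin 8, sgn (b (π k)) = 1) ∨
      ((∀ k, σ (π k) = π ((![1, 2, 3, 4, 5, 0, 6, 7] : Fin 8 → Fin 8) k)) ∧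
        ((∀ k, b (π k) = (![false, true, false, true, true, false, true, false] : Fin 8 → Bool) k) ∨
        (∀ k, b (π k) = (![true, true, false, true, false, false, true, false] : Fin 8 → Bool) k))) ∨
      ((∀ k, σ (π k) = π ((![1, 2, 3, 4, 5, 0, 7, 6] : Fin 8 → Fin 8) k)) ∧
        ((∀ k : Fin 6, b (π (Fin.castLE (by norm_num) k)) =
          (![false, true, false, true, true, false] : Fin 6 → Bool) k) ∨
        (∀ k : Fin 6, b (π (Fin.castLE (by norm_num) k)) =
          (![true, true, false, true, false, false] : Fin 6 → Bool) k)) ∧ b (π 6) ≠ b (π 7)) := by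
  by_cases hs : ∀ i, ∃ j : ℤ, ∀ k : ℤ, b ((σ ^ k) i) = b ((σ ^ (j - k)) i)
  · exact Or.inl hs
  right
  push Not at hs
  obtain ⟨i, hi⟩ := hs
  have hper : ∀ i, (σ ^ Function.minimalPeriod σ i) i = i := fun i => by
    rw [Equiv.Perm.coe_pow]; exact Function.iterate_minimalPeriod
  have hpos : ∀ i, Function.minimalPeriod σ i ≠ 0 := fun i h => by
    rw [Function.minimalPeriod_eq_zero_iff_notMem_periodicPts] at h
    exact h (σ.injective.mem_periodicPts i)
  have hle : Function.minimalPeriod σ i ≤ 8 := by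
    have h1 := Set.InjOn.ncard_image (Function.iterate_injOn_Iio_minimalPeriod (f := σ) (x := i))
    have h2 := Set.ncard_le_card ((fun n => σ^[n] i) '' Set.Iio (Function.minimalPeriod σ i))
    rw [h1] at h2
    simpa using h2
  have hnot : ∀ L, Function.minimalPeriod σ i = L → ∀ [NeZero L],
      ¬ SymmWord (L := L) fun z => b ((σ ^ z.val) i) := by
    rintro L rfl _ h
    obtain ⟨j, hj⟩ := exists_symm_of_symmWord (hper i) b h
    obtain ⟨k, hk⟩ := hi j
    exact hk (hj k)
  have hge : 6 ≤ Function.minimalPeriod σ i := by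
    by_contra hlt
    have : NeZero (Function.minimalPeriod σ i) := ⟨hpos i⟩
    exact hnot _ rfl (symmWord_of_le (hpos i) (by omega) _)
  have hrot : ∀ r : ℕ, Function.minimalPeriod σ ((σ ^ r) i) = Function.minimalPeriod σ i := fun r => by
    rw [Equiv.Perm.coe_pow]
    exact Function.minimalPeriod_apply_iterate (σ.injective.mem_periodicPts i) r
  have hprod := prod_eq_one_of_sum (e := fun i => sgn (b i))
    (fun i => by unfold sgn; cases b i <;> simp) hb
  have hLi := hper i
  generalize Function.minimalPeriod σ i = L at *
  have hπ' : ∀ r : ℕ, ∃ π : Equiv.Perm (Fin 8),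
      (∀ k : Fin 8, (k : ℕ) < L → π k = (σ ^ (k : ℕ)) ((σ ^ r) i)) ∧
      (∀ k l : Fin 8, (k : ℕ) < L → (l : ℕ) = (k + 1) % L → σ (π k) = π l) ∧
      ∀ k : Fin 8, L ≤ (k : ℕ) → ∃ l : Fin 8, L ≤ (l : ℕ) ∧ σ (π k) = π l := fun r => by
    obtain ⟨π, hπ⟩ := exists_perm_extend σ ((σ ^ r) i)
    have h1 : ∀ k : Fin 8, (k : ℕ) < L → π k = (σ ^ (k : ℕ)) ((σ ^ r) i) := fun k hk =>
      hπ k (by rw [hrot]; exact hk)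
    have h2 : ∀ k l : Fin 8, (k : ℕ) < L → (l : ℕ) = (k + 1) % L → σ (π k) = π l := by
      intro k l hk hl
      rw [h1 k hk, h1 l (hl ▸ Nat.mod_lt _ (by omega)), ← Equiv.Perm.mul_apply, ← pow_succ', hl]
      rcases eq_or_ne (k + 1 : ℕ) L with hkL | hkL
      · have := hper ((σ ^ r) i)
        rw [hrot] at this
        rw [hkL, Nat.mod_self, this]
        rfl
      · rw [Nat.mod_eq_of_lt (by omega)]
    refine ⟨π, h1, h2, fun k hk => ⟨π.symm (σ (π k)), ?_, by simp⟩⟩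
    by_contra! hlt
    generalize hl : π.symm (σ (π k)) = l at hlt
    have hl' : σ (π k) = π l := by rw [← hl]; simp
    rcases Nat.eq_zero_or_pos (l : ℕ) with h0 | h0
    · have h3 := h2 ⟨L - 1, by omega⟩ l (by simp; omega)
        (by simp only [h0]; rw [Nat.sub_add_cancel (by omega), Nat.mod_self])
      rw [← hl', σ.apply_eq_iff_eq, π.apply_eq_iff_eq] at h3
      rw [← h3] at hk
      simp at hk
      omega
    · have h3 := h2 ⟨l - 1, by omega⟩ l (by simp; omega)
        (by simp only; rw [Nat.sub_add_cancel (by omega), Nat.mod_eq_of_lt hlt])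
      rw [← hl', σ.apply_eq_iff_eq, π.apply_eq_iff_eq] at h3
      rw [← h3] at hk
      simp at hk
      omega
  have hsum : ∀ π : Equiv.Perm (Fin 8), ∑ k, sgn (b (π k)) = ∑ k, sgn (b k) := fun π =>
    Equiv.sum_comp π fun k => sgn (b k)
  obtain rfl | rfl | rfl : L = 6 ∨ L = 7 ∨ L = 8 := by omega
  · obtain ⟨r, hr⟩ := (word_six fun z => b ((σ ^ z.val) i)).resolve_left (hnot 6 rfl)
    obtain ⟨π, h1, h2, h3⟩ := hπ' r.val
    have hw : ∀ k : Fin 6, b (π (Fin.castLE (by norm_num) k)) = b ((σ ^ (r + k).val) i) := fun k => by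
      rw [h1 _ k.2]
      exact congrArg b (pow_val_add_apply (L := 6) hLi r k).symm
    have hr' : (∀ k : Fin 6, b (π (Fin.castLE (by norm_num) k)) =
          (![false, true, false, true, true, false] : Fin 6 → Bool) k) ∨
        (∀ k : Fin 6, b (π (Fin.castLE (by norm_num) k)) =
          (![true, true, false, true, false, false] : Fin 6 → Bool) k) :=
      hr.imp (fun h k => (hw k).trans (h k)) (fun h k => (hw k).trans (h k))
    have hne : b (π 6) ≠ b (π 7) := by
      intro he
      rw [← hsum π, Fin.sum_univ_eight] at hb
      have h6 : ∀ k : Fin 6, b (π (Fin.castLE (by norm_num) k)) = false ∨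
        b (π (Fin.castLE (by norm_num) k)) = true := fun k => by simp
      have e : ∑ k : Fin 6, sgn (b (π (Fin.castLE (by norm_num) k))) = 0 := by
        rcases hr' with h | h <;> simp_rw [h] <;> decide
      rw [Fin.sum_univ_six] at e
      rw [← he] at hb
      have : (4 : ℤ) ∣ 0 + sgn (b (π 6)) + sgn (b (π 6)) := by rw [← e]; exact hb
      revert this
      cases b (π 6) <;> decide
    have hσ : ∀ k : Fin 8, (k : ℕ) < 6 → σ (π k) = π ((![1, 2, 3, 4, 5, 0, 6, 7] : Fin 8 → Fin 8) k) :=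
      fun k hk => h2 _ _ hk (by revert k; decide)
    have h67 : ∀ k : Fin 8, 6 ≤ (k : ℕ) → k = 6 ∨ k = 7 := by decide
    obtain ⟨l6, hl6, e6⟩ := h3 6 (by decide)
    obtain ⟨l7, hl7, e7⟩ := h3 7 (by decide)
    have hinj : l6 ≠ l7 := by
      rintro rfl
      have := σ.injective (e6.trans e7.symm)
      rw [π.apply_eq_iff_eq] at this
      exact absurd this (by decide)
    have hcase : l6 = 6 ∧ l7 = 7 ∨ l6 = 7 ∧ l7 = 6 := by
      rcases h67 l6 hl6 with h | h <;> rcases h67 l7 hl7 with h' | h' <;> simp_all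
    rcases hcase with ⟨rfl, rfl⟩ | ⟨rfl, rfl⟩
    · have hfix : ∀ k, σ (π k) = π ((![1, 2, 3, 4, 5, 0, 6, 7] : Fin 8 → Fin 8) k) := fun k => by
        by_cases hk : (k : ℕ) < 6
        · exact hσ k hk
        · rcases h67 k (by omega) with rfl | rfl
          · exact e6
          · exact e7
      rcases hb6 : b (π 6) with _ | _
      · have hb7 : b (π 7) = true := by rw [hb6] at hne; simpa using hne.symm
        refine ⟨(Equiv.swap 6 7).trans π, Or.inr (Or.inr (Or.inl ⟨fun k => ?_, hr'.imp ?_ ?_⟩))⟩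
        · simp only [Equiv.trans_apply]
          rw [hfix]
          congr 1
          revert k; decide
        · intro h k
          by_cases hk : (k : ℕ) < 6
          · have := h ⟨k, hk⟩
            rw [Equiv.trans_apply, Equiv.swap_apply_of_ne_of_ne (by rintro rfl; omega)
              (by rintro rfl; omega)]
            refine this.trans ?_; clear this
            revert k; decide
          · rcases h67 k (by omega) with rfl | rfl <;> simp [hb6, hb7]
        · intro h k
          by_cases hk : (k : ℕ) < 6
          · have := h ⟨k, hk⟩
            rw [Equiv.trans_apply, Equiv.swap_apply_of_ne_of_ne (by rintro rfl; omega)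
              (by rintro rfl; omega)]
            refine this.trans ?_; clear this
            revert k; decide
          · rcases h67 k (by omega) with rfl | rfl <;> simp [hb6, hb7]
      · have hb7 : b (π 7) = false := by rw [hb6] at hne; simpa using hne.symm
        refine ⟨π, Or.inr (Or.inr (Or.inl ⟨hfix, hr'.imp ?_ ?_⟩))⟩
        all_goals
          intro h k
          by_cases hk : (k : ℕ) < 6
          · have := h ⟨k, hk⟩
            refine this.trans ?_; clear this
            revert k; decide
          · rcases h67 k (by omega) with rfl | rfl <;> simp [hb6, hb7]
    · refine ⟨π, Or.inr (Or.inr (Or.inr ⟨fun k => ?_, hr', hne⟩))⟩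
      by_cases hk : (k : ℕ) < 6
      · rw [hσ k hk]
        congr 1
        revert k; decide
      · rcases h67 k (by omega) with rfl | rfl
        · exact e6
        · exact e7
  · obtain ⟨π, -, h2, h3⟩ := hπ' 0
    refine ⟨π, Or.inr (Or.inl ⟨fun k => ?_, ?_⟩)⟩
    · by_cases hk : (k : ℕ) < 7
      · exact h2 _ _ hk (by revert k; decide)
      · obtain rfl : k = 7 := by apply Fin.ext; simp; omega
        obtain ⟨l, hl, e⟩ := h3 7 (by decide)
        obtain rfl : l = 7 := by apply Fin.ext; simp; omega
        exact e
    · rw [Equiv.prod_comp π fun k => sgn (b k)]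
      exact hprod
  · obtain ⟨r, hr⟩ := (word_eight (fun z => b ((σ ^ z.val) i)) (by
      obtain ⟨π, h1, -, -⟩ := hπ' 0
      rw [← hsum π] at hb
      convert hb using 4 with k
      rw [h1 k k.2]
      rfl)).resolve_left (hnot 8 rfl)
    obtain ⟨π, h1, h2, -⟩ := hπ' r.val
    have hw : ∀ k : Fin 8, b (π k) = b ((σ ^ (r + k).val) i) := fun k => by
      rw [h1 _ k.2]
      exact congrArg b (pow_val_add_apply (L := 8) hLi r k).symm
    refine ⟨π, Or.inl ⟨fun k => h2 _ _ k.2 (by revert k; decide), ?_⟩⟩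
    simp only [hw]
    exact hr

end

section

variable {V : Type*} [NormedAddCommGroup V] [InnerProductSpace ℝ V]

theorem Critical.eq_zero_of_refl_mul_fixed [FiniteDimensional ℝ V] {Φ : Set V} {w : V ≃ₗᵢ[ℝ] V}
    (h : Critical Φ w) {a : V} (ha : a ∈ Φ) {x : V} (hx : (refl a * w) x = x) (h0 : ⟪a, x⟫ = 0) :
    x = 0 := by
  refine h.eq_zero_of_fixed ?_
  rw [mul_apply] at hx
  rw [← refl_refl (a := a) (w x), hx, refl_eq_of_inner_eq_zero (h.isRoot.norm a ha) h0]

namespace E8Frame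
variable {Φ : Set V} {f : Fin 8 → V}

theorem half_sum_mem (h : E8Frame Φ f) : (1 / 2 : ℝ) • ∑ i, f i ∈ Φ := by
  have := h.spin 1 (by simp) (by simp)
  simpa using this

theorem inner_half_sum_one (h : E8Frame Φ f) (j : Fin 8) : ⟪f j, (1 / 2 : ℝ) • ∑ i, f i⟫ = 1 / 2 := by
  have := h.inner_half_sum 1 j
  rw [real_inner_comm]
  simpa using this

theorem sum_signs (h : E8Frame Φ f) (hΦ : IsRoot Φ) {w : V ≃ₗᵢ[ℝ] V} (hw : w ∈ weyl Φ)
    {σ : Equiv.Perm (Fin 8)} {t : Fin 8 → ℤ} (ht : ∀ i, w (f i) = (t i : ℝ) • f (σ i)) :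
    4 ∣ ∑ i, t i := by
  obtain ⟨n, hn⟩ := h.gram _ h.half_sum_mem _ (hΦ.map_mem hw _ h.half_sum_mem)
  refine ⟨n, ?_⟩
  rw [real_inner_comm, map_smul, map_sum, real_inner_smul_left, sum_inner] at hn
  simp only [ht, real_inner_smul_left] at hn
  simp only [h.inner_half_sum_one] at hn
  rw [← Finset.sum_mul] at hn
  have : ((∑ i, t i : ℤ) : ℝ) = 4 * n := by push_cast; linarith
  exact_mod_cast this

theorem false_of_normal_form [FiniteDimensional ℝ V] (h : E8Frame Φ f) {w : V ≃ₗᵢ[ℝ] V}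
    (hw : Critical Φ w) {c : Fin 8 → Fin 8} {t : Fin 8 → ℤ} (hts : ∀ k, t k = 1 ∨ t k = -1)
    (ht : ∀ k, (refl ((1 / 2 : ℝ) • ∑ i, f i) * w) (f k) = (t k : ℝ) • f (c k))
    (hzero : ∀ x : Fin 8 → ℝ, (∀ k, x (c k) = t k * x k) → ∀ k, x k = 0) : False := by
  obtain ⟨u, hu1, hu⟩ := hw.exists_fixed_refl_mul h.half_sum_mem
  have hx := hzero (fun k => ⟪f k, u⟫) fun k => by
    have h1 : f (c k) = (t k : ℝ) • (refl ((1 / 2 : ℝ) • ∑ i, f i) * w) (f k) := by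
      rw [ht, smul_smul]
      rcases hts k with h | h <;> simp [h]
    rw [h1, real_inner_smul_left]
    nth_rewrite 1 [← hu]
    rw [LinearIsometryEquiv.inner_map_map]
  have : u = 0 := by
    rw [← Orthonormal.sum_inner_smul h.orthonormal h.span u]
    simp [hx]
  rw [this, inner_zero_left] at hu1
  norm_num at hu1

theorem sgn_eq (b : Bool) : sgn b = 1 ∨ sgn b = -1 := by cases b <;> simp [sgn]

theorem false_of_signed_refl_mul [FiniteDimensional ℝ V] (h : E8Frame Φ f) {w : V ≃ₗᵢ[ℝ] V}
    (hw : Critical Φ w) {σ : Equiv.Perm (Fin 8)} {b : Fin 8 → Bool}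
    (ht : ∀ k, (refl ((1 / 2 : ℝ) • ∑ i, f i) * w) (f k) = (sgn (b k) : ℝ) • f (σ k)) : False := by
  have hα := h.half_sum_mem
  rcases exists_normal_form σ b
    (h.sum_signs hw.isRoot (mul_mem (refl_mem_weyl hα) hw.mem) ht) with hsym | ⟨π, hπ⟩
  · obtain ⟨u, hu, hfix, hrev⟩ := exists_weyl_reversing h.orthonormal h.sub_mem
      (t := fun k => (sgn (b k) : ℝ)) (fun i => by rcases sgn_eq (b i) with h | h <;> simp [h]) ht
      (fun i => (hsym i).imp fun j hj k => by simp only [hj k])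
    refine hw.false_of_refl_mul hα hu (hfix _ fun i j => ?_) h.span
      (by rintro _ ⟨i, rfl⟩; exact hrev i)
    rw [inner_sub_left, h.inner_half_sum_one, h.inner_half_sum_one, sub_self]
  have hp := h.perm π
  have hsum : ∑ i, f (π i) = ∑ i, f i := Equiv.sum_comp π f
  have ht' : ∀ k, (refl ((1 / 2 : ℝ) • ∑ i, f (π i)) * w) (f (π k)) =
      (sgn (b (π k)) : ℝ) • f (σ (π k)) := fun k => by rw [hsum]; exact ht _
  have hmat : ∀ (c : Fin 8 → Fin 8) (t : Fin 8 → Bool), (∀ k, σ (π k) = π (c k)) →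
      (∀ k, b (π k) = t k) → ∀ k, (refl ((1 / 2 : ℝ) • ∑ i, f (π i)) * w) (f (π k)) =
        (sgn (t k) : ℝ) • f (π (c k)) := fun c t h1 h2 k => by rw [ht', h1, h2]
  rcases hπ with ⟨hc, hb | hb | hb | hb⟩ | ⟨hc, hb⟩ | ⟨hc, hb | hb⟩ | ⟨hc, hb, hne⟩
  · exact hp.false_of_matrix hw (t := fun k => sgn (_ : Bool)) (hmat _ _ hc hb)
      ![![2, 2, 0, 0, 0, 0, 0, 0], ![0, 0, 2, -2, 0, 0, 0, 0], ![0, 0, 0, 0, 0, 2, 0, -2],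
        ![1, -1, -1, -1, 1, -1, -1, -1]] (by decide +kernel) (by decide +kernel) (by decide +kernel)
  · exact hp.false_of_matrix hw (t := fun k => sgn (_ : Bool)) (hmat _ _ hc hb)
      ![![2, 2, 0, 0, 0, 0, 0, 0], ![0, 0, 0, 0, 2, 0, 0, 2], ![0, 0, 0, 0, 0, 2, -2, 0],
        ![1, -1, 1, 1, 1, -1, -1, -1]] (by decide +kernel) (by decide +kernel) (by decide +kernel)
  · exact hp.false_of_matrix hw (t := fun k => sgn (_ : Bool)) (hmat _ _ hc hb)
      ![![2, 2, 0, 0, 0, 0, 0, 0], ![0, 0, 2, 0, 2, 0, 0, 0], ![0, 0, 0, 0, 0, 2, 0, -2],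
        ![1, -1, 1, -1, -1, -1, -1, -1]] (by decide +kernel) (by decide +kernel) (by decide +kernel)
  · exact hp.false_of_matrix hw (t := fun k => sgn (_ : Bool)) (hmat _ _ hc hb)
      ![![2, -2, 0, 0, 0, 0, 0, 0], ![0, 0, 2, 0, 0, 0, 0, 2], ![0, 0, 0, 2, -2, 0, 0, 0],
        ![1, 1, 1, 1, 1, -1, 1, -1]] (by decide +kernel) (by decide +kernel) (by decide +kernel)
  · have hbp : (sgn (b (π 0)) * sgn (b (π 1)) * sgn (b (π 2)) * sgn (b (π 3)) * sgn (b (π 4)) *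
        sgn (b (π 5)) * sgn (b (π 6)) * sgn (b (π 7)) : ℝ) = 1 := by
      rw [Fin.prod_univ_eight] at hb
      exact_mod_cast hb
    rcases hb7 : b (π 7) with _ | _
    · refine hp.false_of_normal_form hw (c := ![1, 2, 3, 4, 5, 6, 0, 7]) (t := fun k => sgn (b (π k)))
        (fun k => sgn_eq _) (fun k => by rw [ht', hc]) fun x hx => ?_
      have hb' : (sgn (b (π 0)) * sgn (b (π 1)) * sgn (b (π 2)) * sgn (b (π 3)) * sgn (b (π 4)) *
          sgn (b (π 5)) * sgn (b (π 6)) : ℝ) = -1 := by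
        have : sgn (b (π 7)) = -1 := by rw [hb7]; rfl
        rw [this] at hbp
        push_cast at hbp
        linarith
      have h7 : (sgn (b (π 7)) : ℝ) = -1 := by rw [hb7]; simp [sgn]
      have e := fun k : Fin 8 => hx k
      have e0 : x 1 = _ := e 0
      have e1 : x 2 = _ := e 1
      have e2 : x 3 = _ := e 2
      have e3 : x 4 = _ := e 3
      have e4 : x 5 = _ := e 4
      have e5 : x 6 = _ := e 5
      have e6 : x 0 = _ := e 6
      have e7 : x 7 = _ := e 7
      have h0 : x 0 = 0 := by
        rw [e5, e4, e3, e2, e1, e0] at e6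
        linear_combination (e6 + x 0 * hb') / 2
      have h1 : x 7 = 0 := by rw [h7] at e7; linarith
      rw [h0, mul_zero] at e0
      rw [e0, mul_zero] at e1
      rw [e1, mul_zero] at e2
      rw [e2, mul_zero] at e3
      rw [e3, mul_zero] at e4
      rw [e4, mul_zero] at e5
      intro k
      fin_cases k <;> assumption
    · have h7 : (sgn (b (π 7)) : ℝ) = 1 := by rw [hb7]; simp [sgn]
      rw [h7, mul_one] at hbp
      obtain ⟨w', hw'⟩ : ∃ w', w' = refl ((1 / 2 : ℝ) • ∑ i, f (π i)) * w := ⟨_, rfl⟩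
      obtain ⟨t, hts⟩ : ∃ t : Fin 8 → ℝ, t = fun k => (sgn (b (π k)) : ℝ) := ⟨_, rfl⟩
      have hw2 : ∀ k, w' (f (π k)) = t k • f (σ (π k)) := fun k => by rw [hw', hts, ht']
      replace hbp : t 0 * t 1 * t 2 * t 3 * t 4 * t 5 * t 6 = 1 := by rw [hts]; exact hbp
      replace h7 : t 7 = 1 := by rw [hts]; exact h7
      have ht2 : ∀ k, t k * t k = 1 := fun k => by
        rw [hts]; rcases sgn_eq (b (π k)) with h | h <;> simp [h]
      obtain ⟨x, hx⟩ : ∃ x : V, x = f (π 0) + t 0 • f (π 1) + (t 0 * t 1) • f (π 2) +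
        (t 0 * t 1 * t 2) • f (π 3) + (t 0 * t 1 * t 2 * t 3) • f (π 4) +
        (t 0 * t 1 * t 2 * t 3 * t 4) • f (π 5) +
        (t 0 * t 1 * t 2 * t 3 * t 4 * t 5) • f (π 6) := ⟨_, rfl⟩
      have hwx : w' x = x := by
        rw [hx]
        simp only [map_add, map_smul, hw2, hc]
        simp only [Matrix.cons_val, smul_smul]
        linear_combination (norm := module) hbp • f (π 0)
      have hwy : w' (f (π 7)) = f (π 7) := by
        rw [hw2, hc, h7, one_smul]; rfl
      have hα' := hp.half_sum_mem
      have hz := hw.eq_zero_of_refl_mul_fixed hα'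
        (x := x - (2 * ⟪(1 / 2 : ℝ) • ∑ i, f (π i), x⟫) • f (π 7))
        (by rw [← hw', map_sub, map_smul, hwx, hwy])
        (by rw [inner_sub_right, inner_smul_right, real_inner_comm, real_inner_comm (f (π 7)),
          hp.inner_half_sum_one 7]; ring)
      have hi0 : ∀ k, k ≠ 0 → ⟪f (π 0), f (π k)⟫ = 0 := fun k hk => hp.inner_ne hk.symm
      have := congrArg (⟪f (π 0), ·⟫) hz
      simp only [hx, inner_sub_right, inner_add_right, inner_smul_right, inner_zero_right,
        hp.inner_self 0, hi0 1 (by decide), hi0 2 (by decide), hi0 3 (by decide), hi0 4 (by decide),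
        hi0 5 (by decide), hi0 6 (by decide), hi0 7 (by decide)] at this
      norm_num at this
  · exact hp.false_of_matrix hw (t := fun k => sgn (_ : Bool)) (hmat _ _ hc hb)
      ![![2, 2, 0, 0, 0, 0, 0, 0], ![0, 0, 2, -2, 0, 0, 0, 0], ![1, -1, 1, 1, -1, -1, -1, 1],
        ![1, -1, -1, -1, 1, -1, -1, -1]] (by decide +kernel) (by decide +kernel) (by decide +kernel)
  · exact hp.false_of_matrix hw (t := fun k => sgn (_ : Bool)) (hmat _ _ hc hb)
      ![![2, 2, 0, 0, 0, 0, 0, 0], ![0, 0, 2, 0, 0, 0, -2, 0], ![0, 0, 0, 2, 0, 2, 0, 0],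
        ![1, -1, 1, 1, -1, -1, 1, -1]] (by decide +kernel) (by decide +kernel) (by decide +kernel)
  · refine hp.false_of_normal_form hw (c := ![1, 2, 3, 4, 5, 0, 7, 6]) (t := fun k => sgn (b (π k)))
      (fun k => sgn_eq _) (fun k => by rw [ht', hc]) fun x hx => ?_
    have e0 : x 1 = _ := hx 0
    have e1 : x 2 = _ := hx 1
    have e2 : x 3 = _ := hx 2
    have e3 : x 4 = _ := hx 3
    have e4 : x 5 = _ := hx 4
    have e5 : x 0 = _ := hx 5
    have e6 : x 7 = _ := hx 6
    have e7 : x 6 = _ := hx 7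
    have hb' : (sgn (b (π 0)) * sgn (b (π 1)) * sgn (b (π 2)) * sgn (b (π 3)) * sgn (b (π 4)) *
        sgn (b (π 5)) : ℝ) = -1 := by
      rcases hb with hb | hb <;>
      · have b0 : b (π 0) = _ := hb 0
        have b1 : b (π 1) = _ := hb 1
        have b2 : b (π 2) = _ := hb 2
        have b3 : b (π 3) = _ := hb 3
        have b4 : b (π 4) = _ := hb 4
        have b5 : b (π 5) = _ := hb 5
        rw [b0, b1, b2, b3, b4, b5]
        simp [sgn]
    have h0 : x 0 = 0 := by
      rw [e4, e3, e2, e1, e0] at e5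
      linear_combination (e5 + x 0 * hb') / 2
    have h67 : (sgn (b (π 6)) * sgn (b (π 7)) : ℝ) = -1 := by
      revert hne
      cases b (π 6) <;> cases b (π 7) <;> simp [sgn]
    have h6 : x 6 = 0 := by
      rw [e6] at e7
      linear_combination (e7 + x 6 * h67) / 2
    rw [h0, mul_zero] at e0
    rw [e0, mul_zero] at e1
    rw [e1, mul_zero] at e2
    rw [e2, mul_zero] at e3
    rw [e3, mul_zero] at e4
    rw [h6, mul_zero] at e6
    intro k
    fin_cases k <;> assumption
end E8Frame

end

section

variable {V : Type*} [NormedAddCommGroup V] [InnerProductSpace ℝ V]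
namespace E8Frame
variable {Φ : Set V} {f : Fin 8 → V} {w : V ≃ₗᵢ[ℝ] V}

theorem false_of_one (h : E8Frame Φ f) (hw : Critical Φ w) {j k : Fin 8}
    (hj : w (f j) = f k ∨ w (f j) = -f k) : False :=
  hw.false_of_signed h.toFrame h.span (h.signed_of_one hw.isRoot hw.mem hj)

theorem inner_two_smul_self (h : E8Frame Φ f) (j : Fin 8) : ⟪(2 : ℝ) • f j, (2 : ℝ) • f j⟫ = 4 := by
  rw [real_inner_smul_left, real_inner_smul_right, h.inner_self]; norm_num

theorem false_of_congr (h : E8Frame Φ f) (hw : Critical Φ w) {j k : Fin 8} {s : ℝ}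
    (hs : s = 1 ∨ s = -1) {r : V} (hr : r ∈ dualLattice Φ)
    (he : w ((2 : ℝ) • f j) = (2 * s) • f k + (2 : ℝ) • r) : False := by
  obtain ⟨i, hi⟩ := h.eq_of_congr (by rw [w.inner_map_map, h.inner_two_smul_self]) hs hr he
  refine h.false_of_one hw (j := j) (k := i) ?_
  rw [map_smul] at hi
  refine hi.imp (fun h => ?_) (fun h => ?_)
  · exact smul_right_injective V (two_ne_zero (α := ℝ)) h
  · refine smul_right_injective V (two_ne_zero (α := ℝ)) ?_
    simp only [h]
    module

theorem exists_root_of_three (h : E8Frame Φ f) (hΦ : IsRoot Φ) {y : V} (hy : y ∈ dualLattice Φ) (hy4 : ⟪y, y⟫ = 4)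
    {m : Fin 8 → ℤ} (hm : ∀ i, ⟪f i, y⟫ = m i / 2) {k : Fin 8} (hk : m k = 3 ∨ m k = -3)
    (hi : ∀ i, i ≠ k → m i = 1 ∨ m i = -1) : ∃ α ∈ Φ, ∃ s : ℝ, (s = 1 ∨ s = -1) ∧
      (∀ i, ⟪f i, α⟫ = 1 / 2 ∨ ⟪f i, α⟫ = -1 / 2) ∧ refl α y = (2 * s) • f k := by
  obtain ⟨s, hs, hks⟩ : ∃ s : ℝ, (s = 1 ∨ s = -1) ∧ (m k : ℝ) = 3 * s := by
    rcases hk with hk | hk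
    · exact ⟨1, by simp, by rw [hk]; norm_num⟩
    · exact ⟨-1, by simp, by rw [hk]; norm_num⟩
  have hss : s * s = 1 := by rcases hs with rfl | rfl <;> norm_num
  have hmem : (2 * s) • f k ∈ dualLattice Φ := by
    rcases hs with rfl | rfl
    · simpa using h.two_smul_mem_dualLattice k
    · have := neg_mem (h.two_smul_mem_dualLattice k)
      rw [← neg_smul] at this
      simpa using this
  have hcoord : ∀ i, ⟪f i, (2 * s) • f k - y⟫ = 1 / 2 ∨ ⟪f i, (2 * s) • f k - y⟫ = -1 / 2 := by
    intro i
    rw [inner_sub_right, inner_smul_right, hm]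
    rcases eq_or_ne i k with rfl | hik
    · rw [h.inner_self, hks]
      rcases hs with rfl | rfl <;> norm_num
    · rw [h.inner_ne hik]
      rcases hi i hik with h | h <;> rw [h] <;> norm_num
  have hα := h.mem_of_coord (sub_mem hmem hy) hcoord
  refine ⟨_, hα, s, hs, hcoord, ?_⟩
  have h1 : ⟪(2 * s) • f k - y, y⟫ = -1 := by
    rw [inner_sub_left, hy4, real_inner_smul_left, hm, hks]
    linear_combination 3 * hss
  rw [refl_apply (hΦ.norm _ hα), h1]
  module

theorem exists_signs_eq (h : E8Frame Φ f) (hΦ : IsRoot Φ) {α : V} (hα : α ∈ Φ)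
    (hc : ∀ i, ⟪f i, α⟫ = 1 / 2 ∨ ⟪f i, α⟫ = -1 / 2) :
    ∃ e : Fin 8 → ℝ, (∀ i, e i = 1 ∨ e i = -1) ∧ E8Frame Φ (fun i => e i • f i) ∧
      α = (1 / 2 : ℝ) • ∑ i, e i • f i := by
  obtain ⟨m, hm, -, -, h4⟩ := h.exists_coord (h.root_mem_dualLattice hα)
  have hm1 : ∀ i, m i = 1 ∨ m i = -1 := fun i => by
    have := hc i
    rw [hm] at this
    rcases this with h | h
    · exact Or.inl (by exact_mod_cast (by linarith : (m i : ℝ) = 1))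
    · exact Or.inr (by exact_mod_cast (by linarith : (m i : ℝ) = -1))
  have hp : ∏ i, m i = 1 := prod_eq_one_of_sum hm1 (by simpa using h4 1 (by simp) (by simp))
  have he : ∀ i, (m i : ℝ) = 1 ∨ (m i : ℝ) = -1 := fun i =>
    (hm1 i).imp (fun h => by simp [h]) (fun h => by simp [h])
  refine ⟨fun i => m i, he, h.signs hΦ he (by exact_mod_cast hp), ?_⟩
  rw [Finset.smul_sum]
  conv_lhs => rw [← Orthonormal.sum_inner_smul h.orthonormal h.span α]
  refine Finset.sum_congr rfl fun i _ => ?_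
  rw [hm, smul_smul]
  ring_nf

theorem false_of_three [FiniteDimensional ℝ V] (h : E8Frame Φ f) (hw : Critical Φ w) {j : Fin 8}
    {m : Fin 8 → ℤ} (hm : ∀ i, ⟪f i, w ((2 : ℝ) • f j)⟫ = m i / 2) {k : Fin 8}
    (hk : m k = 3 ∨ m k = -3) (hi : ∀ i, i ≠ k → m i = 1 ∨ m i = -1) : False := by
  obtain ⟨α, hα, s, hs, hc, hr⟩ := h.exists_root_of_three hw.isRoot
    (map_mem_dualLattice hw.isRoot hw.mem (h.two_smul_mem_dualLattice j))
    (by rw [w.inner_map_map, h.inner_two_smul_self]) hm hk hi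
  have hj : (refl α * w) (f j) = f k ∨ (refl α * w) (f j) = -f k := by
    rw [map_smul, map_smul, mul_smul] at hr
    have := smul_right_injective V (two_ne_zero (α := ℝ)) hr
    rw [mul_apply, this]
    rcases hs with rfl | rfl
    · exact Or.inl (one_smul _ _)
    · exact Or.inr (by rw [neg_smul, one_smul])
  obtain ⟨σ, t, ht, hσ⟩ := exists_perm_of_signed h.orthonormal
    (h.signed_of_one hw.isRoot (mul_mem (refl_mem_weyl hα) hw.mem) hj)
  obtain ⟨e, he, hf, rfl⟩ := h.exists_signs_eq hw.isRoot hα hc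
  have hee : ∀ i, e i * e i = 1 := fun i => by rcases he i with h | h <;> rw [h] <;> norm_num
  refine hf.false_of_signed_refl_mul hw (σ := σ) (b := fun i => decide (e i * t i * e (σ i) = 1))
    fun i => ?_
  have hb : (sgn (decide (e i * t i * e (σ i) = 1)) : ℝ) = e i * t i * e (σ i) := by
    rcases he i with h | h <;> rcases ht i with h' | h' <;> rcases he (σ i) with h2 | h2 <;>
      rw [h, h', h2] <;> norm_num [sgn]
  rw [hb, map_smul, hσ, smul_smul, smul_smul, mul_assoc, hee, mul_one]

theorem exists_eq_of_three (h : E8Frame Φ f) (hΦ : IsRoot Φ) {y : V} (hy : y ∈ dualLattice Φ)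
    (hy4 : ⟪y, y⟫ = 4)
    {m : Fin 8 → ℤ} (hm : ∀ i, ⟪f i, y⟫ = m i / 2) {k : Fin 8} (hk : m k = 3 ∨ m k = -3)
    (hi : ∀ i, i ≠ k → m i = 1 ∨ m i = -1) :
    ∃ g : Fin 8 → V, E8Frame Φ g ∧ ∃ k, ∃ s : ℝ, (s = 1 ∨ s = -1) ∧ y = (2 * s) • g k := by
  obtain ⟨α, hα, s, hs, -, hr⟩ := h.exists_root_of_three hΦ hy hy4 hm hk hi
  refine ⟨_, h.map hΦ (refl_mem_weyl hα), k, s, hs, ?_⟩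
  rw [← map_smul, ← hr, refl_refl]

theorem exists_signs_sum_eq {m : Fin 8 → ℤ} (hm : ∀ i, m i = 0 ∨ m i = 2 ∨ m i = -2)
    (hsum : ∑ i, m i ^ 2 = 16) : ∃ e : Fin 8 → ℤ, (∀ i, e i = 1 ∨ e i = -1) ∧ ∏ i, e i = 1 ∧
      ∑ i, e i * m i = 4 := by
  have h0 : ∃ i, m i = 0 := by
    by_contra! hcon
    have : ∀ i, m i ^ 2 = 4 := fun i => by
      rcases (hm i).resolve_left (hcon i) with h | h <;> rw [h] <;> norm_num
    simp [this] at hsum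
  have h1 : ∃ i, m i ≠ 0 := by
    by_contra! hcon
    simp [hcon] at hsum
  obtain ⟨p, hp⟩ := h0
  obtain ⟨q, hq⟩ := h1
  have hpq : p ≠ q := fun h => hq (h ▸ hp)
  obtain ⟨e, he⟩ : ∃ e : Fin 8 → ℤ, e = fun i => if m i = -2 then -1 else 1 := ⟨_, rfl⟩
  have he1 : ∀ i, e i = 1 ∨ e i = -1 := fun i => by rw [he]; dsimp only; split_ifs <;> simp
  have hem : ∀ i, 2 * (e i * m i) = m i ^ 2 := fun i => by
    rw [he]; rcases hm i with h | h | h <;> simp [h]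
  have hs : ∑ i, e i * m i = 8 := by
    have : 2 * ∑ i, e i * m i = 16 := by rw [← hsum, Finset.mul_sum]; simp only [hem]
    linarith
  obtain ⟨z, hz, hz'⟩ : ∃ z : ℤ, (z = 1 ∨ z = -1) ∧ z * -1 * ∏ i, e i = 1 := by
    have : ∏ i, e i = 1 ∨ ∏ i, e i = -1 := by
      refine Finset.prod_induction _ (fun x => x = 1 ∨ x = -1) ?_ (by simp) fun i _ => he1 i
      rintro a b (rfl | rfl) (rfl | rfl) <;> simp
    rcases this with h | h
    · exact ⟨-1, by simp [h]⟩
    · exact ⟨1, by simp [h]⟩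
  refine ⟨fun i => (if i = p then z else 1) * (if i = q then -1 else 1) * e i, fun i => ?_, ?_, ?_⟩
  · rcases he1 i with h | h <;> rcases hz with h' | h' <;> dsimp only <;> split_ifs <;> simp [h, h']
  · rw [Finset.prod_mul_distrib, Finset.prod_mul_distrib, Finset.prod_ite_eq', Finset.prod_ite_eq']
    simpa using hz'
  · have : ∀ i, (if i = p then z else 1) * (if i = q then -1 else 1) * e i * m i =
        e i * m i - if i = q then m i ^ 2 else 0 := fun i => by
      rw [← hem]
      rcases eq_or_ne i p with rfl | hip
      · simp [hp]
      · rw [if_neg hip]; split_ifs <;> ring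
    simp only [this]
    rw [Finset.sum_sub_distrib, hs, Finset.sum_ite_eq' Finset.univ q]
    rcases (hm q).resolve_left hq with h | h <;> simp [h]

theorem exists_eq_smul (h : E8Frame Φ f) (hΦ : IsRoot Φ) {y : V} (hy : y ∈ dualLattice Φ)
    (hy4 : ⟪y, y⟫ = 4) :
    ∃ g : Fin 8 → V, E8Frame Φ g ∧ ∃ k, ∃ s : ℝ, (s = 1 ∨ s = -1) ∧ y = (2 * s) • g k := by
  obtain ⟨m, hm, hpar, hsum, -⟩ := h.exists_coord hy
  have hs : ∑ i, m i ^ 2 = 16 := by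
    have : ((∑ i, m i ^ 2 : ℤ) : ℝ) = 16 := by rw [hsum, hy4]; norm_num
    exact_mod_cast this
  rcases coord_cases hpar hs with ⟨k, hk, hi⟩ | h2 | ⟨k, hk, hi⟩
  · refine ⟨f, h, k, m k / 4, ?_, ?_⟩
    · rcases hk with h | h <;> rw [h] <;> norm_num
    · conv_lhs => rw [← Orthonormal.sum_inner_smul h.orthonormal h.span y]
      rw [Finset.sum_eq_single k (fun i _ hik => by rw [hm, hi i hik]; simp) (by simp), hm]
      ring_nf
  · obtain ⟨e, he, hp, hem⟩ := exists_signs_sum_eq h2 hs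
    have hβ := h.spin (fun i => e i) (fun i => (he i).imp (fun h => by simp [h]) fun h => by simp [h])
      (by exact_mod_cast hp)
    obtain ⟨β, hβe⟩ : ∃ β, β = (1 / 2 : ℝ) • ∑ i, (e i : ℝ) • f i := ⟨_, rfl⟩
    rw [← hβe] at hβ
    have hβy : ⟪β, y⟫ = 1 := by
      rw [hβe, real_inner_smul_left, sum_inner]
      simp only [real_inner_smul_left, hm]
      have : ((∑ i, e i * m i : ℤ) : ℝ) = 4 := by rw [hem]; norm_num
      push_cast at this
      rw [show ∑ i, (e i : ℝ) * ((m i : ℝ) / 2) = (∑ i, (e i : ℝ) * m i) / 2 by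
        rw [Finset.sum_div]; exact Finset.sum_congr rfl fun i _ => by ring, this]
      norm_num
    have hy' := map_mem_dualLattice hΦ (refl_mem_weyl hβ) hy
    have hy4' : ⟪refl β y, refl β y⟫ = 4 := by rw [LinearIsometryEquiv.inner_map_map, hy4]
    obtain ⟨m', hm', hpar', hsum', -⟩ := h.exists_coord hy'
    have hs' : ∑ i, m' i ^ 2 = 16 := by
      have : ((∑ i, m' i ^ 2 : ℤ) : ℝ) = 16 := by rw [hsum', hy4']; norm_num
      exact_mod_cast this
    have hmm : ∀ i, m' i = m i - e i := fun i => by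
      have h1 := hm' i
      rw [refl_apply (hΦ.norm _ hβ), hβy, one_smul, inner_sub_right, hm,
        real_inner_comm β (f i), hβe, h.inner_half_sum] at h1
      exact_mod_cast (by linarith : (m' i : ℝ) = m i - e i)
    have hodd : ∀ i, m' i % 2 = 1 := fun i => by
      rw [hmm]
      rcases he i with h | h <;> rcases h2 i with h' | h' | h' <;> rw [h, h'] <;> rfl
    rcases coord_cases hpar' hs' with ⟨k, hk, -⟩ | h3 | ⟨k, hk, hi⟩
    · have := hodd k
      rcases hk with h | h <;> rw [h] at this <;> norm_num at this
    · have := hodd 0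
      rcases h3 0 with h | h | h <;> rw [h] at this <;> norm_num at this
    · obtain ⟨g, hg, k, s, hs, hgy⟩ := h.exists_eq_of_three hΦ hy' hy4' hm' hk hi
      refine ⟨_, hg.map hΦ (refl_mem_weyl hβ), k, s, hs, ?_⟩
      rw [← map_smul, ← hgy, refl_refl]
  · exact h.exists_eq_of_three hΦ hy hy4 hm hk hi

theorem even_inner_map [FiniteDimensional ℝ V] (h : E8Frame Φ f) (hw : Critical Φ w) {y : V}
    (hy : y ∈ dualLattice Φ) (hy4 : ⟪y, y⟫ = 4) : ∃ n : ℤ, ⟪y, w y⟫ = 2 * n := by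
  obtain ⟨g, hg, k, s, hs, rfl⟩ := h.exists_eq_smul hw.isRoot hy hy4
  have hx := map_mem_dualLattice hw.isRoot hw.mem (hg.two_smul_mem_dualLattice k)
  obtain ⟨m, hm, hpar, hsum, -⟩ := hg.exists_coord hx
  have hs' : ∑ i, m i ^ 2 = 16 := by
    have : ((∑ i, m i ^ 2 : ℤ) : ℝ) = 16 := by
      rw [hsum, w.inner_map_map, hg.inner_two_smul_self]; norm_num
    exact_mod_cast this
  have hss : s * s = 1 := by rcases hs with rfl | rfl <;> norm_num
  have hval : ⟪(2 * s) • g k, w ((2 * s) • g k)⟫ = m k := by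
    have := hm k
    rw [map_smul, inner_smul_right] at this
    rw [map_smul, inner_smul_right, real_inner_smul_left]
    linear_combination 2 * this + (4 * ⟪g k, w (g k)⟫) * hss
  have : 2 ∣ m k := by
    rcases coord_cases hpar hs' with ⟨l, hl, hi⟩ | h2 | ⟨l, hl, hi⟩
    · rcases eq_or_ne k l with rfl | hkl
      · rcases hl with h | h <;> rw [h] <;> norm_num
      · rw [hi k hkl]; norm_num
    · rcases h2 k with h | h | h <;> rw [h] <;> norm_num
    · exact (hg.false_of_three hw hm hl hi).elim
  obtain ⟨n, hn⟩ := this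
  exact ⟨n, by rw [hval, hn]; push_cast; rfl⟩
end E8Frame

end

section

variable {V : Type*} [NormedAddCommGroup V] [InnerProductSpace ℝ V]
namespace E8Frame
variable {Φ : Set V} {f : Fin 8 → V} {w : V ≃ₗᵢ[ℝ] V}

theorem exists_three_eq {m : Fin 8 → ℤ} (hpar : ∀ i j, m i % 2 = m j % 2) (hsum : ∑ i, m i ^ 2 = 8) :
    ∃ i j k : Fin 8, i ≠ j ∧ i ≠ k ∧ j ≠ k ∧ m i = m j ∧ m j = m k ∧
      (i ≠ 0 ∧ i ≠ 1) ∧ (j ≠ 0 ∧ j ≠ 1) ∧ k ≠ 0 ∧ k ≠ 1 := by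
  have key : ∀ p : Fin 5 → Bool, ∃ i j k : Fin 5, i ≠ j ∧ i ≠ k ∧ j ≠ k ∧ p i = p j ∧ p j = p k := by
    decide +kernel
  obtain ⟨ι, hι, hι01⟩ : ∃ ι : Fin 5 → Fin 8, Function.Injective ι ∧ ∀ i, ι i ≠ 0 ∧ ι i ≠ 1 :=
    ⟨![2, 3, 4, 5, 6], by decide, by decide⟩
  suffices ∃ i j k : Fin 5, i ≠ j ∧ i ≠ k ∧ j ≠ k ∧ m (ι i) = m (ι j) ∧ m (ι j) = m (ι k) by
    obtain ⟨i, j, k, hij, hik, hjk, h1, h2⟩ := this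
    exact ⟨ι i, ι j, ι k, hι.ne hij, hι.ne hik, hι.ne hjk, h1, h2, hι01 i, hι01 j, hι01 k⟩
  rcases Int.emod_two_eq_zero_or_one (m 0) with h0 | h0
  · have heven : ∀ i, m i = 0 ∨ 4 ≤ m i ^ 2 := fun i => by
      have := hpar i 0
      rw [or_iff_not_imp_left]
      intro h
      rcases (by omega : 2 ≤ m i ∨ m i ≤ -2) with h | h <;> nlinarith
    obtain ⟨i, j, k, hij, hik, hjk, h1, h2⟩ := key fun i => decide (m (ι i) = 0)
    simp only [decide_eq_decide] at h1 h2
    refine ⟨i, j, k, hij, hik, hjk, ?_⟩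
    by_cases hi : m (ι i) = 0
    · rw [hi, h1.1 hi, h2.1 (h1.1 hi)]
      exact ⟨rfl, rfl⟩
    · have hle : ∑ l ∈ {ι i, ι j, ι k}, m l ^ 2 ≤ ∑ l, m l ^ 2 :=
        Finset.sum_le_univ_sum_of_nonneg fun _ => sq_nonneg _
      rw [Finset.sum_insert (by simp [hι.ne hij, hι.ne hik]), Finset.sum_pair (hι.ne hjk)] at hle
      have e1 := (heven _).resolve_left hi
      have e2 := (heven _).resolve_left fun h => hi (h1.2 h)
      have e3 := (heven _).resolve_left fun h => hi (h1.2 (h2.2 h))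
      omega
  · have hodd : ∀ i, 1 ≤ m i ^ 2 := fun i => by
      have := hpar i 0
      rcases (by omega : 1 ≤ m i ∨ m i ≤ -1) with h | h <;> nlinarith
    have hone : ∀ i, m i = 1 ∨ m i = -1 := fun i => by
      have h1 : ∑ l ∈ Finset.univ.erase i, (1 : ℤ) ≤ ∑ l ∈ Finset.univ.erase i, m l ^ 2 :=
        Finset.sum_le_sum fun l _ => hodd l
      rw [← Finset.add_sum_erase _ _ (Finset.mem_univ i)] at hsum
      have h2 : ∑ l ∈ Finset.univ.erase i, (1 : ℤ) = 7 := by simp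
      have h3 : (m i - 1) * (m i + 1) = 0 := by
        have := hodd i
        linarith
      rcases mul_eq_zero.1 h3 with h | h <;> omega
    obtain ⟨i, j, k, hij, hik, hjk, h1, h2⟩ := key fun i => decide (m (ι i) = 1)
    simp only [decide_eq_decide] at h1 h2
    have := hone (ι i)
    have := hone (ι j)
    have := hone (ι k)
    exact ⟨i, j, k, hij, hik, hjk, by omega, by omega⟩

theorem even_add [FiniteDimensional ℝ V] (h : E8Frame Φ f) (hw : Critical Φ w) {a b : V}
    (ha : a ∈ Φ) (hb : b ∈ Φ) (hab : ⟪a, b⟫ = 0) :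
    ∃ n : ℤ, ⟪a, w a⟫ + ⟪b, w b⟫ + (⟪a, w b⟫ + ⟪b, w a⟫) = 2 * n := by
  obtain ⟨n, hn⟩ := h.even_inner_map hw
    (add_mem (h.root_mem_dualLattice ha) (h.root_mem_dualLattice hb))
    (by rw [inner_add_left, inner_add_right, inner_add_right, real_inner_comm a b, hab,
      hw.isRoot.norm a ha, hw.isRoot.norm b hb]; norm_num)
  refine ⟨n, ?_⟩
  rw [← hn, map_add]
  simp only [inner_add_left, inner_add_right]
  ring

theorem _root_.RootSet.IsRoot.add_mem {Φ : Set V} (hΦ : IsRoot Φ) {a b : V} (ha : a ∈ Φ) (hb : b ∈ Φ)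
    (hab : ⟪a, b⟫ = -1) : a + b ∈ Φ := by
  have := hΦ.refl_mem a ha b hb
  rw [refl_apply (hΦ.norm a ha), hab] at this
  convert this using 1
  module

theorem even_sub [FiniteDimensional ℝ V] (h : E8Frame Φ f) (hw : Critical Φ w) {b c d : V}
    (hb : b ∈ Φ) (hc : c ∈ Φ) (hd : d ∈ Φ) (hcd : ⟪c, d⟫ = -1) (hbc : ⟪b, c⟫ = 0) (hbd : ⟪b, d⟫ = 0) :
    ∃ n : ℤ, ⟪b, w b⟫ - (⟪c, w d⟫ + ⟪d, w c⟫) = 2 * n := by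
  obtain ⟨n1, h1⟩ := h.even_add hw hb hc hbc
  obtain ⟨n2, h2⟩ := h.even_add hw hb hd hbd
  obtain ⟨n3, h3⟩ := h.even_add hw hb (hw.isRoot.add_mem hc hd hcd)
    (by rw [inner_add_right, hbc, hbd, add_zero])
  obtain ⟨q, hq⟩ := h.gram b hb _ (hw.isRoot.map_mem hw.mem b hb)
  obtain ⟨r, hr⟩ := h.gram c hc _ (hw.isRoot.map_mem hw.mem d hd)
  obtain ⟨s, hs⟩ := h.gram d hd _ (hw.isRoot.map_mem hw.mem c hc)
  refine ⟨n1 + n2 - n3, ?_⟩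
  rw [map_add] at h3
  simp only [inner_add_left, inner_add_right] at h3
  push_cast
  linarith

theorem even_sub_base [FiniteDimensional ℝ V] (h : E8Frame Φ f) (hw : Critical Φ w) {b : V}
    (hb : b ∈ Φ) : ∃ n : ℤ, ⟪b, w b⟫ - ⟪f 0 + f 1, w (f 0 + f 1)⟫ = 2 * n := by
  obtain ⟨m, hm, hpar, hsum, -⟩ := h.exists_coord (h.root_mem_dualLattice hb)
  have hs : ∑ i, m i ^ 2 = 8 := by
    have : ((∑ i, m i ^ 2 : ℤ) : ℝ) = 8 := by rw [hsum, hw.isRoot.norm b hb]; norm_num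
    exact_mod_cast this
  obtain ⟨i, j, k, hij, hik, hjk, hmij, hmjk, ⟨hi0, hi1⟩, ⟨hj0, hj1⟩, hk0, hk1⟩ :=
    exists_three_eq hpar hs
  have hc := h.sub_mem i j hij
  have hd := h.sub_mem j k hjk
  have hcd : ⟪f i - f j, f j - f k⟫ = -1 := by
    simp [inner_sub_left, inner_sub_right, h.inner_ne hij, h.inner_ne hik, h.inner_ne hjk, 
      -inner_self_eq_norm_sq_to_K, h.inner_self]
  obtain ⟨n1, h1⟩ := h.even_sub hw hb hc hd hcd
    (by rw [real_inner_comm, inner_sub_left, hm, hm, hmij, sub_self])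
    (by rw [real_inner_comm, inner_sub_left, hm, hm, hmjk, sub_self])
  obtain ⟨n2, h2⟩ := h.even_sub hw (h.add_mem 0 1 (by decide)) hc hd hcd
    (by simp [inner_sub_right, inner_add_left, h.inner_ne hi0.symm, h.inner_ne hi1.symm,
      h.inner_ne hj0.symm, h.inner_ne hj1.symm])
    (by simp [inner_sub_right, inner_add_left, h.inner_ne hk0.symm, h.inner_ne hk1.symm,
      h.inner_ne hj0.symm, h.inner_ne hj1.symm])
  exact ⟨n1 - n2, by push_cast; linarith⟩

theorem inner_mem (h : E8Frame Φ f) (hΦ : IsRoot Φ) {a b : V} (ha : a ∈ Φ) (hb : b ∈ Φ)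
    (h1 : a ≠ b) (h2 : a ≠ -b) : ⟪a, b⟫ = -1 ∨ ⟪a, b⟫ = 0 ∨ ⟪a, b⟫ = 1 := by
  obtain ⟨n, hn⟩ := h.gram a ha b hb
  have h3 := hΦ.inner_lt_two ha hb h1
  have h4 := hΦ.inner_lt_two ha (hΦ.neg_mem hb) h2
  rw [inner_neg_right] at h4
  rw [hn] at h3 h4 ⊢
  have h5 : n < 2 := by exact_mod_cast h3
  have h6 : -2 < n := by exact_mod_cast (by linarith : (-2 : ℝ) < n)
  obtain rfl | rfl | rfl : n = -1 ∨ n = 0 ∨ n = 1 := by omega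
  all_goals norm_num

theorem even_form [FiniteDimensional ℝ V] (h : E8Frame Φ f) (hw : Critical Φ w) {κ : ℤ}
    (hκ : ∀ a ∈ Φ, ∃ n : ℤ, ⟪a, w a⟫ - κ = 2 * n) {a b : V} (ha : a ∈ Φ) (hb : b ∈ Φ) :
    ∃ n : ℤ, ⟪a, w b⟫ + ⟪b, w a⟫ - κ * ⟪a, b⟫ = 2 * n := by
  have key : ∀ b ∈ Φ, ⟪a, b⟫ = -1 → ∃ n : ℤ, ⟪a, w b⟫ + ⟪b, w a⟫ - κ * ⟪a, b⟫ = 2 * n := by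
    intro b hb hab
    obtain ⟨n1, h1⟩ := hκ a ha
    obtain ⟨n2, h2⟩ := hκ b hb
    obtain ⟨n3, h3⟩ := hκ _ (hw.isRoot.add_mem ha hb hab)
    rw [map_add] at h3
    simp only [inner_add_left, inner_add_right] at h3
    exact ⟨n3 - n1 - n2, by rw [hab]; push_cast; linarith⟩
  obtain ⟨n1, h1⟩ := hκ a ha
  by_cases e1 : a = b
  · subst e1
    exact ⟨2 * n1, by rw [hw.isRoot.norm a ha]; push_cast; linarith⟩
  by_cases e2 : a = -b
  · obtain rfl : b = -a := by rw [e2, neg_neg]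
    refine ⟨-(2 * n1), ?_⟩
    rw [map_neg, inner_neg_right, inner_neg_left, inner_neg_right, hw.isRoot.norm a ha]
    push_cast
    linarith
  rcases h.inner_mem hw.isRoot ha hb e1 e2 with hab | hab | hab
  · exact key b hb hab
  · obtain ⟨n2, h2⟩ := hκ b hb
    obtain ⟨n3, h3⟩ := h.even_add hw ha hb hab
    exact ⟨n3 - n1 - n2 - κ, by rw [hab]; push_cast; linarith⟩
  · obtain ⟨n, hn⟩ := key (-b) (hw.isRoot.neg_mem hb) (by rw [inner_neg_right, hab])
    refine ⟨-n, ?_⟩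
    rw [map_neg, inner_neg_right, inner_neg_left, inner_neg_right] at hn
    push_cast
    linarith

theorem neg_mem_weyl [FiniteDimensional ℝ V] (h : E8Frame Φ f) (hΦ : IsRoot Φ) :
    LinearIsometryEquiv.neg ℝ ∈ weyl Φ := by
  obtain ⟨p, e, hpe, hpp, hee, ho⟩ : ∃ (p : Fin 8 → Fin 8) (e : Fin 8 → ℤ), (∀ i, i ≠ p i) ∧
      (∀ i, p (p i) = i) ∧ (∀ i, (e i = 1 ∨ e i = -1) ∧ e (p i) = -e i) ∧
      ∀ i j, i ≠ j → (if i = j then 1 else 0) + e j * (if i = p j then 1 else 0) +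
        e i * ((if p i = j then 1 else 0) + e j * (if p i = p j then 1 else 0)) = 0 :=
    ⟨![1, 0, 3, 2, 5, 4, 7, 6], ![1, -1, 1, -1, 1, -1, 1, -1], by decide, by decide, by decide,
      by decide +kernel⟩
  have hmem : ∀ i, f i + (e i : ℝ) • f (p i) ∈ Φ := fun i => by
    rcases (hee i).1 with h1 | h1 <;> rw [h1]
    · simpa using h.add_mem _ _ (hpe i)
    · simpa [← sub_eq_add_neg] using h.sub_mem _ _ (hpe i)
  refine neg_mem_weyl_of_family (fun i => f i + (e i : ℝ) • f (p i)) (fun i => hΦ.norm _ (hmem i)) hmem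
    (fun i j hij => ?_) (h.span.trans (Submodule.span_le.2 ?_))
  · have := ho i j hij
    simp only [inner_add_left, inner_add_right, inner_smul_right, real_inner_smul_left, h.inner_eq]
    rw [← Int.cast_inj (α := ℝ)] at this
    push_cast at this
    linear_combination this
  · rintro _ ⟨i, rfl⟩
    have h1 := Submodule.subset_span (R := ℝ)
      (Set.mem_range_self (f := fun i => f i + (e i : ℝ) • f (p i)) i)
    have h2 := Submodule.subset_span (R := ℝ)
      (Set.mem_range_self (f := fun i => f i + (e i : ℝ) • f (p i)) (p i))
    have hss : (e i * e i : ℝ) = 1 := by rcases (hee i).1 with h | h <;> rw [h] <;> norm_num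
    have h3 := Submodule.smul_mem _ (1 / 2 : ℝ) (sub_mem h1 (Submodule.smul_mem _ (e i : ℝ) h2))
    refine (congrArg (· ∈ Submodule.span ℝ _) ?_).mp h3
    simp only [hpp, (hee i).2]
    push_cast
    linear_combination (norm := module) (1 / 2 : ℝ) • congrArg (· • f i) hss

theorem false_of_critical [FiniteDimensional ℝ V] (h : E8Frame Φ f) (hw : Critical Φ w) : False := by
  have ha := h.add_mem 0 1 (by decide)
  obtain ⟨κ, hκ0⟩ := h.gram _ ha _ (hw.isRoot.map_mem hw.mem _ ha)
  have hκ : ∀ a ∈ Φ, ∃ n : ℤ, ⟪a, w a⟫ - κ = 2 * n := fun a ha => hκ0 ▸ h.even_sub_base hw ha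
  generalize f 0 + f 1 = a at ha hκ0
  have hwa := hw.isRoot.map_mem hw.mem a ha
  have hww := hw.isRoot.map_mem hw.mem _ hwa
  have haa := hw.isRoot.norm a ha
  have hlt : ⟪w (w a), a⟫ < 2 := by
    refine hw.isRoot.inner_lt_two hww ha fun he => ?_
    have : a + w a = 0 := hw.eq_zero_of_fixed (by rw [map_add, he, add_comm])
    exact hw.apply_ne_neg ha (eq_neg_of_add_eq_zero_right this)
  have hq : ⟪a, w a⟫ = -1 ∨ ⟪a, w a⟫ = 0 ∨ ⟪a, w a⟫ = 1 :=
    h.inner_mem hw.isRoot ha hwa (fun he => hw.apply_ne_self ha he.symm)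
      fun he => hw.apply_ne_neg ha (by rw [← neg_eq_iff_eq_neg.2 he])
  have key : w (w a) + a = (κ : ℝ) • w a := by
    have hz : (1 / 2 : ℝ) • (w (w a) + a - (κ : ℝ) • w a) = 0 := by
      refine h.eq_zero_of_inner_lt (fun b hb => ?_) ?_
      · have hb' := hw.isRoot.map_mem (inv_mem hw.mem) b hb
        obtain ⟨n, hn⟩ := h.even_form hw hκ ha hb'
        refine ⟨n, ?_⟩
        rw [apply_inv_self] at hn
        rw [real_inner_comm (w a) (w⁻¹ b), inner_inv_right, inner_inv_right] at hn
        rw [real_inner_smul_left, inner_sub_left, inner_add_left, real_inner_smul_left]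
        linarith
      · simp only [real_inner_smul_left, inner_smul_right, inner_sub_left, inner_sub_right,
          inner_add_left, inner_add_right, w.inner_map_map, real_inner_comm (w (w a)) a,
          real_inner_comm a (w a), hκ0, haa]
        nlinarith [sq_nonneg (κ : ℝ)]
    rw [smul_eq_zero_iff_right (by norm_num), sub_eq_zero] at hz
    exact hz
  rw [hκ0] at hq
  obtain hk | hk | hk : κ = -1 ∨ κ = 0 ∨ κ = 1 := by exact_mod_cast hq
  · refine hw.sq_add_ne_zero ha ?_
    rw [hk] at key
    push_cast at key
    linear_combination (norm := module) key
  · rw [hk] at key hκ0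
    push_cast at key hκ0
    rw [zero_smul] at key
    obtain ⟨g, hg, k, s, hs, hv⟩ := h.exists_eq_smul hw.isRoot (y := a - w a)
      (sub_mem (h.root_mem_dualLattice ha) (h.root_mem_dualLattice hwa))
      (by rw [inner_sub_left, inner_sub_right, inner_sub_right, real_inner_comm a (w a), hκ0,
        w.inner_map_map, haa]; norm_num)
    have hwv : w ((2 * s) • g k) = (2 * s) • g k + (2 : ℝ) • w a := by
      rw [← hv, map_sub]
      linear_combination (norm := module) -key
    have hss : s * s = 1 := by rcases hs with rfl | rfl <;> norm_num
    refine hg.false_of_congr hw (j := k) (k := k) (s := 1) (r := s • w a) (Or.inl rfl) ?_ ?_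
    · rcases hs with rfl | rfl
      · rw [one_smul]; exact h.root_mem_dualLattice hwa
      · rw [neg_smul, one_smul]; exact neg_mem (h.root_mem_dualLattice hwa)
    · have := congrArg (s • ·) hwv
      simp only [map_smul, smul_add, smul_smul] at this
      rw [show s * (2 * s) = 2 by linear_combination 2 * hss] at this
      rw [map_smul, this]
      module
  · refine (hw.neg (h.neg_mem_weyl hw.isRoot)).sq_add_ne_zero ha ?_
    rw [hk] at key
    simp only [mul_apply, LinearIsometryEquiv.coe_neg, map_neg, neg_neg]
    push_cast at key
    linear_combination (norm := module) key
end E8Frame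

end

section

variable {V : Type*} [NormedAddCommGroup V] [InnerProductSpace ℝ V]

namespace IsBase
variable {Φ : Set V} {ρ : V} {Δ : Finset V}

theorem map_induction (b : IsBase Φ ρ Δ) (h : IsRoot Φ) {P : V → Prop}
    (hP : ∀ d ∈ Δ, ∀ x, P x → P (refl d x)) {w : V ≃ₗᵢ[ℝ] V} (hw : w ∈ weyl Φ) {x : V} (hx : P x) :
    P (w x) := by
  rw [← b.weyl_eq h] at hw
  exact weyl_induction (p := fun w => P (w x)) hx (fun d hd g _ hg => hP d hd _ hg) hw

theorem root_induction (b : IsBase Φ ρ Δ) (h : IsRoot Φ) {P : V → Prop} (h1 : ∀ d ∈ Δ, P d)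
    (hP : ∀ d ∈ Δ, ∀ x, P x → P (refl d x)) {a : V} (ha : a ∈ Φ) : P a := by
  obtain ⟨g, hg, d, hd, rfl⟩ := b.exists_conj h ha
  rw [b.weyl_eq h] at hg
  exact b.map_induction h hP hg (h1 d hd)

theorem exists_inner_eq [FiniteDimensional ℝ V] (b : IsBase Φ ρ Δ) (c : V → ℝ) :
    ∃ v, ∀ d ∈ Δ, ⟪v, d⟫ = c d := by
  have hli : LinearIndependent ℝ (fun d : ↥(Δ : Set V) => (d : V)) := by
    have := b.linearIndepOn
    exact this
  obtain ⟨φ, hφ⟩ := LinearMap.exists_extend ((Module.Basis.span hli).constr ℝ fun d => c d)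
  refine ⟨(InnerProductSpace.toDual ℝ V).symm (LinearMap.toContinuousLinearMap φ), fun d hd => ?_⟩
  rw [InnerProductSpace.toDual_symm_apply]
  have h2 := LinearMap.congr_fun hφ (Module.Basis.span hli ⟨d, hd⟩)
  rw [Module.Basis.constr_basis, LinearMap.comp_apply, Submodule.subtype_apply,
    Module.Basis.span_apply] at h2
  exact h2

end IsBase

/-- The vectors `a 0, …, a (n - 1)` are roots, where `a 1, …, a (n - 1)` form a simply laced path
and `a 0` is joined to `a p` only, with inner product `-x`. -/
structure Diagram (Φ : Set V) (a : ℕ → V) (n p : ℕ) (x : ℝ) : Prop where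
  mem : ∀ i < n, a i ∈ Φ
  chain : ∀ i, 1 ≤ i → i + 1 < n → ⟪a i, a (i + 1)⟫ = -1
  far : ∀ i j, 1 ≤ i → i + 1 < j → j < n → ⟪a i, a j⟫ = 0
  root : 1 ≤ p → p < n → ⟪a 0, a p⟫ = -x
  root_far : ∀ j, 1 ≤ j → j < n → j ≠ p → ⟪a 0, a j⟫ = 0

/-- The orthonormal vectors attached to a path. -/
def pathFrame (f₀ : V) (a : ℕ → V) : ℕ → V
  | 0 => f₀
  | i + 1 => pathFrame f₀ a i + a (i + 1)

/-- A simply laced path `a 1, …, a (n - 1)` with a vector `f₀` dual to its first element. -/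
structure Path (f₀ : V) (a : ℕ → V) (n : ℕ) : Prop where
  norm : ∀ i, 1 ≤ i → i < n → ⟪a i, a i⟫ = 2
  chain : ∀ i, 1 ≤ i → i + 1 < n → ⟪a i, a (i + 1)⟫ = -1
  far : ∀ i j, 1 ≤ i → i + 1 < j → j < n → ⟪a i, a j⟫ = 0
  first : 1 < n → ⟪f₀, a 1⟫ = -1
  first_far : ∀ j, 1 < j → j < n → ⟪f₀, a j⟫ = 0

namespace Path
variable {f₀ : V} {a : ℕ → V} {n : ℕ}

theorem inner_eq (h : Path f₀ a n) {i j : ℕ} (hi : i < n) (hj : 1 ≤ j) (hjn : j < n) :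
    ⟪pathFrame f₀ a i, a j⟫ = (if i = j then 1 else 0) - if i + 1 = j then 1 else 0 := by
  induction i with
  | zero =>
    rw [pathFrame]
    rcases Nat.lt_or_ge 1 j with h1 | h1
    · rw [h.first_far j h1 hjn, if_neg (by omega), if_neg (by omega), sub_zero]
    · obtain rfl : j = 1 := by omega
      rw [h.first hjn]; norm_num
  | succ i ih =>
    rw [pathFrame, inner_add_left, ih (by omega)]
    rcases lt_trichotomy (i + 1) j with h1 | h1 | h1
    · rcases Nat.lt_or_ge (i + 2) j with h2 | h2
      · rw [h.far _ _ (by omega) (by omega) hjn]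
        split_ifs <;> first | omega | norm_num
      · obtain rfl : j = i + 1 + 1 := by omega
        rw [h.chain _ (by omega) hjn]
        split_ifs <;> first | omega | norm_num
    · subst h1
      rw [h.norm _ (by omega) hjn]
      split_ifs <;> first | omega | norm_num
    · rcases Nat.lt_or_ge j i with h2 | h2
      · rw [real_inner_comm, h.far _ _ hj (by omega) hi]
        split_ifs <;> first | omega | norm_num
      · obtain rfl : i = j := by omega
        rw [real_inner_comm, h.chain _ hj hi]
        split_ifs <;> first | omega | norm_num

theorem inner_frame (h : Path f₀ a n) (h1 : ⟪f₀, f₀⟫ = 1) {i j : ℕ} (hi : i < n) (hj : j < n) :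
    ⟪pathFrame f₀ a i, pathFrame f₀ a j⟫ = if i = j then 1 else 0 := by
  have key : ∀ j, j < n → ∀ i, i ≤ j → ⟪pathFrame f₀ a i, pathFrame f₀ a j⟫ = if i = j then 1 else 0 := by
    intro j
    induction j with
    | zero => intro _ i hi; obtain rfl : i = 0 := by omega
              simpa [pathFrame] using h1
    | succ j ih =>
      intro hj i hi
      rcases Nat.lt_or_ge j i with h2 | h2
      · obtain rfl : i = j + 1 := by omega
        simp only [pathFrame, inner_add_right, inner_add_left]
        rw [ih (by omega) j le_rfl, real_inner_comm (pathFrame f₀ a j) (a (j + 1)),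
          h.inner_eq (by omega) (by omega) hj, h.norm _ (by omega) hj]
        split_ifs <;> first | omega | norm_num
      · rw [pathFrame, inner_add_right, ih (by omega) i h2, h.inner_eq (by omega) (by omega) hj,
          if_neg (show i ≠ j + 1 by omega)]
        split_ifs <;> first | omega | norm_num
  rcases le_total i j with hij | hij
  · exact key j hj i hij
  · rw [real_inner_comm, key i hi j hij]; simp only [eq_comm]

theorem orthonormal (h : Path f₀ a n) (h1 : ⟪f₀, f₀⟫ = 1) :
    Orthonormal ℝ fun i : Fin n => pathFrame f₀ a i := by
  rw [orthonormal_iff_ite]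
  intro i j
  rw [h.inner_frame h1 i.2 j.2]
  simp only [Fin.ext_iff]

theorem refl_apply (h : Path f₀ a n) {j : ℕ} (hj : j + 1 < n) {i : ℕ} (hi : i < n) :
    refl (a (j + 1)) (pathFrame f₀ a i) =
      if i = j then pathFrame f₀ a (j + 1) else if i = j + 1 then pathFrame f₀ a j
        else pathFrame f₀ a i := by
  rw [RootSet.refl_apply (h.norm _ (by omega) hj), real_inner_comm, h.inner_eq hi (by omega) hj]
  split_ifs with h1 h2 h3 h4 h5 h6 <;> first | omega | skip
  · subst h1; simp [pathFrame]
  · subst h6; simp [pathFrame, add_comm]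
  · simp

theorem sub_mem {Φ : Set V} (hΦ : IsRoot Φ) (h : Path f₀ a n) (ha : ∀ i, 1 ≤ i → i < n → a i ∈ Φ)
    {i j : ℕ} (hi : i < n) (hj : j < n) (hij : i ≠ j) :
    pathFrame f₀ a i - pathFrame f₀ a j ∈ Φ := by
  have key : ∀ i, i < n → ∀ j, j < i → pathFrame f₀ a i - pathFrame f₀ a j ∈ Φ := by
    intro i
    induction i with
    | zero => intro _ j hj; omega
    | succ i ih =>
      intro hi j hj
      rcases Nat.lt_or_ge j i with h1 | h1
      · have := hΦ.add_mem (ih (by omega) j h1) (ha (i + 1) (by omega) hi) (by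
          rw [inner_sub_left, h.inner_eq (by omega) (by omega) hi,
            h.inner_eq (by omega) (by omega) hi]
          split_ifs <;> first | omega | norm_num)
        convert this using 1
        rw [pathFrame]; abel
      · obtain rfl : j = i := by omega
        rw [pathFrame, add_sub_cancel_left]
        exact ha _ (by omega) hi
  rcases Nat.lt_or_ge j i with h1 | h1
  · exact key i hi j h1
  · rw [← neg_sub]; exact hΦ.neg_mem (key j hj i (by omega))

theorem frame {Φ : Set V} (hΦ : IsRoot Φ) (h : Path f₀ a n) (ha : ∀ i, 1 ≤ i → i < n → a i ∈ Φ)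
    (h1 : ⟪f₀, f₀⟫ = 1) (h2 : 1 < n) (h01 : f₀ + (f₀ + a 1) ∈ Φ) :
    Frame Φ fun i : Fin n => pathFrame f₀ a i := by
  have hsub : ∀ i j : Fin n, i ≠ j → pathFrame f₀ a i - pathFrame f₀ a j ∈ Φ := fun i j hij =>
    h.sub_mem hΦ ha i.2 j.2 (Fin.val_ne_of_ne hij)
  refine ⟨h.orthonormal h1, fun i j hij => ?_, hsub⟩
  obtain ⟨π, hπ0, hπ1⟩ : ∃ π : Equiv.Perm (Fin n), π ⟨0, by omega⟩ = i ∧ π ⟨1, h2⟩ = j := by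
    have h0 : (⟨0, by omega⟩ : Fin n) ≠ ⟨1, h2⟩ := by simp
    refine ⟨Equiv.swap (Equiv.swap ⟨0, by omega⟩ i ⟨1, h2⟩) j * Equiv.swap ⟨0, by omega⟩ i, ?_, ?_⟩
    · rw [Equiv.Perm.mul_apply, Equiv.swap_apply_left, Equiv.swap_apply_of_ne_of_ne _ hij]
      intro he
      have := congrArg (Equiv.swap ⟨0, by omega⟩ i) he
      rw [Equiv.swap_apply_right, Equiv.swap_apply_self] at this
      exact h0 this
    · rw [Equiv.Perm.mul_apply, Equiv.swap_apply_left]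
  obtain ⟨u, hu, hu1, -⟩ := exists_weyl_perm (h.orthonormal h1) hsub π
  have := hΦ.map_mem hu _ h01
  have e0 := hu1 ⟨0, by omega⟩
  have e1 := hu1 ⟨1, h2⟩
  rw [hπ0] at e0
  rw [hπ1] at e1
  simp only [pathFrame] at e0 e1
  rw [map_add, e0, e1] at this
  exact this

theorem span_le {i : ℕ} (hi : i < n) (h1 : 1 ≤ i) :
    a i ∈ Submodule.span ℝ (Set.range fun i : Fin n => pathFrame f₀ a i) := by
  obtain ⟨i, rfl⟩ : ∃ k, i = k + 1 := ⟨i - 1, by omega⟩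
  have := Submodule.sub_mem _ (Submodule.subset_span (R := ℝ)
    (Set.mem_range_self (f := fun i : Fin n => pathFrame f₀ a i) ⟨i + 1, hi⟩))
    (Submodule.subset_span (R := ℝ)
    (Set.mem_range_self (f := fun i : Fin n => pathFrame f₀ a i) ⟨i, by omega⟩))
  simpa [pathFrame] using this

end Path

end

section

variable {V : Type*} [NormedAddCommGroup V] [InnerProductSpace ℝ V]

theorem IsBase.top_le_span {Φ : Set V} {ρ : V} {Δ : Finset V} {w : V ≃ₗᵢ[ℝ] V}
    (b : IsBase Φ ρ Δ) (h : Critical Φ w) {S : Set V}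
    (hS : ∀ d ∈ Δ, d ∈ Submodule.span ℝ S) : ⊤ ≤ Submodule.span ℝ S := by
  rw [← h.span, ← b.span_eq h.isRoot, Submodule.span_le]
  exact fun d hd => hS d hd

theorem pathFrame_mem_span (f₀ : V) (a : ℕ → V) {n i : ℕ} (hi : i < n) :
    pathFrame f₀ a i ∈ Submodule.span ℝ (Set.range fun i : Fin n => pathFrame f₀ a i) :=
  Submodule.subset_span (Set.mem_range_self (f := fun i : Fin n => pathFrame f₀ a i) ⟨i, hi⟩)

theorem Path.false_of_critical {f₀ : V} {a : ℕ → V} {n : ℕ} {Φ : Set V} {ρ : V} {Δ : Finset V}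
    {w : V ≃ₗᵢ[ℝ] V} (p : Path f₀ a n) (h : Critical Φ w) (b : IsBase Φ ρ Δ)
    (hΔ : ∀ d, d ∈ Δ ↔ ∃ i < n, a i = d) (hn : 1 < n) (h1 : ⟪f₀, f₀⟫ = 1)
    (h01 : f₀ + (f₀ + a 1) ∈ Φ)
    (h0 : a 0 ∈ Submodule.span ℝ (Set.range fun i : Fin n => pathFrame f₀ a i))
    (hr : ∀ i : Fin n, ∃ j : Fin n, refl (a 0) (pathFrame f₀ a i) = pathFrame f₀ a j ∨
      refl (a 0) (pathFrame f₀ a i) = -pathFrame f₀ a j) : False := by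
  have ha : ∀ i, 1 ≤ i → i < n → a i ∈ Φ := fun i _ hi => b.mem _ ((hΔ _).2 ⟨i, hi, rfl⟩)
  refine h.false_of_signed (p.frame h.isRoot ha h1 hn h01) (b.top_le_span h fun d hd => ?_)
    fun i => ?_
  · obtain ⟨i, hi, rfl⟩ := (hΔ d).1 hd
    rcases Nat.eq_zero_or_pos i with rfl | h2
    · exact h0
    · exact Path.span_le hi h2
  · refine b.map_induction h.isRoot
      (P := fun x => ∃ j : Fin n, x = pathFrame f₀ a j ∨ x = -pathFrame f₀ a j) ?_ h.mem
      ⟨i, Or.inl rfl⟩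
    rintro d hd x ⟨j, hj⟩
    have key : ∃ k : Fin n, refl d (pathFrame f₀ a j) = pathFrame f₀ a k ∨
        refl d (pathFrame f₀ a j) = -pathFrame f₀ a k := by
      obtain ⟨i, hi, rfl⟩ := (hΔ d).1 hd
      rcases Nat.eq_zero_or_pos i with rfl | h2
      · exact hr j
      · obtain ⟨i, rfl⟩ : ∃ k, i = k + 1 := ⟨i - 1, by omega⟩
        rw [p.refl_apply hi j.2]
        split_ifs
        exacts [⟨⟨_, hi⟩, Or.inl rfl⟩, ⟨⟨i, by omega⟩, Or.inl rfl⟩, ⟨j, Or.inl rfl⟩]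
    obtain ⟨k, hk⟩ := key
    refine ⟨k, ?_⟩
    rcases hj with rfl | rfl
    · exact hk
    · rw [map_neg]
      rcases hk with hk | hk <;> rw [hk] <;> simp

namespace Diagram
variable {Φ : Set V} {a : ℕ → V} {n p : ℕ} {x : ℝ} {ρ : V} {Δ : Finset V} {w : V ≃ₗᵢ[ℝ] V}

theorem path (D : Diagram Φ a n p x) (h : IsRoot Φ) {f₀ : V} (h1 : 1 < n → ⟪f₀, a 1⟫ = -1)
    (h2 : ∀ j, 1 < j → j < n → ⟪f₀, a j⟫ = 0) : Path f₀ a n :=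
  ⟨fun i _ hi => h.norm _ (D.mem i hi), D.chain, D.far, h1, h2⟩

theorem false_of_sqrt_two (D : Diagram Φ a n 1 √2) (h : Critical Φ w) (b : IsBase Φ ρ Δ)
    (hΔ : ∀ d, d ∈ Δ ↔ ∃ i < n, a i = d) (hn : 1 < n) : False := by
  have hs : √2 * √2 = 2 := Real.mul_self_sqrt (by norm_num)
  have hs0 : √2 ≠ 0 := by positivity
  have ha0 := h.isRoot.norm _ (D.mem 0 (by omega))
  have ha1 := D.root le_rfl hn
  have P : Path ((√2)⁻¹ • a 0) a n := D.path h.isRoot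
    (fun _ => by rw [real_inner_smul_left, ha1]; field_simp)
    (fun j h1 h2 => by rw [real_inner_smul_left, D.root_far j (by omega) h2 (by omega), mul_zero])
  have h1 : ⟪(√2)⁻¹ • a 0, (√2)⁻¹ • a 0⟫ = 1 := by
    rw [real_inner_smul_left, real_inner_smul_right, ha0]; field_simp; linarith
  have he : a 0 = √2 • pathFrame ((√2)⁻¹ • a 0) a 0 := by
    rw [pathFrame, smul_smul, mul_inv_cancel₀ hs0, one_smul]
  refine P.false_of_critical h b hΔ hn h1 ?_ ?_ fun i => ⟨i, ?_⟩
  · have := h.isRoot.refl_mem _ (D.mem 0 (by omega)) _ (D.mem 1 hn)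
    rw [refl_apply ha0, ha1] at this
    convert this using 1
    rw [← add_assoc, ← add_smul, add_comm, neg_smul, sub_neg_eq_add]
    congr 2
    field_simp
    linarith
  · generalize hf : (√2)⁻¹ • a 0 = f₀ at *
    rw [he]
    refine Submodule.smul_mem _ _ ?_
    exact pathFrame_mem_span _ _ (by omega)
  · generalize hf : (√2)⁻¹ • a 0 = f₀ at *
    rw [refl_apply ha0, he, real_inner_smul_left, P.inner_frame h1 (by omega) i.2]
    split_ifs with h3
    · right
      rw [← h3, smul_smul, mul_one, hs, two_smul]; abel
    · left; simp

theorem false_of_fork (D : Diagram Φ a n 2 1) (h : Critical Φ w) (b : IsBase Φ ρ Δ)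
    (hΔ : ∀ d, d ∈ Δ ↔ ∃ i < n, a i = d) (hn : 2 < n) : False := by
  have ha0 := h.isRoot.norm _ (D.mem 0 (by omega))
  have ha1 := h.isRoot.norm _ (D.mem 1 (by omega))
  have h01 := D.root_far 1 le_rfl (by omega) (by omega)
  have P : Path ((1 / 2 : ℝ) • (a 0 - a 1)) a n := D.path h.isRoot
    (fun _ => by rw [real_inner_smul_left, inner_sub_left, h01, ha1]; norm_num)
    (fun j h1 h2 => by
      rw [real_inner_smul_left, inner_sub_left]
      rcases eq_or_ne j 2 with rfl | h3
      · rw [D.root (by omega) h2, D.chain 1 le_rfl h2]; norm_num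
      · rw [D.root_far j (by omega) h2 h3, D.far 1 j le_rfl (by omega) h2]; norm_num)
  have h1 : ⟪(1 / 2 : ℝ) • (a 0 - a 1), (1 / 2 : ℝ) • (a 0 - a 1)⟫ = 1 := by
    simp only [real_inner_smul_left, real_inner_smul_right, inner_sub_left, inner_sub_right, ha0,
      ha1, h01, real_inner_comm (a 0) (a 1)]
    norm_num
  have he : a 0 = pathFrame ((1 / 2 : ℝ) • (a 0 - a 1)) a 0 +
      pathFrame ((1 / 2 : ℝ) • (a 0 - a 1)) a 1 := by
    simp only [pathFrame]; module
  refine P.false_of_critical h b hΔ (by omega) h1 ?_ ?_ fun i => ?_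
  · simp only [pathFrame] at he
    rw [← he]; exact D.mem 0 (by omega)
  · generalize hf : (1 / 2 : ℝ) • (a 0 - a 1) = f₀ at *
    rw [he]
    refine Submodule.add_mem _ ?_ ?_
    · exact pathFrame_mem_span _ _ (by omega)
    · exact pathFrame_mem_span _ _ (by omega)
  · rw [refl_apply ha0]
    generalize hf : (1 / 2 : ℝ) • (a 0 - a 1) = f₀ at *
    rw [he, inner_add_left, P.inner_frame h1 (by omega) i.2, P.inner_frame h1 (by omega) i.2]
    rcases i with ⟨i, hi⟩
    rcases Nat.lt_or_ge 1 i with h2 | h2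
    · refine ⟨⟨i, hi⟩, Or.inl ?_⟩
      rw [if_neg (by simp; omega), if_neg (by simp; omega)]; simp
    · obtain rfl | rfl : i = 0 ∨ i = 1 := by omega
      · exact ⟨⟨1, by omega⟩, Or.inr (by simp)⟩
      · exact ⟨⟨0, by omega⟩, Or.inr (by simp)⟩

theorem false_of_simple_path [FiniteDimensional ℝ V] (D : Diagram Φ a n 1 1) (h : Critical Φ w)
    (b : IsBase Φ ρ Δ) (hΔ : ∀ d, d ∈ Δ ↔ ∃ i < n, a i = d) : False := by
  classical
  obtain ⟨f₀, hf₀⟩ := b.exists_inner_eq fun d => if d = a 0 then -1 else 0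
  have hf : ∀ j < n, ⟪f₀, a j⟫ = if j = 0 then -1 else 0 := by
    intro j hj
    rw [hf₀ _ ((hΔ _).2 ⟨j, hj, rfl⟩)]
    rcases eq_or_ne j 0 with rfl | h0
    · simp
    · rw [if_neg h0, if_neg]
      intro he
      have h2 := h.isRoot.norm _ (D.mem j hj)
      nth_rw 1 [he] at h2
      rcases eq_or_ne j 1 with rfl | h1
      · rw [D.root le_rfl hj] at h2; norm_num at h2
      · rw [D.root_far j (by omega) hj h1] at h2; norm_num at h2
  have P : Path f₀ (fun i => a (i - 1)) (n + 1) := by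
    refine ⟨fun i h1 h2 => h.isRoot.norm _ (D.mem _ (by omega)), fun i h1 h2 => ?_,
      fun i j h1 h2 h3 => ?_, fun h1 => ?_, fun j h1 h2 => ?_⟩
    · obtain ⟨i, rfl⟩ : ∃ k, i = k + 1 := ⟨i - 1, by omega⟩
      simp only [Nat.add_sub_cancel]
      rcases Nat.eq_zero_or_pos i with rfl | h3
      · exact D.root le_rfl (by omega)
      · exact D.chain i h3 (by omega)
    · obtain ⟨i, rfl⟩ : ∃ k, i = k + 1 := ⟨i - 1, by omega⟩
      simp only [Nat.add_sub_cancel]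
      rcases Nat.eq_zero_or_pos i with rfl | h3
      · exact D.root_far _ (by omega) (by omega) (by omega)
      · exact D.far i _ h3 (by omega) (by omega)
    · simpa using hf 0 (by omega)
    · rw [hf _ (by omega), if_neg (by omega)]
  set f : Fin (n + 1) → V := fun i => pathFrame f₀ (fun i => a (i - 1)) i with hfdef
  have hr : ∀ j : Fin n, ∀ i, refl (a j) (f i) = f (Equiv.swap j.castSucc j.succ i) := by
    intro j i
    have := P.refl_apply (j := j) (by omega) i.2
    simp only [Nat.add_sub_cancel] at this
    rw [hfdef]
    simp only
    rw [this, Equiv.swap_apply_def]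
    simp only [Fin.ext_iff, Fin.val_castSucc, Fin.val_succ]
    split_ifs <;> simp
  have hperm : ∀ g ∈ weyl Φ, ∃ σ : Equiv.Perm (Fin (n + 1)), ∀ i, g (f i) = f (σ i) := by
    intro g hg
    rw [← b.weyl_eq h.isRoot] at hg
    refine weyl_induction (p := fun g => ∃ σ : Equiv.Perm (Fin (n + 1)), ∀ i, g (f i) = f (σ i))
      ⟨1, fun i => rfl⟩ ?_ hg
    rintro d hd g - ⟨σ, hσ⟩
    obtain ⟨j, hj, rfl⟩ := (hΔ d).1 hd
    exact ⟨Equiv.swap (Fin.castSucc ⟨j, hj⟩) (Fin.succ ⟨j, hj⟩) * σ, fun i => by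
      rw [mul_apply, hσ, hr ⟨j, hj⟩, Equiv.Perm.mul_apply]⟩
  have hreal : ∀ π : Equiv.Perm (Fin (n + 1)), ∃ g ∈ weyl Φ, ∀ i, g (f i) = f (π i) := by
    intro π
    have hπ : π ∈ Submonoid.closure
        (Set.range fun i : Fin n => Equiv.swap i.castSucc i.succ) := by
      rw [Equiv.Perm.mclosure_swap_castSucc_succ]; trivial
    induction hπ using Submonoid.closure_induction with
    | mem π hπ =>
      obtain ⟨j, rfl⟩ := hπ
      exact ⟨refl (a j), refl_mem_weyl (D.mem j j.2), fun i => hr j i⟩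
    | one => exact ⟨1, one_mem _, fun i => rfl⟩
    | mul π π' _ _ h1 h2 =>
      obtain ⟨g, hg, h1⟩ := h1
      obtain ⟨g', hg', h2⟩ := h2
      exact ⟨g * g', mul_mem hg hg', fun i => by rw [mul_apply, h2, h1, Equiv.Perm.mul_apply]⟩
  obtain ⟨σ, hσ⟩ := hperm w h.mem
  obtain ⟨π, hπ⟩ : ∃ π, π * σ * π⁻¹ = σ⁻¹ :=
    isConj_iff.1 (Equiv.Perm.isConj_iff_cycleType_eq.2 (Equiv.Perm.cycleType_inv σ).symm)
  obtain ⟨g, hg, hgπ⟩ := hreal π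
  refine h.false_of_reverses hg (S := Set.range f) (b.top_le_span h fun d hd => ?_) ?_
  · obtain ⟨j, hj, rfl⟩ := (hΔ d).1 hd
    exact Path.span_le (a := fun i => a (i - 1)) (i := j + 1) (by omega) (by omega)
  · rintro _ ⟨i, rfl⟩
    rw [hσ, hgπ, hσ, hgπ]
    have : σ * (π * σ) = π := by
      rw [mul_inv_eq_iff_eq_mul.1 hπ, mul_inv_cancel_left]
    exact congrArg f (Equiv.Perm.congr_fun this i)

end Diagram

end

section

variable {V : Type*} [NormedAddCommGroup V] [InnerProductSpace ℝ V]

theorem Critical.even_card_of_family [FiniteDimensional ℝ V] {Φ : Set V} {w : V ≃ₗᵢ[ℝ] V}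
    (h : Critical Φ w) {n : ℕ} (f : Fin n → V) (hf : ∀ i, f i ∈ Φ)
    (ho : ∀ i j, i < j → ⟪f i, f j⟫ = 0) (hspan : ⊤ ≤ Submodule.span ℝ (Set.range f)) :
    Even n := by
  have ho' : ∀ i j, i ≠ j → ⟪f i, f j⟫ = 0 := fun i j hij => by
    rcases lt_or_gt_of_ne hij with h1 | h1
    · exact ho i j h1
    · rw [real_inner_comm]; exact ho j i h1
  have hli : LinearIndependent ℝ f := linearIndependent_of_ne_zero_of_inner_eq_zero
    (fun i => h.isRoot.ne_zero (hf i)) fun i j hij => ho' i j hij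
  have := h.even_finrank (neg_mem_weyl_of_family f (fun i => h.isRoot.norm _ (hf i)) hf ho' hspan)
  rwa [Module.finrank_eq_card_basis (Module.Basis.mk hli hspan), Fintype.card_fin] at this

theorem IsRoot.sub_smul_mem {Φ : Set V} (h : IsRoot Φ) {a b : V} (ha : a ∈ Φ) (hb : b ∈ Φ) {c : ℝ}
    (hc : ⟪a, b⟫ = c) : b - c • a ∈ Φ := by
  have := h.refl_mem a ha b hb
  rwa [refl_apply (h.norm a ha), hc] at this

namespace Diagram
variable {Φ : Set V} {a : ℕ → V} {n p : ℕ} {x : ℝ} {ρ : V} {Δ : Finset V} {w : V ≃ₗᵢ[ℝ] V}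

theorem inner_eq (D : Diagram Φ a n p x) (h : IsRoot Φ) (hp : 1 ≤ p) (hpn : p < n) {i j : ℕ}
    (hi : i < n) (hj : j < n) : ⟪a i, a j⟫ = if i = j then 2 else if i = 0 then
      (if j = p then -x else 0) else if j = 0 then (if i = p then -x else 0) else
      if i + 1 = j ∨ j + 1 = i then -1 else 0 := by
  split_ifs with h1 h2 h3 h4 h5 h6
  · rw [h1]; exact h.norm _ (D.mem j hj)
  · rw [h2, h3]; exact D.root hp hpn
  · rw [h2]; exact D.root_far j (by omega) hj h3
  · rw [h4, h5, real_inner_comm]; exact D.root hp hpn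
  · rw [h4, real_inner_comm]; exact D.root_far i (by omega) hi h5
  · rcases h6 with rfl | rfl
    · exact D.chain i (by omega) hj
    · rw [real_inner_comm]; exact D.chain j (by omega) hi
  · rcases lt_or_gt_of_ne h1 with h7 | h7
    · exact D.far i j (by omega) (by omega) hj
    · rw [real_inner_comm]; exact D.far j i (by omega) (by omega) hi

theorem false_of_golden_three [FiniteDimensional ℝ V] (D : Diagram Φ a 3 1 Real.goldenRatio)
    (h : Critical Φ w) (b : IsBase Φ ρ Δ) (hΔ : ∀ d, d ∈ Δ ↔ ∃ i < 3, a i = d) : False := by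
  have G : ∀ i < 3, ∀ j < 3, _ := fun i hi j hj =>
    D.inner_eq h.isRoot le_rfl (by norm_num) hi hj
  set q := Real.goldenRatio with hq
  have hq2 : q ^ 2 = q + 1 := Real.goldenRatio_sq
  have hq0 : 0 < q := Real.goldenRatio_pos
  have hm : ∀ i < 3, a i ∈ Φ := D.mem
  have N : ∀ i < 3, ‖a i‖ ^ 2 = 2 := fun i hi => by
    rw [← real_inner_self_eq_norm_sq, h.isRoot.norm _ (hm i hi)]
  have h1 := h.isRoot.sub_smul_mem (hm 0 (by norm_num)) (hm 1 (by norm_num)) (c := -q) (by simp [G])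
  have h2 := h.isRoot.sub_smul_mem (hm 2 (by norm_num)) h1 (c := -1)
    (by simp [G, inner_add_right, real_inner_smul_right])
  have h3 := h.isRoot.sub_smul_mem (hm 1 (by norm_num)) h2 (c := -q)
    (by simp [N, G, inner_add_right, real_inner_smul_right]; nlinarith)
  have h4 := h.isRoot.sub_smul_mem (hm 2 (by norm_num)) h3 (c := 1 - q)
    (by simp [N, G, inner_add_right, real_inner_smul_right]; nlinarith)
  have h5 := h.isRoot.sub_smul_mem (hm 0 (by norm_num)) h4 (c := -1)
    (by simp [N, G, inner_sub_right, inner_add_right, real_inner_smul_right]; nlinarith)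
  have h6 := h.isRoot.sub_smul_mem (hm 1 (by norm_num)) h5 (c := 1 - q)
    (by simp [N, G, inner_sub_right, inner_add_right, real_inner_smul_right]; nlinarith)
  have h7 : (q + 1) • a 0 + (2 * q) • a 1 + q • a 2 ∈ Φ := by
    convert h6 using 1
    module
  have := h.even_card_of_family ![a 0, a 2, (q + 1) • a 0 + (2 * q) • a 1 + q • a 2]
    (by intro i; fin_cases i; exacts [hm 0 (by norm_num), hm 2 (by norm_num), h7])
    (by
      intro i j hij
      fin_cases i <;> fin_cases j <;> first | (exact absurd hij (by decide)) |
        (simp [N, G, inner_add_right, real_inner_smul_right]; try nlinarith))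
    (b.top_le_span h fun d hd => by
      obtain ⟨i, hi, rfl⟩ := (hΔ d).1 hd
      have s0 : a 0 ∈ Submodule.span ℝ
          (Set.range ![a 0, a 2, (q + 1) • a 0 + (2 * q) • a 1 + q • a 2]) :=
        Submodule.subset_span ⟨0, rfl⟩
      have s1 : a 2 ∈ Submodule.span ℝ
          (Set.range ![a 0, a 2, (q + 1) • a 0 + (2 * q) • a 1 + q • a 2]) :=
        Submodule.subset_span ⟨1, rfl⟩
      have s2 : (q + 1) • a 0 + (2 * q) • a 1 + q • a 2 ∈ Submodule.span ℝ
          (Set.range ![a 0, a 2, (q + 1) • a 0 + (2 * q) • a 1 + q • a 2]) :=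
        Submodule.subset_span ⟨2, rfl⟩
      generalize Submodule.span ℝ
        (Set.range ![a 0, a 2, (q + 1) • a 0 + (2 * q) • a 1 + q • a 2]) = U at s0 s1 s2 ⊢
      interval_cases i
      · exact s0
      · have := U.smul_mem (2 * q)⁻¹ (U.sub_mem (U.sub_mem s2 (U.smul_mem (q + 1) s0))
          (U.smul_mem q s1))
        convert this using 1
        rw [add_sub_right_comm, add_sub_cancel_right, add_sub_cancel_left, smul_smul,
          inv_mul_cancel₀ (by positivity), one_smul]
      · exact s1)
  exact absurd this (by decide)

/-- The highest root of the subsystem of type `E₇`. -/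
def highest (a : ℕ → V) : V :=
  a 1 + a 2 + (a 3 + a 0 + a 2 + a 4 + a 3) +
    (a 3 + a 0 + a 2 + a 4 + a 3 + a 5 + a 6 + a 4 + a 5) + a 1

theorem mem_of_seven (D : Diagram Φ a n 3 1) (h : IsRoot Φ) (hn : 7 ≤ n) :
    a 3 + a 0 + a 2 + a 4 + a 3 ∈ Φ ∧
      a 3 + a 0 + a 2 + a 4 + a 3 + a 5 + a 6 + a 4 + a 5 ∈ Φ ∧ highest a ∈ Φ := by
  have G : ∀ i < 7, ∀ j < 7, _ := fun i hi j hj =>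
    D.inner_eq h (by norm_num) (by omega) (hi.trans_le hn) (hj.trans_le hn)
  have hm : ∀ i < 7, a i ∈ Φ := fun i hi => D.mem i (by omega)
  have N : ∀ i < 7, ‖a i‖ ^ 2 = 2 := fun i hi => by
    rw [← real_inner_self_eq_norm_sq, h.norm _ (hm i hi)]
  have r1 := h.add_mem (hm 3 (by norm_num)) (hm 0 (by norm_num)) (by simp [G]; try norm_num)
  have r2 := h.add_mem r1 (hm 2 (by norm_num)) (by simp [G, inner_add_left]; try norm_num)
  have r3 := h.add_mem r2 (hm 4 (by norm_num)) (by simp [G, inner_add_left]; try norm_num)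
  have r4 := h.add_mem r3 (hm 3 (by norm_num)) (by simp [N, G, inner_add_left]; try norm_num)
  set r := a 3 + a 0 + a 2 + a 4 + a 3 with hr
  have s1 := h.add_mem r4 (hm 5 (by norm_num)) (by simp [hr, G, inner_add_left]; try norm_num)
  have s2 := h.add_mem s1 (hm 6 (by norm_num)) (by simp [hr, G, inner_add_left]; try norm_num)
  have s3 := h.add_mem s2 (hm 4 (by norm_num)) (by simp [hr, N, G, inner_add_left]; try norm_num)
  have s4 := h.add_mem s3 (hm 5 (by norm_num)) (by simp [hr, N, G, inner_add_left]; try norm_num)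
  set s := r + a 5 + a 6 + a 4 + a 5 with hs
  have t1 := h.add_mem (hm 1 (by norm_num)) (hm 2 (by norm_num)) (by simp [G]; try norm_num)
  have t2 := h.add_mem t1 r4 (by simp [hr, N, G, inner_add_left, inner_add_right]; try norm_num)
  have t3 := h.add_mem t2 s4
    (by simp [hs, hr, N, G, inner_add_left, inner_add_right]; try norm_num)
  have t4 := h.add_mem t3 (hm 1 (by norm_num))
    (by simp [hs, hr, N, G, inner_add_left]; try norm_num)
  set t := a 1 + a 2 + r + s + a 1 with ht
  exact ⟨r4, s4, t4⟩

theorem false_of_seven [FiniteDimensional ℝ V] (D : Diagram Φ a 7 3 1)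
    (h : Critical Φ w) (b : IsBase Φ ρ Δ) (hΔ : ∀ d, d ∈ Δ ↔ ∃ i < 7, a i = d) : False := by
  have G : ∀ i < 7, ∀ j < 7, _ := fun i hi j hj =>
    D.inner_eq h.isRoot (by norm_num) (by norm_num) hi hj
  have hm : ∀ i < 7, a i ∈ Φ := D.mem
  have N : ∀ i < 7, ‖a i‖ ^ 2 = 2 := fun i hi => by
    rw [← real_inner_self_eq_norm_sq, h.isRoot.norm _ (hm i hi)]
  obtain ⟨r4, s4, t4⟩ := D.mem_of_seven h.isRoot le_rfl
  rw [highest] at t4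
  set r := a 3 + a 0 + a 2 + a 4 + a 3 with hr
  set s := r + a 5 + a 6 + a 4 + a 5 with hs
  set t := a 1 + a 2 + r + s + a 1 with ht
  have hv : ∀ i : Fin 7, ![a 0, a 2, a 4, a 6, r, s, t] i ∈ Φ := by
    intro i
    fin_cases i
    exacts [hm 0 (by norm_num), hm 2 (by norm_num), hm 4 (by norm_num), hm 6 (by norm_num), r4, s4,
      t4]
  have := h.even_card_of_family ![a 0, a 2, a 4, a 6, r, s, t] hv
    (by
      intro i j hij
      fin_cases i <;> fin_cases j <;> first | (exact absurd hij (by decide)) |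
        (simp [ht, hs, hr, G, inner_add_right, inner_add_left, -inner_self_eq_norm_sq_to_K]
         try norm_num))
    (b.top_le_span h fun d hd => by
      obtain ⟨i, hi, rfl⟩ := (hΔ d).1 hd
      have hU : ∀ i, ![a 0, a 2, a 4, a 6, r, s, t] i ∈
          Submodule.span ℝ (Set.range ![a 0, a 2, a 4, a 6, r, s, t]) :=
        fun i => Submodule.subset_span ⟨i, rfl⟩
      generalize Submodule.span ℝ (Set.range ![a 0, a 2, a 4, a 6, r, s, t]) = U at hU ⊢
      have u0 : a 0 ∈ U := hU 0
      have u2 : a 2 ∈ U := hU 1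
      have u4 : a 4 ∈ U := hU 2
      have u6 : a 6 ∈ U := hU 3
      have ur : r ∈ U := hU 4
      have us : s ∈ U := hU 5
      have ut : t ∈ U := hU 6
      have u3 : a 3 ∈ U := by
        have := U.smul_mem (1 / 2 : ℝ) (U.sub_mem (U.sub_mem (U.sub_mem ur u0) u2) u4)
        convert this using 1
        rw [hr]; module
      have u5 : a 5 ∈ U := by
        have := U.smul_mem (1 / 2 : ℝ) (U.sub_mem (U.sub_mem (U.sub_mem us ur) u6) u4)
        convert this using 1
        rw [hs]; module
      have u1 : a 1 ∈ U := by
        have := U.smul_mem (1 / 2 : ℝ) (U.sub_mem (U.sub_mem (U.sub_mem ut us) ur) u2)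
        convert this using 1
        rw [ht]; module
      interval_cases i <;> assumption)
  exact absurd this (by decide)

end Diagram

end

section

variable {V : Type*} [NormedAddCommGroup V] [InnerProductSpace ℝ V]

theorem IsBase.exists_int_inner_of_base {Φ : Set V} {ρ : V} {Δ : Finset V} (b : IsBase Φ ρ Δ)
    (h : IsRoot Φ) (hg : ∀ d ∈ Δ, ∀ e ∈ Δ, ∃ n : ℤ, ⟪d, e⟫ = n) {v : V}
    (hv : ∀ d ∈ Δ, ∃ n : ℤ, ⟪d, v⟫ = n) : ∀ x ∈ Φ, ∃ n : ℤ, ⟪x, v⟫ = n := by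
  intro x hx
  refine (b.root_induction h
    (P := fun x => (∃ n : ℤ, ⟪x, v⟫ = n) ∧ ∀ d ∈ Δ, ∃ n : ℤ, ⟪d, x⟫ = n)
    (fun d hd => ⟨hv d hd, fun e he => hg e he d hd⟩) (fun d hd y hy => ?_) hx).1
  obtain ⟨⟨k, hk⟩, hy⟩ := hy
  obtain ⟨l, hl⟩ := hy d hd
  rw [refl_apply (h.norm d (b.mem d hd)), hl]
  refine ⟨?_, fun e he => ?_⟩
  · obtain ⟨m, hm⟩ := hv d hd
    exact ⟨k - l * m, by rw [inner_sub_left, real_inner_smul_left, hk, hm]; push_cast; ring⟩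
  · obtain ⟨m, hm⟩ := hg e he d hd
    obtain ⟨k', hk'⟩ := hy e he
    exact ⟨k' - l * m, by rw [inner_sub_right, real_inner_smul_right, hk', hm]; push_cast; ring⟩

theorem IsBase.exists_int_inner {Φ : Set V} {ρ : V} {Δ : Finset V} (b : IsBase Φ ρ Δ)
    (h : IsRoot Φ) (hg : ∀ d ∈ Δ, ∀ e ∈ Δ, ∃ n : ℤ, ⟪d, e⟫ = n) :
    ∀ x ∈ Φ, ∀ y ∈ Φ, ∃ n : ℤ, ⟪x, y⟫ = n := by
  intro x hx y hy
  refine b.exists_int_inner_of_base h hg (fun d hd => ?_) x hx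
  obtain ⟨n, hn⟩ := b.exists_int_inner_of_base h hg (fun e he => hg e he d hd) y hy
  exact ⟨n, by rw [real_inner_comm, hn]⟩

theorem signs_induction {ι : Type*} [Fintype ι] [DecidableEq ι] {P : (ι → ℝ) → Prop}
    (hP : ∀ e, (∀ i, e i = 1 ∨ e i = -1) → P e → ∀ i j, i ≠ j →
      P fun k => if k = i ∨ k = j then -e k else e k)
    {e₀ : ι → ℝ} (he₀ : ∀ i, e₀ i = 1 ∨ e₀ i = -1) (h0 : P e₀) {e : ι → ℝ}
    (he : ∀ i, e i = 1 ∨ e i = -1) (hprod : ∏ i, e i = ∏ i, e₀ i) : P e := by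
  classical
  induction hc : (Finset.univ.filter fun i => e i ≠ e₀ i).card using Nat.strong_induction_on
    generalizing e with
  | _ c ih =>
    by_cases hall : ∀ i, e i = e₀ i
    · rwa [funext hall]
    push Not at hall
    obtain ⟨i, hi⟩ := hall
    obtain ⟨j, hij, hj⟩ : ∃ j, i ≠ j ∧ e j ≠ e₀ j := by
      by_contra! hcon
      rw [← Finset.mul_prod_erase _ _ (Finset.mem_univ i),
        ← Finset.mul_prod_erase _ e₀ (Finset.mem_univ i)] at hprod
      have h1 : ∏ x ∈ Finset.univ.erase i, e x = ∏ x ∈ Finset.univ.erase i, e₀ x :=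
        Finset.prod_congr rfl fun x hx => hcon x (Finset.ne_of_mem_erase hx).symm
      rw [h1] at hprod
      refine hi (mul_right_cancel₀ (Finset.prod_ne_zero_iff.2 fun x _ => ?_) hprod)
      rcases he₀ x with hx | hx <;> rw [hx] <;> norm_num
    have hne : ∀ x, e x ≠ e₀ x → -e x = e₀ x := fun x hx => by
      rcases he x with h1 | h1 <;> rcases he₀ x with h2 | h2 <;>
        first | exact absurd (h1.trans h2.symm) hx | (rw [h1, h2]; try norm_num)
    have he' : ∀ k, (if k = i ∨ k = j then -e k else e k) = 1 ∨
        (if k = i ∨ k = j then -e k else e k) = -1 := fun k => by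
      rcases he k with h1 | h1 <;> split_ifs <;> rw [h1] <;> norm_num
    have h1 := ih _ ?_ (e := fun k => if k = i ∨ k = j then -e k else e k) he' ?_ rfl
    · have h2 := hP _ he' h1 i j hij
      convert h2 using 2 with k
      split_ifs <;> simp
    · rw [← hc]
      refine Finset.card_lt_card (Finset.ssubset_iff_of_subset ?_ |>.2 ⟨i, by simpa using hi, ?_⟩)
      · intro k
        simp only [Finset.mem_filter, Finset.mem_univ, true_and]
        split_ifs with hk
        · rcases hk with rfl | rfl
          · exact fun _ => hi
          · exact fun _ => hj
        · exact id
      · simpa using hne i hi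
    · rw [← hprod, ← Finset.mul_prod_erase _ _ (Finset.mem_univ i),
        ← Finset.mul_prod_erase _ e (Finset.mem_univ i),
        ← Finset.mul_prod_erase _ _ (Finset.mem_erase.2 ⟨hij.symm, Finset.mem_univ j⟩),
        ← Finset.mul_prod_erase _ e (Finset.mem_erase.2 ⟨hij.symm, Finset.mem_univ j⟩),
        if_pos (Or.inl rfl), if_pos (Or.inr rfl)]
      have : ∀ x ∈ (Finset.univ.erase i).erase j,
          (if x = i ∨ x = j then -e x else e x) = e x := fun x hx => by
        simp only [Finset.mem_erase] at hx
        rw [if_neg (by tauto)]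
      rw [Finset.prod_congr rfl this]
      ring

theorem Frame.spin_mem {ι : Type*} [Fintype ι] {Φ : Set V} {f : ι → V} (hf : Frame Φ f)
    (hΦ : IsRoot Φ) {c : V} (hc : ∀ i, ⟪f i, c⟫ = 0) {e₀ : ι → ℝ}
    (he₀ : ∀ i, e₀ i = 1 ∨ e₀ i = -1) (h0 : (1 / 2 : ℝ) • ∑ i, e₀ i • f i + c ∈ Φ) {e : ι → ℝ}
    (he : ∀ i, e i = 1 ∨ e i = -1) (hprod : ∏ i, e i = ∏ i, e₀ i) :
    (1 / 2 : ℝ) • ∑ i, e i • f i + c ∈ Φ := by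
  classical
  refine signs_induction (P := fun e => (1 / 2 : ℝ) • ∑ i, e i • f i + c ∈ Φ)
    (fun e he h i j hij => ?_) he₀ h0 he hprod
  have hr : e i • f i + e j • f j ∈ Φ := (hf.signs hΦ he).add_mem i j hij
  have hsq : ∀ i, e i * e i = 1 := fun i => by rcases he i with h | h <;> rw [h] <;> norm_num
  have := hΦ.sub_smul_mem hr h (c := 1) (by
    simp only [inner_add_left, inner_add_right, real_inner_smul_left, real_inner_smul_right, hc,
      hf.orthonormal.inner_right_fintype]
    linarith [hsq i, hsq j])
  convert this using 1
  have key : ∑ k, (if k = i ∨ k = j then -e k else e k) • f k =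
      ∑ k, e k • f k - (2 : ℝ) • (e i • f i + e j • f j) := by
    have : ∀ k, (if k = i ∨ k = j then -e k else e k) • f k = e k • f k -
        ((if k = i then (2 * e i) • f i else 0) + if k = j then (2 * e j) • f j else 0) := by
      intro k
      by_cases h1 : k = i
      · subst h1; simp [hij]; module
      · by_cases h2 : k = j
        · subst h2; simp [h1]; module
        · simp [h1, h2]
    rw [Finset.sum_congr rfl fun k _ => this k, Finset.sum_sub_distrib, Finset.sum_add_distrib]
    simp [mul_smul]
  simp only
  rw [key]
  module

namespace Diagram
variable {Φ : Set V} {a : ℕ → V} {n p : ℕ} {x : ℝ} {ρ : V} {Δ : Finset V} {w : V ≃ₗᵢ[ℝ] V}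

theorem path_of_three (D : Diagram Φ a (n + 1) 3 1) (h : IsRoot Φ) (hn : 3 ≤ n) :
    Path ((1 / 2 : ℝ) • (a 0 - a 2)) (fun i => a (i + 1)) n := by
  have G : ∀ i < n + 1, ∀ j < n + 1, _ := fun i hi j hj =>
    D.inner_eq h (by norm_num) (by omega) hi hj
  refine ⟨fun i h1 h2 => ?_, fun i h1 h2 => ?_, fun i j h1 h2 h3 => ?_, fun h1 => ?_,
    fun j h1 h2 => ?_⟩
  · rw [G _ (by omega) _ (by omega), if_pos rfl]
  · exact D.chain _ (by omega) (by omega)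
  · exact D.far _ _ (by omega) (by omega) (by omega)
  · simp only [real_inner_smul_left, inner_sub_left]
    rw [G _ (by omega) _ (by omega), G _ (by omega) _ (by omega)]; norm_num
  · simp only [real_inner_smul_left, inner_sub_left]
    rw [G _ (by omega) _ (by omega), G _ (by omega) _ (by omega)]
    rcases eq_or_ne j 2 with rfl | h3
    · norm_num
    · rw [if_neg (by omega), if_pos rfl, if_neg (by omega), if_neg (by omega), if_neg (by omega),
        if_neg (by omega), if_neg (by omega)]
      norm_num

theorem norm_of_three (D : Diagram Φ a (n + 1) 3 1) (h : IsRoot Φ) (hn : 3 ≤ n) :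
    ⟪(1 / 2 : ℝ) • (a 0 - a 2), (1 / 2 : ℝ) • (a 0 - a 2)⟫ = 1 := by
  have G : ∀ i < n + 1, ∀ j < n + 1, _ := fun i hi j hj =>
    D.inner_eq h (by norm_num) (by omega) hi hj
  simp only [real_inner_smul_left, real_inner_smul_right, inner_sub_left, inner_sub_right]
  rw [G _ (by omega) _ (by omega), G _ (by omega) _ (by omega), G _ (by omega) _ (by omega),
    G _ (by omega) _ (by omega)]
  norm_num

theorem false_of_eight [FiniteDimensional ℝ V] (D : Diagram Φ a 8 3 1)
    (h : Critical Φ w) (b : IsBase Φ ρ Δ) (hΔ : ∀ d, d ∈ Δ ↔ ∃ i < 8, a i = d) : False := by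
  have G : ∀ i < 8, ∀ j < 8, _ := fun i hi j hj =>
    D.inner_eq h.isRoot (by norm_num) (by norm_num) hi hj
  have hm : ∀ i < 8, a i ∈ Φ := D.mem
  obtain ⟨-, -, ht⟩ := D.mem_of_seven h.isRoot (by norm_num)
  have P7 := D.path_of_three h.isRoot (by norm_num)
  set a' : ℕ → V := fun i => if i = 7 then highest a else a (i + 1) with ha'
  have hθ : ∀ i < 8, ⟪a i, highest a⟫ = if i = 1 then 1 else if i = 7 then -1 else 0 := by
    intro i hi
    simp only [highest, inner_add_right]
    interval_cases i <;> simp [G, -inner_self_eq_norm_sq_to_K] <;>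
      norm_num
  have P : Path ((1 / 2 : ℝ) • (a 0 - a 2)) a' 8 := by
    refine ⟨fun i h1 h2 => ?_, fun i h1 h2 => ?_, fun i j h1 h2 h3 => ?_, fun h1 => ?_,
      fun j h1 h2 => ?_⟩ <;> simp only [ha']
    · split_ifs with h3
      · exact h.isRoot.norm _ ht
      · exact P7.norm i h1 (by omega)
    · rw [if_neg (by omega)]
      split_ifs with h3
      · rw [hθ _ (by omega), if_neg (by omega), if_pos h3]
      · exact P7.chain i h1 (by omega)
    · rw [if_neg (by omega)]
      split_ifs with h4
      · rw [hθ _ (by omega), if_neg (by omega), if_neg (by omega)]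
      · exact P7.far i j h1 h2 (by omega)
    · exact P7.first (by norm_num)
    · split_ifs with h4
      · rw [real_inner_smul_left, inner_sub_left, hθ _ (by omega), hθ _ (by omega)]; norm_num
      · exact P7.first_far j h1 (by omega)
  have h1 := D.norm_of_three h.isRoot (by norm_num)
  have hF := P.frame h.isRoot (fun i h2 h3 => by
      simp only [ha']; split_ifs
      · exact ht
      · exact hm _ (by omega)) h1 (by norm_num) (by
      convert hm 0 (by norm_num) using 1
      simp only [ha', if_neg (show 1 ≠ 7 by norm_num)]
      module)
  set f := fun i : Fin 8 => pathFrame ((1 / 2 : ℝ) • (a 0 - a 2)) a' i with hf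
  have ha1 : a 1 = (1 / 2 : ℝ) • ∑ i, (![1, -1, -1, -1, -1, -1, -1, 1] : Fin 8 → ℝ) i • f i + 0 := by
    simp [Fin.sum_univ_eight, hf, pathFrame, ha', highest]
    module
  have hE : E8Frame Φ f := by
    refine { toFrame := hF, span := ?_, spin := fun e he hp => ?_, gram := ?_ }
    · refine b.top_le_span h fun d hd => ?_
      obtain ⟨i, hi, rfl⟩ := (hΔ d).1 hd
      rcases Nat.lt_or_ge 1 i with h2 | h2
      · have := Path.span_le (f₀ := (1 / 2 : ℝ) • (a 0 - a 2)) (a := a') (n := 8) (i := i - 1)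
          (by omega) (by omega)
        simp only [ha', if_neg (show i - 1 ≠ 7 by omega), show i - 1 + 1 = i by omega] at this
        exact this
      · obtain rfl | rfl : i = 0 ∨ i = 1 := by omega
        · have : a 0 = f 0 + f 1 := by simp [hf, pathFrame, ha']; module
          rw [this]
          exact Submodule.add_mem _ (Submodule.subset_span ⟨0, rfl⟩)
            (Submodule.subset_span ⟨1, rfl⟩)
        · rw [ha1, add_zero]
          exact Submodule.smul_mem _ _ (Submodule.sum_mem _ fun i _ => Submodule.smul_mem _ _
            (Submodule.subset_span ⟨i, rfl⟩))
    · have := hF.spin_mem h.isRoot (c := 0) (fun _ => inner_zero_right _)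
        (e₀ := ![1, -1, -1, -1, -1, -1, -1, 1])
        (by intro i; fin_cases i <;> norm_num) (ha1 ▸ hm 1 (by norm_num)) he
        (by rw [hp]; simp [Fin.prod_univ_eight])
      rwa [add_zero] at this
    · exact b.exists_int_inner h.isRoot fun d hd e he => by
        obtain ⟨i, hi, rfl⟩ := (hΔ d).1 hd
        obtain ⟨j, hj, rfl⟩ := (hΔ e).1 he
        rw [G i hi j hj]
        split_ifs
        exacts [⟨2, by norm_num⟩, ⟨-1, by norm_num⟩, ⟨0, by norm_num⟩, ⟨-1, by norm_num⟩,
          ⟨0, by norm_num⟩, ⟨-1, by norm_num⟩, ⟨0, by norm_num⟩]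
  exact hE.false_of_critical h

end Diagram

end

section

variable {V : Type*} [NormedAddCommGroup V] [InnerProductSpace ℝ V]

theorem exists_reflection_symm_of_card_le_five {ι : Type*} [Finite ι] (hι : Nat.card ι ≤ 5)
    (σ : Equiv.Perm ι) {t : ι → ℝ} (ht : ∀ i, t i = 1 ∨ t i = -1) (i : ι) :
    ∃ j : ℤ, ∀ k : ℤ, t ((σ ^ k) i) = t ((σ ^ (j - k)) i) := by
  classical
  obtain ⟨m, hm0, hm5, hm⟩ : ∃ m : ℕ, 0 < m ∧ m ≤ 5 ∧ (σ ^ m) i = i := by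
    have hni : ¬ Function.Injective fun k : Fin 6 => (σ ^ (k : ℕ)) i := fun hinj => by
      have := Nat.card_le_card_of_injective _ hinj
      rw [Nat.card_eq_fintype_card, Fintype.card_fin] at this
      omega
    have aux : ∀ k l : ℕ, k < l → l < 6 → (σ ^ k) i = (σ ^ l) i →
        ∃ m : ℕ, 0 < m ∧ m ≤ 5 ∧ (σ ^ m) i = i := fun k l hkl hl he => by
      refine ⟨l - k, by omega, by omega, (σ ^ k).injective ?_⟩
      rw [← Equiv.Perm.mul_apply, ← pow_add, Nat.add_sub_cancel' hkl.le, he]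
    simp only [Function.Injective, not_forall] at hni
    obtain ⟨k, l, he, hkl⟩ := hni
    rcases lt_or_gt_of_ne (Fin.val_ne_of_ne hkl) with h1 | h1
    · exact aux k l h1 l.2 he
    · exact aux l k h1 k.2 he.symm
  have : NeZero m := ⟨hm0.ne'⟩
  have hred : ∀ k : ℤ, (σ ^ k) i = (σ ^ ((k : ZMod m).val)) i := fun k => by
    rw [← zpow_natCast, ZMod.val_intCast]
    conv_lhs => rw [← Int.emod_add_mul_ediv k m, zpow_add, Equiv.Perm.mul_apply, zpow_mul,
      zpow_natCast]
    rw [Equiv.Perm.zpow_apply_eq_self_of_apply_eq_self hm]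
  have hdec : ∀ τ : ZMod m → Bool, ∃ j, ∀ k, τ k = τ (j - k) := by
    obtain rfl | rfl | rfl | rfl | rfl : m = 1 ∨ m = 2 ∨ m = 3 ∨ m = 4 ∨ m = 5 := by omega
    · decide
    · decide
    · decide
    · decide
    · decide
  obtain ⟨j, hj⟩ := hdec fun z => decide (t ((σ ^ z.val) i) = 1)
  refine ⟨(j.val : ℤ), fun k => ?_⟩
  have h1 := hj (k : ZMod m)
  rw [hred k, hred, Int.cast_sub, Int.cast_natCast, ZMod.natCast_zmod_val]
  rw [decide_eq_decide] at h1
  rcases ht ((σ ^ (k : ZMod m).val) i) with h2 | h2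
  · rw [h2, h1.1 h2]
  · rcases ht ((σ ^ (j - (k : ZMod m)).val) i) with h3 | h3
    · rw [h1.2 h3, h3]
    · rw [h2, h3]

end

section

variable {V : Type*} [NormedAddCommGroup V] [InnerProductSpace ℝ V]

/-- The short half of a root system of type `F₄`. -/
theorem sqrt_two_half_mem {Φ : Set V} (hΦ : IsRoot Φ) {f : Fin 4 → V} (hf : Orthonormal ℝ f)
    (hs : ∀ i, √2 • f i ∈ Φ) (h0 : -((√2 / 2) • ∑ i, f i) ∈ Φ) {e : Fin 4 → ℝ}
    (he : ∀ i, e i = 1 ∨ e i = -1) : (√2 / 2) • ∑ i, e i • f i ∈ Φ := by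
  classical
  have h2 : √2 * √2 = 2 := Real.mul_self_sqrt (by norm_num)
  have key : ∀ s : Finset (Fin 4), (√2 / 2) • ∑ i, (if i ∈ s then (1 : ℝ) else -1) • f i ∈ Φ := by
    intro s
    induction s using Finset.induction_on with
    | empty => simpa using h0
    | insert j s hj ih =>
      have := hΦ.sub_smul_mem (hs j) ih (c := -1) (by
        rw [real_inner_smul_left, real_inner_smul_right, hf.inner_right_fintype, if_neg hj]
        linarith)
      convert this using 1
      have h3 : ∀ i, (if i ∈ insert j s then (1 : ℝ) else -1) • f i =
          (if i ∈ s then (1 : ℝ) else -1) • f i + if i = j then (2 : ℝ) • f j else 0 := by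
        intro i
        by_cases h1 : i = j
        · subst h1; simp [hj]; module
        · simp [h1]
      rw [Finset.sum_congr rfl fun i _ => h3 i, Finset.sum_add_distrib]
      simp
      module
  convert key (Finset.univ.filter fun i => e i = 1) using 4 with i
  rcases he i with h1 | h1 <;> simp [h1]

theorem Critical.false_of_half_frame {Φ : Set V} {w : V ≃ₗᵢ[ℝ] V} (h : Critical Φ w)
    {f : Fin 4 → V} (hf : Frame Φ f) (hspan : ⊤ ≤ Submodule.span ℝ (Set.range f))
    (hhalf : ∀ e : Fin 4 → ℝ, (∀ i, e i = 1 ∨ e i = -1) → (√2 / 2) • ∑ i, e i • f i ∈ Φ)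
    (horb : ∀ g ∈ weyl Φ, ∀ i, (∃ j, g (f i) = f j ∨ g (f i) = -f j) ∨
      ∃ e : Fin 4 → ℝ, (∀ i, e i = 1 ∨ e i = -1) ∧ g (f i) = (1 / 2 : ℝ) • ∑ i, e i • f i) :
    False := by
  have h2 : √2 * √2 = 2 := Real.mul_self_sqrt (by norm_num)
  have hsign : ∀ g ∈ weyl Φ, (∃ j, g (f 0) = f j ∨ g (f 0) = -f j) →
      ∀ i, ∃ j, g (f i) = f j ∨ g (f i) = -f j := by
    intro g hg ⟨k, hk⟩ i
    rcases eq_or_ne i 0 with rfl | hi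
    · exact ⟨k, hk⟩
    refine (horb g hg i).resolve_right ?_
    rintro ⟨e, he, hge⟩
    have h0 : ⟪g (f 0), g (f i)⟫ = 0 := by rw [g.inner_map_map, hf.inner_ne hi.symm]
    rw [hge] at h0
    have h1 : ⟪f k, (1 / 2 : ℝ) • ∑ i, e i • f i⟫ = 1 / 2 * e k := by
      rw [real_inner_smul_right, hf.orthonormal.inner_right_fintype]
    rcases hk with hk | hk <;> rw [hk] at h0 <;> simp only [inner_neg_left, h1] at h0 <;>
      rcases he k with h3 | h3 <;> rw [h3] at h0 <;> norm_num at h0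
  rcases horb w h.mem 0 with h1 | ⟨e, he, hw⟩
  · exact h.false_of_signed hf hspan (hsign w h.mem h1)
  set e' : Fin 4 → ℝ := fun i => if i = 0 then e i else -e i with he'
  have hs' : ∀ i, e' i = 1 ∨ e' i = -1 := fun i => by
    simp only [he']; split_ifs
    · exact he i
    · rcases he i with h | h <;> rw [h] <;> norm_num
  have hsq : ∀ i, e i * e i = 1 := fun i => by rcases he i with h | h <;> rw [h] <;> norm_num
  have hsq' : ∀ i, e' i * e' i = 1 := fun i => by rcases hs' i with h | h <;> rw [h] <;> norm_num
  set α := (√2 / 2) • ∑ i, e' i • f i with hα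
  have hαΦ : α ∈ Φ := hhalf e' hs'
  have hg := hf.signs h.isRoot hs'
  have hw0 : (refl α * w) (f 0) = e 0 • f 0 := by
    have h3 : ⟪α, w (f 0)⟫ = -(√2 / 2) := by
      rw [hw, hα, real_inner_smul_left, real_inner_smul_right, hf.orthonormal.inner_sum]
      simp only [conj_trivial, he', Fin.sum_univ_four]
      simp [hsq]
      ring
    rw [mul_apply, refl_apply (h.isRoot.norm α hαΦ), h3, hα, smul_smul, hw]
    rw [show -(√2 / 2) * (√2 / 2) = -(1 / 2) by linarith]
    simp only [he', Fin.sum_univ_four]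
    simp
    module
  have hwm := mul_mem (refl_mem_weyl hαΦ) h.mem
  have hwsign := hsign _ hwm ⟨0, by
    rw [hw0]; rcases he 0 with h1 | h1 <;> rw [h1] <;> simp⟩
  obtain ⟨σ, t, ht, hσ⟩ := exists_perm_of_signed hg.orthonormal (w := refl α * w) fun i => by
    obtain ⟨j, hj⟩ := hwsign i
    refine ⟨j, ?_⟩
    rw [map_smul]
    rcases hj with hj | hj <;> rw [hj] <;> rcases hs' i with h1 | h1 <;>
      rcases hs' j with h2 | h2 <;> rw [h1, h2] <;> simp
  obtain ⟨u, hu, hfix, hrev⟩ := exists_weyl_reversing hg.orthonormal hg.sub_mem ht hσ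
    (exists_reflection_symm_of_card_le_five (by simp) σ ht)
  refine h.false_of_refl_mul hαΦ hu (hfix α fun i j => ?_)
    (S := Set.range fun i => e' i • f i) ?_ ?_
  · rw [hα, inner_sub_left]
    simp only [real_inner_smul_left, real_inner_smul_right, hf.orthonormal.inner_right_fintype]
    rw [mul_left_comm, hsq', mul_left_comm, hsq', sub_self]
  · refine hspan.trans (Submodule.span_le.2 ?_)
    rintro _ ⟨i, rfl⟩
    have := Submodule.smul_mem _ (e' i) (Submodule.subset_span (R := ℝ)
      (Set.mem_range_self (f := fun i => e' i • f i) i))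
    rwa [smul_smul, hsq', one_smul] at this
  · rintro _ ⟨i, rfl⟩
    exact hrev i

theorem exists_of_sum_sq_eq_four {k : Fin 4 → ℤ} (hp : ∀ i j, (2 : ℤ) ∣ k i - k j)
    (hs : ∑ i, k i * k i = 4) :
    (∀ i, k i = 1 ∨ k i = -1) ∨ ∃ j, (k j = 2 ∨ k j = -2) ∧ ∀ i, i ≠ j → k i = 0 := by
  rw [Fin.sum_univ_four] at hs
  have hb : ∀ i, -2 ≤ k i ∧ k i ≤ 2 := by
    intro i
    have : k i * k i ≤ 4 := by
      fin_cases i <;> simp <;>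
        nlinarith [mul_self_nonneg (k 0), mul_self_nonneg (k 1), mul_self_nonneg (k 2),
          mul_self_nonneg (k 3)]
    constructor <;> nlinarith
  have hd : ∀ i, (k i = 0 ∨ k i = 2 ∨ k i = -2) ∨ (k i = 1 ∨ k i = -1) := fun i => by
    obtain ⟨h1, h2⟩ := hb i; omega
  by_cases h0 : k 0 = 1 ∨ k 0 = -1
  · left
    intro i
    have := hp i 0
    rcases hd i with h1 | h1 <;> omega
  · right
    have he : ∀ i, k i = 0 ∨ k i = 2 ∨ k i = -2 := fun i => by
      have := hp i 0
      rcases hd i with h1 | h1 <;> rcases hd 0 with h2 | h2 <;> omega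
    have hz : ∀ i, k i * k i = 0 ∧ k i = 0 ∨ k i * k i = 4 ∧ (k i = 2 ∨ k i = -2) := fun i => by
      rcases he i with h | h | h <;> rw [h] <;> norm_num
    obtain h1 | h1 := hz 0
    · obtain h2 | h2 := hz 1
      · obtain h3 | h3 := hz 2
        · obtain h4 | h4 := hz 3
          · omega
          · exact ⟨3, h4.2, by intro i hi; fin_cases i <;> simp_all⟩
        · refine ⟨2, h3.2, ?_⟩
          have : k 3 = 0 := by have := hz 3; omega
          intro i hi; fin_cases i <;> simp_all
      · refine ⟨1, h2.2, ?_⟩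
        have h3 : k 3 = 0 := by have := hz 3; have := hz 2; omega
        have h4 : k 2 = 0 := by have := hz 3; have := hz 2; omega
        intro i hi; fin_cases i <;> simp_all
    · refine ⟨0, h1.2, ?_⟩
      have h3 : k 3 = 0 := by have := hz 3; have := hz 2; have := hz 1; omega
      have h4 : k 2 = 0 := by have := hz 3; have := hz 2; have := hz 1; omega
      have h5 : k 1 = 0 := by have := hz 3; have := hz 2; have := hz 1; omega
      intro i hi; fin_cases i <;> simp_all

theorem Critical.false_of_f4 [FiniteDimensional ℝ V] {Φ : Set V} {w : V ≃ₗᵢ[ℝ] V}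
    (h : Critical Φ w) {ρ : V} {Δ : Finset V} (b : IsBase Φ ρ Δ) {d₀ d₁ d₂ d₃ : V}
    (hΔ : ∀ d, d ∈ Δ ↔ d = d₀ ∨ d = d₁ ∨ d = d₂ ∨ d = d₃) (h01 : ⟪d₀, d₁⟫ = -1)
    (h12 : ⟪d₁, d₂⟫ = -√2) (h23 : ⟪d₂, d₃⟫ = -1) (h02 : ⟪d₀, d₂⟫ = 0) (h03 : ⟪d₀, d₃⟫ = 0)
    (h13 : ⟪d₁, d₃⟫ = 0) : False := by
  have h2 : √2 * √2 = 2 := Real.mul_self_sqrt (by norm_num)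
  have hpos : 0 < √2 := by positivity
  have hd0 : d₀ ∈ Φ := b.mem _ ((hΔ _).2 (by simp))
  have hd1 : d₁ ∈ Φ := b.mem _ ((hΔ _).2 (by simp))
  have hd2 : d₂ ∈ Φ := b.mem _ ((hΔ _).2 (by simp))
  have hd3 : d₃ ∈ Φ := b.mem _ ((hΔ _).2 (by simp))
  have h00 := h.isRoot.norm _ hd0
  have h11 := h.isRoot.norm _ hd1
  have h22 := h.isRoot.norm _ hd2
  have h33 := h.isRoot.norm _ hd3
  have h10 : ⟪d₁, d₀⟫ = -1 := by rw [real_inner_comm, h01]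
  have h21 : ⟪d₂, d₁⟫ = -√2 := by rw [real_inner_comm, h12]
  have h32 : ⟪d₃, d₂⟫ = -1 := by rw [real_inner_comm, h23]
  have h20 : ⟪d₂, d₀⟫ = 0 := by rw [real_inner_comm, h02]
  have h30 : ⟪d₃, d₀⟫ = 0 := by rw [real_inner_comm, h03]
  have h31 : ⟪d₃, d₁⟫ = 0 := by rw [real_inner_comm, h13]
  have hr : d₁ + √2 • d₂ ∈ Φ := by
    have := h.isRoot.sub_smul_mem hd2 hd1 h21
    rwa [neg_smul, sub_neg_eq_add] at this
  have hr3 : d₁ + √2 • d₂ + √2 • d₃ ∈ Φ := by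
    have := h.isRoot.sub_smul_mem hd3 hr (c := -√2) (by
      rw [inner_add_right, real_inner_smul_right, h31, h32]; ring)
    rwa [neg_smul, sub_neg_eq_add] at this
  have hs1 : d₂ + √2 • d₁ ∈ Φ := by
    have := h.isRoot.sub_smul_mem hd1 hd2 h12
    rwa [neg_smul, sub_neg_eq_add] at this
  have hs2 : d₂ + √2 • d₁ + √2 • d₀ ∈ Φ := by
    have := h.isRoot.sub_smul_mem hd0 hs1 (c := -√2) (by
      rw [inner_add_right, real_inner_smul_right, h01, h02]; ring)
    rwa [neg_smul, sub_neg_eq_add] at this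
  set a₃ := -((2 * √2) • d₂ + (3 : ℝ) • d₁ + (2 : ℝ) • d₀ + √2 • d₃) with ha3
  have h3m : a₃ ∈ Φ := by
    have := h.isRoot.neg_mem (h.isRoot.sub_smul_mem hs2 hr3 (c := -√2) (by
      simp only [inner_add_right, inner_add_left, real_inner_smul_right, real_inner_smul_left, *]
      linear_combination -√2 * h2))
    convert this using 1
    rw [ha3, neg_smul, sub_neg_eq_add, smul_add, smul_add, smul_smul, smul_smul, h2]
    module
  set a : ℕ → V := fun i => if i = 1 then d₁ else if i = 2 then d₀ else a₃ with ha
  have hn3 := h.isRoot.norm _ h3m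
  have P : Path ((√2 / 2) • d₂) a 4 := by
    refine ⟨fun i h1 h2 => ?_, fun i h1 h2 => ?_, fun i j h1 h2 h3 => ?_, fun h1 => ?_,
      fun j h1 h2 => ?_⟩
    · interval_cases i <;> simp only [ha] <;> norm_num [h11, h00, hn3, -inner_self_eq_norm_sq_to_K]
    · obtain rfl | rfl : i = 1 ∨ i = 2 := by omega
      · simpa [ha] using h10
      · simp [ha, ha3, inner_add_right, inner_neg_right, real_inner_smul_right, h00, h01, h02, h03,
          -inner_self_eq_norm_sq_to_K]
        norm_num
    · obtain ⟨rfl, rfl⟩ : i = 1 ∧ j = 3 := by omega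
      simp [ha, ha3, inner_add_right, inner_neg_right, real_inner_smul_right, h10, h11, h12, h13,
          -inner_self_eq_norm_sq_to_K]
      linarith
    · simp [ha, real_inner_smul_left, h21]; linarith
    · obtain rfl | rfl : j = 2 ∨ j = 3 := by omega
      · simp [ha, real_inner_smul_left, h20]
      · simp [ha, ha3, inner_add_right, inner_neg_right, real_inner_smul_right, h20, h21, h22, h23,
          real_inner_smul_left, -inner_self_eq_norm_sq_to_K]
        nlinarith [Real.mul_self_sqrt (show (0:ℝ) ≤ 2 by norm_num)]
  have hf1 : ⟪(√2 / 2) • d₂, (√2 / 2) • d₂⟫ = 1 := by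
    rw [real_inner_smul_left, real_inner_smul_right, h22]; linarith
  have hF := P.frame h.isRoot (fun i _ _ => by
      simp only [ha]; split_ifs
      · exact hd1
      · exact hd0
      · exact h3m) hf1 (by norm_num) (by
      convert hr using 1
      simp only [ha, if_true]; module)
  set f := fun i : Fin 4 => pathFrame ((√2 / 2) • d₂) a i with hf
  have hd2f : d₂ = √2 • f 0 := by
    simp only [hf, pathFrame, smul_smul]
    rw [show √2 * (√2 / 2) = 1 by linarith, one_smul]
  have hd1f : d₁ = f 1 - f 0 := by simp [hf, pathFrame, ha]
  have hd0f : d₀ = f 2 - f 1 := by simp [hf, pathFrame, ha]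
  have hsum : -√2 • d₃ = ∑ i, f i := by
    simp [Fin.sum_univ_four, hf, pathFrame, ha, ha3]; module
  have hd3f : d₃ = -((√2 / 2) • ∑ i, f i) := by
    rw [← hsum, smul_smul, ← neg_smul, show -(√2 / 2 * -√2) = 1 by linarith, one_smul]
  have hspan : ⊤ ≤ Submodule.span ℝ (Set.range f) := by
    have hm : ∀ i, f i ∈ Submodule.span ℝ (Set.range f) := fun i => Submodule.subset_span ⟨i, rfl⟩
    refine b.top_le_span h fun d hd => ?_
    rcases (hΔ d).1 hd with rfl | rfl | rfl | rfl
    · rw [hd0f]; exact Submodule.sub_mem _ (hm _) (hm _)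
    · rw [hd1f]; exact Submodule.sub_mem _ (hm _) (hm _)
    · rw [hd2f]; exact Submodule.smul_mem _ _ (hm _)
    · rw [hd3f]
      exact Submodule.neg_mem _ (Submodule.smul_mem _ _ (Submodule.sum_mem _ fun i _ => hm i))
  have hs : ∀ i, √2 • f i ∈ Φ := fun i => by
    obtain ⟨u, hu, hu1, -⟩ := exists_weyl_perm hF.orthonormal hF.sub_mem (Equiv.swap 0 i)
    have := h.isRoot.map_mem hu _ hd2
    rwa [hd2f, map_smul, hu1, Equiv.swap_apply_left] at this
  refine h.false_of_half_frame hF hspan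
    (fun e he => sqrt_two_half_mem h.isRoot hF.orthonormal hs (hd3f ▸ hd3) he) fun g hg i => ?_
  have hint : (∃ n : ℤ, ⟪d₀, g (f i)⟫ = n) ∧ (∃ n : ℤ, ⟪d₁, g (f i)⟫ = n) ∧
      (∃ n : ℤ, √2 * ⟪d₂, g (f i)⟫ = n) ∧ ∃ n : ℤ, √2 * ⟪d₃, g (f i)⟫ = n := by
    refine b.map_induction h.isRoot (P := fun x => (∃ n : ℤ, ⟪d₀, x⟫ = n) ∧
      (∃ n : ℤ, ⟪d₁, x⟫ = n) ∧ (∃ n : ℤ, √2 * ⟪d₂, x⟫ = n) ∧ ∃ n : ℤ, √2 * ⟪d₃, x⟫ = n)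
      (fun d hd x hx => ?_) hg ?_
    · obtain ⟨⟨n₀, hn₀⟩, ⟨n₁, hn₁⟩, ⟨n₂, hn₂⟩, ⟨n₃, hn₃⟩⟩ := hx
      rw [refl_apply (h.isRoot.norm d (b.mem d hd))]
      simp only [inner_sub_right, real_inner_smul_right]
      rcases (hΔ d).1 hd with rfl | rfl | rfl | rfl
      · simp only [h00, h10, h20, h30, hn₀, hn₁]
        exact ⟨⟨-n₀, by push_cast; ring⟩, ⟨n₁ + n₀, by push_cast; ring⟩,
          ⟨n₂, by linarith⟩, ⟨n₃, by linarith⟩⟩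
      · simp only [h01, h11, h21, h31, hn₀, hn₁]
        exact ⟨⟨n₀ + n₁, by push_cast; ring⟩, ⟨-n₁, by push_cast; ring⟩,
          ⟨n₂ + 2 * n₁, by push_cast; linear_combination hn₂ + n₁ * h2⟩, ⟨n₃, by linarith⟩⟩
      · simp only [h02, h12, h22, h32, hn₀, hn₁]
        exact ⟨⟨n₀, by ring⟩, ⟨n₁ + n₂, by push_cast; linear_combination hn₂⟩,
          ⟨-n₂, by push_cast; linear_combination -hn₂⟩,
          ⟨n₃ + n₂, by push_cast; linear_combination hn₂ + hn₃⟩⟩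
      · simp only [h03, h13, h23, h33, hn₀, hn₁]
        exact ⟨⟨n₀, by ring⟩, ⟨n₁, by ring⟩, ⟨n₂ + n₃, by push_cast; linear_combination hn₂ + hn₃⟩,
          ⟨-n₃, by push_cast; linear_combination -hn₃⟩⟩
    · have hs0 : √2 * √2 = ((2 : ℤ) : ℝ) := by rw [h2]; norm_num
      rw [hd0f, hd1f, hd2f, hd3f]
      simp only [inner_sub_left, inner_neg_left, real_inner_smul_left, sum_inner, hF.inner_eq,
        Finset.sum_ite_eq', Finset.mem_univ, if_true]
      refine ⟨?_, ?_, ?_, -1, by push_cast; linarith⟩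
      · exact ⟨(if 2 = i then 1 else 0) - if 1 = i then 1 else 0, by push_cast; rfl⟩
      · exact ⟨(if 1 = i then 1 else 0) - if 0 = i then 1 else 0, by push_cast; rfl⟩
      · exact ⟨2 * if 0 = i then 1 else 0, by push_cast; rw [← mul_assoc, h2]⟩
  obtain ⟨⟨n₀, hn₀⟩, ⟨n₁, hn₁⟩, ⟨n₂, hn₂⟩, ⟨n₃, hn₃⟩⟩ := hint
  set x := g (f i) with hx
  rw [hd0f, inner_sub_left] at hn₀
  rw [hd1f, inner_sub_left] at hn₁
  rw [hd2f, real_inner_smul_left, ← mul_assoc, h2] at hn₂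
  rw [hd3f, inner_neg_left, real_inner_smul_left, sum_inner, Fin.sum_univ_four] at hn₃
  have hn₃' : ⟪f 0, x⟫ + ⟪f 1, x⟫ + ⟪f 2, x⟫ + ⟪f 3, x⟫ = -n₃ := by
    linear_combination -hn₃ - (⟪f 0, x⟫ + ⟪f 1, x⟫ + ⟪f 2, x⟫ + ⟪f 3, x⟫) / 2 * h2
  set k : Fin 4 → ℤ := ![n₂, n₂ + 2 * n₁, n₂ + 2 * n₁ + 2 * n₀,
    -2 * n₃ - 3 * n₂ - 4 * n₁ - 2 * n₀] with hk
  have hkx : ∀ j, ⟪f j, x⟫ = k j / 2 := by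
    intro j; fin_cases j <;> simp [hk] <;> linarith
  have hxs : x = (1 / 2 : ℝ) • ∑ j, (k j : ℝ) • f j := by
    rw [← Orthonormal.sum_inner_smul hF.orthonormal hspan x, Finset.smul_sum]
    refine Finset.sum_congr rfl fun j _ => ?_
    rw [hkx, smul_smul]; congr 1; ring
  have hsq : ∑ j, k j * k j = 4 := by
    have := Orthonormal.sum_inner_sq hF.orthonormal hspan x
    rw [hx, g.inner_map_map, hF.inner_self, ← hx] at this
    simp only [hkx] at this
    have h4 : (∑ j, (k j : ℝ) * k j) = 4 := by
      simp only [Fin.sum_univ_four] at this ⊢; linarith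
    exact_mod_cast h4
  rcases exists_of_sum_sq_eq_four (fun i j => by
    fin_cases i <;> fin_cases j <;> simp [hk] <;> omega) hsq with h4 | ⟨j, hj, hz⟩
  · exact Or.inr ⟨fun j => k j, fun j => by
      rcases h4 j with h | h <;> simp only [h] <;> norm_num, hxs⟩
  · left
    refine ⟨j, ?_⟩
    rw [Finset.sum_eq_single j (fun i _ hi => by rw [hz i hi]; simp) (by simp)] at hxs
    rcases hj with hj | hj <;> rw [hj] at hxs <;> rw [hxs]
    · left; push_cast; module
    · right; push_cast; module

end

section

variable {V : Type*} [NormedAddCommGroup V] [InnerProductSpace ℝ V]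

theorem sq_eq_of_sum_eq_card {ι : Type*} [Fintype ι] {k : ι → ℤ} (h : ∀ i, ¬ (2 : ℤ) ∣ k i)
    (hs : ∑ i, k i * k i = Fintype.card ι) (i : ι) : k i = 1 ∨ k i = -1 := by
  have h1 : ∀ i ∈ Finset.univ, (1 : ℤ) ≤ k i * k i := fun i _ => by
    have : k i ≠ 0 := fun h0 => h i (h0 ▸ dvd_zero _)
    have := mul_self_pos.2 this
    omega
  have h2 := (Finset.sum_eq_sum_iff_of_le h1).1 (by rw [hs]; simp) i (Finset.mem_univ i)
  exact mul_self_eq_one_iff.1 h2.symm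

theorem exists_of_sum_sq_eq_four' {ι : Type*} [Fintype ι] {k : ι → ℤ} (h : ∀ i, (2 : ℤ) ∣ k i)
    (hs : ∑ i, k i * k i = 4) : ∃ j, (k j = 2 ∨ k j = -2) ∧ ∀ i, i ≠ j → k i = 0 := by
  classical
  obtain ⟨j, hj⟩ : ∃ j, k j ≠ 0 := by
    by_contra! h0
    simp [h0] at hs
  obtain ⟨m, hm⟩ := h j
  have hm0 : m ≠ 0 := fun h0 => hj (by rw [hm, h0, mul_zero])
  have hm1 : 1 ≤ m * m := by have := mul_self_pos.2 hm0; omega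
  rw [← Finset.add_sum_erase _ _ (Finset.mem_univ j)] at hs
  have hnn : ∀ i ∈ Finset.univ.erase j, 0 ≤ k i * k i := fun i _ => mul_self_nonneg _
  have h0 := Finset.sum_nonneg hnn
  have h1 : m * m = 1 ∧ ∑ i ∈ Finset.univ.erase j, k i * k i = 0 := by
    rw [hm] at hs; constructor <;> nlinarith
  refine ⟨j, ?_, fun i hi => ?_⟩
  · rcases mul_self_eq_one_iff.1 h1.1 with h2 | h2 <;> rw [hm, h2] <;> norm_num
  · exact mul_self_eq_zero.1 ((Finset.sum_eq_zero_iff_of_nonneg hnn).1 h1.2 i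
      (Finset.mem_erase.2 ⟨hi, Finset.mem_univ i⟩))

/-- A frame of type `D₅` together with a fundamental weight `l` in a root system of type `E₆`. -/
structure E6Frame (Φ : Set V) (f : Fin 5 → V) (l : V) : Prop extends Frame Φ f where
  perp : ∀ i, ⟪f i, l⟫ = 0
  norm : ⟪l, l⟫ = 4 / 3
  span : ⊤ ≤ Submodule.span ℝ (insert l (Set.range f))
  spin : ∀ e : Fin 5 → ℝ, (∀ i, e i = 1 ∨ e i = -1) → ∏ i, e i = 1 →
    (1 / 2 : ℝ) • ∑ i, e i • f i + (3 / 4 : ℝ) • l ∈ Φ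
  weight : ∀ r ∈ Φ, ∃ n : ℤ, ⟪r, l⟫ = n
  weight_sub : ∀ i, ∀ r ∈ Φ, ∃ n : ℤ, ⟪r, f i - (1 / 2 : ℝ) • l⟫ = n

namespace E6Frame
variable {Φ : Set V} {f : Fin 5 → V} {l : V} {w : V ≃ₗᵢ[ℝ] V}

theorem sum_repr (h : E6Frame Φ f l) (x : V) :
    ∑ i, ⟪f i, x⟫ • f i + (3 / 4 * ⟪l, x⟫) • l = x := by
  rw [← sub_eq_zero]
  set y := ∑ i, ⟪f i, x⟫ • f i + (3 / 4 * ⟪l, x⟫) • l - x with hy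
  have hp : ∀ i, ⟪l, f i⟫ = 0 := fun i => by rw [real_inner_comm, h.perp]
  have : y ∈ (Submodule.span ℝ (insert l (Set.range f)))ᗮ := by
    rw [Submodule.mem_orthogonal]
    intro u hu
    induction hu using Submodule.span_induction with
    | mem u hu =>
      rcases hu with rfl | ⟨i, rfl⟩
      · simp [hy, inner_add_right, inner_sub_right, inner_sum, real_inner_smul_right, hp, h.norm,
          -inner_self_eq_norm_sq_to_K]
        ring
      · rw [hy, inner_sub_right, inner_add_right, h.orthonormal.inner_right_fintype,
          real_inner_smul_right, h.perp]
        ring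
    | zero => exact inner_zero_left _
    | add u v _ _ hu hv => rw [inner_add_left, hu, hv, add_zero]
    | smul c u _ hu => rw [real_inner_smul_left, hu, mul_zero]
  rw [top_le_iff.1 h.span, Submodule.top_orthogonal_eq_bot] at this
  exact this

theorem inner_self_eq (h : E6Frame Φ f l) (x : V) :
    ⟪x, x⟫ = ∑ i, ⟪f i, x⟫ * ⟪f i, x⟫ + 3 / 4 * ⟪l, x⟫ * ⟪l, x⟫ := by
  have := congrArg (fun y => ⟪y, x⟫) (h.sum_repr x)
  simp only [inner_add_left, sum_inner, real_inner_smul_left] at this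
  exact this.symm

theorem exists_coords (h : E6Frame Φ f l) {x : V} (hx : ∀ r ∈ Φ, ∃ n : ℤ, ⟪r, x⟫ = n) :
    ∃ k : Fin 5 → ℤ, (∀ i, ⟪f i, x⟫ = k i / 2) ∧ ∀ i j, (2 : ℤ) ∣ k i - k j := by
  have h1 : ∀ i, ∃ k : ℤ, ⟪f i, x⟫ = k / 2 := fun i => by
    obtain ⟨j, hj⟩ := exists_ne i
    obtain ⟨m, hm⟩ := hx _ (h.add_mem i j hj.symm)
    obtain ⟨n, hn⟩ := hx _ (h.sub_mem i j hj.symm)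
    rw [inner_add_left] at hm
    rw [inner_sub_left] at hn
    exact ⟨m + n, by push_cast; linarith⟩
  choose k hk using h1
  refine ⟨k, hk, fun i j => ?_⟩
  rcases eq_or_ne i j with rfl | hij
  · simp
  obtain ⟨n, hn⟩ := hx _ (h.sub_mem i j hij)
  rw [inner_sub_left, hk, hk] at hn
  refine ⟨n, ?_⟩
  have : (k i : ℝ) - k j = 2 * n := by linarith
  exact_mod_cast this

theorem exists_int_map (hΦ : IsRoot Φ) {x : V} (hx : ∀ r ∈ Φ, ∃ n : ℤ, ⟪r, x⟫ = n)
    (hw : w ∈ weyl Φ) : ∀ r ∈ Φ, ∃ n : ℤ, ⟪r, w x⟫ = n := fun r hr => by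
  rw [← inner_inv_left]
  exact hx _ (hΦ.map_mem (inv_mem hw) r hr)

theorem signed_of_fixed (h : E6Frame Φ f l) (hΦ : IsRoot Φ) (hw : w ∈ weyl Φ) (hl : w l = l)
    (i : Fin 5) : ∃ j, w (f i) = f j ∨ w (f i) = -f j := by
  have hint := exists_int_map hΦ (h.weight_sub i) hw
  rw [map_sub, map_smul, hl] at hint
  obtain ⟨k, hk, hp⟩ := h.exists_coords hint
  simp only [inner_sub_right, real_inner_smul_right, h.perp, mul_zero, sub_zero] at hk
  have hwl : ⟪l, w (f i)⟫ = 0 := by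
    conv_lhs => rw [← hl]
    rw [w.inner_map_map, real_inner_comm, h.perp]
  have hsq : ∑ j, k j * k j = 4 := by
    have := h.inner_self_eq (w (f i))
    rw [w.inner_map_map, h.inner_self, hwl] at this
    simp only [hk] at this
    have h4 : (∑ j, (k j : ℝ) * k j) = 4 := by
      simp only [Fin.sum_univ_five] at this ⊢; linarith
    exact_mod_cast h4
  have heven : ∀ j, (2 : ℤ) ∣ k j := by
    by_contra! hcon
    obtain ⟨j, hj⟩ := hcon
    have hodd : ∀ i, ¬ (2 : ℤ) ∣ k i := fun i hi => hj (by have := hp i j; omega)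
    have h1 : ∀ i, (1 : ℤ) ≤ k i * k i := fun i => by
      have : k i ≠ 0 := fun h0 => hodd i (h0 ▸ dvd_zero _)
      have := mul_self_pos.2 this
      omega
    have := Finset.sum_le_sum fun i (_ : i ∈ Finset.univ) => h1 i
    rw [hsq] at this
    simp at this
  obtain ⟨j, hj, hz⟩ := exists_of_sum_sq_eq_four' heven hsq
  have hs := h.sum_repr (w (f i))
  rw [hwl, mul_zero, zero_smul, add_zero,
    Finset.sum_eq_single j (fun m _ hm => by rw [hk, hz m hm]; simp) (by simp), hk] at hs
  refine ⟨j, ?_⟩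
  rcases hj with hj | hj <;> rw [hj] at hs <;> rw [← hs] <;> norm_num

theorem inner_weight (h : E6Frame Φ f l) (hΦ : IsRoot Φ) (hw : w ∈ weyl Φ) :
    ∃ n : ℤ, ⟪w l, l⟫ = 4 / 3 + n := by
  refine weyl_induction (p := fun w => ∃ n : ℤ, ⟪w l, l⟫ = 4 / 3 + n) ⟨0, ?_⟩ ?_ hw
  · change ⟪l, l⟫ = _
    rw [h.norm]; norm_num
  · rintro a ha g hg ⟨n, hn⟩
    obtain ⟨m, hm⟩ := exists_int_map hΦ h.weight hg a ha
    obtain ⟨k, hk⟩ := h.weight a ha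
    refine ⟨n - m * k, ?_⟩
    rw [mul_apply, refl_apply (hΦ.norm a ha), inner_sub_left, real_inner_smul_left, hn, hm, hk]
    push_cast; ring

/-- The case where the weight and its image differ by a root. -/
theorem false_of_inner_eq_third [FiniteDimensional ℝ V] (h : E6Frame Φ f l) (hw : Critical Φ w)
    (h3 : ⟪w l, l⟫ = 1 / 3) : False := by
  have hint := exists_int_map hw.isRoot h.weight hw.mem
  obtain ⟨k, hk, hp⟩ := h.exists_coords hint
  have h3' : ⟪l, w l⟫ = 1 / 3 := by rw [real_inner_comm, h3]
  have hsq : ∑ j, k j * k j = 5 := by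
    have := h.inner_self_eq (w l)
    rw [w.inner_map_map, h.norm, h3'] at this
    simp only [hk] at this
    have h4 : (∑ j, (k j : ℝ) * k j) = 5 := by
      simp only [Fin.sum_univ_five] at this ⊢; linarith
    exact_mod_cast h4
  have hodd : ∀ i, ¬ (2 : ℤ) ∣ k i := by
    intro i hi
    have : (2 : ℤ) ∣ ∑ j, k j * k j := Finset.dvd_sum fun j _ =>
      Dvd.dvd.mul_right (by have := hp i j; omega) _
    rw [hsq] at this
    omega
  have hk1 := sq_eq_of_sum_eq_card hodd hsq
  set e : Fin 5 → ℝ := fun i => -(k i : ℝ) with he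
  have hs : ∀ i, e i = 1 ∨ e i = -1 := fun i => by
    rcases hk1 i with h | h <;> simp [he, h]
  have hes : ∀ i, e i * e i = 1 := fun i => by rcases hs i with h | h <;> rw [h] <;> norm_num
  have hprod : ∏ i, e i = 1 := by
    obtain ⟨n, hn⟩ := hint _ (h.spin (fun _ => 1) (by simp) (by simp))
    have hn' : (1 + k 0 + k 1 + k 2 + k 3 + k 4 : ℤ) = 4 * n := by
      rw [inner_add_left, real_inner_smul_left, real_inner_smul_left, sum_inner, h3'] at hn
      simp only [one_smul, hk, Fin.sum_univ_five] at hn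
      have : (1 + k 0 + k 1 + k 2 + k 3 + k 4 : ℝ) = 4 * n := by linarith
      exact_mod_cast this
    have : ∏ i, -k i = 1 := by
      rw [Fin.prod_univ_five]
      rcases hk1 0 with h0 | h0 <;> rcases hk1 1 with h1 | h1 <;> rcases hk1 2 with h2 | h2 <;>
        rcases hk1 3 with h3 | h3 <;> rcases hk1 4 with h4 | h4 <;>
        rw [h0, h1, h2, h3, h4] at hn' ⊢ <;> omega
    simp only [he]; exact_mod_cast this
  have hwl : w l = (1 / 4 : ℝ) • l - (1 / 2 : ℝ) • ∑ i, e i • f i := by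
    rw [← h.sum_repr (w l), h3', Finset.smul_sum, sub_eq_add_neg, ← Finset.sum_neg_distrib,
      add_comm]
    congr 1
    · norm_num
    · refine Finset.sum_congr rfl fun i _ => ?_
      rw [hk, he]; module
  set α := (1 / 2 : ℝ) • ∑ i, e i • f i + (3 / 4 : ℝ) • l with hα
  have hαΦ : α ∈ Φ := h.spin e hs hprod
  have hαl : α = l - w l := by rw [hα, hwl]; module
  have hfix : (refl α * w) l = l := by
    rw [mul_apply, refl_apply (hw.isRoot.norm α hαΦ), hαl, inner_sub_left, h3', w.inner_map_map,
      h.norm]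
    module
  have hg := h.signs hw.isRoot hs
  have hwsign := h.signed_of_fixed hw.isRoot (mul_mem (refl_mem_weyl hαΦ) hw.mem) hfix
  obtain ⟨σ, t, ht, hσ⟩ := exists_perm_of_signed hg.orthonormal (w := refl α * w) fun i => by
    obtain ⟨j, hj⟩ := hwsign i
    refine ⟨j, ?_⟩
    rw [map_smul]
    rcases hj with hj | hj <;> rw [hj] <;> rcases hs i with h1 | h1 <;>
      rcases hs j with h2 | h2 <;> rw [h1, h2] <;> simp
  obtain ⟨u, hu, hufix, hrev⟩ := exists_weyl_reversing hg.orthonormal hg.sub_mem ht hσ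
    (exists_reflection_symm_of_card_le_five (by simp) σ ht)
  have hul : u l = l := hufix l fun i j => by
    simp only [inner_sub_left, real_inner_smul_left, h.perp]; ring
  refine hw.false_of_refl_mul hαΦ hu (hufix α fun i j => ?_)
    (S := insert l (Set.range fun i => e i • f i)) ?_ ?_
  · simp only [hα, inner_sub_left, inner_add_right]
    simp only [real_inner_smul_left, real_inner_smul_right, h.perp,
      h.orthonormal.inner_right_fintype]
    linear_combination (1 / 2) * hes i - (1 / 2) * hes j
  · refine h.span.trans (Submodule.span_le.2 ?_)
    rintro _ (rfl | ⟨i, rfl⟩)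
    · exact Submodule.subset_span (Or.inl rfl)
    · have := Submodule.smul_mem _ (e i) (Submodule.subset_span (R := ℝ)
        (Set.mem_insert_of_mem l (Set.mem_range_self (f := fun i => e i • f i) i)))
      rwa [smul_smul, hes, one_smul] at this
  · rintro _ (rfl | ⟨i, rfl⟩)
    · rw [hfix, hul, hfix]
    · exact hrev i

theorem inner_eq_neg [FiniteDimensional ℝ V] (h : E6Frame Φ f l) (hw : Critical Φ w) :
    ⟪w l, l⟫ = -(2 / 3) := by
  obtain ⟨n, hn⟩ := h.inner_weight hw.isRoot hw.mem
  have h0 : l ≠ 0 := fun h0 => by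
    have := h.norm; rw [h0, inner_zero_left] at this; norm_num at this
  have h1 : ⟪w l - l, w l - l⟫ = -(2 * n) := by
    rw [inner_sub_left, inner_sub_right, inner_sub_right, w.inner_map_map, real_inner_comm (w l) l, hn,
      h.norm]
    ring
  have h2 : ⟪w l + l, w l + l⟫ = 16 / 3 + 2 * n := by
    rw [inner_add_left, inner_add_right, inner_add_right, w.inner_map_map, real_inner_comm (w l) l, hn,
      h.norm]
    ring
  have h3 : n ≤ 0 := by
    have : 0 ≤ ⟪w l - l, w l - l⟫ := real_inner_self_nonneg
    have : (n : ℝ) ≤ 0 := by linarith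
    exact_mod_cast this
  have h4 : -3 < n := by
    have : 0 ≤ ⟪w l + l, w l + l⟫ := real_inner_self_nonneg
    have : (-3 : ℝ) < n := by linarith
    exact_mod_cast this
  obtain rfl | rfl | rfl : n = 0 ∨ n = -1 ∨ n = -2 := by omega
  · rw [Int.cast_zero, mul_zero, neg_zero, inner_self_eq_zero, sub_eq_zero] at h1
    exact absurd (hw.eq_zero_of_fixed h1) h0
  · exact (h.false_of_inner_eq_third hw (by rw [hn]; norm_num)).elim
  · rw [hn]; norm_num

theorem inner_map_eq_neg [FiniteDimensional ℝ V] (h : E6Frame Φ f l) (hw : Critical Φ w)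
    {g : V ≃ₗᵢ[ℝ] V} (hg : g ∈ weyl Φ) : ⟪w (g l), g l⟫ = -(2 / 3) := by
  have := h.inner_eq_neg (hw.conj (inv_mem hg))
  rw [inv_inv, mul_apply, mul_apply, inner_inv_left] at this
  exact this

theorem sq_add_eq_zero [FiniteDimensional ℝ V] (h : E6Frame Φ f l) (hw : Critical Φ w) :
    w (w l) + w l + l = 0 := by
  have hF : ∀ i (c : ℝ), c = 1 ∨ c = -1 →
      ∃ g ∈ weyl Φ, g l = -((1 / 2 : ℝ) • l) - c • f i := by
    intro i c hc
    have hcc : c * c = 1 := by rcases hc with h | h <;> rw [h] <;> norm_num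
    set e : Fin 5 → ℝ := fun j => if j = i ∨ j = i + 1 then c else 1 with he
    set e' : Fin 5 → ℝ := fun j => if j = i then c else -e j with he'
    have hs : ∀ j, e j = 1 ∨ e j = -1 := fun j => by
      simp only [he]; split_ifs
      exacts [hc, Or.inl rfl]
    have hs' : ∀ j, e' j = 1 ∨ e' j = -1 := fun j => by
      simp only [he']; split_ifs
      · exact hc
      · rcases hs j with h | h <;> rw [h] <;> norm_num
    have hp : ∏ j, e j = 1 := by
      rw [Fin.prod_univ_five]; fin_cases i <;> simp [he] <;> simp [hcc]
    have hp' : ∏ j, e' j = 1 := by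
      rw [Fin.prod_univ_five]; fin_cases i <;> simp [he', he] <;> simp [hcc]
    have hr := h.spin e hs hp
    have hr' := h.spin e' hs' hp'
    have hrr : (1 / 2 : ℝ) • ∑ i, e i • f i + (3 / 4 : ℝ) • l +
        ((1 / 2 : ℝ) • ∑ i, e' i • f i + (3 / 4 : ℝ) • l) = c • f i + (3 / 2 : ℝ) • l := by
      have h1 : ∑ j, e j • f j + ∑ j, e' j • f j = (2 * c) • f i := by
        rw [← Finset.sum_add_distrib, Finset.sum_eq_single i]
        · simp [he, he']; module
        · intro j _ hj
          simp [he', hj]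
        · simp
      calc _ = (1 / 2 : ℝ) • (∑ j, e j • f j + ∑ j, e' j • f j) + (3 / 2 : ℝ) • l := by module
        _ = _ := by rw [h1]; module
    set r := (1 / 2 : ℝ) • ∑ i, e i • f i + (3 / 4 : ℝ) • l with hrd
    set r' := (1 / 2 : ℝ) • ∑ i, e' i • f i + (3 / 4 : ℝ) • l with hrd'
    have hl : ⟪r, l⟫ = 1 := by
      simp [hrd, inner_add_left, real_inner_smul_left, sum_inner, h.perp, h.norm,
        -inner_self_eq_norm_sq_to_K]
    have hl' : ⟪r', l⟫ = 1 := by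
      simp [hrd', inner_add_left, real_inner_smul_left, sum_inner, h.perp, h.norm,
        -inner_self_eq_norm_sq_to_K]
    have h0 : ⟪r', r⟫ = 0 := by
      have h1 : ⟪r, r⟫ = 2 := hw.isRoot.norm r hr
      have h2 : ⟪r', r'⟫ = 2 := hw.isRoot.norm r' hr'
      have h3 : ⟪r + r', r + r'⟫ = 4 := by
        rw [hrr, inner_add_left, inner_add_right, inner_add_right]
        simp only [real_inner_smul_left, real_inner_smul_right, h.inner_self, h.norm,
          real_inner_comm (f i) l, h.perp]
        linarith
      rw [inner_add_left r, inner_add_right r, inner_add_right r', h1, h2, real_inner_comm r' r] at h3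
      linarith
    refine ⟨refl r' * refl r, mul_mem (refl_mem_weyl hr') (refl_mem_weyl hr), ?_⟩
    rw [mul_apply, refl_apply (hw.isRoot.norm r hr), refl_apply (hw.isRoot.norm r' hr'),
      inner_sub_right, real_inner_smul_right, hl, hl', h0]
    have : r = c • f i + (3 / 2 : ℝ) • l - r' := by rw [← hrr]; abel
    rw [this]
    module
  have hfl : ∀ i, ⟪f i, w l⟫ + ⟪w (f i), l⟫ = 0 := by
    intro i
    have key : ∀ c : ℝ, c = 1 ∨ c = -1 → ⟪w ((1 / 2 : ℝ) • l + c • f i),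
        (1 / 2 : ℝ) • l + c • f i⟫ = -(2 / 3) := fun c hc => by
      obtain ⟨g, hg, hgl⟩ := hF i c hc
      have := h.inner_map_eq_neg hw hg
      rw [hgl, show -((1 / 2 : ℝ) • l) - c • f i = -((1 / 2 : ℝ) • l + c • f i) by abel, map_neg,
        inner_neg_neg] at this
      exact this
    have h1 := key 1 (Or.inl rfl)
    have h2 := key (-1) (Or.inr rfl)
    simp only [map_add, map_smul, inner_add_left, inner_add_right, real_inner_smul_left,
      real_inner_smul_right] at h1 h2
    rw [real_inner_comm (w l) (f i)]
    linarith
  have hz : w l + w⁻¹ l + l = 0 := by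
    have h1 : ⟪l, w l + w⁻¹ l + l⟫ = 0 := by
      rw [inner_add_right, inner_add_right, inner_inv_right, real_inner_comm (w l) l, h.norm,
        h.inner_eq_neg hw]
      norm_num
    have h2 : ∀ i, ⟪f i, w l + w⁻¹ l + l⟫ = 0 := fun i => by
      rw [inner_add_right, inner_add_right, inner_inv_right, h.perp, hfl, add_zero]
    rw [← h.sum_repr (w l + w⁻¹ l + l), h1]
    simp only [h2, zero_smul, Finset.sum_const_zero, mul_zero, add_zero]
  have := congrArg w hz
  rw [map_add, map_add, apply_inv_self, map_zero] at this
  rw [← this]; abel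

theorem false_of_critical [FiniteDimensional ℝ V] (h : E6Frame Φ f l) (hw : Critical Φ w) :
    False := by
  have hr := h.spin (fun _ => 1) (by simp) (by simp)
  set r := (1 / 2 : ℝ) • ∑ i, (1 : ℝ) • f i + (3 / 4 : ℝ) • l with hr'
  have h1 := h.sq_add_eq_zero hw
  have h2 := h.sq_add_eq_zero (hw.conj (k := (refl r)⁻¹) (inv_mem (refl_mem_weyl hr)))
  refine hw.sq_add_ne_zero hr ?_
  have h3 : refl r l = l - r := by
    rw [refl_apply (hw.isRoot.norm r hr), hr', inner_add_left, real_inner_smul_left, sum_inner,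
      real_inner_smul_left, h.norm]
    simp only [one_smul, h.perp]
    simp
  rw [inv_inv] at h2
  simp only [mul_apply, apply_inv_self] at h2
  have h4 := congrArg (refl r) h2
  rw [map_zero, map_add, map_add, apply_inv_self, apply_inv_self, h3] at h4
  simp only [map_sub] at h4
  have h5 : w (w r) + w r + r = (w (w l) + w l + l) -
    (w (w l) - w (w r) + (w l - w r) + (l - r)) := by abel
  rw [h5, h1, h4, sub_zero]

end E6Frame

theorem Diagram.false_of_six [FiniteDimensional ℝ V] {Φ : Set V} {a : ℕ → V} {w : V ≃ₗᵢ[ℝ] V}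
    (D : Diagram Φ a 6 3 1) (h : Critical Φ w) {ρ : V} {Δ : Finset V} (b : IsBase Φ ρ Δ)
    (hΔ : ∀ d, d ∈ Δ ↔ ∃ i < 6, a i = d) : False := by
  have G : ∀ i < 6, ∀ j < 6, _ := fun i hi j hj =>
    D.inner_eq h.isRoot (by norm_num) (by norm_num) hi hj
  have hm : ∀ i < 6, a i ∈ Φ := D.mem
  have P := D.path_of_three h.isRoot (by norm_num)
  have h1 := D.norm_of_three h.isRoot (by norm_num)
  have hF := P.frame h.isRoot (fun i h2 h3 => hm _ (by omega)) h1 (by norm_num) (by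
      convert hm 0 (by norm_num) using 1
      module)
  set f := fun i : Fin 5 => pathFrame ((1 / 2 : ℝ) • (a 0 - a 2)) (fun i => a (i + 1)) i with hf
  set e₀ : Fin 5 → ℝ := ![1, -1, -1, -1, -1] with he₀
  have hs₀ : ∀ i, e₀ i = 1 ∨ e₀ i = -1 := by intro i; fin_cases i <;> simp [he₀]
  set l := (4 / 3 : ℝ) • (a 1 - (1 / 2 : ℝ) • ∑ i, e₀ i • f i) with hl
  have ha1 : a 1 = (1 / 2 : ℝ) • ∑ i, e₀ i • f i + (3 / 4 : ℝ) • l := by rw [hl]; module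
  have hfa : ∀ i, ∀ j, 2 ≤ j → j < 6 → ⟪f i, a j⟫ =
      (if (i : ℕ) + 1 = j then 1 else 0) - if (i : ℕ) + 2 = j then 1 else 0 := fun i j h2 h3 => by
    obtain ⟨j, rfl⟩ : ∃ k, j = k + 1 := ⟨j - 1, by omega⟩
    have := P.inner_eq (i := i) (j := j) i.2 (by omega) (by omega)
    rw [this]
    simp only [Nat.add_right_cancel_iff, show (i : ℕ) + 2 = j + 1 ↔ (i : ℕ) + 1 = j by omega]
  have hfa1 : ∀ i, ⟪f i, a 1⟫ = 1 / 2 * e₀ i := fun i => by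
    fin_cases i <;> simp [hf, pathFrame, he₀, inner_add_left, inner_sub_left, real_inner_smul_left,
      G, -inner_self_eq_norm_sq_to_K] <;> norm_num
  have ha0 : a 0 = f 0 + f 1 := by simp [hf, pathFrame]; module
  have hfa0 : ∀ i, ⟪f i, a 0⟫ = (if i = 0 then 1 else 0) + if i = 1 then 1 else 0 := fun i => by
    rw [ha0, inner_add_right, hF.inner_eq, hF.inner_eq]
  have hperp : ∀ i, ⟪f i, l⟫ = 0 := fun i => by
    rw [hl, real_inner_smul_right, inner_sub_right, real_inner_smul_right,
      hF.orthonormal.inner_right_fintype, hfa1, sub_self, mul_zero]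
  have hperp' : ∀ i, ⟪l, f i⟫ = 0 := fun i => by rw [real_inner_comm, hperp]
  have hsum : ⟪∑ i, e₀ i • f i, ∑ i, e₀ i • f i⟫ = 5 := by
    rw [hF.orthonormal.inner_sum]; simp [Fin.sum_univ_five, he₀]; norm_num
  have hnorm : ⟪l, l⟫ = 4 / 3 := by
    have h2 : ⟪a 1, a 1⟫ = 2 := h.isRoot.norm _ (hm 1 (by norm_num))
    have h3 : ⟪∑ i, e₀ i • f i, l⟫ = 0 := by
      simp [sum_inner, real_inner_smul_left, hperp]
    have h4 : ⟪l, ∑ i, e₀ i • f i⟫ = 0 := by rw [real_inner_comm, h3]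
    rw [ha1] at h2
    simp only [inner_add_left, inner_add_right, real_inner_smul_left, real_inner_smul_right, hsum,
      h3, h4] at h2
    linarith
  have hla : ∀ j < 6, ⟪a j, l⟫ = if j = 1 then 1 else 0 := fun j hj => by
    rcases Nat.lt_or_ge 1 j with h2 | h2
    · have := Path.span_le (f₀ := (1 / 2 : ℝ) • (a 0 - a 2)) (a := fun i => a (i + 1)) (n := 5)
        (i := j - 1) (by omega) (by omega)
      simp only [show j - 1 + 1 = j by omega] at this
      rw [if_neg (by omega)]
      refine Submodule.span_induction (p := fun x _ => ⟪x, l⟫ = 0) ?_ (inner_zero_left _)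
        (fun x y _ _ hx hy => by rw [inner_add_left, hx, hy, add_zero])
        (fun c x _ hx => by rw [real_inner_smul_left, hx, mul_zero]) this
      rintro _ ⟨i, rfl⟩
      exact hperp i
    · obtain rfl | rfl : j = 0 ∨ j = 1 := by omega
      · rw [ha0, inner_add_left, hperp, hperp]; norm_num
      · rw [ha1, inner_add_left, real_inner_smul_left, real_inner_smul_left, hnorm, sum_inner]
        simp [real_inner_smul_left, hperp]
  have hint : ∀ d ∈ Δ, ∀ e ∈ Δ, ∃ n : ℤ, ⟪d, e⟫ = n := fun d hd e he => by
    obtain ⟨i, hi, rfl⟩ := (hΔ d).1 hd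
    obtain ⟨j, hj, rfl⟩ := (hΔ e).1 he
    rw [G i hi j hj]
    split_ifs
    exacts [⟨2, by norm_num⟩, ⟨-1, by norm_num⟩, ⟨0, by norm_num⟩, ⟨-1, by norm_num⟩,
      ⟨0, by norm_num⟩, ⟨-1, by norm_num⟩, ⟨0, by norm_num⟩]
  have hE : E6Frame Φ f l := by
    refine ⟨hF, hperp, hnorm, ?_, fun e he hp => ?_,
      b.exists_int_inner_of_base h.isRoot hint fun d hd => ?_,
      fun i => b.exists_int_inner_of_base h.isRoot hint fun d hd => ?_⟩
    · have hml : l ∈ Submodule.span ℝ (insert l (Set.range f)) :=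
        Submodule.subset_span (Or.inl rfl)
      have hmf : ∀ i, f i ∈ Submodule.span ℝ (insert l (Set.range f)) := fun i =>
        Submodule.subset_span (Or.inr ⟨i, rfl⟩)
      refine b.top_le_span h fun d hd => ?_
      obtain ⟨j, hj, rfl⟩ := (hΔ d).1 hd
      rcases Nat.lt_or_ge 1 j with h2 | h2
      · have := Path.span_le (f₀ := (1 / 2 : ℝ) • (a 0 - a 2)) (a := fun i => a (i + 1)) (n := 5)
          (i := j - 1) (by omega) (by omega)
        simp only [show j - 1 + 1 = j by omega] at this
        exact Submodule.span_mono (Set.subset_insert _ _) this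
      · obtain rfl | rfl : j = 0 ∨ j = 1 := by omega
        · rw [ha0]
          exact Submodule.add_mem _ (hmf _) (hmf _)
        · rw [ha1]
          exact Submodule.add_mem _ (Submodule.smul_mem _ _ (Submodule.sum_mem _ fun i _ =>
            Submodule.smul_mem _ _ (hmf i))) (Submodule.smul_mem _ _ hml)
    · exact hF.spin_mem h.isRoot (fun i => by rw [real_inner_smul_right, hperp, mul_zero]) hs₀
        (ha1 ▸ hm 1 (by norm_num)) he (by rw [hp]; simp [Fin.prod_univ_five, he₀])
    · obtain ⟨j, hj, rfl⟩ := (hΔ d).1 hd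
      rw [hla j hj]
      exact ⟨if j = 1 then 1 else 0, by push_cast; rfl⟩
    · obtain ⟨j, hj, rfl⟩ := (hΔ d).1 hd
      rw [inner_sub_right, real_inner_smul_right, hla j hj, real_inner_comm]
      rcases Nat.lt_or_ge 1 j with h2 | h2
      · rw [hfa i j h2 hj, if_neg (show j ≠ 1 by omega)]
        exact ⟨(if (i : ℕ) + 1 = j then 1 else 0) - if (i : ℕ) + 2 = j then 1 else 0, by
          push_cast; ring⟩
      · obtain rfl | rfl : j = 0 ∨ j = 1 := by omega
        · rw [hfa0]
          exact ⟨(if i = 0 then 1 else 0) + if i = 1 then 1 else 0, by push_cast; norm_num⟩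
        · rw [hfa1]
          rcases hs₀ i with h3 | h3 <;> rw [h3]
          · exact ⟨0, by norm_num⟩
          · exact ⟨-1, by norm_num⟩
  exact hE.false_of_critical h

end

section

variable {V : Type*} [NormedAddCommGroup V] [InnerProductSpace ℝ V]

section transport
variable {V' : Type*} [NormedAddCommGroup V'] [InnerProductSpace ℝ V']

/-- Conjugation of linear isometries by an isometry between two spaces. -/
def transport (e : V ≃ₗᵢ[ℝ] V') : (V ≃ₗᵢ[ℝ] V) ≃* (V' ≃ₗᵢ[ℝ] V') where
  toFun g := (e.symm.trans g).trans e
  invFun g := (e.trans g).trans e.symm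
  left_inv g := by ext x; simp
  right_inv g := by ext x; simp
  map_mul' g k := by ext x; simp [mul_apply]

theorem transport_apply (e : V ≃ₗᵢ[ℝ] V') (g : V ≃ₗᵢ[ℝ] V) (x : V') :
    transport e g x = e (g (e.symm x)) := rfl

theorem map_refl (e : V ≃ₗᵢ[ℝ] V') {a : V} (ha : ⟪a, a⟫ = 2) (x : V) :
    e (refl a x) = refl (e a) (e x) := by
  rw [refl_apply ha, refl_apply (by rwa [e.inner_map_map])]
  simp [e.inner_map_map]

theorem IsRoot.image {Φ : Set V} (h : IsRoot Φ) (e : V ≃ₗᵢ[ℝ] V') : IsRoot (e '' Φ) where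
  finite := h.finite.image e
  norm := by
    rintro _ ⟨a, ha, rfl⟩
    rw [e.inner_map_map, h.norm a ha]
  refl_mem := by
    rintro _ ⟨a, ha, rfl⟩ _ ⟨b, hb, rfl⟩
    exact ⟨_, h.refl_mem a ha b hb, map_refl e (h.norm a ha) b⟩

theorem IsRoot.weyl_image {Φ : Set V} (h : IsRoot Φ) (e : V ≃ₗᵢ[ℝ] V') :
    weyl (e '' Φ) = (weyl Φ).map (transport e).toMonoidHom := by
  rw [weyl, weyl, MonoidHom.map_closure, Set.image_image, Set.image_image]
  congr 1
  refine Set.image_congr fun a ha => ?_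
  ext x
  refine Eq.trans ?_ (transport_apply e (refl a) x).symm
  rw [map_refl e (h.norm a ha), e.apply_symm_apply]

theorem Reversible.image {Φ : Set V} (hr : Reversible Φ) (h : IsRoot Φ) (e : V ≃ₗᵢ[ℝ] V') :
    Reversible (e '' Φ) := by
  intro w hw
  rw [h.weyl_image e] at hw ⊢
  obtain ⟨w, hw, rfl⟩ := hw
  obtain ⟨g, hg, hgw⟩ := hr w hw
  refine ⟨_, ⟨g, hg, rfl⟩, ?_⟩
  rw [← map_inv, ← map_inv, ← map_mul, ← map_mul, hgw]

theorem Critical.image {Φ : Set V} {w : V ≃ₗᵢ[ℝ] V} (h : Critical Φ w) (e : V ≃ₗᵢ[ℝ] V') :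
    Critical (e '' Φ) (transport e w) where
  isRoot := h.isRoot.image e
  span := by
    have := Submodule.span_image (R := ℝ) (s := Φ) e.toLinearEquiv.toLinearMap
    rw [h.span, Submodule.map_top, LinearMap.range_eq_top.2 e.surjective] at this
    exact this
  mem := by
    rw [h.isRoot.weyl_image e]
    exact ⟨w, h.mem, rfl⟩
  irrev := by
    rw [h.isRoot.weyl_image e]
    rintro _ ⟨g, hg, rfl⟩ hgw
    refine h.irrev g hg ((transport e).injective ?_)
    rw [map_mul, map_mul, map_inv, map_inv]
    exact hgw
  ih Ψ hΨ hR := by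
    have h1 : e '' (e.symm '' Ψ) = Ψ := by
      rw [Set.image_image]; simp
    rw [← h1]
    refine (h.ih _ ?_ (hR.image e.symm)).image (hR.image e.symm) e
    rw [← h1, ssubset_iff_subset_not_subset, Set.image_subset_image_iff e.injective,
      Set.image_subset_image_iff e.injective] at hΨ
    exact hΨ

theorem exists_isometry_of_inner_eq {n : ℕ} {f : Fin n → V} {g : Fin n → V'}
    [FiniteDimensional ℝ V'] (hf : LinearIndependent ℝ f) (hs : ⊤ ≤ Submodule.span ℝ (Set.range f))
    (hn : Module.finrank ℝ V' = n) (hfg : ∀ i j, ⟪f i, f j⟫ = ⟪g i, g j⟫) :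
    ∃ e : V ≃ₗᵢ[ℝ] V', ∀ i, e (f i) = g i := by
  let B := Module.Basis.mk hf hs
  have hB : ∀ i, B i = f i := fun i => Module.Basis.mk_apply hf hs i
  let L := B.constr ℝ g
  have hL : ∀ i, L (f i) = g i := fun i => by rw [← hB, Module.Basis.constr_basis]
  have hin : ∀ x y, ⟪L x, L y⟫ = ⟪x, y⟫ := by
    intro x y
    rw [← B.sum_repr x, ← B.sum_repr y]
    simp only [map_sum, map_smul, hB, hL, sum_inner, inner_sum, real_inner_smul_left,
      real_inner_smul_right, hfg]
  have : FiniteDimensional ℝ V := B.finiteDimensional_of_finite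
  refine ⟨(L.isometryOfInner hin).toLinearIsometryEquiv ?_, fun i => ?_⟩
  · rw [hn, Module.finrank_eq_card_basis B, Fintype.card_fin]
  · exact hL i

end transport

end

section

variable {V : Type*} [NormedAddCommGroup V] [InnerProductSpace ℝ V]

section quaternion
open scoped Quaternion

variable {Φ : Set ℍ[ℝ]} {w : ℍ[ℝ] ≃ₗᵢ[ℝ] ℍ[ℝ]} {a b u : ℍ[ℝ]}

/-- Left multiplication by `a` belongs to the reflection group. -/
def LeftMem (Φ : Set ℍ[ℝ]) (a : ℍ[ℝ]) : Prop := ∃ g ∈ weyl Φ, ∀ x, g x = a * x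

theorem quaternion_mul_star (hu : ⟪u, u⟫ = 1) : u * star u = 1 ∧ star u * u = 1 := by
  rw [Quaternion.inner_self] at hu
  rw [Quaternion.self_mul_star, Quaternion.star_mul_self, hu]
  simp

theorem inner_eq_one_of_sqrt_two_smul (hu : ⟪(√2 : ℝ) • u, (√2 : ℝ) • u⟫ = 2) : ⟪u, u⟫ = 1 := by
  rw [real_inner_smul_left, real_inner_smul_right, ← mul_assoc,
    Real.mul_self_sqrt zero_le_two] at hu
  linarith

theorem refl_sqrt_two_smul (hu : ⟪(√2 : ℝ) • u, (√2 : ℝ) • u⟫ = 2) (x : ℍ[ℝ]) :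
    refl ((√2 : ℝ) • u) x = -(u * star x * u) := by
  have h1 := (quaternion_mul_star (inner_eq_one_of_sqrt_two_smul hu)).2
  have h2 : u * star x + x * star u = ((2 * (u * star x).re : ℝ) : ℍ[ℝ]) := by
    rw [← Quaternion.self_add_star' (u * star x), star_mul, star_star]
  have h3 : u * star x * u + x = (2 * (u * star x).re) • u := by
    rw [← Quaternion.coe_mul_eq_smul, ← h2, add_mul, mul_assoc x, h1, mul_one]
  rw [refl_apply hu, real_inner_smul_left, smul_smul, mul_right_comm,
    Real.mul_self_sqrt zero_le_two, Quaternion.inner_def, ← h3]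
  abel

namespace LeftMem

theorem mul (ha : LeftMem Φ a) (hb : LeftMem Φ b) : LeftMem Φ (a * b) := by
  obtain ⟨g, hg, h1⟩ := ha
  obtain ⟨k, hk, h2⟩ := hb
  exact ⟨g * k, mul_mem hg hk, fun x => by rw [mul_apply, h2, h1, mul_assoc]⟩

theorem one : LeftMem Φ 1 := ⟨1, one_mem _, fun x => by rw [one_mul]; rfl⟩

theorem mul_star (ha : LeftMem Φ a) : a * star a = 1 ∧ star a * a = 1 := by
  obtain ⟨g, hg, h1⟩ := ha
  refine quaternion_mul_star ?_
  rw [← mul_one a, ← h1, g.inner_map_map, Quaternion.inner_self]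
  simp

theorem star (ha : LeftMem Φ a) : LeftMem Φ (star a) := by
  have h := ha.mul_star
  obtain ⟨g, hg, h1⟩ := ha
  refine ⟨g⁻¹, inv_mem hg, fun x => g.injective ?_⟩
  rw [apply_inv_self, h1, ← mul_assoc, h.1, one_mul]

end LeftMem

/-- The reflection group contains the reflection in `1`, and left multiplication by each unit root. -/
structure Quaternionic (Φ : Set ℍ[ℝ]) : Prop where
  isRoot : IsRoot Φ
  one_mem : (√2 : ℝ) • (1 : ℍ[ℝ]) ∈ Φ
  left_mem : ∀ u, (√2 : ℝ) • u ∈ Φ → LeftMem Φ u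

theorem LeftMem.right (hQ : IsRoot Φ) (h1 : (√2 : ℝ) • (1 : ℍ[ℝ]) ∈ Φ) (ha : LeftMem Φ a) :
    ∃ g ∈ weyl Φ, ∀ x, g x = x * Star.star a := by
  obtain ⟨g, hg, hga⟩ := ha
  have hs := refl_sqrt_two_smul (hQ.norm _ h1)
  refine ⟨refl ((√2 : ℝ) • (1 : ℍ[ℝ])) * (g * refl ((√2 : ℝ) • (1 : ℍ[ℝ]))),
    mul_mem (refl_mem_weyl h1) (mul_mem hg (refl_mem_weyl h1)), fun x => ?_⟩
  rw [mul_apply, mul_apply, hs, hs, hga]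
  simp

namespace Quaternionic

theorem exists_mem (hQ : Quaternionic Φ) (ha : LeftMem Φ a) (hb : LeftMem Φ b) :
    ∃ g ∈ weyl Φ, ∀ x, g x = a * x * star b := by
  obtain ⟨g, hg, h1⟩ := ha
  obtain ⟨k, hk, h2⟩ := hb.right hQ.isRoot hQ.one_mem
  exact ⟨g * k, mul_mem hg hk, fun x => by rw [mul_apply, h2, h1, mul_assoc]⟩

theorem cases (hQ : Quaternionic Φ) (hw : w ∈ weyl Φ) : ∃ a b, LeftMem Φ a ∧ LeftMem Φ b ∧
    ((∀ x, w x = a * x * star b) ∨ ∀ x, w x = a * star x * star b) := by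
  refine weyl_induction (p := fun w : ℍ[ℝ] ≃ₗᵢ[ℝ] ℍ[ℝ] => ∃ a b, LeftMem Φ a ∧ LeftMem Φ b ∧
    ((∀ x, w x = a * x * star b) ∨ ∀ x, w x = a * star x * star b))
    ⟨1, 1, .one, .one, .inl fun x => by rw [star_one, one_mul, mul_one]; rfl⟩ ?_ hw
  rintro d hd g - ⟨a, b, ha, hb, h⟩
  obtain ⟨u, rfl⟩ : ∃ u, d = (√2 : ℝ) • u := ⟨(√2 : ℝ)⁻¹ • d, by
    rw [smul_smul, mul_inv_cancel₀ (by positivity), one_smul]⟩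
  have hs := refl_sqrt_two_smul (hQ.isRoot.norm _ hd)
  have hu := hQ.left_mem _ hd
  have hn : LeftMem Φ (-u) := hQ.left_mem _ (by rw [smul_neg]; exact hQ.isRoot.neg_mem hd)
  refine ⟨-u * b, star u * a, hn.mul hb, hu.star.mul ha, ?_⟩
  refine h.symm.imp (fun h x => ?_) (fun h x => ?_) <;>
    rw [mul_apply, h, hs] <;> simp [mul_assoc]

theorem eq_one_or_neg_one {e : ℍ[ℝ]} (he : e * star e = 1) (h : ∀ x, e * x = x * e) :
    e = 1 ∨ e = -1 := by
  obtain ⟨i, hi⟩ : ∃ i : ℍ[ℝ], i.re = 0 ∧ i.imI = 1 ∧ i.imJ = 0 ∧ i.imK = 0 :=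
    ⟨⟨0, 1, 0, 0⟩, rfl, rfl, rfl, rfl⟩
  obtain ⟨j, hj⟩ : ∃ j : ℍ[ℝ], j.re = 0 ∧ j.imI = 0 ∧ j.imJ = 1 ∧ j.imK = 0 :=
    ⟨⟨0, 0, 1, 0⟩, rfl, rfl, rfl, rfl⟩
  have h1 := h i
  have h2 := h j
  have h3 : e * e = 1 := by
    have : star e = e := by
      rw [Quaternion.ext_iff] at h1 h2 ⊢
      simp [hi, hj] at h1 h2 ⊢
      refine ⟨?_, ?_, ?_⟩ <;> linarith [h1.1, h1.2, h2.1, h2.2]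
    rwa [this] at he
  exact mul_self_eq_one_iff.1 h3

theorem exists_conj_eq_star (hQ : Quaternionic Φ)
    (ih : ∀ Ψ, Ψ ⊂ Φ → IsRoot Ψ → Reversible Ψ) (ha : LeftMem Φ a) :
    ∃ c, LeftMem Φ c ∧ c * a = star a * c := by
  obtain ⟨r, hr, hra⟩ := hQ.exists_mem ha ha
  have hr1 : r 1 = 1 := by rw [hra, mul_one, ha.mul_star.1]
  have hr' := hQ.isRoot.mem_weyl_of_fixed hr hr1
  set Ψ := Φ ∩ ((ℝ ∙ (1 : ℍ[ℝ]))ᗮ : Submodule ℝ ℍ[ℝ]) with hΨ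
  have hΨr : IsRoot Ψ := hQ.isRoot.inter _
  have hfix : ∀ g ∈ weyl Ψ, g 1 = 1 := fun g hg =>
    weyl_induction (p := fun g : ℍ[ℝ] ≃ₗᵢ[ℝ] ℍ[ℝ] => g 1 = 1) rfl (fun d hd g _ h => by
      rw [mul_apply, h, refl_eq_of_inner_eq_zero (hΨr.norm d hd)]
      exact (Submodule.mem_orthogonal_singleton_iff_inner_left).1 hd.2) hg
  have hss : Ψ ⊂ Φ := by
    refine ssubset_of_subset_of_ne Set.inter_subset_left fun h => ?_
    have h1 := hQ.one_mem
    rw [← h] at h1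
    have h2 := (Submodule.mem_orthogonal_singleton_iff_inner_left).1 h1.2
    rw [real_inner_smul_left, Quaternion.inner_self] at h2
    simp at h2
  obtain ⟨g, hg, hgr⟩ := ih Ψ hss hΨr r hr'
  have key : ∀ x, r (g (r x)) = g x := fun x => by
    rw [mul_inv_eq_iff_eq_mul, eq_inv_mul_iff_mul_eq] at hgr
    exact congrArg (fun f : ℍ[ℝ] ≃ₗᵢ[ℝ] ℍ[ℝ] => f x) hgr
  obtain ⟨c, d, hc, hd, h⟩ := hQ.cases (weyl_mono Set.inter_subset_left hg)
  have hdc : d = c := by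
    have h1 : c * star d = 1 := by
      have := hfix g hg
      rcases h with h | h <;> rw [h] at this <;> simpa using this
    rw [← one_mul d, ← h1, mul_assoc, hd.mul_star.2, mul_one]
  subst hdc
  obtain ⟨e, hed⟩ : ∃ e, e = star d * a * d * a := ⟨_, rfl⟩
  have he : LeftMem Φ e := hed ▸ ((hd.star.mul ha).mul hd).mul ha
  have hde : d * e = a * d * a := by
    rw [hed, ← mul_assoc, ← mul_assoc, ← mul_assoc, hd.mul_star.1, one_mul]
  have key2 : ∀ y, e * y * star e = y := by
    intro y
    have h2 : d * (e * y * star e) * star d = d * y * star d := by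
      rcases h with h | h
      · have := key y
        rw [hra, hra, h, h] at this
        calc _ = (d * e) * y * star (d * e) := by simp only [star_mul, mul_assoc]
          _ = _ := by rw [hde, ← this]; simp only [star_mul, mul_assoc]
      · have := key (star y)
        rw [hra, hra, h, h] at this
        calc _ = (d * e) * y * star (d * e) := by simp only [star_mul, mul_assoc]
          _ = _ := by
            rw [star_star] at this
            rw [hde, ← this]; simp only [star_mul, mul_assoc, star_star]
    have h3 := congrArg (fun z => star d * z * d) h2
    simpa only [mul_assoc, hd.mul_star.2, mul_one, ← mul_assoc (star d) d, one_mul] using h3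
  have hee : ∀ x, e * x = x * e := fun x => by
    conv_rhs => rw [← key2 x]
    rw [mul_assoc, he.mul_star.2, mul_one]
  rcases eq_one_or_neg_one he.mul_star.1 hee with h1 | h1
  · refine ⟨star d, hd.star, ?_⟩
    have h2 : star d * a * d * a = 1 := by rw [← hed, h1]
    have h3 := congrArg (fun z => z * (star a * star d)) h2
    simpa only [mul_assoc, one_mul, ha.mul_star.1, ← mul_assoc a (star a), hd.mul_star.1,
      mul_one] using h3
  · have h2 : star d * a * d = -star a := by
      rw [← mul_one (star d * a * d), ← ha.mul_star.1, ← mul_assoc, ← hed, h1, neg_one_mul]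
    have h3 : a.re = 0 := by
      have h4 := congrArg (fun z : ℍ[ℝ] => z.re) h2
      have h5 := congrArg (fun z : ℍ[ℝ] => z.re) hd.mul_star.1
      simp only [Quaternion.re_mul, Quaternion.re_star, Quaternion.re_neg, Quaternion.imI_mul,
        Quaternion.imJ_mul, Quaternion.imK_mul, Quaternion.imI_star, Quaternion.imJ_star,
        Quaternion.imK_star, Quaternion.re_one] at h4 h5
      linear_combination (1 / 2) * h4 - (1 / 2) * a.re * h5
    have hsa : star a = -a := by
      have := Quaternion.self_add_star a
      rw [h3] at this
      exact eq_neg_of_add_eq_zero_right (by simpa using this)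
    have h4 := hΨr.mem_weyl_of_fixed hr' (v := a) (by rw [hra, mul_assoc, ha.mul_star.1, mul_one])
    obtain ⟨z, hz⟩ : (Ψ ∩ ((ℝ ∙ a)ᗮ : Submodule ℝ ℍ[ℝ])).Nonempty := by
      by_contra! h0
      rw [h0, weyl, Set.image_empty, Subgroup.closure_empty, Subgroup.mem_bot] at h4
      have h5 : ∀ x, a * x = x * a := fun x => by
        have := hra x
        rw [h4] at this
        conv_rhs => rw [show x = a * x * star a from this]
        rw [mul_assoc, ha.mul_star.2, mul_one]
      rcases eq_one_or_neg_one ha.mul_star.1 h5 with h6 | h6 <;> rw [h6] at h3 <;> simp at h3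
    obtain ⟨u, rfl⟩ : ∃ u, z = (√2 : ℝ) • u := ⟨(√2 : ℝ)⁻¹ • z, by
      rw [smul_smul, mul_inv_cancel₀ (by positivity), one_smul]⟩
    refine ⟨u, hQ.left_mem u hz.1.1, ?_⟩
    have i1 := (Submodule.mem_orthogonal_singleton_iff_inner_left).1 hz.1.2
    have i2 := (Submodule.mem_orthogonal_singleton_iff_inner_left).1 hz.2
    have hs : (√2 : ℝ) ≠ 0 := by positivity
    rw [real_inner_smul_left, mul_eq_zero, or_iff_right hs, Quaternion.inner_def] at i1 i2
    have i3 : u.re = 0 := by simpa using i1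
    rw [hsa, Quaternion.ext_iff]
    simp [h3, i3] at i2 ⊢
    refine ⟨by linarith, by ring, by ring, by ring⟩

theorem false_of_critical (hQ : Quaternionic Φ) (h : Critical Φ w) : False := by
  obtain ⟨a, b, ha, hb, hw | hw⟩ := hQ.cases h.mem
  · obtain ⟨c, hc, hca⟩ := hQ.exists_conj_eq_star h.ih ha
    obtain ⟨d, hd, hdb⟩ := hQ.exists_conj_eq_star h.ih hb
    obtain ⟨g, hg, hgx⟩ := hQ.exists_mem hc hd
    refine h.false_of_reverses hg (S := Set.univ) (by simp) fun x _ => ?_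
    have h1 : a * (c * a) = c := by rw [hca, ← mul_assoc, ha.mul_star.1, one_mul]
    have h2 : star b * (star d * star b) = star d := by
      rw [← star_mul, ← star_mul, mul_assoc, hdb, ← mul_assoc, hb.mul_star.1, one_mul]
    rw [hw, hw, hgx, hgx]
    calc _ = a * (c * a) * x * (star b * (star d * star b)) := by simp only [mul_assoc]
      _ = _ := by rw [h1, h2]
  · have h1 : w (a + star b) = a + star b := by
      rw [hw, star_add, star_star, mul_add, add_mul, mul_assoc a b, hb.mul_star.1,
        ha.mul_star.1, one_mul, mul_one, add_comm]
    have h2 := eq_neg_of_add_eq_zero_right (h.eq_zero_of_fixed h1)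
    refine h.mul_self_ne_one ?_
    ext1 x
    rw [mul_apply, hw, hw, h2]
    calc _ = a * star a * x * (star a * a) := by simp [mul_assoc]
      _ = x := by rw [ha.mul_star.1, ha.mul_star.2, one_mul, mul_one]

end Quaternionic
end quaternion

end

section

variable {V : Type*} [NormedAddCommGroup V] [InnerProductSpace ℝ V]

section quaternion
open scoped Quaternion

/-- A quaternion given by its components. -/
def quat (a b c d : ℝ) : ℍ[ℝ] := ⟨a, b, c, d⟩

theorem re_quat (a b c d : ℝ) : (quat a b c d).re = a := rfl

theorem imI_quat (a b c d : ℝ) : (quat a b c d).imI = b := rfl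

theorem imJ_quat (a b c d : ℝ) : (quat a b c d).imJ = c := rfl

theorem imK_quat (a b c d : ℝ) : (quat a b c d).imK = d := rfl

theorem quat_mul (a b c d a' b' c' d' : ℝ) : quat a b c d * quat a' b' c' d' =
    quat (a * a' - b * b' - c * c' - d * d') (a * b' + b * a' + c * d' - d * c')
      (a * c' - b * d' + c * a' + d * b') (a * d' + b * c' - c * b' + d * a') := by
  rw [Quaternion.ext_iff]
  simp [re_quat, imI_quat, imJ_quat, imK_quat]

theorem star_quat (a b c d : ℝ) : star (quat a b c d) = quat a (-b) (-c) (-d) := by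
  rw [Quaternion.ext_iff]
  simp [re_quat, imI_quat, imJ_quat, imK_quat]

theorem neg_quat (a b c d : ℝ) : -(quat a b c d) = quat (-a) (-b) (-c) (-d) := rfl

theorem quat_congr {a b c d a' b' c' d' : ℝ} (ha : a = a') (hb : b = b') (hc : c = c')
    (hd : d = d') : quat a b c d = quat a' b' c' d' := by
  rw [ha, hb, hc, hd]

theorem inner_quat (a b c d a' b' c' d' : ℝ) :
    ⟪quat a b c d, quat a' b' c' d'⟫ = a * a' + b * b' + c * c' + d * d' := by
  rw [Quaternion.inner_def, star_quat, quat_mul]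
  rw [re_quat]
  ring

variable {Φ : Set ℍ[ℝ]} {x y : ℍ[ℝ]}

theorem IsRoot.sqrt_two_mul_mem (h : IsRoot Φ) (hx : (√2 : ℝ) • x ∈ Φ) (hy : (√2 : ℝ) • y ∈ Φ) :
    (√2 : ℝ) • -(x * star y * x) ∈ Φ := by
  have := h.refl_mem _ hx _ hy
  rw [refl_sqrt_two_smul (h.norm _ hx)] at this
  simpa using this

theorem IsRoot.leftMem_commutator (h : IsRoot Φ) (h1 : (√2 : ℝ) • (1 : ℍ[ℝ]) ∈ Φ)
    (hx : (√2 : ℝ) • x ∈ Φ) (hy : (√2 : ℝ) • y ∈ Φ) (hw : (√2 : ℝ) • (star y * x) ∈ Φ) :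
    LeftMem Φ (x * star y * (star x * y)) := by
  refine ⟨refl ((√2 : ℝ) • x) * (refl ((√2 : ℝ) • y) * (refl ((√2 : ℝ) • (1 : ℍ[ℝ])) *
    refl ((√2 : ℝ) • (star y * x)))), mul_mem (refl_mem_weyl hx) (mul_mem (refl_mem_weyl hy)
    (mul_mem (refl_mem_weyl h1) (refl_mem_weyl hw))), fun v => ?_⟩
  rw [mul_apply, mul_apply, mul_apply, refl_sqrt_two_smul (h.norm _ hx),
    refl_sqrt_two_smul (h.norm _ hy), refl_sqrt_two_smul (h.norm _ h1),
    refl_sqrt_two_smul (h.norm _ hw)]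
  have h2 := (quaternion_mul_star (inner_eq_one_of_sqrt_two_smul (h.norm _ hx))).2
  have h3 := (quaternion_mul_star (inner_eq_one_of_sqrt_two_smul (h.norm _ hy))).1
  calc _ = x * star y * (star x * y) * v * (star x * (y * star y) * x) := by simp [mul_assoc]
    _ = _ := by rw [h3, mul_one, h2, mul_one]

theorem LeftMem.refl_apply {Φ : Set ℍ[ℝ]} (h : IsRoot Φ) (hx : (√2 : ℝ) • x ∈ Φ)
    (hn : LeftMem Φ (-1)) (hx' : LeftMem Φ x) (hy : LeftMem Φ y) :
    ∃ z, refl ((√2 : ℝ) • x) ((√2 : ℝ) • y) = (√2 : ℝ) • z ∧ LeftMem Φ z := by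
  refine ⟨-1 * (x * Star.star y * x), ?_, hn.mul ((hx'.mul hy.star).mul hx')⟩
  rw [refl_sqrt_two_smul (h.norm _ hx)]
  simp

theorem golden_words {r : ℝ} (hr : r ^ 2 = r + 1) {n m : ℍ[ℝ]}
    (hn : n = quat (r / 2) ((1 - r) / 2) 0 (-1 / 2))
    (hm : m = quat (r / 2) 0 (-1 / 2) ((1 - r) / 2)) :
    n * m * n = quat 0 (-(r - 1) / 2) (-1 / 2) (-r / 2) ∧
    m * m * n = quat 0 ((r - 1) / 2) (-1 / 2) (-r / 2) ∧
    n * n * n * (m * m) = quat (-1 / 2) (-r / 2) 0 ((r - 1) / 2) := by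
  have hr3 : r ^ 3 = 2 * r + 1 := by linear_combination (r + 1) * hr
  have h1 : n * m = quat (1 / 2) (-1 / 2) (-1 / 2) (-1 / 2) := by
    rw [hn, hm, quat_mul]
    apply quat_congr <;> linarith
  have h2 : m * m = quat ((r - 1) / 2) 0 (-r / 2) (-1 / 2) := by
    rw [hm, quat_mul]
    apply quat_congr <;> linarith
  have h3 : n * n = quat ((r - 1) / 2) (-1 / 2) 0 (-r / 2) := by
    rw [hn, quat_mul]
    apply quat_congr <;> linarith
  have h4 : n * n * n = quat ((1 - r) / 2) (-1 / 2) 0 (-r / 2) := by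
    rw [h3, hn, quat_mul]
    apply quat_congr <;> linarith
  rw [h4, h1, h2, hn, quat_mul, quat_mul, quat_mul]
  refine ⟨?_, ?_, ?_⟩ <;> apply quat_congr <;> linarith

variable {V : Type*} [NormedAddCommGroup V] [InnerProductSpace ℝ V]

theorem Diagram.false_of_golden_four [FiniteDimensional ℝ V] {Φ : Set V} {a : ℕ → V}
    {w : V ≃ₗᵢ[ℝ] V} {ρ : V} {Δ : Finset V}
    (D : Diagram Φ a 4 1 Real.goldenRatio) (h : Critical Φ w) (b : IsBase Φ ρ Δ)
    (hΔ : ∀ d, d ∈ Δ ↔ ∃ i < 4, a i = d) : False := by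
  have G : ∀ i < 4, ∀ j < 4, _ := fun i hi j hj =>
    D.inner_eq h.isRoot le_rfl (by norm_num) hi hj
  have hr2 := Real.goldenRatio_sq
  have h0 := Real.goldenRatio_pos
  have hr3 : Real.goldenRatio ^ 3 = 2 * Real.goldenRatio + 1 := by
    linear_combination (Real.goldenRatio + 1) * hr2
  have hr4 : Real.goldenRatio ^ 4 = 3 * Real.goldenRatio + 2 := by
    linear_combination (Real.goldenRatio ^ 2 + Real.goldenRatio + 2) * hr2
  generalize Real.goldenRatio = r at D G hr2 h0 hr3 hr4
  let q : Fin 4 → ℍ[ℝ] := ![quat 0 ((r - 1) / 2) (1 / 2) (r / 2),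
    quat 0 ((r - 1) / 2) (-1 / 2) (-r / 2), quat (-1 / 2) (-r / 2) 0 ((r - 1) / 2), quat 1 0 0 0]
  have hGq : ∀ i j : Fin 4, ⟪a i, a j⟫ = ⟪(√2 : ℝ) • q i, (√2 : ℝ) • q j⟫ := by
    intro i j
    rw [real_inner_smul_left, real_inner_smul_right, ← mul_assoc, Real.mul_self_sqrt zero_le_two,
      G i i.2 j j.2]
    fin_cases i <;> fin_cases j <;> simp [q, inner_quat, -inner_self_eq_norm_sq_to_K] <;> grind
  have hinj : Function.Injective fun i : Fin 4 => a i := by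
    intro i j hij
    have h1 := hGq i j
    have h2 := hGq j j
    simp only at hij
    rw [hij, G j j.2 j j.2] at h1
    by_contra hne
    rw [← hGq, G i i.2 j j.2] at h1
    fin_cases i <;> fin_cases j <;> simp at h1 hne <;> linarith
  have hli : LinearIndependent ℝ fun i : Fin 4 => a i := by
    have := b.linearIndepOn
    have h1 : ∀ i : Fin 4, a i ∈ (Δ : Set V) := fun i => (hΔ _).2 ⟨i, i.2, rfl⟩
    exact LinearIndependent.comp this (fun i : Fin 4 => (⟨a i, h1 i⟩ : (Δ : Set V)))
      fun i j hij => hinj (Subtype.ext_iff.1 hij)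
  have hspan : ⊤ ≤ Submodule.span ℝ (Set.range fun i : Fin 4 => a i) :=
    b.top_le_span h fun d hd => by
      obtain ⟨i, hi, rfl⟩ := (hΔ d).1 hd
      exact Submodule.subset_span ⟨⟨i, hi⟩, rfl⟩
  obtain ⟨e, he⟩ := exists_isometry_of_inner_eq hli hspan Quaternion.finrank_eq_four hGq
  have hΦ := h.isRoot.image e
  have hm : ∀ i, (√2 : ℝ) • q i ∈ e '' Φ := fun i => he i ▸ ⟨_, D.mem i i.2, rfl⟩
  have hone : quat 1 0 0 0 = 1 := rfl
  have h1 : (√2 : ℝ) • (1 : ℍ[ℝ]) ∈ e '' Φ := hm 3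
  have m1 : (√2 : ℝ) • quat 0 (r / 2) ((1 - r) / 2) (-1 / 2) ∈ e '' Φ := by
    convert hΦ.sqrt_two_mul_mem (hm 1) (hm 0) using 2
    simp only [q, Matrix.cons_val, star_quat, quat_mul, neg_quat]
    apply quat_congr <;> linarith
  have m2 : (√2 : ℝ) • quat (-r / 2) (-1 / 2) ((1 - r) / 2) 0 ∈ e '' Φ := by
    convert hΦ.sqrt_two_mul_mem (hm 2) m1 using 2
    simp only [q, Matrix.cons_val, star_quat, quat_mul, neg_quat]
    apply quat_congr <;> linarith
  have m3 : (√2 : ℝ) • quat (-r / 2) ((1 - r) / 2) 0 (1 / 2) ∈ e '' Φ := by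
    convert hΦ.sqrt_two_mul_mem (hm 0) m2 using 2
    simp only [q, Matrix.cons_val, star_quat, quat_mul, neg_quat]
    apply quat_congr <;> linarith
  have n1 : LeftMem (e '' Φ) (quat (r / 2) ((1 - r) / 2) 0 (-1 / 2)) := by
    convert hΦ.leftMem_commutator h1 m1 m3 ?_ using 1
    · simp only [star_quat, quat_mul]
      apply quat_congr <;> linarith
    · convert hm 2 using 2
      simp only [q, Matrix.cons_val, star_quat, quat_mul]
      apply quat_congr <;> linarith
  have n2 : LeftMem (e '' Φ) (quat (r / 2) 0 (-1 / 2) ((1 - r) / 2)) := by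
    convert hΦ.leftMem_commutator h1 (hm 2) m3 ?_ using 1
    · simp only [q, Matrix.cons_val, star_quat, quat_mul]
      apply quat_congr <;> linarith
    · convert hΦ.neg_mem m2 using 1
      rw [← smul_neg]
      simp only [q, Matrix.cons_val, star_quat, quat_mul, neg_quat]
      congr 1
      apply quat_congr <;> linarith
  have hq : ∀ i, LeftMem (e '' Φ) (q i) := by
    intro i
    fin_cases i
    · convert ((n1.mul n2).mul n1).star using 1
      rw [(golden_words hr2 rfl rfl).1, star_quat]
      apply quat_congr <;> linarith
    · convert (n2.mul n2).mul n1 using 1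
      exact (golden_words hr2 rfl rfl).2.1.symm
    · convert ((n1.mul n1).mul n1).mul (n2.mul n2) using 1
      exact (golden_words hr2 rfl rfl).2.2.symm
    · exact .one
  have hneg : LeftMem (e '' Φ) (-1) := by
    convert (hq 0).mul (hq 0) using 1
    rw [← hone]
    simp only [q, Matrix.cons_val, neg_quat, quat_mul]
    apply quat_congr <;> linarith
  have key : ∀ x ∈ Φ, ∃ z, e x = (√2 : ℝ) • z ∧ LeftMem (e '' Φ) z := by
    intro x hx
    refine b.root_induction h.isRoot (P := fun x => ∃ z, e x = (√2 : ℝ) • z ∧ LeftMem (e '' Φ) z)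
      ?_ ?_ hx
    · intro d hd
      obtain ⟨i, hi, rfl⟩ := (hΔ d).1 hd
      exact ⟨q ⟨i, hi⟩, he ⟨i, hi⟩, hq _⟩
    · rintro d hd y ⟨z, hyz, hz⟩
      obtain ⟨i, hi, rfl⟩ := (hΔ d).1 hd
      rw [map_refl e (h.isRoot.norm _ (D.mem i hi)), hyz, he ⟨i, hi⟩]
      exact LeftMem.refl_apply hΦ (hm _) hneg (hq _) hz
  refine Quaternionic.false_of_critical ⟨hΦ, h1, ?_⟩ (h.image e)
  rintro u ⟨x, hx, hxu⟩
  obtain ⟨z, hz, hl⟩ := key x hx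
  rw [hxu] at hz
  rwa [smul_right_injective ℍ[ℝ] (show (√2 : ℝ) ≠ 0 by positivity) hz]

end quaternion

end

section

variable {V : Type*} [NormedAddCommGroup V] [InnerProductSpace ℝ V]

/-- A diagram formed by elements of a base, with its distinguished node attached to the path. -/
structure Chart (Φ : Set V) (Δ : Finset V) (a : ℕ → V) (n p : ℕ) (x : ℝ) : Prop
    extends Diagram Φ a n p x where
  one_le : 1 ≤ p
  lt : p < n
  base : ∀ i < n, a i ∈ Δ

theorem inner_sum_le {ι : Type*} {s : Finset ι} {f : ι → V} {v : V} {c : ℝ} {j : ι}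
    (hf : ∀ i ∈ s, ⟪f i, v⟫ ≤ 0) (hj : j ∈ s) (hc : ⟪f j, v⟫ ≤ c) : ⟪∑ i ∈ s, f i, v⟫ ≤ c := by
  classical
  rw [sum_inner, ← Finset.add_sum_erase s _ hj]
  have := Finset.sum_nonpos (s := s.erase j) fun i hi => hf i (Finset.mem_of_mem_erase hi)
  linarith

theorem inner_sum_le_add {ι : Type*} {s : Finset ι} {f : ι → V} {v : V} {c c' : ℝ} {j k : ι}
    (hf : ∀ i ∈ s, ⟪f i, v⟫ ≤ 0) (hj : j ∈ s) (hk : k ∈ s) (hjk : j ≠ k) (hc : ⟪f j, v⟫ ≤ c)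
    (hc' : ⟪f k, v⟫ ≤ c') : ⟪∑ i ∈ s, f i, v⟫ ≤ c + c' := by
  classical
  rw [← Finset.add_sum_erase s _ hj, inner_add_left]
  have := inner_sum_le (fun i hi => hf i (Finset.mem_of_mem_erase hi))
    (Finset.mem_erase.2 ⟨hjk.symm, hk⟩) hc'
  linarith

theorem inner_add_add_self (u v : V) : ⟪u + v, u + v⟫ = ⟪u, u⟫ + 2 * ⟪u, v⟫ + ⟪v, v⟫ := by
  simp only [inner_add_left, inner_add_right, real_inner_comm u v]
  ring

variable {Φ : Set V} {ρ : V} {Δ : Finset V} {a : ℕ → V} {n p : ℕ} {x : ℝ}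

namespace IsBase

theorem inner_self_pos {v : V} (hv : 0 < ⟪ρ, v⟫) : 0 < ⟪v, v⟫ := by
  refine real_inner_self_pos.2 ?_
  rintro rfl
  simp at hv

/-- Two features cannot be joined by a connected set of nodes with sum `P`. -/
theorem false_of_tails {P L L' : V} (hP : 0 < ⟪ρ, P⟫) (hL : 0 < ⟪ρ, L⟫) (hL' : 0 < ⟪ρ, L'⟫)
    (hPP : ⟪P, P⟫ ≤ 2) (hLL : ⟪L, L⟫ ≤ 4) (hLL' : ⟪L', L'⟫ ≤ 4) (hPL : ⟪P, L⟫ ≤ -2)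
    (hPL' : ⟪P, L'⟫ ≤ -2) (h : ⟪L, L'⟫ ≤ 0) : False := by
  have h1 : 0 < ⟪ρ, (2 : ℝ) • P + (L + L')⟫ := by
    simp only [inner_add_right, real_inner_smul_right]
    linarith
  have := inner_self_pos h1
  rw [inner_add_add_self, inner_add_add_self, inner_add_right, real_inner_smul_left,
    real_inner_smul_left, real_inner_smul_left, real_inner_smul_right] at this
  linarith

theorem inner_eq_or_le (b : IsBase Φ ρ Δ) (h : IsRoot Φ) {d e : V} (hd : d ∈ Δ) (he : e ∈ Δ)
    (hde : d ≠ e) (h0 : ⟪d, e⟫ ≠ 0) : ⟪d, e⟫ = -1 ∨ ⟪d, e⟫ ≤ -√2 := by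
  have h2 : √2 ≤ 3 / 2 := Real.sqrt_le_iff.2 (by norm_num)
  have h3 : √2 ≤ √3 := Real.sqrt_le_sqrt (by norm_num)
  have h5 : 3 / 2 < Real.goldenRatio := by
    have := Real.goldenRatio_sq
    nlinarith [Real.goldenRatio_pos]
  rcases b.gram_values h hd he hde with h' | h' | h' | h' | h'
  · exact absurd h' h0
  · exact .inl h'
  all_goals right; linarith

theorem inner_le_neg_one (b : IsBase Φ ρ Δ) (h : IsRoot Φ) {d e : V} (hd : d ∈ Δ) (he : e ∈ Δ)
    (hde : d ≠ e) (h0 : ⟪d, e⟫ ≠ 0) : ⟪d, e⟫ ≤ -1 := by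
  have h2 : 1 ≤ √2 := Real.one_le_sqrt.2 (by norm_num)
  rcases b.inner_eq_or_le h hd he hde h0 with h' | h' <;> linarith

theorem tail_of_le (b : IsBase Φ ρ Δ) (h : IsRoot Φ) {d P : V} (hd : d ∈ Δ) (hP : ⟪P, d⟫ ≤ -√2) :
    0 < ⟪ρ, √2 • d⟫ ∧ ⟪√2 • d, √2 • d⟫ ≤ 4 ∧ ⟪P, √2 • d⟫ ≤ -2 := by
  have h2 : √2 * √2 = 2 := Real.mul_self_sqrt (by norm_num)
  have h0 : 0 < √2 := by positivity
  simp only [real_inner_smul_left, real_inner_smul_right, h.norm d (b.mem d hd)]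
  refine ⟨mul_pos h0 (b.pos d hd), by linarith, ?_⟩
  nlinarith

theorem tail_of_add (b : IsBase Φ ρ Δ) (h : IsRoot Φ) {d e P : V} (hd : d ∈ Δ) (he : e ∈ Δ)
    (hde : d ≠ e) (hP : ⟪P, d⟫ ≤ -1) (hP' : ⟪P, e⟫ ≤ -1) :
    0 < ⟪ρ, d + e⟫ ∧ ⟪d + e, d + e⟫ ≤ 4 ∧ ⟪P, d + e⟫ ≤ -2 := by
  have h1 := b.obtuse d hd e he hde
  rw [inner_add_add_self, inner_add_right, inner_add_right, h.norm d (b.mem d hd),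
    h.norm e (b.mem e he)]
  exact ⟨add_pos (b.pos d hd) (b.pos e he), by linarith, by linarith⟩

end IsBase

namespace Chart

theorem gram (C : Chart Φ Δ a n p x) (h : IsRoot Φ) {i j : ℕ} (hi : i < n) (hj : j < n) :
    ⟪a i, a j⟫ = if i = j then 2 else if i = 0 then (if j = p then -x else 0) else
      if j = 0 then (if i = p then -x else 0) else if i + 1 = j ∨ j + 1 = i then -1 else 0 :=
  C.toDiagram.inner_eq h C.one_le C.lt hi hj

theorem inner_nonpos (C : Chart Φ Δ a n p x) (h : IsRoot Φ) (hx : 0 ≤ x) {i j : ℕ} (hi : i < n)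
    (hj : j < n) (hij : i ≠ j) : ⟪a i, a j⟫ ≤ 0 := by
  rw [C.gram h hi hj, if_neg hij]
  split_ifs <;> linarith

theorem ne (C : Chart Φ Δ a n p x) (h : IsRoot Φ) (hx : 0 ≤ x) {i j : ℕ} (hi : i < n)
    (hj : j < n) (hij : i ≠ j) : a i ≠ a j := by
  intro he
  have h1 := C.inner_nonpos h hx hi hj hij
  rw [he, h.norm _ (C.mem j hj)] at h1
  linarith

theorem le_card (C : Chart Φ Δ a n p x) (h : IsRoot Φ) (hx : 0 ≤ x) : n ≤ Δ.card := by
  have := Finset.card_le_card_of_injOn (s := Finset.range n) (t := Δ) a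
    (fun i hi => C.base i (by simpa using hi)) fun i hi j hj hij => by
      by_contra hne
      exact C.ne h hx (by simpa using hi) (by simpa using hj) hne hij
  simpa using this

theorem snoc (C : Chart Φ Δ a n p x) (b : IsBase Φ ρ Δ) {s : V} (hs : s ∈ Δ)
    (h1 : ⟪a (n - 1), s⟫ = -1) (h0 : ∀ i < n - 1, ⟪a i, s⟫ = 0) :
    Chart Φ Δ (fun i => if i = n then s else a i) (n + 1) p x := by
  have hp := C.one_le
  have hpn := C.lt
  have hbase : ∀ i < n + 1, (if i = n then s else a i) ∈ Δ := fun i hi => by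
    split_ifs with hin
    · exact hs
    · exact C.base i (by omega)
  refine ⟨⟨fun i hi => b.mem _ (hbase i hi), fun i hi hi' => ?_, fun i j hi hij hj => ?_,
    fun _ _ => ?_, fun j hj hjn hjp => ?_⟩, hp, by omega, hbase⟩
  · simp only [if_neg (show i ≠ n by omega)]
    split_ifs with hin
    · rwa [show i = n - 1 by omega]
    · exact C.chain i hi (by omega)
  · simp only [if_neg (show i ≠ n by omega)]
    split_ifs with hin
    · exact h0 i (by omega)
    · exact C.far i j hi hij (by omega)
  · simp only [if_neg (show p ≠ n by omega), if_neg (show 0 ≠ n by omega)]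
    exact C.root hp hpn
  · simp only [if_neg (show 0 ≠ n by omega)]
    split_ifs with hin
    · exact h0 0 (by omega)
    · exact C.root_far j hj (by omega) hjp

theorem reverse (C : Chart Φ Δ a n p x) :
    Chart Φ Δ (fun i => if i = 0 then a 0 else a (n - i)) n (n - p) x := by
  have hp := C.one_le
  have hpn := C.lt
  refine ⟨⟨fun i hi => ?_, fun i hi hi' => ?_, fun i j hi hij hj => ?_,
    fun _ _ => ?_, fun j hj hjn hjp => ?_⟩, by omega, by omega, fun i hi => ?_⟩
  · split_ifs <;> exact C.mem _ (by omega)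
  · simp only [if_neg (show i ≠ 0 by omega), if_neg (show i + 1 ≠ 0 by omega)]
    rw [real_inner_comm, show n - i = n - (i + 1) + 1 by omega]
    exact C.chain _ (by omega) (by omega)
  · simp only [if_neg (show i ≠ 0 by omega), if_neg (show j ≠ 0 by omega)]
    rw [real_inner_comm]
    exact C.far _ _ (by omega) (by omega) (by omega)
  · simp only [if_neg (show n - p ≠ 0 by omega), if_true]
    rw [show n - (n - p) = p by omega]
    exact C.root hp hpn
  · simp only [if_neg (show j ≠ 0 by omega), if_true]
    exact C.root_far _ (by omega) (by omega) (by omega)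
  · split_ifs <;> exact C.base _ (by omega)

theorem shift (C : Chart Φ Δ a n p x) {k : ℕ} (hk : k < p) :
    Chart Φ Δ (fun i => if i = 0 then a 0 else a (i + k)) (n - k) (p - k) x := by
  have hp := C.one_le
  have hpn := C.lt
  refine ⟨⟨fun i hi => ?_, fun i hi hi' => ?_, fun i j hi hij hj => ?_,
    fun _ _ => ?_, fun j hj hjn hjp => ?_⟩, by omega, by omega, fun i hi => ?_⟩
  · split_ifs <;> exact C.mem _ (by omega)
  · simp only [if_neg (show i ≠ 0 by omega), if_neg (show i + 1 ≠ 0 by omega)]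
    rw [show i + 1 + k = i + k + 1 by omega]
    exact C.chain _ (by omega) (by omega)
  · simp only [if_neg (show i ≠ 0 by omega), if_neg (show j ≠ 0 by omega)]
    exact C.far _ _ (by omega) (by omega) (by omega)
  · simp only [if_neg (show p - k ≠ 0 by omega), if_true]
    rw [show p - k + k = p by omega]
    exact C.root hp hpn
  · simp only [if_neg (show j ≠ 0 by omega), if_true]
    exact C.root_far _ (by omega) (by omega) (by omega)
  · split_ifs <;> exact C.base _ (by omega)

theorem take (C : Chart Φ Δ a n p x) {m : ℕ} (hm : p < m) (hmn : m ≤ n) : Chart Φ Δ a m p x :=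
  ⟨⟨fun i hi => C.mem i (by omega), fun i hi hi' => C.chain i hi (by omega),
    fun i j hi hij hj => C.far i j hi hij (by omega), fun h1 _ => C.root h1 C.lt,
    fun j hj hjn hjp => C.root_far j hj (by omega) hjp⟩, C.one_le, hm,
    fun i hi => C.base i (by omega)⟩

theorem path_reverse (C : Chart Φ Δ a n 1 1) : Chart Φ Δ (fun i => a (n - 1 - i)) n 1 1 := by
  have hn := C.lt
  have hch : ∀ i, i + 1 < n → ⟪a i, a (i + 1)⟫ = -1 := fun i hi => by
    rcases Nat.eq_zero_or_pos i with rfl | hi'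
    · exact C.root le_rfl C.lt
    · exact C.chain i hi' hi
  have hfar : ∀ i j, i + 1 < j → j < n → ⟪a i, a j⟫ = 0 := fun i j hij hj => by
    rcases Nat.eq_zero_or_pos i with rfl | hi'
    · exact C.root_far j (by omega) hj (by omega)
    · exact C.far i j hi' hij hj
  refine ⟨⟨fun i hi => C.mem _ (by omega), fun i hi hi' => ?_, fun i j hi hij hj => ?_,
    fun _ _ => ?_, fun j hj hjn hjp => ?_⟩, by omega, by omega, fun i hi => C.base _ (by omega)⟩
  · rw [real_inner_comm, show n - 1 - i = n - 1 - (i + 1) + 1 by omega]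
    exact hch _ (by omega)
  · rw [real_inner_comm]
    exact hfar _ _ (by omega) (by omega)
  · rw [real_inner_comm, show n - 1 - 0 = n - 1 - 1 + 1 by omega]
    exact hch _ (by omega)
  · rw [real_inner_comm]
    exact hfar _ _ (by omega) (by omega)

theorem inner_sum_pos (C : Chart Φ Δ a n p x) (b : IsBase Φ ρ Δ) {i j : ℕ} (hij : i ≤ j)
    (hj : j < n) : 0 < ⟪ρ, ∑ k ∈ Finset.Icc i j, a k⟫ := by
  rw [inner_sum]
  exact Finset.sum_pos (fun k hk => b.pos _ (C.base k (by grind)))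
    (Finset.nonempty_Icc.2 hij)

theorem inner_sum_self (C : Chart Φ Δ a n p x) (h : IsRoot Φ) {i j : ℕ} (hi : 1 ≤ i) (hij : i ≤ j)
    (hj : j < n) : ⟪∑ k ∈ Finset.Icc i j, a k, ∑ k ∈ Finset.Icc i j, a k⟫ ≤ 2 := by
  induction j, hij using Nat.le_induction with
  | base => simp [h.norm _ (C.mem i hj), -inner_self_eq_norm_sq_to_K]
  | succ j hij IH =>
    rw [← Finset.insert_Icc_right_eq_Icc_add_one (by omega), Finset.sum_insert (by simp), add_comm,
      inner_add_add_self, h.norm _ (C.mem _ hj)]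
    have h1 : ⟪∑ k ∈ Finset.Icc i j, a k, a (j + 1)⟫ ≤ -1 := by
      refine inner_sum_le (j := j) (fun k hk => ?_) (by simp [hij])
        (C.chain j (by omega) hj).le
      rw [Finset.mem_Icc] at hk
      rcases hk.2.eq_or_lt with rfl | hkj
      · rw [C.chain k (by omega) hj]; norm_num
      · rw [C.far k _ (by omega) (by omega) hj]
    linarith [IH (by omega)]

/-- A further element of the base is adjacent to at most one node. -/
theorem eq_of_inner_ne_zero (C : Chart Φ Δ a n p x) (h : IsRoot Φ) (b : IsBase Φ ρ Δ) (hx : 1 ≤ x)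
    {s : V} (hs : s ∈ Δ) (hsa : ∀ i < n, a i ≠ s) {i j : ℕ} (hi : i < n) (hj : j < n)
    (hi' : ⟪a i, s⟫ ≠ 0) (hj' : ⟪a j, s⟫ ≠ 0) : i = j := by
  have hp := C.one_le
  have hpn := C.lt
  by_contra hij
  have hr : Finset.range n = insert 0 (Finset.Icc 1 (n - 1)) := by
    ext k; simp only [Finset.mem_range, Finset.mem_insert, Finset.mem_Icc]; omega
  have h1 : ⟪∑ k ∈ Finset.range n, a k, ∑ k ∈ Finset.range n, a k⟫ ≤ 2 := by
    rw [hr, Finset.sum_insert (by simp), add_comm, inner_add_add_self,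
      h.norm _ (C.mem 0 (by omega))]
    have h2 := C.inner_sum_self h le_rfl (show 1 ≤ n - 1 by omega) (by omega)
    have h3 : ⟪∑ k ∈ Finset.Icc 1 (n - 1), a k, a 0⟫ ≤ -1 := by
      refine inner_sum_le (j := p) (fun k hk => ?_) (by simp; omega) ?_
      · rw [Finset.mem_Icc] at hk
        exact C.inner_nonpos h (by linarith) (by omega) (by omega) (by omega)
      · rw [real_inner_comm, C.root hp hpn]; linarith
    linarith
  have h2 : ⟪∑ k ∈ Finset.range n, a k, s⟫ ≤ -1 + -1 :=
    inner_sum_le_add (fun k hk => b.obtuse _ (C.base k (by simpa using hk)) _ hs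
      (hsa k (by simpa using hk))) (by simpa using hi) (by simpa using hj) hij
      (b.inner_le_neg_one h (C.base i hi) hs (hsa i hi) hi')
      (b.inner_le_neg_one h (C.base j hj) hs (hsa j hj) hj')
  have h3 : 0 < ⟪ρ, ∑ k ∈ Finset.range n, a k + s⟫ := by
    rw [inner_add_right, inner_sum]
    refine add_pos_of_nonneg_of_pos (Finset.sum_nonneg fun k hk => ?_) (b.pos s hs)
    exact (b.pos _ (C.base k (by simpa using hk))).le
  have h4 := IsBase.inner_self_pos h3
  rw [inner_add_add_self, h.norm s (b.mem s hs)] at h4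
  linarith

end Chart

end

section

variable {V : Type*} [NormedAddCommGroup V] [InnerProductSpace ℝ V]

variable {Φ : Set V} {ρ : V} {Δ : Finset V} {a : ℕ → V} {n p : ℕ} {x : ℝ}

namespace Chart

theorem false_of_heavy (C : Chart Φ Δ a n 1 x) (h : IsRoot Φ) (b : IsBase Φ ρ Δ) (hx : √2 ≤ x)
    {s : V} (hs : s ∈ Δ) (hsa : ∀ i < n, a i ≠ s) {j : ℕ} (hj : 1 ≤ j) (hjn : j < n)
    (h0 : ⟪a j, s⟫ ≤ -√2 ∨ ⟪a j, s⟫ ≠ 0 ∧ j + 1 < n) : False := by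
  have hx0 : 0 ≤ x := (Real.sqrt_nonneg 2).trans hx
  have hs0 : ∀ i < n, ⟪a i, s⟫ ≤ 0 := fun i hi => b.obtuse _ (C.base i hi) _ hs (hsa i hi)
  have hP0 : ⟪∑ k ∈ Finset.Icc 1 j, a k, a 0⟫ ≤ -√2 := by
    refine inner_sum_le (j := 1) (fun k hk => ?_) (by simpa) ?_
    · rw [Finset.mem_Icc] at hk
      exact C.inner_nonpos h hx0 (by omega) (by omega) (by omega)
    · rw [real_inner_comm, C.root le_rfl C.lt]; linarith
  obtain ⟨h1, h2, h3⟩ := b.tail_of_le h (C.base 0 (by omega)) hP0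
  have hPs : ∀ c, ⟪a j, s⟫ ≤ c → ⟪∑ k ∈ Finset.Icc 1 j, a k, s⟫ ≤ c := fun c hc =>
    inner_sum_le (j := j) (fun k hk => hs0 k (by rw [Finset.mem_Icc] at hk; omega))
      (by simpa) hc
  have hP := C.inner_sum_pos b hj hjn
  have hPP := C.inner_sum_self h le_rfl hj hjn
  have h00 := hs0 0 (by omega)
  rcases h0 with h0 | ⟨h0, hj'⟩
  · obtain ⟨h1', h2', h3'⟩ := b.tail_of_le h hs (hPs _ h0)
    refine IsBase.false_of_tails hP h1 h1' hPP h2 h2' h3 h3' ?_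
    rw [real_inner_smul_left, real_inner_smul_right]
    exact mul_nonpos_of_nonneg_of_nonpos (by positivity)
      (mul_nonpos_of_nonneg_of_nonpos (by positivity) h00)
  · have h4 : ⟪∑ k ∈ Finset.Icc 1 j, a k, a (j + 1)⟫ ≤ -1 := by
      refine inner_sum_le (j := j) (fun k hk => ?_) (by simpa) (C.chain j hj hj').le
      rw [Finset.mem_Icc] at hk
      exact C.inner_nonpos h hx0 (by omega) hj' (by omega)
    obtain ⟨h1', h2', h3'⟩ := b.tail_of_add h hs (C.base (j + 1) hj') (hsa _ hj').symm
      (hPs _ (b.inner_le_neg_one h (C.base j hjn) hs (hsa j hjn) h0)) h4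
    refine IsBase.false_of_tails hP h1 h1' hPP h2 h2' h3 h3' ?_
    rw [real_inner_smul_left, inner_add_right]
    have := C.inner_nonpos h hx0 (by omega : 0 < n) hj' (by omega)
    exact mul_nonpos_of_nonneg_of_nonpos (by positivity) (by linarith)

theorem false_of_heavy_root (C : Chart Φ Δ a n 1 x) (h : IsRoot Φ) (b : IsBase Φ ρ Δ) (hx : √2 ≤ x)
    {s : V} (hs : s ∈ Δ) (hsa : ∀ i < n, a i ≠ s) (h0 : ⟪a 0, s⟫ ≤ -√2) : False := by
  have hn := C.lt
  have h1 := C.root le_rfl hn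
  obtain ⟨h1, h2, h3⟩ := b.tail_of_le h (C.base 1 hn) (P := a 0) (by linarith)
  obtain ⟨h1', h2', h3'⟩ := b.tail_of_le h hs h0
  refine IsBase.false_of_tails (b.pos _ (C.base 0 (by omega))) h1 h1'
    (h.norm _ (C.mem 0 (by omega))).le h2 h2' h3 h3' ?_
  rw [real_inner_smul_left, real_inner_smul_right]
  exact mul_nonpos_of_nonneg_of_nonpos (by positivity) (mul_nonpos_of_nonneg_of_nonpos
    (by positivity) (b.obtuse _ (C.base 1 hn) _ hs (hsa 1 hn)))

theorem false_of_two_branches (C : Chart Φ Δ a n p 1) (h : IsRoot Φ) (b : IsBase Φ ρ Δ)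
    (hp : 2 ≤ p) {s : V} (hs : s ∈ Δ) (hsa : ∀ i < n, a i ≠ s) {j : ℕ} (hj : p ≤ j)
    (hjn : j + 1 < n) (h0 : ⟪a j, s⟫ ≠ 0) : False := by
  have hs0 : ∀ i < n, ⟪a i, s⟫ ≤ 0 := fun i hi => b.obtuse _ (C.base i hi) _ hs (hsa i hi)
  have hc : ∀ i < n, ∀ j < n, i ≠ j → ⟪a i, a j⟫ ≤ 0 := fun i hi j hj hij =>
    C.inner_nonpos h zero_le_one hi hj hij
  have hP0 : ⟪∑ k ∈ Finset.Icc p j, a k, a 0⟫ ≤ -1 := by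
    refine inner_sum_le (j := p) (fun k hk => ?_) (by simpa) ?_
    · rw [Finset.mem_Icc] at hk
      exact hc _ (by omega) _ (by omega) (by omega)
    · rw [real_inner_comm, C.root C.one_le C.lt]
  have hP1 : ⟪∑ k ∈ Finset.Icc p j, a k, a (p - 1)⟫ ≤ -1 := by
    refine inner_sum_le (j := p) (fun k hk => ?_) (by simpa) ?_
    · rw [Finset.mem_Icc] at hk
      exact hc _ (by omega) _ (by omega) (by omega)
    · obtain ⟨q, rfl⟩ : ∃ q, p = q + 1 := ⟨p - 1, by omega⟩
      rw [real_inner_comm]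
      exact (C.chain q (by omega) C.lt).le
  have hP2 : ⟪∑ k ∈ Finset.Icc p j, a k, a (j + 1)⟫ ≤ -1 := by
    refine inner_sum_le (j := j) (fun k hk => ?_) (by simpa) (C.chain j (by omega) hjn).le
    rw [Finset.mem_Icc] at hk
    exact hc _ (by omega) _ (by omega) (by omega)
  have hPs : ⟪∑ k ∈ Finset.Icc p j, a k, s⟫ ≤ -1 :=
    inner_sum_le (j := j) (fun k hk => hs0 k (by rw [Finset.mem_Icc] at hk; omega))
      (by simpa) (b.inner_le_neg_one h (C.base j (by omega)) hs (hsa j (by omega)) h0)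
  obtain ⟨h1, h2, h3⟩ := b.tail_of_add h (C.base 0 (by omega)) (C.base (p - 1) (by omega))
    (C.ne h zero_le_one (by omega) (by omega) (by omega)) hP0 hP1
  obtain ⟨h1', h2', h3'⟩ := b.tail_of_add h hs (C.base (j + 1) hjn) (hsa _ hjn).symm hPs hP2
  refine IsBase.false_of_tails (C.inner_sum_pos b hj (by omega)) h1 h1'
    (C.inner_sum_self h (by omega) hj (by omega)) h2 h2' h3 h3' ?_
  simp only [inner_add_left, inner_add_right]
  linarith [hs0 0 (by omega), hs0 (p - 1) (by omega), hc 0 (by omega) (j + 1) hjn (by omega),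
    hc (p - 1) (by omega) (j + 1) hjn (by omega)]

theorem false_of_sqrt_three (C : Chart Φ Δ a n 1 x) (h : IsRoot Φ) (b : IsBase Φ ρ Δ)
    (hx : √3 ≤ x) {s : V} (hs : s ∈ Δ) (hsa : ∀ i < n, a i ≠ s) (h0 : ⟪a 0, s⟫ ≤ -1) :
    False := by
  have hn := C.lt
  have h3 : √3 * √3 = 3 := Real.mul_self_sqrt (by norm_num)
  have hp : 0 < √3 := by positivity
  have hpos : 0 < ⟪ρ, (2 : ℝ) • a 0 + (√3 • a 1 + s)⟫ := by
    have h0 := b.pos _ (C.base 0 (by omega))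
    have h1 := b.pos _ (C.base 1 hn)
    have h2 := b.pos _ hs
    simp only [inner_add_right, real_inner_smul_right]
    positivity
  have h1 := C.root le_rfl hn
  have h2 := b.obtuse _ (C.base 1 hn) _ hs (hsa 1 hn)
  have := IsBase.inner_self_pos hpos
  simp only [↓inner_add_add_self, inner_add_right, real_inner_smul_right, real_inner_smul_left,
    h.norm _ (C.mem 0 (by omega)), h.norm _ (C.mem 1 hn), h.norm s (b.mem s hs), h1] at this
  nlinarith [mul_nonneg hp.le (sub_nonneg.2 hx), mul_nonneg hp.le (neg_nonneg.2 h2)]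

theorem false_of_golden_middle (C : Chart Φ Δ a n 1 Real.goldenRatio) (h : IsRoot Φ)
    (b : IsBase Φ ρ Δ) (hn : 3 ≤ n) {s : V} (hs : s ∈ Δ) (hsa : ∀ i < n, a i ≠ s)
    (h0 : ⟪a 0, s⟫ ≤ -1) : False := by
  have hr := Real.goldenRatio_sq
  have hr0 := Real.goldenRatio_pos
  have hpos : 0 < ⟪ρ, (2 : ℝ) • a 0 + ((2 : ℝ) • a 1 + (a 2 + s))⟫ := by
    have h0 := b.pos _ (C.base 0 (by omega))
    have h1 := b.pos _ (C.base 1 (by omega))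
    have h2 := b.pos _ (C.base 2 (by omega))
    have h3 := b.pos _ hs
    simp only [inner_add_right, real_inner_smul_right]
    positivity
  have h2 := b.obtuse _ (C.base 1 (by omega)) _ hs (hsa 1 (by omega))
  have h3 := b.obtuse _ (C.base 2 (by omega)) _ hs (hsa 2 (by omega))
  have := IsBase.inner_self_pos hpos
  simp only [↓inner_add_add_self, inner_add_right, real_inner_smul_right, real_inner_smul_left,
    h.norm _ (C.mem 0 (by omega)), h.norm _ (C.mem 1 (by omega)), h.norm _ (C.mem 2 (by omega)),
    h.norm s (b.mem s hs), C.root le_rfl (by omega), C.root_far 2 (by omega) (by omega) (by omega),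
    C.chain 1 le_rfl (by omega)] at this
  nlinarith

theorem false_of_golden_five (C : Chart Φ Δ a 5 1 Real.goldenRatio) (h : IsRoot Φ)
    (b : IsBase Φ ρ Δ) : False := by
  have G : ∀ i < 5, ∀ j < 5, _ := fun i hi j hj => C.gram h hi hj
  have hb := fun i hi => b.pos _ (C.base i hi)
  have hr := Real.goldenRatio_sq
  have hr0 := Real.goldenRatio_pos
  generalize Real.goldenRatio = r at *
  have hpos : 0 < ⟪ρ, (5 : ℝ) • a 0 + r • ((4 : ℝ) • a 1 + ((3 : ℝ) • a 2 + ((2 : ℝ) • a 3 +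
      a 4)))⟫ := by
    have h0 := hb 0 (by omega)
    have h1 := hb 1 (by omega)
    have h2 := hb 2 (by omega)
    have h3 := hb 3 (by omega)
    have h4 := hb 4 (by omega)
    simp only [inner_add_right, real_inner_smul_right]
    positivity
  have := IsBase.inner_self_pos hpos
  simp [G, inner_add_left, inner_add_right, real_inner_smul_left, real_inner_smul_right,
    -inner_self_eq_norm_sq_to_K] at this
  nlinarith

theorem false_of_sqrt_two_middle (C : Chart Φ Δ a 4 1 √2) (h : IsRoot Φ) (b : IsBase Φ ρ Δ)
    {s : V} (hs : s ∈ Δ) (h0 : ⟪a 0, s⟫ = -1) (hsa : ∀ i < 4, i ≠ 0 → ⟪a i, s⟫ = 0) : False := by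
  have G : ∀ i < 4, ∀ j < 4, _ := fun i hi j hj => C.gram h hi hj
  have hb := fun i hi => b.pos _ (C.base i hi)
  have h2 : √2 * √2 = 2 := Real.mul_self_sqrt (by norm_num)
  have hpos : 0 < ⟪ρ, √2 • s + ((2 * √2) • a 0 + ((3 : ℝ) • a 1 + ((2 : ℝ) • a 2 + a 3)))⟫ := by
    have h0 := hb 0 (by omega)
    have h1 := hb 1 (by omega)
    have h2 := hb 2 (by omega)
    have h3 := hb 3 (by omega)
    have h4 := b.pos _ hs
    simp only [inner_add_right, real_inner_smul_right]
    positivity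
  have := IsBase.inner_self_pos hpos
  have hs' := fun i hi hi' => (real_inner_comm (a i) s).trans (hsa i hi hi')
  rw [real_inner_comm] at h0
  simp only [↓inner_add_add_self, inner_add_right, real_inner_smul_right, real_inner_smul_left,
    h.norm s (b.mem s hs), h0, hs' 1 (by omega) (by omega), hs' 2 (by omega) (by omega),
    hs' 3 (by omega) (by omega)] at this
  simp [G, -inner_self_eq_norm_sq_to_K] at this
  nlinarith

theorem false_of_six (C : Chart Φ Δ a 6 3 1) (h : IsRoot Φ) (b : IsBase Φ ρ Δ)
    {s : V} (hs : s ∈ Δ) (h0 : ⟪a 0, s⟫ = -1) (hsa : ∀ i < 6, i ≠ 0 → ⟪a i, s⟫ = 0) : False := by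
  have G : ∀ i < 6, ∀ j < 6, _ := fun i hi j hj => C.gram h hi hj
  have hpos : 0 < ⟪ρ, s + ((2 : ℝ) • a 0 + (a 1 + ((2 : ℝ) • a 2 + ((3 : ℝ) • a 3 +
      ((2 : ℝ) • a 4 + a 5)))))⟫ := by
    have := b.pos _ hs
    have hb := fun i hi => b.pos _ (C.base i hi)
    simp only [inner_add_right, real_inner_smul_right]
    linarith [hb 0 (by omega), hb 1 (by omega), hb 2 (by omega), hb 3 (by omega), hb 4 (by omega),
      hb 5 (by omega)]
  have := IsBase.inner_self_pos hpos
  have hs' := fun i hi hi' => (real_inner_comm (a i) s).trans (hsa i hi hi')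
  rw [real_inner_comm] at h0
  simp only [↓inner_add_add_self, inner_add_right, real_inner_smul_right, real_inner_smul_left,
    h.norm s (b.mem s hs), h0, hs' 1 (by omega) (by omega), hs' 2 (by omega) (by omega),
    hs' 3 (by omega) (by omega), hs' 4 (by omega) (by omega), hs' 5 (by omega) (by omega)] at this
  simp [G, -inner_self_eq_norm_sq_to_K] at this
  norm_num at this

theorem false_of_eight (C : Chart Φ Δ a 8 4 1) (h : IsRoot Φ) (b : IsBase Φ ρ Δ) : False := by
  have G : ∀ i < 8, ∀ j < 8, _ := fun i hi j hj => C.gram h hi hj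
  have hpos : 0 < ⟪ρ, (2 : ℝ) • a 0 + (a 1 + ((2 : ℝ) • a 2 + ((3 : ℝ) • a 3 +
      ((4 : ℝ) • a 4 + ((3 : ℝ) • a 5 + ((2 : ℝ) • a 6 + a 7))))))⟫ := by
    have hb := fun i hi => b.pos _ (C.base i hi)
    simp only [inner_add_right, real_inner_smul_right]
    linarith [hb 0 (by omega), hb 1 (by omega), hb 2 (by omega), hb 3 (by omega), hb 4 (by omega),
      hb 5 (by omega), hb 6 (by omega), hb 7 (by omega)]
  have := IsBase.inner_self_pos hpos
  simp only [↓inner_add_add_self, inner_add_right, real_inner_smul_right,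
    real_inner_smul_left] at this
  simp [G, -inner_self_eq_norm_sq_to_K] at this
  norm_num at this

theorem false_of_nine (C : Chart Φ Δ a 9 3 1) (h : IsRoot Φ) (b : IsBase Φ ρ Δ) : False := by
  have G : ∀ i < 9, ∀ j < 9, _ := fun i hi j hj => C.gram h hi hj
  have hpos : 0 < ⟪ρ, (3 : ℝ) • a 0 + ((2 : ℝ) • a 1 + ((4 : ℝ) • a 2 + ((6 : ℝ) • a 3 +
      ((5 : ℝ) • a 4 + ((4 : ℝ) • a 5 + ((3 : ℝ) • a 6 + ((2 : ℝ) • a 7 + a 8)))))))⟫ := by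
    have hb := fun i hi => b.pos _ (C.base i hi)
    simp only [inner_add_right, real_inner_smul_right]
    linarith [hb 0 (by omega), hb 1 (by omega), hb 2 (by omega), hb 3 (by omega), hb 4 (by omega),
      hb 5 (by omega), hb 6 (by omega), hb 7 (by omega), hb 8 (by omega)]
  have := IsBase.inner_self_pos hpos
  simp only [↓inner_add_add_self, inner_add_right, real_inner_smul_right,
    real_inner_smul_left] at this
  simp [G, -inner_self_eq_norm_sq_to_K] at this
  norm_num at this

end Chart

end

section

variable {V : Type*} [NormedAddCommGroup V] [InnerProductSpace ℝ V]

variable {Φ : Set V} {ρ : V} {Δ : Finset V} {a : ℕ → V} {n p : ℕ} {x : ℝ} {w : V ≃ₗᵢ[ℝ] V}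

theorem exists_maximal_of_le {P : ℕ → Prop} {N : ℕ} (h : ∃ n, P n) (hN : ∀ n, P n → n ≤ N) :
    ∃ n, P n ∧ ∀ m, P m → m ≤ n := by
  classical
  obtain ⟨n, hn⟩ := h
  exact ⟨Nat.findGreatest P N, Nat.findGreatest_spec (hN n hn) hn,
    fun m hm => Nat.le_findGreatest (hN m hm) hm⟩

theorem IsBase.exists_chart (b : IsBase Φ ρ Δ) {d e : V} (hd : d ∈ Δ) (he : e ∈ Δ)
    (hx : ⟪d, e⟫ = -x) : ∃ a, Chart Φ Δ a 2 1 x := by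
  have hb : ∀ i < 2, (if i = 0 then d else e) ∈ Δ := fun i _ => by split_ifs <;> assumption
  exact ⟨fun i => if i = 0 then d else e, ⟨fun i hi => b.mem _ (hb i hi), by omega, by omega,
    fun _ _ => by simpa using hx, by omega⟩, le_rfl, one_lt_two, hb⟩

namespace Chart

theorem exists_swap (C : Chart Φ Δ a n 1 x) : ∃ a', a' 0 = a 1 ∧ a' 1 = a 0 ∧
    Chart Φ Δ a' 2 1 x := by
  have hn := C.lt
  have hb : ∀ i < 2, (if i = 0 then a 1 else a 0) ∈ Δ := fun i _ => by
    split_ifs <;> exact C.base _ (by omega)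
  exact ⟨fun i => if i = 0 then a 1 else a 0, rfl, rfl, ⟨fun i _ => by
    split_ifs <;> exact C.mem _ (by omega), by omega, by omega,
    fun _ _ => by simpa [real_inner_comm] using C.root le_rfl hn, by omega⟩, le_rfl,
    one_lt_two, hb⟩

theorem full_or_exists [FiniteDimensional ℝ V] (C : Chart Φ Δ a n p x) (h : Critical Φ w)
    (b : IsBase Φ ρ Δ) (hx : 1 ≤ x) : (∀ d, d ∈ Δ ↔ ∃ i < n, a i = d) ∨
    ∃ s ∈ Δ, (∀ i < n, a i ≠ s) ∧ ∃ j < n, ⟪a j, s⟫ ≠ 0 ∧ ∀ i < n, i ≠ j → ⟪a i, s⟫ = 0 := by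
  classical
  have hn := C.lt
  have hT : ∀ d, d ∈ (Finset.range n).image a ↔ ∃ i < n, a i = d := by simp
  by_cases hΔ : (Finset.range n).image a = Δ
  · left
    rw [← hΔ]
    exact hT
  obtain ⟨s, hs, hsT, t, ht, hst⟩ := h.exists_adjacent b (T := (Finset.range n).image a)
    (fun d hd => by obtain ⟨i, hi, rfl⟩ := (hT d).1 hd; exact C.base i hi)
    ⟨a 0, (hT _).2 ⟨0, by omega, rfl⟩⟩ hΔ
  obtain ⟨j, hj, rfl⟩ := (hT t).1 ht
  rw [real_inner_comm] at hst
  have hsa : ∀ i < n, a i ≠ s := fun i hi he => hsT ((hT s).2 ⟨i, hi, he⟩)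
  refine .inr ⟨s, hs, hsa, j, hj, hst, fun i hi hij => ?_⟩
  by_contra hne
  exact hij (C.eq_of_inner_ne_zero h.isRoot b hx hs hsa hi hj hne hst)

theorem false_of_adj_of_maximal (C : Chart Φ Δ a n 1 x) (h : IsRoot Φ) (b : IsBase Φ ρ Δ)
    (hx : √2 ≤ x) (hmax : ∀ m, (∃ a y, √2 ≤ y ∧ Chart Φ Δ a m 1 y) → m ≤ n)
    {s : V} (hs : s ∈ Δ) (hsa : ∀ i < n, a i ≠ s) {j : ℕ} (hj : 1 ≤ j) (hjn : j < n)
    (h0 : ⟪a j, s⟫ ≠ 0) : False := by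
  have h1 : 1 ≤ √2 := Real.one_le_sqrt.2 (by norm_num)
  rcases b.inner_eq_or_le h (C.base j hjn) hs (hsa j hjn) h0 with h2 | h2
  · by_cases hj' : j + 1 < n
    · exact C.false_of_heavy h b hx hs hsa hj hjn (.inr ⟨h0, hj'⟩)
    · obtain rfl : j = n - 1 := by omega
      have := hmax _ ⟨_, x, hx, C.snoc b hs h2 fun i hi => by
        by_contra hne
        have := C.eq_of_inner_ne_zero h b (h1.trans hx) hs hsa (by omega) hjn hne h0
        omega⟩
      omega
  · exact C.false_of_heavy h b hx hs hsa hj hjn (.inl h2)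

theorem weight_eq (C : Chart Φ Δ a n 1 x) (h : IsRoot Φ) (b : IsBase Φ ρ Δ) (hx : √2 ≤ x) :
    x = √2 ∨ x = Real.goldenRatio ∨ √3 ≤ x := by
  have h1 : 1 < √2 := (Real.lt_sqrt zero_le_one).2 (by norm_num)
  have hn := C.lt
  have h0 := C.root le_rfl hn
  rcases b.gram_values h (C.base 0 (by omega)) (C.base 1 hn)
    (C.ne h (by linarith) (by omega) hn (by omega)) with h' | h' | h' | h' | h'
  · linarith
  · linarith
  · exact .inl (by linarith)
  · exact .inr (.inl (by linarith))
  · exact .inr (.inr (by linarith))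

theorem false_of_f4 [FiniteDimensional ℝ V] (C : Chart Φ Δ a 3 1 √2) (h : Critical Φ w)
    (b : IsBase Φ ρ Δ) (hmax : ∀ m, (∃ a y, √2 ≤ y ∧ Chart Φ Δ a m 1 y) → m ≤ 3)
    {s : V} (hs : s ∈ Δ) (hsa : ∀ i < 3, a i ≠ s) (h0 : ⟪a 0, s⟫ = -1)
    (hsa0 : ∀ i < 3, i ≠ 0 → ⟪a i, s⟫ = 0) : False := by
  classical
  obtain ⟨a', ha0, ha1, C'⟩ := C.exists_swap
  have C₂ := C'.snoc b hs (by rwa [ha1]) fun i hi => by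
    obtain rfl : i = 0 := by omega
    rw [ha0]; exact hsa0 1 (by omega) (by omega)
  have h20 : ⟪s, a 0⟫ = -1 := by rwa [real_inner_comm]
  by_cases hΔ : ({s, a 0, a 1, a 2} : Finset V) = Δ
  · refine h.false_of_f4 b (d₀ := s) (d₁ := a 0) (d₂ := a 1) (d₃ := a 2) (fun d => by
      rw [← hΔ]; simp) h20 (C.root le_rfl (by omega)) (C.chain 1 le_rfl (by omega)) ?_ ?_
      (C.root_far 2 (by omega) (by omega) (by omega))
    · rw [real_inner_comm]; exact hsa0 1 (by omega) (by omega)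
    · rw [real_inner_comm]; exact hsa0 2 (by omega) (by omega)
  · obtain ⟨s', hs', hsT, t, ht, hst⟩ := h.exists_adjacent b (T := {s, a 0, a 1, a 2})
      (fun d hd => by
        simp only [Finset.mem_insert, Finset.mem_singleton] at hd
        rcases hd with rfl | rfl | rfl | rfl
        · exact hs
        all_goals exact C.base _ (by omega)) ⟨s, by simp⟩ hΔ
    simp only [Finset.mem_insert, Finset.mem_singleton, not_or] at hsT ht
    rw [real_inner_comm] at hst
    have h1 : ∀ i < 3, a i ≠ s' := fun i hi he => by
      interval_cases i
      · exact hsT.2.1 he.symm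
      · exact hsT.2.2.1 he.symm
      · exact hsT.2.2.2 he.symm
    have h2 : ∀ i < 2 + 1, (if i = 2 then s else a' i) ≠ s' := fun i hi he => by
      interval_cases i
      · exact h1 1 (by omega) (ha0 ▸ he)
      · exact h1 0 (by omega) (ha1 ▸ he)
      · exact hsT.1 he.symm
    rcases ht with rfl | rfl | rfl | rfl
    · exact C₂.false_of_adj_of_maximal h.isRoot b le_rfl hmax hs' h2 (j := 2) (by omega) (by omega)
        hst
    · exact C₂.false_of_adj_of_maximal h.isRoot b le_rfl hmax hs' h2 (j := 1) (by omega) (by omega)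
        (by simpa [ha1] using hst)
    · exact C.false_of_adj_of_maximal h.isRoot b le_rfl hmax hs' h1 (j := 1) (by omega) (by omega)
        hst
    · exact C.false_of_adj_of_maximal h.isRoot b le_rfl hmax hs' h1 (j := 2) (by omega) (by omega)
        hst

theorem false_of_heavy_maximal [FiniteDimensional ℝ V] (C : Chart Φ Δ a n 1 x) (h : Critical Φ w)
    (b : IsBase Φ ρ Δ) (hc : 2 < Δ.card) (hx : √2 ≤ x)
    (hmax : ∀ m, (∃ a y, √2 ≤ y ∧ Chart Φ Δ a m 1 y) → m ≤ n) : False := by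
  classical
  have h1 : 1 ≤ √2 := Real.one_le_sqrt.2 (by norm_num)
  have hn := C.lt
  obtain ⟨a', ha0, ha1, C'⟩ := C.exists_swap
  rcases C.full_or_exists h b (h1.trans hx) with hΔ | ⟨s, hs, hsa, j, hj, hjs, hj0⟩
  · have hn3 : 3 ≤ n := by
      have h2 : Δ ⊆ (Finset.range n).image a := fun d hd => by simpa using (hΔ d).1 hd
      have := (Finset.card_le_card h2).trans Finset.card_image_le
      rw [Finset.card_range] at this
      omega
    rcases C.weight_eq h.isRoot b hx with rfl | rfl | hx3
    · exact C.toDiagram.false_of_sqrt_two h b hΔ hn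
    · rcases (by omega : n = 3 ∨ n = 4 ∨ 5 ≤ n) with rfl | rfl | h5
      · exact C.toDiagram.false_of_golden_three h b hΔ
      · exact C.toDiagram.false_of_golden_four h b hΔ
      · exact (C.take (by omega) h5).false_of_golden_five h.isRoot b
    · refine C'.false_of_sqrt_three h.isRoot b hx3 (C.base 2 (by omega)) (fun i hi => ?_) ?_
      · have hx0 : 0 ≤ x := by linarith
        interval_cases i
        · rw [ha0]; exact C.ne h.isRoot hx0 (by omega) (by omega) (by omega)
        · rw [ha1]; exact C.ne h.isRoot hx0 (by omega) (by omega) (by omega)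
      · rw [ha0]; exact (C.chain 1 le_rfl (by omega)).le
  · rcases Nat.eq_zero_or_pos j with rfl | hj'
    · rcases b.inner_eq_or_le h.isRoot (C.base 0 hj) hs (hsa 0 hj) hjs with h2 | h2
      · have hn2 : n ≠ 2 := by
          rintro rfl
          have := hmax _ ⟨_, x, hx, C'.snoc b hs (by rwa [ha1]) fun i hi => by
            obtain rfl : i = 0 := by omega
            rw [ha0]; exact hj0 1 (by omega) (by omega)⟩
          omega
        rcases C.weight_eq h.isRoot b hx with rfl | rfl | hx3
        · rcases (by omega : n = 3 ∨ 4 ≤ n) with rfl | h4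
          · exact C.false_of_f4 h b hmax hs hsa h2 hj0
          · exact (C.take (by omega) h4).false_of_sqrt_two_middle h.isRoot b hs h2
              fun i hi hi0 => hj0 i (by omega) hi0
        · exact C.false_of_golden_middle h.isRoot b (by omega) hs hsa h2.le
        · exact C.false_of_sqrt_three h.isRoot b hx3 hs hsa h2.le
      · exact C.false_of_heavy_root h.isRoot b hx hs hsa h2
    · exact C.false_of_adj_of_maximal h.isRoot b hx hmax hs hsa hj' hj hjs

theorem extend_fork (C : Chart Φ Δ a n 2 1) (b : IsBase Φ ρ Δ) {s : V} (hs : s ∈ Δ)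
    (h0 : ⟪a 0, s⟫ = -1) (hs0 : ∀ i < n, i ≠ 0 → ⟪a i, s⟫ = 0) : Chart Φ Δ
    (fun i => if i = 0 then a 1 else if i = 1 then s else if i = 2 then a 0 else a (i - 1))
    (n + 1) 3 1 := by
  have hn := C.lt
  have hb : ∀ i < n + 1, (if i = 0 then a 1 else if i = 1 then s else if i = 2 then a 0
      else a (i - 1)) ∈ Δ := fun i hi => by
    split_ifs
    · exact C.base _ (by omega)
    · exact hs
    all_goals exact C.base _ (by omega)
  have hs' := fun i hi hi' => (real_inner_comm (a i) s).trans (hs0 i hi hi')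
  refine ⟨⟨fun i hi => b.mem _ (hb i hi), fun i hi hi' => ?_, fun i j hi hij hj => ?_,
    fun _ _ => ?_, fun j hj hjn hjp => ?_⟩, by omega, by omega, hb⟩
  · rcases (by omega : i = 1 ∨ i = 2 ∨ 3 ≤ i) with rfl | rfl | hi3
    · simpa [real_inner_comm] using h0
    · simpa using C.root (by omega) hn
    · simp only [if_neg (show i ≠ 0 by omega), if_neg (show i ≠ 1 by omega),
        if_neg (show i ≠ 2 by omega), if_neg (show i + 1 ≠ 0 by omega),
        if_neg (show i + 1 ≠ 1 by omega), if_neg (show i + 1 ≠ 2 by omega)]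
      rw [show i + 1 - 1 = i - 1 + 1 by omega]
      exact C.chain _ (by omega) (by omega)
  · simp only [if_neg (show j ≠ 0 by omega), if_neg (show j ≠ 1 by omega),
        if_neg (show j ≠ 2 by omega), if_neg (show i ≠ 0 by omega)]
    split_ifs
    · exact hs' _ (by omega) (by omega)
    · exact C.root_far _ (by omega) (by omega) (by omega)
    · exact C.far _ _ (by omega) (by omega) (by omega)
  · simpa using C.chain 1 le_rfl (by omega)
  · simp only [if_neg (show j ≠ 0 by omega), if_true]
    split_ifs
    · exact hs0 1 (by omega) (by omega)
    · rw [real_inner_comm]; exact C.root_far 1 le_rfl (by omega) (by omega)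
    · exact C.far _ _ (by omega) (by omega) (by omega)

theorem false_of_branch_maximal_aux [FiniteDimensional ℝ V] (C : Chart Φ Δ a n p 1)
    (h : Critical Φ w) (b : IsBase Φ ρ Δ)
    (hsimple : ∀ d ∈ Δ, ∀ e ∈ Δ, d ≠ e → ⟪d, e⟫ ≠ 0 → ⟪d, e⟫ = -1) (hp : 2 ≤ p) (hpn : 2 * p ≤ n)
    (hn : p + 1 < n)
    (hmax : ∀ m, (∃ a p, 2 ≤ p ∧ p + 1 < m ∧ Chart Φ Δ a m p 1) → m ≤ n) : False := by
  rcases C.full_or_exists h b le_rfl with hΔ | ⟨s, hs, hsa, j, hj, hjs, hj0⟩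
  · rcases (by omega : p = 2 ∨ p = 3 ∨ 4 ≤ p) with rfl | rfl | h4
    · exact C.toDiagram.false_of_fork h b hΔ C.lt
    · rcases (by omega : n = 6 ∨ n = 7 ∨ n = 8 ∨ 9 ≤ n) with rfl | rfl | rfl | h9
      · exact C.toDiagram.false_of_six h b hΔ
      · exact C.toDiagram.false_of_seven h b hΔ
      · exact C.toDiagram.false_of_eight h b hΔ
      · exact (C.take (by omega) h9).false_of_nine h.isRoot b
    · have C' := (C.shift (k := p - 4) (by omega)).take (m := 8) (by omega) (by omega)
      rw [show p - (p - 4) = 4 by omega] at C'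
      exact C'.false_of_eight h.isRoot b
  have h1 := hsimple _ (C.base j hj) _ hs (hsa j hj) hjs
  have hrs : ∀ i < n, (if i = 0 then a 0 else a (n - i)) ≠ s := fun i hi => by
    split_ifs
    · exact hsa 0 (by omega)
    · exact hsa _ (by omega)
  rcases (by omega : j = 0 ∨ j = 1 ∨ j = n - 1 ∨ 1 < j ∧ j < p ∨ p ≤ j ∧ j + 1 < n) with
    rfl | rfl | rfl | hj' | hj'
  · rcases (by omega : p = 2 ∨ 3 ≤ p) with rfl | h3
    · have := hmax _ ⟨_, 3, by omega, by omega, C.extend_fork b hs h1 hj0⟩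
      omega
    · have C' := (C.shift (k := p - 3) (by omega)).take (m := 6) (by omega) (by omega)
      rw [show p - (p - 3) = 3 by omega] at C'
      refine C'.false_of_six h.isRoot b hs h1 fun i hi hi0 => ?_
      rw [if_neg hi0]
      exact hj0 _ (by omega) (by omega)
  · have := hmax _ ⟨_, n - p, by omega, by omega, C.reverse.snoc b hs
      (by rwa [if_neg (by omega), show n - (n - 1) = 1 by omega]) fun i hi => by
        split_ifs
        · exact hj0 0 (by omega) (by omega)
        · exact hj0 _ (by omega) (by omega)⟩
    omega
  · have := hmax _ ⟨_, p, by omega, by omega, C.snoc b hs h1 fun i hi =>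
      hj0 i (by omega) (by omega)⟩
    omega
  · refine C.reverse.false_of_two_branches h.isRoot b (by omega) hs hrs (j := n - j) (by omega)
      (by omega) ?_
    rwa [if_neg (by omega), show n - (n - j) = j by omega]
  · exact C.false_of_two_branches h.isRoot b hp hs hsa hj'.1 hj'.2 hjs

theorem false_of_branch_maximal [FiniteDimensional ℝ V] (C : Chart Φ Δ a n p 1)
    (h : Critical Φ w) (b : IsBase Φ ρ Δ)
    (hsimple : ∀ d ∈ Δ, ∀ e ∈ Δ, d ≠ e → ⟪d, e⟫ ≠ 0 → ⟪d, e⟫ = -1) (hp : 2 ≤ p) (hn : p + 1 < n)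
    (hmax : ∀ m, (∃ a p, 2 ≤ p ∧ p + 1 < m ∧ Chart Φ Δ a m p 1) → m ≤ n) : False := by
  rcases (by omega : 2 * p ≤ n ∨ 2 * (n - p) ≤ n) with h2 | h2
  · exact C.false_of_branch_maximal_aux h b hsimple hp h2 hn hmax
  · exact C.reverse.false_of_branch_maximal_aux h b hsimple (by omega) h2 (by omega) hmax

theorem branch (C : Chart Φ Δ a n 1 1) (b : IsBase Φ ρ Δ) {s : V} (hs : s ∈ Δ) {j : ℕ}
    (hj : j < n) (h0 : ⟪a j, s⟫ = -1) (hs0 : ∀ i < n, i ≠ j → ⟪a i, s⟫ = 0) :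
    Chart Φ Δ (fun i => if i = 0 then s else a (i - 1)) (n + 1) (j + 1) 1 := by
  have hn := C.lt
  have hb : ∀ i < n + 1, (if i = 0 then s else a (i - 1)) ∈ Δ := fun i hi => by
    split_ifs
    · exact hs
    · exact C.base _ (by omega)
  refine ⟨⟨fun i hi => b.mem _ (hb i hi), fun i hi hi' => ?_, fun i j hi hij hj => ?_,
    fun _ _ => ?_, fun j hj hjn hjp => ?_⟩, by omega, by omega, hb⟩
  · simp only [if_neg (show i ≠ 0 by omega), if_neg (show i + 1 ≠ 0 by omega)]
    rcases (by omega : i = 1 ∨ 2 ≤ i) with rfl | hi2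
    · exact C.root le_rfl hn
    · rw [show i + 1 - 1 = i - 1 + 1 by omega]
      exact C.chain _ (by omega) (by omega)
  · simp only [if_neg (show i ≠ 0 by omega), if_neg (show j ≠ 0 by omega)]
    rcases (by omega : i = 1 ∨ 2 ≤ i) with rfl | hi2
    · exact C.root_far _ (by omega) (by omega) (by omega)
    · exact C.far _ _ (by omega) (by omega) (by omega)
  · simpa [real_inner_comm] using h0
  · simp only [if_neg (show j ≠ 0 by omega), if_true]
    rw [real_inner_comm]
    exact hs0 _ (by omega) (by omega)

end Chart

/-- There is no minimal counterexample to reversibility. -/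
theorem Critical.false [FiniteDimensional ℝ V] (h : Critical Φ w) : False := by
  classical
  obtain ⟨ρ, Δ, b⟩ := h.isRoot.exists_base
  have hc : 2 < Δ.card := by
    have h1 := b.top_le_span h (S := (Δ : Set V)) fun d hd => Submodule.subset_span hd
    have h2 := finrank_span_finset_le_card (R := ℝ) Δ
    rw [Set.finrank, top_le_iff.1 h1, finrank_top] at h2
    exact h.two_lt_finrank.trans_le h2
  have h1 : 1 ≤ √2 := Real.one_le_sqrt.2 (by norm_num)
  by_cases hheavy : ∃ n a x, √2 ≤ x ∧ Chart Φ Δ a n 1 x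
  · obtain ⟨n, ⟨a, x, hx, C⟩, hmax⟩ := exists_maximal_of_le hheavy (N := Δ.card)
      fun n ⟨a, x, hx, C⟩ => C.le_card h.isRoot (by linarith)
    exact C.false_of_heavy_maximal h b hc hx hmax
  have hsimple : ∀ d ∈ Δ, ∀ e ∈ Δ, d ≠ e → ⟪d, e⟫ ≠ 0 → ⟪d, e⟫ = -1 := by
    intro d hd e he hde h0
    rcases b.inner_eq_or_le h.isRoot hd he hde h0 with h2 | h2
    · exact h2
    · obtain ⟨a, C⟩ := b.exists_chart hd he (x := -⟪d, e⟫) (by ring)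
      exact absurd ⟨2, a, _, by linarith, C⟩ hheavy
  by_cases hbranch : ∃ n a p, 2 ≤ p ∧ p + 1 < n ∧ Chart Φ Δ a n p 1
  · obtain ⟨n, ⟨a, p, hp, hn, C⟩, hmax⟩ := exists_maximal_of_le hbranch (N := Δ.card)
      fun n ⟨a, p, _, _, C⟩ => C.le_card h.isRoot zero_le_one
    exact C.false_of_branch_maximal h b hsimple hp hn hmax
  have hpath : ∃ n a, Chart Φ Δ a n 1 1 := by
    obtain ⟨d, hd⟩ := Finset.card_pos.1 (by omega : 0 < Δ.card)
    obtain ⟨s, hs, hsT, t, ht, hst⟩ := h.exists_adjacent b (T := {d}) (by simpa) (by simp)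
      fun he => by simp [← he] at hc
    obtain rfl : t = d := by simpa using ht
    exact ⟨2, b.exists_chart hs hd (hsimple _ hs _ hd (by simpa using hsT) hst)⟩
  obtain ⟨n, ⟨a, C⟩, hmax⟩ := exists_maximal_of_le hpath (N := Δ.card)
    fun n ⟨a, C⟩ => C.le_card h.isRoot zero_le_one
  rcases C.full_or_exists h b le_rfl with hΔ | ⟨s, hs, hsa, j, hj, hjs, hj0⟩
  · exact C.toDiagram.false_of_simple_path h b hΔ
  have h2 := hsimple _ (C.base j hj) _ hs (hsa j hj) hjs
  have hn := C.lt
  rcases (by omega : j = 0 ∨ j = n - 1 ∨ 1 ≤ j ∧ j + 1 < n) with rfl | rfl | hj'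
  · have := hmax _ ⟨_, C.path_reverse.snoc b hs
      (by rwa [show n - 1 - (n - 1) = 0 by omega]) fun i hi => hj0 _ (by omega) (by omega)⟩
    omega
  · have := hmax _ ⟨_, C.snoc b hs h2 fun i hi => hj0 _ (by omega) (by omega)⟩
    omega
  · exact hbranch ⟨_, _, _, by omega, by omega, C.branch b hs hj h2 hj0⟩

end

end RootSet

namespace CoxeterSystem

open Real Module RootSet
open scoped RealInnerProductSpace

/-- The rescaled Chebyshev sequence `sin (n θ) / sin θ`, where `c = cos θ`. -/
noncomputable def dihedralSeq (c : ℝ) : ℕ → ℝ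
  | 0 => 0
  | 1 => 1
  | n + 2 => 2 * c * dihedralSeq c (n + 1) - dihedralSeq c n

theorem dihedralSeq_add_two (c : ℝ) (n : ℕ) :
    dihedralSeq c (n + 2) = 2 * c * dihedralSeq c (n + 1) - dihedralSeq c n := by
  rw [dihedralSeq]

theorem dihedralSeq_cos (θ : ℝ) (n : ℕ) : dihedralSeq (cos θ) n * sin θ = sin (n * θ) := by
  induction n using Nat.twoStepInduction with
  | zero => simp [dihedralSeq]
  | one => simp [dihedralSeq]
  | more n h0 h1 =>
    rw [dihedralSeq_add_two, sub_mul, h0, mul_assoc, h1]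
    have e1 : ((n + 2 : ℕ) : ℝ) * θ = ((n + 1 : ℕ) : ℝ) * θ + θ := by push_cast; ring
    have e2 : (n : ℝ) * θ = ((n + 1 : ℕ) : ℝ) * θ - θ := by push_cast; ring
    rw [e1, e2, sin_add, sin_sub]
    ring

theorem dihedralSeq_one (n : ℕ) : dihedralSeq 1 n = n := by
  induction n using Nat.twoStepInduction with
  | zero => simp [dihedralSeq]
  | one => simp [dihedralSeq]
  | more n h0 h1 => rw [dihedralSeq_add_two, h0, h1]; push_cast; ring

theorem sin_pi_div_pos {m : ℕ} (hm : 2 ≤ m) : 0 < sin (π / m) := by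
  have : (2 : ℝ) ≤ m := by exact_mod_cast hm
  apply sin_pos_of_pos_of_lt_pi (by positivity)
  exact div_lt_self pi_pos (by linarith)

theorem dihedralSeq_nonneg {m n : ℕ} (hm : m ≠ 1) (hn : m = 0 ∨ n ≤ m) :
    0 ≤ dihedralSeq (cos (π / m)) n := by
  rcases eq_or_ne m 0 with rfl | h0
  · simp [dihedralSeq_one]
  have hs := sin_pi_div_pos (show 2 ≤ m by lia)
  have hn' : (n : ℝ) ≤ m := by exact_mod_cast hn.resolve_left h0
  have hm' : (0 : ℝ) < m := by positivity
  refine nonneg_of_mul_nonneg_left ?_ hs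
  rw [dihedralSeq_cos]
  apply sin_nonneg_of_nonneg_of_le_pi (by positivity)
  calc (n : ℝ) * (π / m) ≤ m * (π / m) := by gcongr
    _ = π := by field_simp

section Dihedral

variable {X : Type*} [AddCommGroup X] [Module ℝ X] {f g : Dual ℝ X} {a b : X} {c : ℝ}

theorem preReflection_mul_pow_apply_left (hf : f a = 2) (hg : g b = 2) (hfb : f b = -2 * c)
    (hga : g a = -2 * c) (k : ℕ) :
    ((preReflection a f * preReflection b g) ^ k) a =
      dihedralSeq c (2 * k + 1) • a + dihedralSeq c (2 * k) • b := by
  induction k with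
  | zero => simp [dihedralSeq]
  | succ k ih =>
    rw [pow_succ', Module.End.mul_apply, ih, Module.End.mul_apply, preReflection_apply,
      preReflection_apply]
    simp only [map_add, map_sub, map_smul, hf, hg, hfb, hga, smul_eq_mul]
    rw [show 2 * (k + 1) + 1 = 2 * k + 1 + 2 by ring, show 2 * (k + 1) = 2 * k + 2 by ring,
      dihedralSeq_add_two, dihedralSeq_add_two]
    module

theorem preReflection_mul_pow_apply_right (hf : f a = 2) (hg : g b = 2) (hfb : f b = -2 * c)
    (hga : g a = -2 * c) (k : ℕ) :
    ((preReflection a f * preReflection b g) ^ (k + 1)) b =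
      -(dihedralSeq c (2 * k + 2) • a + dihedralSeq c (2 * k + 1) • b) := by
  induction k with
  | zero =>
    simp [dihedralSeq, preReflection_apply, hg, hfb]
    module
  | succ k ih =>
    rw [pow_succ', Module.End.mul_apply, ih, Module.End.mul_apply, preReflection_apply,
      preReflection_apply]
    simp only [map_add, map_sub, map_smul, map_neg, hf, hg, hfb, hga, smul_eq_mul]
    rw [show 2 * (k + 1) + 2 = 2 * k + 2 + 2 by ring, show 2 * (k + 1) + 1 = 2 * k + 1 + 2 by ring,
      dihedralSeq_add_two c (2 * k + 2), show 2 * k + 2 + 1 = 2 * k + 1 + 2 by ring,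
      dihedralSeq_add_two c (2 * k + 1)]
    module

theorem preReflection_mul_pow_eq_one {m : ℕ} (hm : 2 ≤ m) (hf : f a = 2) (hg : g b = 2)
    (hfb : f b = -2 * cos (π / m)) (hga : g a = -2 * cos (π / m)) :
    (preReflection a f * preReflection b g) ^ m = 1 := by
  have hs := sin_pi_div_pos hm
  have hm0 : (m : ℝ) ≠ 0 := by positivity
  set θ := π / m with hθ
  have hmθ : m * θ = π := by rw [hθ]; field_simp
  have hu (n : ℕ) : dihedralSeq (cos θ) n = sin (n * θ) / sin θ := by
    rw [← dihedralSeq_cos]; field_simp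
  have h2 : sin (((2 * m : ℕ) : ℝ) * θ) = 0 := by
    rw [Nat.cast_mul, mul_assoc, hmθ]; simp
  have h3 : sin (((2 * m + 1 : ℕ) : ℝ) * θ) = sin θ := by
    rw [show ((2 * m + 1 : ℕ) : ℝ) * θ = θ + 2 * π by push_cast; rw [← hmθ]; ring, sin_add_two_pi]
  have ha : ((preReflection a f * preReflection b g) ^ m) a = a := by
    rw [preReflection_mul_pow_apply_left hf hg hfb hga, hu, hu, h2, h3, div_self hs.ne']; simp
  have hb : ((preReflection a f * preReflection b g) ^ m) b = b := by
    obtain ⟨k, rfl⟩ := Nat.exists_eq_add_of_le' (show 1 ≤ m by lia)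
    have h1 : sin (((2 * k + 1 : ℕ) : ℝ) * θ) = -sin θ := by
      rw [show ((2 * k + 1 : ℕ) : ℝ) * θ = -θ + 2 * π by
        push_cast at hmθ ⊢; rw [← hmθ]; ring, sin_add_two_pi, sin_neg]
    rw [preReflection_mul_pow_apply_right hf hg hfb hga, hu, hu, h1,
      show 2 * k + 2 = 2 * (k + 1) by ring, h2, neg_div, div_self hs.ne']
    simp
  ext x
  have hdet : 1 - cos θ ^ 2 ≠ 0 := by rw [← sin_sq]; positivity
  obtain ⟨p, q, y, hx, hy1, hy2⟩ : ∃ p q : ℝ, ∃ y, x = y + p • a + q • b ∧ f y = 0 ∧ g y = 0 := by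
    refine ⟨(f x + cos θ * g x) / (2 * (1 - cos θ ^ 2)), (g x + cos θ * f x) /
      (2 * (1 - cos θ ^ 2)), _, (by rw [add_assoc]; exact (sub_add_cancel x _).symm), ?_, ?_⟩ <;>
    · simp only [map_sub, map_add, map_smul, hf, hg, hfb, hga, smul_eq_mul]
      field_simp
      ring
  have hy (k : ℕ) : ((preReflection a f * preReflection b g) ^ k) y = y := by
    induction k with
    | zero => simp
    | succ k ih => rw [pow_succ', Module.End.mul_apply, ih]; simp [preReflection_apply, hy1, hy2]
  simp [hx, ha, hb, hy]

end Dihedral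

section

variable {B W : Type*} [Group W] {M : CoxeterMatrix B} [Fintype B]

/-- The form `x ↦ 2 ⟨α i, x⟩` of the geometric representation. -/
noncomputable def coroot (M : CoxeterMatrix B) (i : B) : Dual ℝ (B → ℝ) :=
  ∑ j, (-2 * cos (π / M i j)) • LinearMap.proj j

variable [DecidableEq B]

/-- The simple root `α i` of the geometric representation. -/
def simpleRoot (i : B) : B → ℝ := Pi.single i 1

theorem coroot_simpleRoot (i j : B) :
    coroot M i (simpleRoot j) = -2 * cos (π / M i j) := by
  simp [coroot, simpleRoot, Pi.single_apply]

theorem coroot_simpleRoot_self (i : B) : coroot M i (simpleRoot i) = 2 := by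
  simp [coroot_simpleRoot]

theorem isLiftable_preReflection :
    M.IsLiftable fun i : B => preReflection (simpleRoot i) (coroot M i) := by
  intro i j
  rcases eq_or_ne i j with rfl | hij
  · rw [M.diagonal, pow_one]
    refine LinearMap.ext fun x => ?_
    exact involutive_preReflection (coroot_simpleRoot_self i) x
  rcases Nat.eq_zero_or_pos (M i j) with h | h
  · rw [h, pow_zero]
  · refine preReflection_mul_pow_eq_one (by have := M.off_diagonal i j hij; lia)
      (coroot_simpleRoot_self i) (coroot_simpleRoot_self j) (coroot_simpleRoot i j) ?_
    rw [coroot_simpleRoot, M.symmetric]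

/-- The geometric representation of a Coxeter group. -/
noncomputable def geomRep (cs : CoxeterSystem M W) : W →* Module.End ℝ (B → ℝ) :=
  cs.lift ⟨_, isLiftable_preReflection⟩

theorem geomRep_simple (cs : CoxeterSystem M W) (i : B) (x : B → ℝ) :
    cs.geomRep (cs.simple i) x = x - coroot M i x • simpleRoot i := by
  rw [geomRep, cs.lift_apply_simple, preReflection_apply]

end

section

variable {B W : Type*} [Group W] {M : CoxeterMatrix B}

theorem exists_eq_mul_alternatingWord (cs : CoxeterSystem M W) {w : W} {i j : B}
    (hi : ¬cs.IsRightDescent w i) (hj : cs.IsRightDescent w j) :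
    ∃ v k, w = v * cs.wordProd (alternatingWord i j k) ∧ cs.length v < cs.length w ∧
      ¬cs.IsRightDescent v i ∧ ¬cs.IsRightDescent v j ∧ (M i j = 0 ∨ k < M i j) := by
  classical
  let P : ℕ → Prop := fun k => ∃ v, w = v * cs.wordProd (alternatingWord i j k) ∧
    cs.length w = cs.length v + k
  have hP1 : P 1 := by
    refine ⟨w * cs.simple j, by simp [alternatingWord], ?_⟩
    rw [isRightDescent_iff] at hj
    exact hj.symm
  have hb (k : ℕ) (hk : P k) : k ≤ cs.length w := by
    obtain ⟨v, -, h⟩ := hk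
    lia
  obtain ⟨v, hw, hl⟩ := Nat.findGreatest_spec (P := P) (hb 1 hP1) hP1
  have hk1 : 1 ≤ Nat.findGreatest P (cs.length w) := Nat.le_findGreatest (hb 1 hP1) hP1
  have hmax : ¬P (Nat.findGreatest P (cs.length w) + 1) := fun h =>
    absurd (Nat.le_findGreatest (hb _ h) h) (by lia)
  generalize Nat.findGreatest P (cs.length w) = k at *
  obtain ⟨k, rfl⟩ := Nat.exists_eq_add_of_le' hk1
  have hbad (v' : W) (l : List B) (h : w = v' * cs.wordProd l) :
      cs.length w ≤ cs.length v' + l.length := by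
    rw [h]
    exact (cs.length_mul_le _ _).trans (by gcongr; exact cs.length_wordProd_le l)
  have hfst : ¬cs.IsRightDescent v (if Even (k + 1) then j else i) := fun h => hmax
    ⟨v * cs.simple (if Even (k + 1) then j else i), by
      rw [alternatingWord_succ' i j (k + 1), wordProd_cons, mul_assoc, simple_mul_simple_cancel_left,
        hw], by
      rw [isRightDescent_iff] at h
      lia⟩
  have hsnd : ¬cs.IsRightDescent v (if Even k then j else i) := fun h => by
    have := hbad (v * cs.simple (if Even k then j else i)) (alternatingWord i j k) (by
      rw [hw, alternatingWord_succ' i j k, wordProd_cons, mul_assoc])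
    rw [isRightDescent_iff] at h
    rw [length_alternatingWord] at this
    lia
  have hvij : ¬cs.IsRightDescent v i ∧ ¬cs.IsRightDescent v j := by
    by_cases hk : Even k <;> simp only [Nat.even_add_one, hk, not_true, not_false_eq_true, if_true,
      if_false] at hfst hsnd
    exacts [⟨hfst, hsnd⟩, ⟨hsnd, hfst⟩]
  refine ⟨v, k + 1, hw, by lia, hvij.1, hvij.2, or_iff_not_imp_left.2 fun hM => ?_⟩
  by_contra! hlt
  rcases hlt.lt_or_eq with hlt | heq
  · have h1 := cs.not_isReduced_alternatingWord i j hM hlt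
    have h2 := cs.length_wordProd_le (alternatingWord i j (k + 1))
    have h3 := cs.length_mul_le v (cs.wordProd (alternatingWord i j (k + 1)))
    rw [IsReduced, length_alternatingWord] at h1
    rw [length_alternatingWord] at h2
    rw [← hw] at h3
    lia
  · apply hi
    have h1 := cs.prod_alternatingWord_eq_prod_alternatingWord_sub i j (k + 1) (by lia)
    rw [show M i j * 2 - (k + 1) = k + 1 by lia, alternatingWord_succ j i, List.concat_eq_append,
      wordProd_append, wordProd_singleton] at h1
    have h2 := cs.length_mul_le v (cs.wordProd (alternatingWord i j k))
    have h3 := cs.length_wordProd_le (alternatingWord i j k)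
    rw [length_alternatingWord] at h3
    have h4 : w * cs.simple i = v * cs.wordProd (alternatingWord i j k) := by
      rw [hw, h1, mul_assoc, simple_mul_simple_cancel_right]
    rw [IsRightDescent, h4]
    lia

variable [DecidableEq B]

theorem simpleRoot_nonneg (i : B) : 0 ≤ simpleRoot i := by simp [simpleRoot]

variable [Fintype B]

theorem geomRep_alternatingWord (cs : CoxeterSystem M W) (i j : B) (k : ℕ) :
    cs.geomRep (cs.wordProd (alternatingWord i j k)) (simpleRoot i) =
      if Even k then dihedralSeq (cos (π / M i j)) (k + 1) • simpleRoot i +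
        dihedralSeq (cos (π / M i j)) k • simpleRoot j
      else dihedralSeq (cos (π / M i j)) k • simpleRoot i +
        dihedralSeq (cos (π / M i j)) (k + 1) • simpleRoot j := by
  induction k with
  | zero => simp [alternatingWord, dihedralSeq]
  | succ k ih =>
    rw [alternatingWord_succ', wordProd_cons, map_mul, Module.End.mul_apply, ih]
    rcases Nat.even_or_odd k with hk | hk
    · rw [if_pos hk, if_pos hk, if_neg (by simpa [Nat.even_add_one] using hk), geomRep_simple]
      simp only [map_add, map_smul, coroot_simpleRoot_self, coroot_simpleRoot, smul_eq_mul,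
        dihedralSeq_add_two, M.symmetric j i]
      module
    · rw [← Nat.not_even_iff_odd] at hk
      rw [if_neg hk, if_neg hk, if_pos (by simpa [Nat.even_add_one] using hk), geomRep_simple]
      simp only [map_add, map_smul, coroot_simpleRoot_self, coroot_simpleRoot, smul_eq_mul,
        dihedralSeq_add_two]
      module

theorem geomRep_simpleRoot_nonneg (cs : CoxeterSystem M W) (w : W) (i : B)
    (hi : ¬cs.IsRightDescent w i) : 0 ≤ cs.geomRep w (simpleRoot i) := by
  induction hn : cs.length w using Nat.strong_induction_on generalizing w i with
  | _ n ih =>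
  subst hn
  rcases eq_or_ne w 1 with rfl | hw1
  · simpa using simpleRoot_nonneg i
  obtain ⟨j, hj⟩ := cs.exists_rightDescent_of_ne_one hw1
  have hij : i ≠ j := fun h => hi (h ▸ hj)
  obtain ⟨v, k, hw, hl, hvi, hvj, hk⟩ := cs.exists_eq_mul_alternatingWord hi hj
  have h1 := ih _ hl v i hvi rfl
  have h2 := ih _ hl v j hvj rfl
  have hM := M.off_diagonal i j hij
  have h3 := dihedralSeq_nonneg hM (n := k) (by lia)
  have h4 := dihedralSeq_nonneg hM (n := k + 1) (by lia)
  rw [hw, map_mul, Module.End.mul_apply, geomRep_alternatingWord]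
  split_ifs <;> rw [map_add, map_smul, map_smul] <;>
    exact add_nonneg (smul_nonneg ‹_› h1) (smul_nonneg ‹_› h2)

theorem geomRep_injective (cs : CoxeterSystem M W) : Function.Injective cs.geomRep := by
  rw [injective_iff_map_eq_one]
  intro w hw
  by_contra hw1
  obtain ⟨i, hi⟩ := cs.exists_rightDescent_of_ne_one hw1
  rw [isRightDescent_iff_not_isRightDescent_mul] at hi
  have h := cs.geomRep_simpleRoot_nonneg _ i hi
  rw [map_mul, hw, one_mul, geomRep_simple, coroot_simpleRoot_self] at h
  have := h i
  simp [simpleRoot] at this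

end

section

variable {B W : Type*} [Group W] {M : CoxeterMatrix B} [Fintype B] [DecidableEq B]

/-- The geometric representation embedded in a Euclidean space, so that the group acts by
isometries of the image. -/
noncomputable def geomEmbed (cs : CoxeterSystem M W) :
    (B → ℝ) →ₗ[ℝ] EuclideanSpace ℝ (W × B) :=
  (WithLp.linearEquiv 2 ℝ (W × B → ℝ)).symm.toLinearMap ∘ₗ
    LinearMap.pi fun p => LinearMap.proj p.2 ∘ₗ cs.geomRep p.1

theorem geomEmbed_apply (cs : CoxeterSystem M W) (x : B → ℝ) (p : W × B) :
    cs.geomEmbed x p = cs.geomRep p.1 x p.2 := rfl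

theorem geomEmbed_injective (cs : CoxeterSystem M W) : Function.Injective cs.geomEmbed := by
  intro x y h
  ext b
  have := congrArg (fun z : EuclideanSpace ℝ (W × B) => z (1, b)) h
  simpa [geomEmbed_apply] using this

variable [Fintype W]

theorem inner_geomEmbed_geomRep (cs : CoxeterSystem M W) (u : W) (x y : B → ℝ) :
    ⟪cs.geomEmbed (cs.geomRep u x), cs.geomEmbed (cs.geomRep u y)⟫ =
      ⟪cs.geomEmbed x, cs.geomEmbed y⟫ := by
  simp only [PiLp.inner_apply]
  refine Fintype.sum_equiv ((Equiv.mulRight u).prodCongr (Equiv.refl B)) _ _ fun p => ?_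
  simp [geomEmbed_apply]

theorem inner_geomEmbed_simpleRoot_pos (cs : CoxeterSystem M W) (i : B) :
    0 < ⟪cs.geomEmbed (simpleRoot i), cs.geomEmbed (simpleRoot i)⟫ := by
  refine real_inner_self_pos.2 fun h => ?_
  have := cs.geomEmbed_injective (h.trans (map_zero cs.geomEmbed).symm)
  simp [simpleRoot] at this

theorem coroot_mul_inner (cs : CoxeterSystem M W) (i : B) (x : B → ℝ) :
    coroot M i x * ⟪cs.geomEmbed (simpleRoot i), cs.geomEmbed (simpleRoot i)⟫ =
      2 * ⟪cs.geomEmbed (simpleRoot i), cs.geomEmbed x⟫ := by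
  have h := cs.inner_geomEmbed_geomRep (cs.simple i) (simpleRoot i) x
  simp only [geomRep_simple, coroot_simpleRoot_self, map_sub, map_smul, inner_sub_left,
    inner_sub_right, real_inner_smul_left, real_inner_smul_right] at h
  linarith

/-- The root `w (α i)`, scaled to have squared norm `2`. -/
noncomputable def scaledRoot (cs : CoxeterSystem M W) (w : W) (i : B) :
    EuclideanSpace ℝ (W × B) :=
  √(2 / ⟪cs.geomEmbed (simpleRoot i), cs.geomEmbed (simpleRoot i)⟫) •
    cs.geomEmbed (cs.geomRep w (simpleRoot i))

theorem inner_scaledRoot_self (cs : CoxeterSystem M W) (w : W) (i : B) :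
    ⟪cs.scaledRoot w i, cs.scaledRoot w i⟫ = 2 := by
  have h := cs.inner_geomEmbed_simpleRoot_pos i
  rw [scaledRoot, real_inner_smul_left, real_inner_smul_right, inner_geomEmbed_geomRep,
    ← mul_assoc, mul_self_sqrt (by positivity)]
  field_simp

theorem refl_scaledRoot_geomEmbed (cs : CoxeterSystem M W) (w : W) (i : B) (x : B → ℝ) :
    refl (cs.scaledRoot w i) (cs.geomEmbed x) =
      cs.geomEmbed (cs.geomRep (w * cs.simple i * w⁻¹) x) := by
  have hx : cs.geomRep w (cs.geomRep w⁻¹ x) = x := by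
    rw [← Module.End.mul_apply, ← map_mul, mul_inv_cancel, map_one, Module.End.one_apply]
  have h := cs.inner_geomEmbed_simpleRoot_pos i
  have h1 := cs.coroot_mul_inner i (cs.geomRep w⁻¹ x)
  rw [← cs.inner_geomEmbed_geomRep w (simpleRoot i) (cs.geomRep w⁻¹ x), hx] at h1
  rw [refl_apply (cs.inner_scaledRoot_self w i), scaledRoot, real_inner_smul_left, smul_smul,
    mul_right_comm, mul_self_sqrt (by positivity), map_mul, map_mul, Module.End.mul_apply,
    Module.End.mul_apply, geomRep_simple, map_sub, map_smul, hx, map_sub, map_smul,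
    div_mul_eq_mul_div, ← h1, mul_div_cancel_right₀ _ h.ne']

theorem isRoot_range_scaledRoot (cs : CoxeterSystem M W) :
    IsRoot (Set.range fun p : W × B => cs.scaledRoot p.1 p.2) where
  finite := Set.finite_range _
  norm := by
    rintro _ ⟨p, rfl⟩
    exact cs.inner_scaledRoot_self p.1 p.2
  refl_mem := by
    rintro _ ⟨⟨w, i⟩, rfl⟩ _ ⟨⟨v, j⟩, rfl⟩
    refine ⟨(w * cs.simple i * w⁻¹ * v, j), ?_⟩
    dsimp only
    rw [scaledRoot.eq_def cs v j, map_smul, refl_scaledRoot_geomEmbed, scaledRoot,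
      map_mul _ _ v, Module.End.mul_apply]

theorem exists_mem_weyl_comp_geomEmbed (cs : CoxeterSystem M W) (w : W) :
    ∃ g ∈ weyl (Set.range fun p : W × B => cs.scaledRoot p.1 p.2),
      ∀ x, g (cs.geomEmbed x) = cs.geomEmbed (cs.geomRep w x) := by
  induction w using cs.simple_induction with
  | simple i =>
    refine ⟨_, refl_mem_weyl ⟨(1, i), rfl⟩, fun x => ?_⟩
    simpa using cs.refl_scaledRoot_geomEmbed 1 i x
  | one => exact ⟨1, one_mem _, fun x => by simp⟩
  | mul u v hu hv =>
    obtain ⟨g, hg, hgu⟩ := hu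
    obtain ⟨k, hk, hkv⟩ := hv
    exact ⟨g * k, mul_mem hg hk, fun x => by
      rw [RootSet.mul_apply, hkv, hgu, map_mul, Module.End.mul_apply]⟩

theorem exists_of_mem_weyl (cs : CoxeterSystem M W)
    {g : EuclideanSpace ℝ (W × B) ≃ₗᵢ[ℝ] EuclideanSpace ℝ (W × B)}
    (hg : g ∈ weyl (Set.range fun p : W × B => cs.scaledRoot p.1 p.2)) :
    ∃ w, ∀ x, g (cs.geomEmbed x) = cs.geomEmbed (cs.geomRep w x) := by
  refine weyl_induction (p := fun g => ∃ w, ∀ x, g (cs.geomEmbed x) =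
    cs.geomEmbed (cs.geomRep w x)) ⟨1, fun x => by simp⟩ ?_ hg
  rintro _ ⟨⟨v, i⟩, rfl⟩ g - ⟨w, hw⟩
  exact ⟨v * cs.simple i * v⁻¹ * w, fun x => by
    rw [RootSet.mul_apply, hw, refl_scaledRoot_geomEmbed, map_mul _ _ w, Module.End.mul_apply]⟩

theorem exists_conj_eq_inv (cs : CoxeterSystem M W) (w : W) : ∃ u : W, u * w * u⁻¹ = w⁻¹ := by
  obtain ⟨g, hg, hgw⟩ := cs.exists_mem_weyl_comp_geomEmbed w
  obtain ⟨k, hk, hkg⟩ :=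
    reversible_of_not_critical (fun _ _ _ _ _ _ h => h.false) cs.isRoot_range_scaledRoot g hg
  obtain ⟨u, hu⟩ := cs.exists_of_mem_weyl hk
  refine ⟨u, ?_⟩
  suffices h : w * u * w = u by
    rw [mul_inv_eq_iff_eq_mul, eq_inv_mul_iff_mul_eq, ← mul_assoc, h]
  have hgk : g * k * g = k := by
    rw [mul_inv_eq_iff_eq_mul, eq_inv_mul_iff_mul_eq, ← mul_assoc] at hkg
    exact hkg
  refine cs.geomRep_injective (LinearMap.ext fun x => cs.geomEmbed_injective ?_)
  rw [← hu, ← hgk]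
  simp only [RootSet.mul_apply, hgw, hu, map_mul, Module.End.mul_apply]

end

end CoxeterSystem

/-- In a finite Coxeter group `W`, every element is conjugate to its
inverse: for each `w ∈ W` there exists `x ∈ W` with `x * w * x⁻¹ = w⁻¹`. -/
theorem finite_coxeter_conjugate_inverse
    {B W : Type*} [Finite B] [Group W] [Finite W]
    {M : CoxeterMatrix B} (cs : CoxeterSystem M W) (w : W) :
    ∃ x : W, x * w * x⁻¹ = w⁻¹ := by
  classical
  cases nonempty_fintype B
  cases nonempty_fintype W
  exact cs.exists_conj_eq_inv w
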